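/- Let n > q ≥ 3 and 3 ≤ k ≤ q, and let Π be a smooth Nambu structure of order q on an open neighborhood U of 0 in ℝⁿ such that Π − Π_{k,q} is flat along Σ = {x ∈ U : x₁ = ⋯ = x_{q+1} = 0}. Then there exist an open neighborhood W ⊆ U of 0 and a C^∞ diffeomorphism φ from W onto an open neighborhood of 0 in ℝⁿ such that φ(0) = 0, φ(x)_j = x_j for all x ∈ W and all j ∈ {k+1, …, q+1}, and (e*_{k+1} ∧ ⋯ ∧ e*_{q+1}) ⌟ (φ_*Π) = (e*_{k+1} ∧ ⋯ ∧ e*_{q+1}) ⌟ Π_{k,q} on φ(W); that is, after a diffeomorphism preserving the coordinates x_{k+1},…,x_{q+1}, the sliced structure (e*_{k+1} ∧ ⋯ ∧ e*_{q+1}) ⌟ Π becomes linear. -/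

import Mathlib

open scoped ContDiff

namespace NambuLin

/-- Index set for the standard basis of the `q`-th exterior power of `ℝⁿ`:
increasing multi-indices, encoded as `q`-element subsets of `Fin n`. -/
abbrev Idx (n q : ℕ) := {s : Finset (Fin n) // s.card = q}

/-- A `q`-vector of `ℝⁿ`, given by its coordinates in the standard basis
`{e_{i₁} ∧ ⋯ ∧ e_{i_q}}` of `⋀^q(ℝⁿ)`. -/
abbrev MultiVec (n q : ℕ) := Idx n q → ℝ

/-- The Jacobian matrix of a map `φ : ℝⁿ → ℝⁿ` at a point `x`. -/
noncomputable def jac {n : ℕ} (φ : (Fin n → ℝ) → (Fin n → ℝ)) (x : Fin n → ℝ) :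
    Matrix (Fin n) (Fin n) ℝ :=
  Matrix.of fun i j => fderiv ℝ φ x (Pi.single j 1) i

/-- The `q`-th exterior power `⋀^q A` of a matrix `A`, acting on `q`-vectors in
coordinates: `((⋀^q A) w)_J = ∑_I det(A[J,I]) w_I`. -/
noncomputable def extPow (n q : ℕ) (A : Matrix (Fin n) (Fin n) ℝ) (w : MultiVec n q) :
    MultiVec n q :=
  fun J => ∑ I : Idx n q,
    (A.submatrix (J.1.orderEmbOfFin J.2) (I.1.orderEmbOfFin I.2)).det * w I

/-- The constant `q`-vector `e₁ ∧ ⋯ ∧ e_q` in coordinates. -/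
def stdVec (n q : ℕ) : MultiVec n q :=
  fun J => if (J : Finset (Fin n)) = Finset.univ.filter (fun i : Fin n => (i : ℕ) < q) then 1 else 0

/-- `φ` is a `C^∞` diffeomorphism from the open set `W` onto the open set `φ '' W`. -/
def IsSmoothDiffeoOn {n : ℕ} (φ : (Fin n → ℝ) → (Fin n → ℝ)) (W : Set (Fin n → ℝ)) : Prop :=
  IsOpen W ∧ IsOpen (φ '' W) ∧ ContDiffOn ℝ ∞ φ W ∧
    ∃ ψ : (Fin n → ℝ) → (Fin n → ℝ), ContDiffOn ℝ ∞ ψ (φ '' W) ∧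
      (∀ x ∈ W, ψ (φ x) = x) ∧ (∀ y ∈ φ '' W, φ (ψ y) = y)

/-- `P` is a (smooth) Nambu structure of order `q` on `U`: it is a smooth `q`-vector
field, and around every point where it does not vanish there is a local `C^∞`
coordinate system in which it becomes the constant `q`-vector `e₁ ∧ ⋯ ∧ e_q`. -/
def IsNambu (n q : ℕ) (P : (Fin n → ℝ) → MultiVec n q) (U : Set (Fin n → ℝ)) : Prop :=
  ContDiffOn ℝ ∞ P U ∧
    ∀ p ∈ U, P p ≠ 0 →
      ∃ W, p ∈ W ∧ W ⊆ U ∧ ∃ φ, IsSmoothDiffeoOn φ W ∧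
        ∀ x ∈ W, extPow n q (jac φ x) (P x) = stdVec n q

/-- The signs `ε_j` (`= 1` for the first `k` indices, `= -1` afterwards;
`0`-based indexing, so `ε_j = 1` iff `j < k`). -/
def eps {n : ℕ} (k : ℕ) (j : Fin n) : ℝ := if (j : ℕ) < k then 1 else -1

/-- The set of indices `{1, …, q+1}` (in `0`-based form: `{0,…,q}`). -/
def topIdx (n q : ℕ) : Finset (Fin n) := Finset.univ.filter (fun i : Fin n => (i : ℕ) < q + 1)

/-- The nondegenerate Type 1 linear Nambu structure `Π_{k,q}` of order `q` and
signature `(k, q+1-k)`: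
`Π_{k,q}(x) = ∑_{j=1}^{q+1} (−1)^{j−1} ε_j x_j e₁ ∧ ⋯ ∧ ê_j ∧ ⋯ ∧ e_{q+1}`
(here written with `0`-based indices `j`, whence the sign `(−1)^j`). -/
def modelPi (n q k : ℕ) (x : Fin n → ℝ) : MultiVec n q :=
  fun J => ∑ j : Fin n,
    if ((j : ℕ) < q + 1 ∧ (J : Finset (Fin n)) = (topIdx n q).erase j)
    then (-1 : ℝ) ^ (j : ℕ) * eps k j * x j else 0

/-- The shuffle sign `(−1)^{#{(s,t) ∈ S × K : s > t}}`: for disjoint increasing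
multi-indices `S, K` one has `e*_S ∧ e*_K = shufSign S K · e*_{S ∪ K}`. -/
def shufSign {n : ℕ} (S K : Finset (Fin n)) : ℝ :=
  (-1 : ℝ) ^ (((S ×ˢ K).filter fun p : Fin n × Fin n => p.2 < p.1).card)

/-- The contraction `e*_S ⌟ w` of a `q`-vector `w` with the basis covector
`e*_S = e*_{s₁} ∧ ⋯ ∧ e*_{s_r}` (`S = {s₁ < ⋯ < s_r}`, `r = q - m`), determined by
`⟨e*_K, e*_S ⌟ w⟩ = ⟨e*_S ∧ e*_K, w⟩`: its `K`-th coordinate is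
`shufSign S K · w_{S ∪ K}` when `S, K` are disjoint (and `0` otherwise, in
accordance with the graded pairing). -/
def contr (n q m : ℕ) (S : Finset (Fin n)) (w : MultiVec n q) : MultiVec n m :=
  fun K => if h : Disjoint S (K : Finset (Fin n)) ∧ (S ∪ (K : Finset (Fin n))).card = q
    then shufSign S K.1 * w ⟨S ∪ K.1, h.2⟩ else 0

/-- The set of indices `{k+1, …, q+1}` (in `0`-based form: `{k,…,q}`), so that
`e*_{k+1} ∧ ⋯ ∧ e*_{q+1}` corresponds to `sliceIdx n q k`. -/
def sliceIdx (n q k : ℕ) : Finset (Fin n) :=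
  Finset.univ.filter fun i : Fin n => k ≤ (i : ℕ) ∧ (i : ℕ) < q + 1

end NambuLin

section FileM1
open scoped ContDiff
open MeasureTheory Set Filter Topology

namespace NambuLin

section ParInt
variable {T : Type} [MeasurableSpace T] {A E : Type}
  [NormedAddCommGroup A] [NormedSpace ℝ A] [FiniteDimensional ℝ A]
  [MeasurableSpace A] [BorelSpace A]
  [NormedAddCommGroup E] [NormedSpace ℝ E] [FiniteDimensional ℝ E]

theorem parInt_hasFDerivAt {G : Type} [NormedAddCommGroup G] [NormedSpace ℝ G] [CompleteSpace G]
    (μ : Measure T) [IsFiniteMeasure μ]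
    (a : T → A) (ha : Measurable a) (C : ℝ) (hC : ∀ t, ‖a t‖ ≤ C)
    (F : A × E → G) (hF : ContDiff ℝ 1 F) (p : E) :
    HasFDerivAt (fun p => ∫ t, F (a t, p) ∂μ)
      (∫ t, (fderiv ℝ F (a t, p)).comp (ContinuousLinearMap.inr ℝ A E) ∂μ) p := by
  have hK : IsCompact (Metric.closedBall (0:A) C ×ˢ Metric.closedBall p 1) :=
    (isCompact_closedBall _ _).prod (isCompact_closedBall _ _)
  have hD : Continuous fun z : A × E => (fderiv ℝ F z).comp (ContinuousLinearMap.inr ℝ A E) :=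
    (hF.continuous_fderiv (by simp)).clm_comp continuous_const
  obtain ⟨M, hM⟩ := hK.exists_bound_of_continuousOn hD.continuousOn
  obtain ⟨M', hM'⟩ := hK.exists_bound_of_continuousOn hF.continuous.continuousOn
  have mem : ∀ t, a t ∈ Metric.closedBall (0:A) C := fun t => by simpa using hC t
  have hmeas : ∀ {H : Type} [NormedAddCommGroup H] (Q : A × E → H) (_ : Continuous Q) (x : E),
      AEStronglyMeasurable (fun t => Q (a t, x)) μ := by
    intro H _ Q hQ x
    have h1 : StronglyMeasurable (fun y : A => Q (y, x)) :=
      (hQ.comp (by fun_prop : Continuous fun y : A => (y, x))).stronglyMeasurable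
    exact (h1.comp_measurable ha).aestronglyMeasurable
  refine hasFDerivAt_integral_of_dominated_of_fderiv_le (bound := fun _ => M)
    (s := Metric.ball p 1)
    (F' := fun x t => (fderiv ℝ F (a t, x)).comp (ContinuousLinearMap.inr ℝ A E))
    (Metric.ball_mem_nhds p one_pos) ?_ ?_ ?_ ?_ ?_ ?_
  · exact Eventually.of_forall fun x => hmeas F hF.continuous x
  · refine Integrable.of_bound (hmeas F hF.continuous p) M' (Eventually.of_forall fun t => ?_)
    exact hM' _ ⟨mem t, by simp⟩
  · exact hmeas _ hD p
  · exact Eventually.of_forall fun t x hx => hM (a t, x) ⟨mem t, Metric.ball_subset_closedBall hx⟩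
  · exact integrable_const _
  · refine Eventually.of_forall fun t x _ => ?_
    have h1 : HasFDerivAt F (fderiv ℝ F (a t, x)) (a t, x) :=
      (hF.differentiable (by simp) _).hasFDerivAt
    exact h1.comp x (hasFDerivAt_prodMk_right (a t) x)

/-- Smooth dependence of integrals on parameters. -/
theorem parInt_contDiff {G : Type} [NormedAddCommGroup G] [NormedSpace ℝ G] [CompleteSpace G]
    (μ : Measure T) [IsFiniteMeasure μ]
    (a : T → A) (ha : Measurable a) (C : ℝ) (hC : ∀ t, ‖a t‖ ≤ C)
    (F : A × E → G) (hF : ContDiff ℝ ∞ F) :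
    ContDiff ℝ ∞ (fun p => ∫ t, F (a t, p) ∂μ) := by
  rw [contDiff_infty]
  intro n
  induction n generalizing G with
  | zero =>
    have : Differentiable ℝ (fun p => ∫ t, F (a t, p) ∂μ) := fun p =>
      (parInt_hasFDerivAt μ a ha C hC F (hF.of_le (by exact_mod_cast le_top)) p).differentiableAt
    exact contDiff_zero.2 this.continuous
  | succ n ih =>
    have h1 := fun p => parInt_hasFDerivAt μ a ha C hC F (hF.of_le (by exact_mod_cast le_top)) p
    push_cast
    rw [contDiff_succ_iff_fderiv]
    refine ⟨fun p => (h1 p).differentiableAt, by simp, ?_⟩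
    have : fderiv ℝ (fun p => ∫ t, F (a t, p) ∂μ) = fun p =>
      (∫ t, (fun z : A × E => (fderiv ℝ F z).comp (ContinuousLinearMap.inr ℝ A E)) (a t, p) ∂μ) :=
      funext fun p => (h1 p).fderiv
    rw [this]
    refine ih (fun z : A × E => (fderiv ℝ F z).comp (ContinuousLinearMap.inr ℝ A E)) ?_
    exact (hF.fderiv_right (by simp)).clm_comp contDiff_const

end ParInt
end NambuLin
end FileM1

section FileM2
open scoped ContDiff BoundedContinuousFunction
open MeasureTheory Set Filter Topology
set_option linter.unusedSectionVars false

namespace NambuLin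

section Nem
variable {I : Type} [TopologicalSpace I] [CompactSpace I]
variable {E : Type} [NormedAddCommGroup E] [NormedSpace ℝ E]

open Classical in
/-- Superposition operator. -/
noncomputable def nem {F : Type} [NormedAddCommGroup F] (v : E → F) (γ : (I →ᵇ E)) : (I →ᵇ F) :=
  if h : Continuous fun t => v (γ t) then
    BoundedContinuousFunction.mkOfCompact ⟨fun t => v (γ t), h⟩ else 0

theorem nem_apply {F : Type} [NormedAddCommGroup F] {v : E → F} {Ω : Set E}
    (hΩ : IsOpen Ω) (hv : ContinuousOn v Ω) {γ : (I →ᵇ E)} (hγ : ∀ t, γ t ∈ Ω) (t : I) :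
    nem v γ t = v (γ t) := by
  have : Continuous fun t => v (γ t) := by
    rw [continuous_iff_continuousAt]
    intro t
    exact ((hv.continuousAt (hΩ.mem_nhds (hγ t))).comp γ.continuous.continuousAt)
  simp [nem, this]

/-- pointwise application as a bilinear map. -/
noncomputable def nemB (I E F : Type) [TopologicalSpace I] [CompactSpace I]
    [NormedAddCommGroup E] [NormedSpace ℝ E] [NormedAddCommGroup F] [NormedSpace ℝ F] :
    (I →ᵇ (E →L[ℝ] F)) →L[ℝ] (I →ᵇ E) →L[ℝ] (I →ᵇ F) :=
  LinearMap.mkContinuous₂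
    (LinearMap.mk₂ ℝ (fun (A : (I →ᵇ (E →L[ℝ] F))) (h : (I →ᵇ E)) =>
      BoundedContinuousFunction.mkOfCompact (⟨fun t => A t (h t), by fun_prop⟩ : C(I, F)))
      (by intros; ext; simp) (by intros; ext; simp) (by intros; ext; simp) (by intros; ext; simp)) 1
    (by
      intro A h
      rw [BoundedContinuousFunction.norm_le (by positivity)]
      intro t
      simp only [LinearMap.mk₂_apply, BoundedContinuousFunction.mkOfCompact_apply,
        ContinuousMap.coe_mk, one_mul]
      exact (A t).le_of_opNorm_le_of_le (A.norm_coe_le_norm t) (h.norm_coe_le_norm t))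

theorem nemB_apply {F : Type} [NormedAddCommGroup F] [NormedSpace ℝ F]
    (A : (I →ᵇ (E →L[ℝ] F))) (h : (I →ᵇ E)) (t : I) : nemB I E F A h t = A t (h t) := rfl

theorem isOpen_range_in {Ω : Set E} (hΩ : IsOpen Ω) : IsOpen {γ : (I →ᵇ E) | ∀ t, γ t ∈ Ω} := by
  rw [isOpen_iff_eventually]
  intro γ hγ
  have := (isCompact_univ (X := I)).eventually_forall_of_forall_eventually (x₀ := γ)
    (P := fun γ t => γ t ∈ Ω) (fun t _ => ?_)
  · exact this.mono fun η h t => h t trivial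
  · exact (ContinuousEval.continuous_eval (F := I →ᵇ E) (X := I) (Y := E)).continuousAt.eventually
      (hΩ.mem_nhds (hγ t))

theorem nem_hasFDerivAt {F : Type} [NormedAddCommGroup F] [NormedSpace ℝ F] {v : E → F} {Ω : Set E}
    (hΩ : IsOpen Ω) (hv : ContDiffOn ℝ 1 v Ω) {γ : (I →ᵇ E)} (hγ : ∀ t, γ t ∈ Ω) :
    HasFDerivAt (nem v) (nemB I E F (nem (fderiv ℝ v) γ)) γ := by
  have hDv : ContinuousOn (fderiv ℝ v) Ω := hv.continuousOn_fderiv_of_isOpen hΩ (by simp)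
  rw [hasFDerivAt_iff_isLittleO_nhds_zero, Asymptotics.isLittleO_iff]
  intro c hc
  have key : ∀ᶠ u : E in 𝓝 0, ∀ t ∈ (univ : Set I), γ t + u ∈ Ω ∧
      ‖v (γ t + u) - v (γ t) - fderiv ℝ v (γ t) u‖ ≤ c * ‖u‖ := by
    apply isCompact_univ.eventually_forall_of_forall_eventually
    intro t _
    have hs : HasStrictFDerivAt v (fderiv ℝ v (γ t)) (γ t) :=
      (hv.contDiffAt (hΩ.mem_nhds (hγ t))).hasStrictFDerivAt (by simp)
    have h1 := (hs.isLittleO.def (half_pos hc))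
    have tend : Tendsto (fun z : E × I => (γ z.2 + z.1, γ z.2)) (𝓝 (0, t)) (𝓝 (γ t, γ t)) := by
      have : Continuous (fun z : E × I => (γ z.2 + z.1, γ z.2)) := by fun_prop
      simpa using this.tendsto (0, t)
    have h2 := tend.eventually h1
    have tend2 : Tendsto (fun z : E × I => γ z.2) (𝓝 (0, t)) (𝓝 (γ t)) := by
      have : Continuous (fun z : E × I => γ z.2) := by fun_prop
      simpa using this.tendsto (0, t)
    have tend3 : Tendsto (fun z : E × I => γ z.2 + z.1) (𝓝 (0, t)) (𝓝 (γ t)) := by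
      have : Continuous (fun z : E × I => γ z.2 + z.1) := by fun_prop
      simpa using this.tendsto (0, t)
    have h3 : ∀ᶠ z : E × I in 𝓝 (0, t), ‖fderiv ℝ v (γ z.2) - fderiv ℝ v (γ t)‖ ≤ c / 2 := by
      have hc' := (hDv.continuousAt (hΩ.mem_nhds (hγ t))).tendsto.comp tend2
      filter_upwards [hc'.eventually (Metric.closedBall_mem_nhds _ (half_pos hc))] with z hz
      simpa [dist_eq_norm] using hz
    filter_upwards [h2, h3, tend3.eventually (hΩ.mem_nhds (hγ t))] with z hz hz' hz3
    refine ⟨hz3, ?_⟩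
    simp only [add_sub_cancel_left] at hz
    calc _ = ‖(v (γ z.2 + z.1) - v (γ z.2) - fderiv ℝ v (γ t) z.1)
          - (fderiv ℝ v (γ z.2) - fderiv ℝ v (γ t)) z.1‖ := by
            congr 1; simp
      _ ≤ c / 2 * ‖z.1‖ + c / 2 * ‖z.1‖ := (norm_sub_le _ _).trans
          (add_le_add hz (ContinuousLinearMap.le_of_opNorm_le _ hz' _))
      _ = c * ‖z.1‖ := by ring
  obtain ⟨δ, hδ, hδ'⟩ := Metric.eventually_nhds_iff.1 key
  filter_upwards [Metric.ball_mem_nhds (0 : (I →ᵇ E)) hδ] with h hh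
  have hh' : ∀ t, ‖h t‖ < δ := fun t => (h.norm_coe_le_norm t).trans_lt (by simpa using hh)
  have hk := fun t => hδ' (y := h t) (by simpa using hh' t) t trivial
  have hcont := hv.continuousOn
  rw [BoundedContinuousFunction.norm_le (by positivity)]
  intro t
  simp only [BoundedContinuousFunction.sub_apply, nemB_apply]
  rw [nem_apply hΩ hDv hγ, nem_apply hΩ hcont hγ, nem_apply hΩ hcont (fun t => (hk t).1)]
  exact (hk t).2.trans (by gcongr; exact h.norm_coe_le_norm t)

theorem nem_contDiffOn {F : Type} [NormedAddCommGroup F] [NormedSpace ℝ F] {v : E → F} {Ω : Set E}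
    (hΩ : IsOpen Ω) (hv : ContDiffOn ℝ ∞ v Ω) :
    ContDiffOn ℝ ∞ (nem v) {γ : (I →ᵇ E) | ∀ t, γ t ∈ Ω} := by
  rw [contDiffOn_infty]
  intro n
  induction n generalizing F with
  | zero =>
    rw [Nat.cast_zero, contDiffOn_zero]
    intro γ hγ
    exact (nem_hasFDerivAt hΩ (hv.of_le (by exact_mod_cast le_top)) hγ).continuousAt.continuousWithinAt
  | succ n ih =>
    push_cast
    rw [contDiffOn_succ_iff_fderiv_of_isOpen (isOpen_range_in hΩ)]
    have h1 := fun γ (hγ : γ ∈ {γ : (I →ᵇ E) | ∀ t, γ t ∈ Ω}) =>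
      nem_hasFDerivAt hΩ (hv.of_le (by exact_mod_cast le_top)) hγ
    refine ⟨fun γ hγ => (h1 γ hγ).differentiableAt.differentiableWithinAt, by simp, ?_⟩
    have h2 : ContDiffOn ℝ n (fun γ => nemB I E F (nem (fderiv ℝ v) γ))
        {γ : (I →ᵇ E) | ∀ t, γ t ∈ Ω} := by
      have hB : ContDiff ℝ n (fun A => nemB I E F A) := by
        apply ContinuousLinearMap.contDiff
      exact hB.comp_contDiffOn (ih ((contDiffOn_infty_iff_fderiv_of_isOpen hΩ).1 hv).2)
    exact h2.congr fun γ hγ => (h1 γ hγ).fderiv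
end Nem

section ODE
variable {E : Type} [NormedAddCommGroup E] [NormedSpace ℝ E] [CompleteSpace E]

/-- The closed unit interval as a type. -/
abbrev II : Type := Icc (0:ℝ) 1

/-- extension of a path to the real line. -/
noncomputable def extPath (γ : (II →ᵇ E)) : ℝ → E := fun s => γ (projIcc 0 1 zero_le_one s)

theorem extPath_cont (γ : (II →ᵇ E)) : Continuous (extPath γ) := γ.continuous.comp continuous_projIcc

theorem extPath_eq (γ : (II →ᵇ E)) (t : II) : extPath γ t = γ t := by
  simp [extPath]

theorem extPath_norm (γ : (II →ᵇ E)) (s : ℝ) : ‖extPath γ s‖ ≤ ‖γ‖ := γ.norm_coe_le_norm _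

/-- the primitive operator. -/
noncomputable def primJ : (II →ᵇ E) →L[ℝ] (II →ᵇ E) :=
  LinearMap.mkContinuous
    { toFun := fun γ => BoundedContinuousFunction.mkOfCompact ⟨fun t => ∫ s in (0:ℝ)..t, extPath γ s, by
        have : Continuous fun t : ℝ => ∫ s in (0:ℝ)..t, extPath γ s :=
          intervalIntegral.continuous_primitive
            (fun a b => (extPath_cont γ).intervalIntegrable a b) 0
        exact this.comp continuous_subtype_val⟩
      map_add' := by
        intro γ η; ext t
        simp only [BoundedContinuousFunction.mkOfCompact_apply, ContinuousMap.coe_mk,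
          BoundedContinuousFunction.add_apply]
        rw [← intervalIntegral.integral_add ((extPath_cont γ).intervalIntegrable _ _)
          ((extPath_cont η).intervalIntegrable _ _)]
        rfl
      map_smul' := by
        intro c γ; ext t
        simp only [BoundedContinuousFunction.mkOfCompact_apply, ContinuousMap.coe_mk,
          BoundedContinuousFunction.smul_apply, RingHom.id_apply]
        rw [← intervalIntegral.integral_smul]
        rfl } 1 (by
      intro γ
      rw [BoundedContinuousFunction.norm_le (by positivity)]
      intro t
      have := intervalIntegral.norm_integral_le_of_norm_le_const (a := 0) (b := (t:ℝ))
        (f := extPath γ) (C := ‖γ‖) (fun s _ => extPath_norm γ s)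
      have h1 : |(t:ℝ) - 0| ≤ 1 := by
        rw [abs_le]; constructor <;> linarith [t.2.1, t.2.2]
      simp only [LinearMap.coe_mk, AddHom.coe_mk,
        BoundedContinuousFunction.mkOfCompact_apply, ContinuousMap.coe_mk, one_mul]
      exact this.trans (by nlinarith [norm_nonneg γ]))

theorem primJ_apply (γ : (II →ᵇ E)) (t : II) : primJ γ t = ∫ s in (0:ℝ)..t, extPath γ s := rfl

theorem volterra_bound (A : (II →ᵇ (E →L[ℝ] E))) (n : ℕ) (γ : (II →ᵇ E)) (t : II) :
    ‖((primJ.comp (nemB II E E A)) ^ n) γ t‖ ≤ ‖A‖ ^ n * (t:ℝ) ^ n / n.factorial * ‖γ‖ := by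
  induction n generalizing t with
  | zero => simpa using γ.norm_coe_le_norm t
  | succ n ih =>
    rw [pow_succ', mul_apply_eq_comp, ContinuousLinearMap.comp_apply, primJ_apply]
    have ht := t.2.1
    have hb : ∀ s ∈ Ioc (0:ℝ) t, ‖extPath (nemB II E E A
        (((primJ.comp (nemB II E E A)) ^ n) γ)) s‖ ≤
        ‖A‖ ^ (n + 1) / n.factorial * ‖γ‖ * s ^ n := by
      intro s hs
      have hsI : s ∈ Icc (0:ℝ) 1 := ⟨hs.1.le, hs.2.trans t.2.2⟩
      have := extPath_eq (nemB II E E A (((primJ.comp (nemB II E E A)) ^ n) γ)) ⟨s, hsI⟩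
      simp only at this
      rw [this, nemB_apply]
      refine ((A ⟨s, hsI⟩).le_of_opNorm_le_of_le (A.norm_coe_le_norm _) (ih ⟨s, hsI⟩)).trans ?_
      apply le_of_eq; simp only; ring
    have hitgr : IntervalIntegrable (fun s : ℝ => ‖A‖ ^ (n + 1) / n.factorial * ‖γ‖ * s ^ n)
        volume 0 t := Continuous.intervalIntegrable (by fun_prop) _ _
    refine (intervalIntegral.norm_integral_le_of_norm_le ht (ae_of_all _ hb) hitgr).trans ?_
    rw [intervalIntegral.integral_const_mul, integral_pow, Nat.factorial_succ]
    apply le_of_eq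
    have : (n.factorial : ℝ) ≠ 0 := by positivity
    push_cast
    field_simp
    simp

theorem volterra_isUnit (A : (II →ᵇ (E →L[ℝ] E))) :
    IsUnit ((1 : (II →ᵇ E) →L[ℝ] (II →ᵇ E)) - primJ.comp (nemB II E E A)) := by
  set K := primJ.comp (nemB II E E A) with hK
  have h1 := (FloorSemiring.tendsto_pow_div_factorial_atTop ‖A‖).eventually (gt_mem_nhds one_pos)
  obtain ⟨N, hN⟩ := h1.exists
  have hKN : ‖K ^ N‖ < 1 := by
    refine lt_of_le_of_lt (ContinuousLinearMap.opNorm_le_bound _ (by positivity) fun γ => ?_) hN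
    rw [BoundedContinuousFunction.norm_le (by positivity)]
    intro t
    refine (volterra_bound A N γ t).trans ?_
    gcongr
    have : (t:ℝ) ^ N ≤ 1 := pow_le_one₀ t.2.1 t.2.2
    nlinarith [pow_nonneg (norm_nonneg A) N]
  have h2 : IsUnit (1 - K ^ N) := isUnit_one_sub_of_norm_lt_one hKN
  have hc : Commute (1 - K) (∑ i ∈ Finset.range N, K ^ i) := by
    apply Commute.sum_right
    intro i _
    exact (Commute.one_left _).sub_left ((Commute.refl K).pow_right i)
  rw [← mul_neg_geom_sum] at h2
  exact (hc.isUnit_mul_iff.1 h2).1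

/-- `γ` solves the autonomous equation with values in `Ω` on `[0,1]`. -/
def IsSol (v : E → E) (Ω : Set E) (γ : ℝ → E) : Prop :=
  ∀ t ∈ Icc (0:ℝ) 1, γ t ∈ Ω ∧ HasDerivWithinAt γ (v (γ t)) (Icc 0 1) t

theorem IsSol.continuousOn {v : E → E} {Ω : Set E} {γ : ℝ → E} (h : IsSol v Ω γ) :
    ContinuousOn γ (Icc 0 1) := fun t ht => (h t ht).2.continuousWithinAt

theorem IsSol.unique {v : E → E} {Ω : Set E} (hΩ : IsOpen Ω) (hv : ContDiffOn ℝ 1 v Ω)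
    {γ η : ℝ → E} (hγ : IsSol v Ω γ) (hη : IsSol v Ω η) (h0 : γ 0 = η 0) :
    EqOn γ η (Icc 0 1) := by
  have hc : IsCompact (γ '' Icc 0 1 ∪ η '' Icc 0 1) :=
    (isCompact_Icc.image_of_continuousOn hγ.continuousOn).union
      (isCompact_Icc.image_of_continuousOn hη.continuousOn)
  have hsub : γ '' Icc 0 1 ∪ η '' Icc 0 1 ⊆ Ω := by
    rintro _ (⟨t, ht, rfl⟩ | ⟨t, ht, rfl⟩)
    exacts [(hγ t ht).1, (hη t ht).1]
  have hL : LocallyLipschitzOn (γ '' Icc 0 1 ∪ η '' Icc 0 1) v := by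
    intro x hx
    obtain ⟨K, s, hs, hK⟩ :=
      (hv.contDiffAt (hΩ.mem_nhds (hsub hx))).exists_lipschitzOnWith
    exact ⟨K, s, mem_nhdsWithin_of_mem_nhds hs, hK⟩
  obtain ⟨K, hK⟩ := hL.exists_lipschitzOnWith_of_compact hc
  have hd : ∀ {f : ℝ → E}, IsSol v Ω f → ∀ t ∈ Ico (0:ℝ) 1, HasDerivWithinAt f (v (f t)) (Ici t) t := by
    intro f hf t ht
    refine (hf t ⟨ht.1, ht.2.le⟩).2.mono_of_mem_nhdsWithin ?_
    exact mem_of_superset (Icc_mem_nhdsGE ht.2) (Icc_subset_Icc_left ht.1)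
  exact ODE_solution_unique_of_mem_Icc_right (v := fun _ => v) (s := fun _ => _) (K := K)
    (fun t _ => hK) hγ.continuousOn (hd hγ) (fun t ht => Or.inl ⟨t, ⟨ht.1, ht.2.le⟩, rfl⟩)
    hη.continuousOn (hd hη) (fun t ht => Or.inr ⟨t, ⟨ht.1, ht.2.le⟩, rfl⟩) h0

/-- Smooth dependence on initial conditions, local version. -/
theorem ode_local {v : E → E} {Ω : Set E} (hΩ : IsOpen Ω) (hv : ContDiffOn ℝ ∞ v Ω)
    {γ : ℝ → E} (hγ : IsSol v Ω γ) :
    ∃ Φ : E → (II →ᵇ E), ContDiffAt ℝ ∞ Φ (γ 0) ∧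
      (∀ᶠ x in 𝓝 (γ 0), extPath (Φ x) 0 = x ∧ IsSol v Ω (extPath (Φ x))) ∧
      ∀ h, ∀ t ∈ Icc (0:ℝ) 1, HasDerivWithinAt (fun t => extPath (fderiv ℝ Φ (γ 0) h) t)
        (fderiv ℝ v (γ t) (extPath (fderiv ℝ Φ (γ 0) h) t)) (Icc 0 1) t := by
  let γ0 : (II →ᵇ E) := BoundedContinuousFunction.mkOfCompact ⟨fun t => γ t, by
    have := hγ.continuousOn
    rwa [continuousOn_iff_continuous_domRestrict] at this⟩
  have hγ0 : ∀ t, γ0 t ∈ Ω := fun t => (hγ t t.2).1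
  let S : (II →ᵇ E) → (II →ᵇ E) := fun η => η - primJ (nem v η)
  have hO := isOpen_range_in (I := II) hΩ
  have hnem : ContDiffAt ℝ ∞ (nem v) γ0 := (nem_contDiffOn hΩ hv).contDiffAt (hO.mem_nhds hγ0)
  have hS : ContDiffAt ℝ ∞ S γ0 := contDiffAt_id.sub ((primJ (E := E)).contDiff.contDiffAt.comp γ0 hnem)
  have hS' : HasFDerivAt S ((1 : (II →ᵇ E) →L[ℝ] (II →ᵇ E)) -
      primJ.comp (nemB II E E (nem (fderiv ℝ v) γ0))) γ0 := by
    have h1 := nem_hasFDerivAt hΩ (hv.of_le (by exact_mod_cast le_top)) hγ0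
    exact (hasFDerivAt_id γ0).sub (primJ.hasFDerivAt.comp γ0 h1)
  obtain ⟨u, hu⟩ := volterra_isUnit (nem (fderiv ℝ v) γ0)
  let e : (II →ᵇ E) ≃L[ℝ] (II →ᵇ E) := ContinuousLinearEquiv.unitsEquiv ℝ _ u
  have he : (e : (II →ᵇ E) →L[ℝ] (II →ᵇ E)) = 1 - primJ.comp (nemB II E E (nem (fderiv ℝ v) γ0)) := by
    rw [← hu]; rfl
  rw [← he] at hS'
  let L := hS.toOpenPartialHomeomorph S hS' (by simp)
  let cst : E →L[ℝ] (II →ᵇ E) := LinearMap.mkContinuous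
    { toFun := fun x => BoundedContinuousFunction.const II x
      map_add' := fun _ _ => rfl
      map_smul' := fun _ _ => rfl } 1 (by
        intro x
        rw [BoundedContinuousFunction.norm_le (by positivity)]
        intro t; rw [one_mul]; exact le_refl ‖x‖)
  have hcst : ∀ x t, cst x t = x := fun x t => rfl
  have hSγ : S γ0 = cst (γ 0) := by
    ext t
    simp only [S, BoundedContinuousFunction.sub_apply, primJ_apply, hcst]
    have h2 : ∫ s in (0:ℝ)..t, extPath (nem v γ0) s = γ t - γ 0 := by
      refine intervalIntegral.integral_eq_sub_of_hasDerivAt_of_le t.2.1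
        (hγ.continuousOn.mono (Icc_subset_Icc_right t.2.2)) (fun s hs => ?_)
        ((extPath_cont _).intervalIntegrable _ _)
      have hsI : s ∈ Icc (0:ℝ) 1 := ⟨hs.1.le, hs.2.le.trans t.2.2⟩
      have h3 := extPath_eq (nem v γ0) ⟨s, hsI⟩
      simp only at h3
      rw [h3, nem_apply hΩ hv.continuousOn hγ0]
      exact (hγ s hsI).2.hasDerivAt (Icc_mem_nhds hs.1 (hs.2.trans_le t.2.2))
    rw [h2]; exact sub_sub_cancel (γ t) (γ 0)
  have hsrc : γ0 ∈ L.source := hS.mem_toOpenPartialHomeomorph_source hS' (by simp)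
  have hLS : ∀ η, L η = S η := fun η => rfl
  have htgt : S γ0 ∈ L.target := L.map_source hsrc
  have hsymm : L.symm (S γ0) = γ0 := L.left_inv hsrc
  have hinv : ContDiffAt ℝ ∞ L.symm (S γ0) := by
    apply L.contDiffAt_symm htgt (f₀' := e)
    · rw [hsymm]; exact hS'
    · rw [hsymm]; exact hS
  rw [hSγ] at hinv htgt hsymm
  refine ⟨fun x => L.symm (cst x), hinv.comp (γ 0) cst.contDiff.contDiffAt, ?_, ?_⟩
  rotate_left
  · intro h t ht
    have hΦ : ContDiffAt ℝ ∞ (fun x => L.symm (cst x)) (γ 0) :=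
      hinv.comp (γ 0) cst.contDiff.contDiffAt
    have hΦ' := (hΦ.differentiableAt (by simp)).hasFDerivAt
    have ev1 : ∀ᶠ x in 𝓝 (γ 0), S (L.symm (cst x)) = cst x := by
      filter_upwards [cst.continuous.continuousAt.eventually (L.open_target.mem_nhds htgt)] with x hx
      exact L.right_inv hx
    have hcomp : HasFDerivAt (fun x => S (L.symm (cst x)))
        ((e : (II →ᵇ E) →L[ℝ] (II →ᵇ E)).comp (fderiv ℝ (fun x => L.symm (cst x)) (γ 0))) (γ 0) := by
      have hS2 : HasFDerivAt S (e : (II →ᵇ E) →L[ℝ] (II →ᵇ E)) (L.symm (cst (γ 0))) := by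
        rw [hsymm]; exact hS'
      exact HasFDerivAt.comp (γ 0) hS2 hΦ'
    have heq := hcomp.unique (cst.hasFDerivAt.congr_of_eventuallyEq ev1)
    set η := fderiv ℝ (fun x => L.symm (cst x)) (γ 0) h with hη
    have h1 : η - primJ (nemB II E E (nem (fderiv ℝ v) γ0) η) = cst h := by
      have := congrArg (fun f : E →L[ℝ] (II →ᵇ E) => f h) heq
      rw [he] at this
      exact this
    have hDv : ContinuousOn (fderiv ℝ v) Ω := hv.continuousOn_fderiv_of_isOpen hΩ (by simp)
    set ζ := nemB II E E (nem (fderiv ℝ v) γ0) η with hζ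
    have hform : ∀ t : II, η t = h + ∫ s in (0:ℝ)..t, extPath ζ s := by
      intro t
      have := congrArg (fun f : (II →ᵇ E) => f t) h1
      simp only [BoundedContinuousFunction.sub_apply, primJ_apply, hcst] at this
      rw [← this]; simp
    have h2 : HasDerivAt (fun t => h + ∫ s in (0:ℝ)..t, extPath ζ s) (extPath ζ t) t :=
      (intervalIntegral.integral_hasDerivAt_right ((extPath_cont _).intervalIntegrable _ _)
        (extPath_cont _).stronglyMeasurable.stronglyMeasurableAtFilter
        (extPath_cont _).continuousAt).const_add h
    have h4 : extPath η t = η ⟨t, ht⟩ := extPath_eq η ⟨t, ht⟩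
    have h3 : extPath ζ t = fderiv ℝ v (γ t) (extPath η t) := by
      have := extPath_eq ζ ⟨t, ht⟩
      simp only at this
      rw [this, h4, hζ, nemB_apply, nem_apply hΩ hDv hγ0]
      rfl
    rw [← h3]
    exact h2.hasDerivWithinAt.congr (fun s hs => by
      rw [← hform ⟨s, hs⟩]; exact extPath_eq η ⟨s, hs⟩) (by rw [h4]; exact hform ⟨t, ht⟩)
  have ev1 : ∀ᶠ x in 𝓝 (γ 0), cst x ∈ L.target :=
    cst.continuous.continuousAt.eventually (L.open_target.mem_nhds htgt)
  have ev2 : ∀ᶠ x in 𝓝 (γ 0), L.symm (cst x) ∈ {η : (II →ᵇ E) | ∀ t, η t ∈ Ω} := by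
    have : ContinuousAt (fun x => L.symm (cst x)) (γ 0) :=
      (hinv.continuousAt).comp cst.continuous.continuousAt
    apply this.eventually
    change ∀ᶠ y in 𝓝 (L.symm (cst (γ 0))), _
    rw [hsymm]
    exact hO.mem_nhds hγ0
  filter_upwards [ev1, ev2] with x hx1 hx2
  set η := L.symm (cst x) with hη
  have hSη : S η = cst x := L.right_inv hx1
  have hform : ∀ t : II, η t = x + ∫ s in (0:ℝ)..t, extPath (nem v η) s := by
    intro t
    have := congrArg (fun f : (II →ᵇ E) => f t) hSη
    simp only [S, BoundedContinuousFunction.sub_apply, primJ_apply, hcst] at this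
    rw [← this]; simp
  refine ⟨?_, ?_⟩
  · have := hform ⟨0, by simp⟩
    rw [← extPath_eq] at this
    simpa using this
  · intro t ht
    have h1 : extPath η t = η ⟨t, ht⟩ := extPath_eq η ⟨t, ht⟩
    refine ⟨by rw [h1]; exact hx2 _, ?_⟩
    have h2 : HasDerivAt (fun t => x + ∫ s in (0:ℝ)..t, extPath (nem v η) s)
        (extPath (nem v η) t) t :=
      (intervalIntegral.integral_hasDerivAt_right ((extPath_cont _).intervalIntegrable _ _)
        (extPath_cont _).stronglyMeasurable.stronglyMeasurableAtFilter
        (extPath_cont _).continuousAt).const_add x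
    have h3 : extPath (nem v η) t = v (extPath η t) := by
      have := extPath_eq (nem v η) ⟨t, ht⟩
      simp only at this
      rw [this, h1, nem_apply hΩ hv.continuousOn hx2]
    rw [← h3]
    exact h2.hasDerivWithinAt.congr (fun s hs => by
      rw [← hform ⟨s, hs⟩]; exact extPath_eq η ⟨s, hs⟩) (by rw [h1]; exact hform ⟨t, ht⟩)

theorem extPath_clm (t : ℝ) : ∃ L : (II →ᵇ E) →L[ℝ] E, ∀ γ, L γ = extPath γ t :=
  ⟨BoundedContinuousFunction.evalCLM ℝ (projIcc 0 1 zero_le_one t), fun γ => rfl⟩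

/-- The set of initial conditions whose solution exists on `[0,1]`. -/
def odeDom (v : E → E) (Ω : Set E) : Set E := {x | ∃ γ : ℝ → E, γ 0 = x ∧ IsSol v Ω γ}

open Classical in
/-- The solution with given initial condition. -/
noncomputable def odeFlow (v : E → E) (Ω : Set E) (x : E) : ℝ → E :=
  if h : x ∈ odeDom v Ω then h.choose else fun _ => x

theorem odeFlow_spec {v : E → E} {Ω : Set E} {x : E} (h : x ∈ odeDom v Ω) :
    odeFlow v Ω x 0 = x ∧ IsSol v Ω (odeFlow v Ω x) := by
  simp only [odeFlow, h, dif_pos]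
  exact h.choose_spec

theorem odeFlow_eq {v : E → E} {Ω : Set E} (hΩ : IsOpen Ω) (hv : ContDiffOn ℝ ∞ v Ω)
    {γ : ℝ → E} (hγ : IsSol v Ω γ) {x : E} (hx : γ 0 = x) : EqOn (odeFlow v Ω x) γ (Icc 0 1) := by
  have h := odeFlow_spec (v := v) (Ω := Ω) ⟨γ, hx, hγ⟩
  exact h.2.unique hΩ (hv.of_le (by exact_mod_cast le_top)) hγ (h.1.trans hx.symm)

theorem odeFlow_local {v : E → E} {Ω : Set E} (hΩ : IsOpen Ω) (hv : ContDiffOn ℝ ∞ v Ω)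
    {x : E} (hx : x ∈ odeDom v Ω) :
    ∃ Φ : E → (II →ᵇ E), ContDiffAt ℝ ∞ Φ x ∧
      (∀ᶠ y in 𝓝 x, y ∈ odeDom v Ω ∧ EqOn (odeFlow v Ω y) (extPath (Φ y)) (Icc 0 1)) ∧
      ∀ h, ∀ t ∈ Icc (0:ℝ) 1, HasDerivWithinAt (fun t => extPath (fderiv ℝ Φ x h) t)
        (fderiv ℝ v (odeFlow v Ω x t) (extPath (fderiv ℝ Φ x h) t)) (Icc 0 1) t := by
  obtain ⟨h0, hs⟩ := odeFlow_spec hx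
  obtain ⟨Φ, h1, h2, h3⟩ := ode_local hΩ hv hs
  rw [h0] at h1 h2 h3
  exact ⟨Φ, h1, h2.mono fun y hy => ⟨⟨_, hy.1, hy.2⟩, odeFlow_eq hΩ hv hy.2 hy.1⟩, h3⟩

theorem isOpen_odeDom {v : E → E} {Ω : Set E} (hΩ : IsOpen Ω) (hv : ContDiffOn ℝ ∞ v Ω) :
    IsOpen (odeDom v Ω) := by
  rw [isOpen_iff_eventually]
  intro x hx
  obtain ⟨Φ, h1, h2, h3⟩ := odeFlow_local hΩ hv hx
  exact h2.mono fun y hy => hy.1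

theorem odeFlow_contDiffAt {v : E → E} {Ω : Set E} (hΩ : IsOpen Ω) (hv : ContDiffOn ℝ ∞ v Ω)
    {x : E} (hx : x ∈ odeDom v Ω) {t : ℝ} (ht : t ∈ Icc (0:ℝ) 1) :
    ContDiffAt ℝ ∞ (fun y => odeFlow v Ω y t) x := by
  obtain ⟨Φ, h1, h2, h3⟩ := odeFlow_local hΩ hv hx
  obtain ⟨L, hL⟩ := extPath_clm (E := E) t
  have : ContDiffAt ℝ ∞ (fun y => L (Φ y)) x := L.contDiff.contDiffAt.comp x h1
  refine this.congr_of_eventuallyEq (h2.mono fun y hy => ?_)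
  change odeFlow v Ω y t = L (Φ y)
  rw [hL]; exact hy.2 ht

theorem odeFlow_fderiv {v : E → E} {Ω : Set E} (hΩ : IsOpen Ω) (hv : ContDiffOn ℝ ∞ v Ω)
    {x : E} (hx : x ∈ odeDom v Ω) (h : E) {t : ℝ} (ht : t ∈ Icc (0:ℝ) 1) :
    HasDerivWithinAt (fun t => fderiv ℝ (fun y => odeFlow v Ω y t) x h)
      (fderiv ℝ v (odeFlow v Ω x t) (fderiv ℝ (fun y => odeFlow v Ω y t) x h)) (Icc 0 1) t := by
  obtain ⟨Φ, h1, h2, h3⟩ := odeFlow_local hΩ hv hx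
  have key : ∀ t ∈ Icc (0:ℝ) 1, fderiv ℝ (fun y => odeFlow v Ω y t) x h =
      extPath (fderiv ℝ Φ x h) t := by
    intro t ht
    obtain ⟨L, hL⟩ := extPath_clm (E := E) t
    have h4 : HasFDerivAt (fun y => L (Φ y)) (L.comp (fderiv ℝ Φ x)) x :=
      L.hasFDerivAt.comp x (h1.differentiableAt (by simp)).hasFDerivAt
    have h5 : (fun y => odeFlow v Ω y t) =ᶠ[𝓝 x] fun y => L (Φ y) :=
      h2.mono fun y hy => by
        change odeFlow v Ω y t = L (Φ y)
        rw [hL]; exact hy.2 ht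
    rw [(h4.congr_of_eventuallyEq h5).fderiv]
    exact hL _
  rw [key t ht]
  exact (h3 h t ht).congr (fun s hs => key s hs) (key t ht)

theorem odeFlow_continuousOn {v : E → E} {Ω : Set E} (hΩ : IsOpen Ω) (hv : ContDiffOn ℝ ∞ v Ω) :
    ContinuousOn (fun z : E × ℝ => odeFlow v Ω z.1 z.2) (odeDom v Ω ×ˢ Icc 0 1) := by
  rintro ⟨x, t⟩ ⟨hx, ht⟩
  obtain ⟨Φ, h1, h2, h3⟩ := odeFlow_local hΩ hv hx
  have hc : ContinuousAt (fun z : E × ℝ => extPath (Φ z.1) z.2) (x, t) := by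
    have h4 : ContinuousAt (fun z : E × ℝ => (Φ z.1, projIcc (0:ℝ) 1 zero_le_one z.2)) (x, t) :=
      (ContinuousAt.comp (f := Prod.fst) (x := (x, t)) h1.continuousAt continuousAt_fst).prodMk
        (continuous_projIcc.comp continuous_snd).continuousAt
    exact ContinuousAt.comp (x := (x, t))
      (ContinuousEval.continuous_eval (F := II →ᵇ E) (X := II) (Y := E)).continuousAt h4
  refine hc.continuousWithinAt.congr_of_eventuallyEq ?_ (h2.self_of_nhds.2 ht)
  have h5 : ∀ᶠ z : E × ℝ in 𝓝 (x, t), EqOn (odeFlow v Ω z.1) (extPath (Φ z.1)) (Icc 0 1) :=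
    continuousAt_fst.eventually (h2.mono fun y hy => hy.2)
  filter_upwards [mem_nhdsWithin_of_mem_nhds h5, self_mem_nhdsWithin] with z hz hz'
  exact hz hz'.2

end ODE
end NambuLin
end FileM2

section FileM3
open scoped ContDiff
open MeasureTheory Set Filter Topology

namespace NambuLin

section Flat

set_option linter.unusedSectionVars false

variable {V Z G : Type} [NormedAddCommGroup V] [NormedSpace ℝ V] [FiniteDimensional ℝ V]
  [NormedAddCommGroup Z] [NormedSpace ℝ Z] [FiniteDimensional ℝ Z]
  [NormedAddCommGroup G] [NormedSpace ℝ G]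

/-- smooth local functions extend globally -/
theorem globalize {f : V → G} {O : Set V} (hO : IsOpen O) (hf : ContDiffOn ℝ ∞ f O) {x : V}
    (hx : x ∈ O) : ∃ c : V → ℝ, ContDiff ℝ ∞ (fun y => c y • f y) ∧ ∀ᶠ y in 𝓝 x, c y = 1 := by
  obtain ⟨d, hd⟩ := Metric.isOpen_iff.1 hO x hx
  let b : ContDiffBump x := ⟨d / 3, d / 2, by linarith [hd.1], by linarith [hd.1]⟩
  refine ⟨b, ?_, ?_⟩
  · rw [contDiff_iff_contDiffAt]
    intro y
    by_cases hy : y ∈ O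
    · exact b.contDiff.contDiffAt.smul (hf.contDiffAt (hO.mem_nhds hy))
    · have : y ∉ tsupport b := by
        intro h
        rw [b.tsupport_eq] at h
        apply hy
        apply hd.2
        rw [Metric.mem_ball]
        have := Metric.mem_closedBall.1 h
        change dist y x ≤ d / 2 at this
        linarith [hd.1]
      have h2 : (fun y => b y • f y) =ᶠ[𝓝 y] fun _ => 0 := by
        have := notMem_tsupport_iff_eventuallyEq.1 this
        filter_upwards [this] with z hz
        simp [hz]
      exact contDiffAt_const.congr_of_eventuallyEq h2
  · exact b.eventuallyEq_one

theorem division_global [CompleteSpace G] {F : ℝ × V → G} (hF : ContDiff ℝ ∞ F)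
    (h0 : ∀ w, F (0, w) = 0) :
    ∃ F₁ : ℝ × V → G, ContDiff ℝ ∞ F₁ ∧ ∀ p, F p = p.1 • F₁ p := by
  borelize ℝ
  let F2 : ℝ × (ℝ × V) → G := fun z => fderiv ℝ F (z.1 * z.2.1, z.2.2) (1, 0)
  have hF2 : ContDiff ℝ ∞ F2 := by
    have : ContDiff ℝ ∞ (fderiv ℝ F) := hF.fderiv_right (m := ∞) (by simp)
    refine (this.comp (?_ : ContDiff ℝ ∞ fun z : ℝ × (ℝ × V) => (z.1 * z.2.1, z.2.2))).clm_apply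
      contDiff_const
    fun_prop
  have := parInt_contDiff (T := ℝ) (volume.restrict (Ioc (0:ℝ) 1))
    (fun t => max 0 (min t 1)) (by fun_prop) 1 (by
      intro t; rw [Real.norm_eq_abs, abs_le]; constructor
      · linarith [le_max_left 0 (min t 1)]
      · exact max_le zero_le_one (min_le_right _ _)) F2 hF2
  refine ⟨_, this, ?_⟩
  rintro ⟨s, w⟩
  have hd : ∀ t : ℝ, HasDerivAt (fun t : ℝ => F (t * s, w)) (s • F2 (t, (s, w))) t := by
    intro t
    have h1 := (hF.differentiable (by simp) (t * s, w)).hasFDerivAt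
    have h2 : HasDerivAt (fun t : ℝ => (t * s, w)) ((s, 0) : ℝ × V) t := by
      have := ((hasDerivAt_id t).mul_const s).prodMk (hasDerivAt_const t w)
      simpa using this
    have h3 := h1.comp_hasDerivAt t h2
    have h5 : s • F2 (t, (s, w)) = (fderiv ℝ F (t * s, w)) (s, 0) := by
      simp only [F2]
      rw [← map_smul]; simp
    rw [h5]; exact h3
  have h4 := intervalIntegral.integral_eq_sub_of_hasDerivAt (a := 0) (b := 1)
    (f := fun t : ℝ => F (t * s, w)) (f' := fun t => s • F2 (t, (s, w))) (fun t _ => hd t) (by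
      apply Continuous.intervalIntegrable
      have := hF2.continuous
      fun_prop)
  simp only [one_mul, zero_mul, h0, sub_zero] at h4
  rw [← h4, intervalIntegral.integral_smul, intervalIntegral.integral_of_le zero_le_one]
  simp only
  congr 1
  apply setIntegral_congr_fun measurableSet_Ioc
  intro t ht
  simp only
  rw [min_eq_left ht.2, max_eq_right ht.1.le]

theorem division [CompleteSpace G] {F : ℝ × V → G} {O : Set (ℝ × V)} (hO : IsOpen O)
    (hF : ContDiffOn ℝ ∞ F O) (h0 : ∀ p : ℝ × V, p.1 ≤ 0 → F p = 0) :
    ContDiffOn ℝ ∞ (fun p => p.1⁻¹ • F p) O := by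
  rintro ⟨s, w⟩ hp
  by_cases hs : s = 0
  · subst hs
    obtain ⟨c, hc1, hc2⟩ := globalize hO hF hp
    obtain ⟨F₁, h1, h2⟩ := division_global hc1 (fun w => by rw [h0 _ le_rfl, smul_zero])
    have h3 : ∀ w, F₁ (0, w) = 0 := by
      intro w
      have hcon : Tendsto (fun s : ℝ => F₁ (s, w)) (𝓝[<] 0) (𝓝 (F₁ (0, w))) := by
        have : Continuous fun s : ℝ => F₁ (s, w) := by have := h1.continuous; fun_prop
        exact (this.tendsto 0).mono_left nhdsWithin_le_nhds
      have hz : Tendsto (fun s : ℝ => F₁ (s, w)) (𝓝[<] 0) (𝓝 0) := by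
        refine tendsto_const_nhds.congr' ?_
        filter_upwards [self_mem_nhdsWithin] with s hs
        have := h2 (s, w)
        rw [h0 (s, w) (le_of_lt (mem_Iio.1 hs)), smul_zero] at this
        exact ((smul_eq_zero.1 this.symm).resolve_left (ne_of_lt hs)).symm
      exact tendsto_nhds_unique hcon hz
    refine (h1.contDiffAt.congr_of_eventuallyEq ?_).contDiffWithinAt
    filter_upwards [hc2] with p hp
    have := h2 p
    rw [hp, one_smul] at this
    obtain ⟨s, w⟩ := p
    by_cases hs : s = 0
    · subst hs; simp [h3]
    · rw [this, smul_smul, inv_mul_cancel₀ hs, one_smul]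
  · have h1 : ContDiffAt ℝ ∞ (fun p : ℝ × V => p.1⁻¹) (s, w) := contDiffAt_fst.inv hs
    exact (h1.smul (hF.contDiffAt (hO.mem_nhds hp))).contDiffWithinAt

/-- blow up of a function -/
noncomputable def bl (g : V × Z → G) : ℝ × V × Z → G :=
  fun p => if 0 < p.1 then g (p.1 • p.2.1, p.2.2) else 0

theorem bl_zero (g : V × Z → G) (p : ℝ × V × Z) (h : p.1 ≤ 0) : bl g p = 0 := if_neg (not_lt.2 h)

theorem bl_forward {g : V × Z → G} {U : Set (V × Z)} (hU : IsOpen U) (hg : ContDiffOn ℝ ∞ g U)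
    (hfl : ∀ l : ℕ, ∀ x ∈ U, x.1 = 0 → iteratedFDeriv ℝ l g x = 0) :
    ContDiffOn ℝ ∞ (bl g) {p : ℝ × V × Z | (p.1 • p.2.1, p.2.2) ∈ U} := by
  set m : ℝ × V × Z → V × Z := fun p => (p.1 • p.2.1, p.2.2) with hm
  have hmC : ContDiff ℝ ∞ m := by fun_prop
  have hO : IsOpen {p : ℝ × V × Z | (p.1 • p.2.1, p.2.2) ∈ U} := hU.preimage hmC.continuous
  rw [contDiffOn_infty]
  intro n
  induction n generalizing G with
  | zero =>
    rw [Nat.cast_zero, contDiffOn_zero]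
    intro p hp
    apply ContinuousAt.continuousWithinAt
    have h1 : ContinuousAt (fun p => g (m p)) p :=
      ContinuousAt.comp (f := m) (g := g) (hg.continuousOn.continuousAt (hU.mem_nhds hp)) hmC.continuous.continuousAt
    rcases lt_trichotomy p.1 0 with h | h | h
    · refine continuousAt_const (y := (0:G)) |>.congr ?_
      filter_upwards [continuousAt_fst.eventually (gt_mem_nhds h)] with y hy
      rw [bl_zero _ _ hy.le]
    · have h0 : g (m p) = 0 := by
        have := hfl 0 (m p) hp (by simp [hm, h])
        have := congrArg (fun f => f ![]) this
        simpa using this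
      rw [ContinuousAt, h0] at h1
      rw [ContinuousAt, bl_zero _ _ h.le]
      refine squeeze_zero_norm (a := fun p => ‖g (m p)‖) (fun y => ?_) (by simpa using h1.norm)
      rw [bl]; split_ifs
      · exact le_rfl
      · simp
    · refine h1.congr ?_
      filter_upwards [continuousAt_fst.eventually (lt_mem_nhds h)] with y hy
      rw [bl, if_pos hy]
  | succ n ih =>
    have hD : ContDiffOn ℝ ∞ (fderiv ℝ g) U := hg.fderiv_of_isOpen hU (by simp)
    have hDf : ∀ l : ℕ, ∀ x ∈ U, x.1 = 0 → iteratedFDeriv ℝ l (fderiv ℝ g) x = 0 := by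
      intro l x hx h
      rw [← norm_eq_zero, norm_iteratedFDeriv_fderiv, norm_eq_zero]
      exact hfl _ x hx h
    have hi := ih hD hDf
    have hder : ∀ p ∈ {p : ℝ × V × Z | (p.1 • p.2.1, p.2.2) ∈ U},
        HasFDerivAt (bl g) ((bl (fderiv ℝ g) p).comp (fderiv ℝ m p)) p := by
      intro p hp
      have hgd : HasFDerivAt g (fderiv ℝ g (m p)) (m p) :=
        ((hg.contDiffAt (hU.mem_nhds hp)).differentiableAt (by simp)).hasFDerivAt
      have hmd : HasFDerivAt m (fderiv ℝ m p) p := (hmC.differentiable (by simp) p).hasFDerivAt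
      have h1 : HasFDerivAt (fun p => g (m p)) ((fderiv ℝ g (m p)).comp (fderiv ℝ m p)) p := hgd.comp p hmd
      rcases lt_trichotomy p.1 0 with h | h | h
      · rw [bl_zero _ _ h.le]
        refine (hasFDerivAt_const (0:G) p).congr_of_eventuallyEq ?_ |>.congr_fderiv (by simp)
        filter_upwards [continuousAt_fst.eventually (gt_mem_nhds h)] with y hy
        rw [bl_zero _ _ hy.le]
      · have h0 : g (m p) = 0 := by
          have := hfl 0 (m p) hp (by simp [hm, h])
          have := congrArg (fun f => f ![]) this
          simpa using this
        have h00 : fderiv ℝ g (m p) = 0 := by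
          have := hDf 0 (m p) hp (by simp [hm, h])
          have := congrArg (fun f => f ![]) this
          simpa using this
        rw [bl_zero _ _ h.le]
        rw [h00] at h1
        rw [hasFDerivAt_iff_isLittleO] at h1 ⊢
        refine Asymptotics.IsBigO.trans_isLittleO (Asymptotics.IsBigO.of_bound 1 (Eventually.of_forall fun y => ?_)) h1
        simp only [h0, bl_zero g p h.le, ContinuousLinearMap.zero_comp, zero_apply, sub_zero, one_mul]
        rw [bl]; split_ifs
        · exact le_rfl
        · simp
      · rw [bl, if_pos h]
        refine h1.congr_of_eventuallyEq ?_
        filter_upwards [continuousAt_fst.eventually (lt_mem_nhds h)] with y hy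
        rw [bl, if_pos hy]
    rw [Nat.cast_add, Nat.cast_one, contDiffOn_succ_iff_fderiv_of_isOpen hO]
    refine ⟨fun p hp => (hder p hp).differentiableAt.differentiableWithinAt, by simp, ?_⟩
    have h5 : ContDiffOn ℝ n (fun p => (bl (fderiv ℝ g) p).comp (fderiv ℝ m p)) {p : ℝ × V × Z | (p.1 • p.2.1, p.2.2) ∈ U} := by
      refine hi.clm_comp ?_
      have : ContDiff ℝ ∞ (fderiv ℝ m) := hmC.fderiv_right (m := ∞) (by simp)
      exact (this.of_le (by exact_mod_cast le_top)).contDiffOn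
    exact h5.congr fun p hp => (hder p hp).fderiv

/-- the predicate for blow down. -/
theorem bl_deriv [CompleteSpace G] {g : V × Z → G} {O : Set (ℝ × V × Z)} (hO : IsOpen O)
    (hg : ContDiffOn ℝ ∞ (bl g) O) :
    (∀ p ∈ O, 0 < p.1 → ContDiffAt ℝ ∞ g (p.1 • p.2.1, p.2.2)) ∧
    ContDiffOn ℝ ∞ (bl (fderiv ℝ g)) O := by
  have h1 : ∀ p ∈ O, 0 < p.1 → ContDiffAt ℝ ∞ g (p.1 • p.2.1, p.2.2) := by
    rintro ⟨s, v, z⟩ hp hs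
    simp only at hs ⊢
    have hc : ContDiff ℝ ∞ (fun x : V × Z => (s, s⁻¹ • x.1, x.2)) := by fun_prop
    have he : (s, s⁻¹ • s • v, z) = (s, v, z) := by rw [smul_smul, inv_mul_cancel₀ hs.ne', one_smul]
    have h2 : ContDiffAt ℝ ∞ (fun x : V × Z => bl g (s, s⁻¹ • x.1, x.2)) (s • v, z) := by
      refine ContDiffAt.comp (g := bl g) (f := fun x : V × Z => (s, s⁻¹ • x.1, x.2)) (s • v, z) ?_ hc.contDiffAt
      simp only [he]
      exact hg.contDiffAt (hO.mem_nhds hp)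
    refine h2.congr_of_eventuallyEq (Eventually.of_forall fun x => ?_)
    simp [bl, hs, smul_smul, hs.ne']
  refine ⟨h1, ?_⟩
  have hD : ContDiffOn ℝ ∞ (fderiv ℝ (bl g)) O := hg.fderiv_of_isOpen hO (by simp)
  let J1 : V →L[ℝ] ℝ × V × Z := (ContinuousLinearMap.inr ℝ ℝ (V × Z)).comp (ContinuousLinearMap.inl ℝ V Z)
  let J2 : Z →L[ℝ] ℝ × V × Z := (ContinuousLinearMap.inr ℝ ℝ (V × Z)).comp (ContinuousLinearMap.inr ℝ V Z)
  let A : ℝ × V × Z → (V →L[ℝ] G) := fun p => if 0 < p.1 then (fderiv ℝ (bl g) p).comp J1 else 0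
  have hz : ∀ p ∈ O, p.1 ≤ 0 → ∀ x, fderiv ℝ (bl g) p (0, x) = 0 := by
    intro p hp hs x
    have h2 := ((hg.contDiffAt (hO.mem_nhds hp)).differentiableAt (by simp)).hasFDerivAt
    have h3 : HasDerivAt (fun t : ℝ => p + t • ((0, x) : ℝ × V × Z)) (0, x) 0 := by
      have := ((hasDerivAt_id (0:ℝ)).smul_const ((0, x) : ℝ × V × Z)).const_add p
      simpa using this
    have h4 := HasFDerivAt.comp_hasDerivAt (l := bl g) (0:ℝ) (by simpa using h2) h3
    have h5 : (bl g ∘ fun t : ℝ => p + t • ((0, x) : ℝ × V × Z)) = fun _ => 0 := by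
      funext t
      apply bl_zero
      simpa using hs
    rw [h5] at h4
    have := h4.unique (hasDerivAt_const (0:ℝ) (0:G))
    simpa using this
  have hA : ContDiffOn ℝ ∞ A O := by
    have : ContDiffOn ℝ ∞ (fun p => (fderiv ℝ (bl g) p).comp J1) O := hD.clm_comp contDiffOn_const
    refine this.congr fun p hp => ?_
    by_cases h : 0 < p.1
    · simp [A, h]
    · simp only [A, h, if_false]
      ext x
      exact (hz p hp (not_lt.1 h) _).symm
  have hA1 := division hO hA (fun p hp => if_neg (not_lt.2 hp))
  have hB : ContDiffOn ℝ ∞ (fun p => ((p.1⁻¹ • A p).comp (ContinuousLinearMap.fst ℝ V Z)) +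
      ((fderiv ℝ (bl g) p).comp J2).comp (ContinuousLinearMap.snd ℝ V Z)) O :=
    (hA1.clm_comp contDiffOn_const).add ((hD.clm_comp contDiffOn_const).clm_comp contDiffOn_const)
  refine hB.congr fun p hp => ?_
  by_cases h : 0 < p.1
  · obtain ⟨s, v, z⟩ := p
    have h2 := ((h1 _ hp h).differentiableAt (by simp)).hasFDerivAt
    simp only at h h2
    have h3 : HasFDerivAt (fun p : ℝ × V × Z => (p.1 • p.2.1, p.2.2))
        ((s • (ContinuousLinearMap.fst ℝ V Z).comp (ContinuousLinearMap.snd ℝ ℝ (V × Z)) +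
          (ContinuousLinearMap.fst ℝ ℝ (V × Z)).smulRight v).prod
          ((ContinuousLinearMap.snd ℝ V Z).comp (ContinuousLinearMap.snd ℝ ℝ (V × Z)))) (s, v, z) := by
      refine HasFDerivAt.prodMk ?_ ?_
      · exact HasFDerivAt.smul (x := (s, v, z)) (ContinuousLinearMap.fst ℝ ℝ (V × Z)).hasFDerivAt
          ((ContinuousLinearMap.fst ℝ V Z).comp (ContinuousLinearMap.snd ℝ ℝ (V × Z))).hasFDerivAt
      · exact ((ContinuousLinearMap.snd ℝ V Z).comp (ContinuousLinearMap.snd ℝ ℝ (V × Z))).hasFDerivAt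
    have h4 := HasFDerivAt.comp (s, v, z) (g := g) h2 h3
    have h5 : HasFDerivAt (bl g) _ (s, v, z) := h4.congr_of_eventuallyEq (by
      filter_upwards [continuousAt_fst.eventually (lt_mem_nhds h)] with y hy
      rw [bl, if_pos hy]; rfl)
    rw [h5.fderiv]
    simp only [bl, A, h, if_true]
    rw [h5.fderiv]
    ext x
    · have h00 : fderiv ℝ g (s • v, z) (0, 0) = 0 := map_zero _
      have : fderiv ℝ g (s • v, z) (s • x, 0) = s • fderiv ℝ g (s • v, z) (x, 0) := by
        rw [← map_smul]; simp
      simp [J1, J2, this, smul_smul, h.ne', h00]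
    · have h00 : fderiv ℝ g (s • v, z) (0, 0) = 0 := map_zero _
      simp [J1, J2, h00]
  · rw [bl_zero _ _ (not_lt.1 h)]
    ext x
    · simp [A, h]
    · simp [A, J2, hz p hp (not_lt.1 h)]

theorem blow_down [CompleteSpace G] {g : V × Z → G} {O : Set (ℝ × V × Z)} (hO : IsOpen O)
    (hg : ContDiffOn ℝ ∞ (bl g) O) {ε : ℝ}
    (hOε : ∀ s σ z, 0 ≤ s → s < ε → ‖σ‖ = 1 → ‖z‖ < ε → (s, σ, z) ∈ O)
    (h0 : ∀ z, ‖z‖ < ε → g (0, z) = 0) :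
    ContDiffOn ℝ ∞ g (Metric.ball 0 ε) ∧
      ∀ z, ‖z‖ < ε → fderiv ℝ g (0, z) = 0 := by
  have key : ∀ {G : Type} [NormedAddCommGroup G] [NormedSpace ℝ G] [CompleteSpace G] {g : V × Z → G},
      ContDiffOn ℝ ∞ (bl g) O → (∀ z, ‖z‖ < ε → g (0, z) = 0) →
      (∀ p ∈ Metric.ball (0 : V × Z) ε, DifferentiableAt ℝ g p) ∧
      ∀ z, ‖z‖ < ε → fderiv ℝ g (0, z) = 0 := by
    intro G _ _ _ g hg h0
    have hz : ∀ z, ‖z‖ < ε → HasFDerivAt g (0 : V × Z →L[ℝ] G) (0, z) := by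
      intro z hz
      have hε : 0 < ε := lt_of_le_of_lt (norm_nonneg _) hz
      have h1 := division hO hg (fun p hp => bl_zero _ _ hp)
      rw [hasFDerivAt_iff_isLittleO, Asymptotics.isLittleO_iff]
      intro c hc
      have h2 : ∀ᶠ x in 𝓝 ((0:ℝ), z), ∀ σ ∈ Metric.sphere (0:V) 1,
          ‖x.1⁻¹ • bl g (x.1, σ, x.2)‖ ≤ c := by
        apply IsCompact.eventually_forall_of_forall_eventually (isCompact_sphere _ _)
        intro σ hσ
        have h3 : ContinuousAt (fun p : ℝ × V × Z => p.1⁻¹ • bl g p) (0, σ, z) :=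
          h1.continuousOn.continuousAt (hO.mem_nhds (hOε _ _ _ le_rfl hε (by simpa using hσ) hz))
        have h4 : Tendsto (fun x : (ℝ × Z) × V => (x.1.1, x.2, x.1.2)) (𝓝 (((0:ℝ), z), σ)) (𝓝 (0, σ, z)) := by
          apply Continuous.tendsto' (by fun_prop); rfl
        have h5 := (h3.tendsto.comp h4).norm
        simp only [Function.comp_def, inv_zero, zero_smul, norm_zero] at h5
        exact (h5.eventually (gt_mem_nhds hc)).mono fun x hx => le_of_lt hx
      have h6 : Tendsto (fun p : V × Z => (‖p.1‖, p.2)) (𝓝 (0, z)) (𝓝 ((0:ℝ), z)) := by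
        apply Continuous.tendsto' (by fun_prop); simp
      have h7 : ∀ᶠ p in 𝓝 ((0:V), z), ‖p.2‖ < ε := by
        apply (continuous_snd.norm.continuousAt (x := ((0:V), z))).eventually (gt_mem_nhds hz)
      filter_upwards [h6.eventually h2, h7] with p hp hp2
      simp only [h0 z hz, sub_zero, zero_apply]
      by_cases hv : p.1 = 0
      · have : p = (0, p.2) := by rw [← hv]
        rw [this, h0 _ hp2]; simp; positivity
      · have hn : 0 < ‖p.1‖ := norm_pos_iff.2 hv
        have := hp (‖p.1‖⁻¹ • p.1) (by simp [norm_smul, hn.ne'])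
        simp only [bl, hn, if_true, smul_smul, mul_inv_cancel₀ hn.ne', one_smul] at this
        rw [norm_smul, norm_inv, norm_norm, inv_mul_le_iff₀ hn] at this
        refine this.trans ?_
        rw [mul_comm]
        gcongr
        have : ‖p.1‖ = ‖(p - (0, z)).1‖ := by simp
        rw [this]
        exact norm_fst_le _
    refine ⟨?_, fun z h => (hz z h).fderiv⟩
    rintro ⟨v, z⟩ hp
    rw [mem_ball_zero_iff, Prod.norm_def, max_lt_iff] at hp
    by_cases hv : v = 0
    · subst hv; exact (hz z hp.2).differentiableAt
    · have hn : 0 < ‖v‖ := norm_pos_iff.2 hv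
      have := (bl_deriv hO hg).1 (‖v‖, ‖v‖⁻¹ • v, z) (hOε _ _ _ hn.le hp.1 (by simp [norm_smul, hn.ne']) hp.2) hn
      simp only [smul_smul, mul_inv_cancel₀ hn.ne', one_smul] at this
      exact this.differentiableAt (by simp)
  refine ⟨?_, (key hg h0).2⟩
  rw [contDiffOn_infty]
  intro n
  induction n generalizing G with
  | zero =>
    rw [Nat.cast_zero, contDiffOn_zero]
    exact fun p hp => ((key hg h0).1 p hp).continuousAt.continuousWithinAt
  | succ n ih =>
    rw [Nat.cast_add, Nat.cast_one, contDiffOn_succ_iff_fderiv_of_isOpen Metric.isOpen_ball]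
    exact ⟨fun p hp => ((key hg h0).1 p hp).differentiableWithinAt, by simp,
      ih (bl_deriv hO hg).2 (key hg h0).2⟩

end Flat
end NambuLin
end FileM3

section FileM4a
open scoped ContDiff
open MeasureTheory Set Filter Topology

namespace NambuLin

section Transport

set_option linter.unusedSectionVars false

variable {X Y Z H Q : Type} [NormedAddCommGroup X] [InnerProductSpace ℝ X] [FiniteDimensional ℝ X]
  [NormedAddCommGroup Y] [InnerProductSpace ℝ Y] [FiniteDimensional ℝ Y]
  [NormedAddCommGroup Z] [NormedSpace ℝ Z] [FiniteDimensional ℝ Z]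
  [NormedAddCommGroup H] [NormedSpace ℝ H]
  [NormedAddCommGroup Q] [NormedSpace ℝ Q] [FiniteDimensional ℝ Q]

/-- model first integrals -/
noncomputable def F0 (p : (X × Y) × Z) : ℝ × Z :=
  ((1/2 : ℝ) * (inner ℝ p.1.1 p.1.1 - inner ℝ p.1.2 p.1.2), p.2)

theorem F0_contDiff : ContDiff ℝ ∞ (F0 : (X × Y) × Z → ℝ × Z) := by
  unfold F0
  refine ContDiff.prodMk (contDiff_const.mul (ContDiff.sub ?_ ?_)) contDiff_snd
  · exact ContDiff.inner ℝ (by fun_prop) (by fun_prop)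
  · exact ContDiff.inner ℝ (by fun_prop) (by fun_prop)

theorem F0_hasDerivAt {γ : ℝ → (X × Y) × Z} {γ' : (X × Y) × Z} {s : Set ℝ} {t : ℝ}
    (h : HasDerivWithinAt γ γ' s t) : HasDerivWithinAt (fun t => F0 (γ t))
      (inner ℝ (γ t).1.1 γ'.1.1 - inner ℝ (γ t).1.2 γ'.1.2, γ'.2) s t := by
  have h1 : HasDerivWithinAt (fun t => (γ t).1.1) γ'.1.1 s t :=
    ((ContinuousLinearMap.fst ℝ X Y).comp (ContinuousLinearMap.fst ℝ (X × Y) Z)).hasFDerivAt.comp_hasDerivWithinAt t h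
  have h2 : HasDerivWithinAt (fun t => (γ t).1.2) γ'.1.2 s t :=
    ((ContinuousLinearMap.snd ℝ X Y).comp (ContinuousLinearMap.fst ℝ (X × Y) Z)).hasFDerivAt.comp_hasDerivWithinAt t h
  have h3 : HasDerivWithinAt (fun t => (γ t).2) γ'.2 s t :=
    (ContinuousLinearMap.snd ℝ (X × Y) Z).hasFDerivAt.comp_hasDerivWithinAt t h
  refine HasDerivWithinAt.prodMk ?_ h3
  have := ((h1.inner ℝ h1).sub (h2.inner ℝ h2)).const_mul (1/2 : ℝ)
  refine this.congr_deriv ?_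
  rw [real_inner_comm (γ t).1.1 γ'.1.1, real_inner_comm (γ t).1.2 γ'.1.2]
  ring

theorem F0_fderiv (p v : (X × Y) × Z) : fderiv ℝ (F0 : (X × Y) × Z → ℝ × Z) p v =
    (inner ℝ p.1.1 v.1.1 - inner ℝ p.1.2 v.1.2, v.2) := by
  have h1 := ((F0_contDiff (X := X) (Y := Y) (Z := Z)).differentiable (by simp) p).hasFDerivAt
  have h2 : HasDerivAt (fun t : ℝ => p + t • v) v 0 := by
    simpa using ((hasDerivAt_id (0:ℝ)).smul_const v).const_add p
  have h3 := HasFDerivAt.comp_hasDerivAt (0:ℝ) (l := F0) (f := fun t : ℝ => p + t • v) (by simpa using h1) h2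
  have h4 := F0_hasDerivAt (hasDerivWithinAt_univ.2 h2)
  rw [hasDerivWithinAt_univ] at h4
  have := h3.unique h4
  simpa using this

/-- dilation along the singular set -/
def dil (s : ℝ) (p : (X × Y) × Z) : (X × Y) × Z := (s • p.1, p.2)

/-- weighted dilation of the values -/
def wt (s : ℝ) (a : ℝ × Z) : ℝ × Z := (s ^ 2 * a.1, a.2)

theorem F0_dil (s : ℝ) (p : (X × Y) × Z) : F0 (dil s p) = wt s (F0 p) := by
  simp only [F0, dil, wt, Prod.smul_fst, Prod.smul_snd, inner_smul_left, inner_smul_right]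
  simp
  ring

theorem wt_inj {s : ℝ} (hs : 0 < s) {a b : ℝ × Z} (h : wt s a = wt s b) : a = b := by
  simp only [wt, Prod.mk.injEq] at h
  exact Prod.ext (mul_left_cancel₀ (by positivity) h.1) h.2

/-- Standing hypotheses for the construction of first integrals. -/
structure Setup (α : (X × Y) × Z → ((X × Y) × Z →L[ℝ] ℝ × Z))
    (αh : ℝ × ((X × Y) × Z) → ((X × Y) × Z →L[ℝ] ℝ × Z)) (O : Set (ℝ × ((X × Y) × Z)))
    (H : Type) [NormedAddCommGroup H] [NormedSpace ℝ H] : Prop where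
  hO : IsOpen O
  smooth : ContDiffOn ℝ ∞ αh O
  neg : ∀ s p, s ≤ 0 → αh (s, p) = fderiv ℝ F0 p
  pos : ∀ s p v, (s, p) ∈ O → 0 < s → α (dil s p) (dil s v) = wt s (αh (s, p) v)
  mem : ∀ x y, (x, y) ≠ (0 : X × Y) → ((0:ℝ), ((x, y), (0:Z))) ∈ O
  int : ∀ s p, (s, p) ∈ O → 0 < s → ∃ h : (X × Y) × Z → H, ∀ᶠ p' in 𝓝 (dil s p),
    DifferentiableAt ℝ h p' ∧ ∀ v, fderiv ℝ h p' v = 0 ↔ α p' v = 0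

theorem const_of_deriv_zero {G : Type} [NormedAddCommGroup G] [NormedSpace ℝ G] {f : ℝ → G}
    {I : Set ℝ} (hI : Convex ℝ I)
    (h : ∀ t ∈ I, HasDerivWithinAt f 0 I t) {a b : ℝ} (ha : a ∈ I) (hb : b ∈ I) : f a = f b := by
  have := hI.norm_image_sub_le_of_norm_hasDerivWithin_le (f := f) (f' := fun _ => 0) (C := 0)
    h (fun _ _ => by simp) ha hb
  rw [zero_mul, norm_le_zero_iff, sub_eq_zero] at this
  exact this.symm

theorem lemmaL {E 𝓕 : Type} [NormedAddCommGroup E] [NormedSpace ℝ E]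
    [NormedAddCommGroup 𝓕] [NormedSpace ℝ 𝓕] (α : E → (E →L[ℝ] 𝓕)) (G : ℝ → ℝ → E) (w : ℝ → E) (u0 : ℝ)
    (hitgr : ∀ t ∈ Icc (0:ℝ) 1, ∃ h : E → H, ∀ᶠ p' in 𝓝 (G t u0),
      DifferentiableAt ℝ h p' ∧ ∀ v, fderiv ℝ h p' v = 0 ↔ α p' v = 0)
    (hc : ∀ t ∈ Icc (0:ℝ) 1, ContinuousWithinAt (fun z : ℝ × ℝ => G z.1 z.2) (Icc 0 1 ×ˢ univ) (t, u0))
    (ht : ∀ᶠ u in 𝓝 u0, ∀ t ∈ Icc (0:ℝ) 1, ∃ g', HasDerivWithinAt (fun t => G t u) g' (Icc 0 1) t ∧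
      α (G t u) g' = 0)
    (hu : ∀ t ∈ Icc (0:ℝ) 1, HasDerivAt (fun u => G t u) (w t) u0)
    (h0 : α (G 0 u0) (w 0) = 0) : α (G 1 u0) (w 1) = 0 := by
  have key : (α (G 0 u0) (w 0) = 0) ↔ (α (G 1 u0) (w 1) = 0) := by
    refine IsPreconnected.induction₂ (s := Icc (0:ℝ) 1) isPreconnected_Icc
      (fun a b => (α (G a u0) (w a) = 0) ↔ (α (G b u0) (w b) = 0)) ?_ ?_ ?_
      (left_mem_Icc.2 zero_le_one) (right_mem_Icc.2 zero_le_one)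
    · intro t0 ht0
      obtain ⟨h, hh⟩ := hitgr t0 ht0
      have h1 := (hc t0 ht0).eventually hh
      rw [nhdsWithin_prod_eq, nhdsWithin_univ, eventually_prod_iff] at h1
      obtain ⟨pa, hpa, pb, hpb, hab⟩ := h1
      obtain ⟨ε, hε, hεs⟩ := Metric.mem_nhdsWithin_iff.1 hpa
      filter_upwards [inter_mem_nhdsWithin (Icc (0:ℝ) 1) (Metric.ball_mem_nhds t0 hε)] with t1 ht1
      set I := Metric.ball t0 ε ∩ Icc (0:ℝ) 1 with hI
      have hIc : Convex ℝ I := (convex_ball _ _).inter (convex_Icc _ _)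
      have m0 : t0 ∈ I := ⟨Metric.mem_ball_self hε, ht0⟩
      have m1 : t1 ∈ I := ⟨ht1.2, ht1.1⟩
      have h2 : (fun u => h (G t0 u)) =ᶠ[𝓝 u0] fun u => h (G t1 u) := by
        filter_upwards [hpb, ht] with u hu1 hu2
        refine const_of_deriv_zero (f := fun t => h (G t u)) hIc (fun t hti => ?_) m0 m1
        obtain ⟨g', hg1, hg2⟩ := hu2 t hti.2
        obtain ⟨k1, k2⟩ := hab (hεs hti) hu1
        have := k1.hasFDerivAt.comp_hasDerivWithinAt t (hg1.mono (s := I) inter_subset_right)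
        rw [(k2 _).2 hg2] at this
        exact this
      have hu0b := hpb.self_of_nhds
      obtain ⟨k1, k2⟩ := hab (hεs m0) hu0b
      obtain ⟨k3, k4⟩ := hab (hεs m1) hu0b
      have d0 := k1.hasFDerivAt.comp_hasDerivAt u0 (hu t0 ht0)
      have d1 := k3.hasFDerivAt.comp_hasDerivAt u0 (hu t1 ht1.1)
      have := d0.unique (d1.congr_of_eventuallyEq h2)
      simp only at this k2 k4
      rw [← k2, ← k4, this]
    · intro a b c _ _ _ h1 h2; exact h1.trans h2
    · intro a b _ _ h1; exact h1.symm
  exact key.1 h0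

/-! ### generic transport -/

/-- direction map -/
noncomputable def inF : (ℝ × Z) →L[ℝ] ℝ × Q × (ℝ × Z) :=
  (ContinuousLinearMap.inr ℝ ℝ (Q × (ℝ × Z))).comp (ContinuousLinearMap.inr ℝ Q (ℝ × Z))

noncomputable def trM (αh : ℝ × ((X × Y) × Z) → ((X × Y) × Z →L[ℝ] ℝ × Z)) (sQ : Q → ℝ)
    (e : ℝ × Q × (ℝ × Z) → (X × Y) × Z) (σ : ℝ × Q × (ℝ × Z)) : (ℝ × Z) →L[ℝ] (ℝ × Z) :=
  (αh (sQ σ.2.1, e σ)).comp ((fderiv ℝ e σ).comp inF)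

noncomputable def trv (αh : ℝ × ((X × Y) × Z) → ((X × Y) × Z →L[ℝ] ℝ × Z)) (sQ : Q → ℝ)
    (e : ℝ × Q × (ℝ × Z) → (X × Y) × Z) (σ : ℝ × Q × (ℝ × Z)) : ℝ × Q × (ℝ × Z) :=
  (1, 0, -(Ring.inverse (trM αh sQ e σ)) (αh (sQ σ.2.1, e σ) (fderiv ℝ e σ (1, 0, 0))))

def trΩ (αh : ℝ × ((X × Y) × Z) → ((X × Y) × Z →L[ℝ] ℝ × Z)) (O : Set (ℝ × ((X × Y) × Z))) (sQ : Q → ℝ)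
    (e : ℝ × Q × (ℝ × Z) → (X × Y) × Z) : Set (ℝ × Q × (ℝ × Z)) :=
  {σ | (sQ σ.2.1, e σ) ∈ O ∧ IsUnit (trM αh sQ e σ)}

variable {α : (X × Y) × Z → ((X × Y) × Z →L[ℝ] ℝ × Z)}
  {αh : ℝ × ((X × Y) × Z) → ((X × Y) × Z →L[ℝ] ℝ × Z)} {O : Set (ℝ × ((X × Y) × Z))}
  {sQ : Q → ℝ} {e : ℝ × Q × (ℝ × Z) → (X × Y) × Z}

theorem Setup.contM (S : Setup α αh O H) (hs : ContDiff ℝ ∞ sQ) (he : ContDiff ℝ ∞ e) :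
    ContDiffOn ℝ ∞ (fun σ : ℝ × Q × (ℝ × Z) => αh (sQ σ.2.1, e σ)) {σ | (sQ σ.2.1, e σ) ∈ O} ∧
    ContDiffOn ℝ ∞ (trM αh sQ e) {σ | (sQ σ.2.1, e σ) ∈ O} ∧
    IsOpen {σ : ℝ × Q × (ℝ × Z) | (sQ σ.2.1, e σ) ∈ O} := by
  have h1 : ContDiff ℝ ∞ (fun σ : ℝ × Q × (ℝ × Z) => (sQ σ.2.1, e σ)) :=
    (hs.comp (by fun_prop : ContDiff ℝ ∞ fun σ : ℝ × Q × (ℝ × Z) => σ.2.1)).prodMk he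
  have h2 : ContDiffOn ℝ ∞ (fun σ : ℝ × Q × (ℝ × Z) => αh (sQ σ.2.1, e σ)) {σ | (sQ σ.2.1, e σ) ∈ O} :=
    S.smooth.comp h1.contDiffOn (fun x hx => hx)
  have h3 : ContDiff ℝ ∞ (fderiv ℝ e) := he.fderiv_right (m := ∞) (by simp)
  refine ⟨h2, ?_, S.hO.preimage h1.continuous⟩
  exact h2.clm_comp (h3.contDiffOn.clm_comp contDiffOn_const)

theorem Setup.isOpen_trΩ (S : Setup α αh O H) (hs : ContDiff ℝ ∞ sQ) (he : ContDiff ℝ ∞ e) :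
    IsOpen (trΩ αh O sQ e) := by
  obtain ⟨h1, h2, h3⟩ := S.contM hs he
  exact h2.continuousOn.isOpen_inter_preimage h3 Units.isOpen

theorem Setup.contDiffOn_trv (S : Setup α αh O H) (hs : ContDiff ℝ ∞ sQ) (he : ContDiff ℝ ∞ e) :
    ContDiffOn ℝ ∞ (trv αh sQ e) (trΩ αh O sQ e) := by
  obtain ⟨h1, h2, h3⟩ := S.contM hs he
  have h4 : ContDiff ℝ ∞ (fderiv ℝ e) := he.fderiv_right (m := ∞) (by simp)
  intro σ hσ
  apply ContDiffAt.contDiffWithinAt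
  have k1 := h1.contDiffAt (h3.mem_nhds hσ.1)
  have k2 := h2.contDiffAt (h3.mem_nhds hσ.1)
  obtain ⟨u, hu⟩ := hσ.2
  have k3 : ContDiffAt ℝ ∞ (fun σ => Ring.inverse (trM αh sQ e σ)) σ := by
    have := contDiffAt_ringInverse ℝ (n := ∞) u
    rw [hu] at this
    exact this.comp σ k2
  exact contDiffAt_const.prodMk (contDiffAt_const.prodMk
    (k3.neg.clm_apply (k1.clm_apply (h4.contDiffAt.clm_apply contDiffAt_const))))

/-- The main identity of the transport field. -/
theorem trv_spec {σ : ℝ × Q × (ℝ × Z)} (h : σ ∈ trΩ αh O sQ e) :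
    αh (sQ σ.2.1, e σ) (fderiv ℝ e σ (trv αh sQ e σ)) = 0 := by
  have h1 : trv αh sQ e σ = (1, 0, 0) + inF (trv αh sQ e σ).2.2 := by
    simp [trv, inF]
  rw [h1, map_add, map_add]
  have h2 : αh (sQ σ.2.1, e σ) (fderiv ℝ e σ (inF (trv αh sQ e σ).2.2)) =
      trM αh sQ e σ (trv αh sQ e σ).2.2 := rfl
  rw [h2]
  simp only [trv, map_neg, neg_apply]
  have h3 : ∀ a, trM αh sQ e σ (Ring.inverse (trM αh sQ e σ) a) = a := by
    intro a
    have := congrArg (fun T : (ℝ × Z) →L[ℝ] (ℝ × Z) => T a) (Ring.mul_inverse_cancel _ h.2)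
    simpa using this
  rw [h3]; simp

theorem tr_unique {σ : ℝ × Q × (ℝ × Z)} (h : σ ∈ trΩ αh O sQ e) {a : ℝ × Z}
    (ha : αh (sQ σ.2.1, e σ) (fderiv ℝ e σ (1, 0, a)) = 0) : ((1:ℝ), (0:Q), a) = trv αh sQ e σ := by
  have h1 : ((1:ℝ), (0:Q), a) = (1, 0, 0) + inF a := by simp [inF]
  rw [h1, map_add, map_add] at ha
  have h2 : αh (sQ σ.2.1, e σ) (fderiv ℝ e σ (inF a)) = trM αh sQ e σ a := rfl
  rw [h2, add_eq_zero_iff_eq_neg] at ha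
  have h3 : Ring.inverse (trM αh sQ e σ) (trM αh sQ e σ a) = a := by
    have := congrArg (fun T : (ℝ × Z) →L[ℝ] (ℝ × Z) => T a) (Ring.inverse_mul_cancel _ h.2)
    simpa using this
  simp [trv, ha, h3]

theorem tr_form {γ : ℝ → ℝ × Q × (ℝ × Z)} (h : IsSol (trv αh sQ e) (trΩ αh O sQ e) γ) {q : Q} {f : ℝ × Z}
    (h0 : γ 0 = (0, q, f)) {t : ℝ} (ht : t ∈ Icc (0:ℝ) 1) : γ t = (t, q, (γ t).2.2) := by
  have a1 : ∀ t ∈ Icc (0:ℝ) 1, HasDerivWithinAt (fun t => (γ t).1 - t) 0 (Icc 0 1) t := by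
    intro t ht
    have := (ContinuousLinearMap.fst ℝ ℝ (Q × (ℝ × Z))).hasFDerivAt.comp_hasDerivWithinAt t (h t ht).2
    have := this.sub (hasDerivWithinAt_id t _)
    refine this.congr_deriv ?_
    simp [trv]
  have a2 : ∀ t ∈ Icc (0:ℝ) 1, HasDerivWithinAt (fun t => (γ t).2.1) 0 (Icc 0 1) t := by
    intro t ht
    have := ((ContinuousLinearMap.fst ℝ Q (ℝ × Z)).comp (ContinuousLinearMap.snd ℝ ℝ (Q × (ℝ × Z)))).hasFDerivAt.comp_hasDerivWithinAt t (h t ht).2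
    exact this
  have z0 := left_mem_Icc.2 (zero_le_one (α := ℝ))
  have b1 := const_of_deriv_zero (convex_Icc _ _) a1 ht z0
  have b2 := const_of_deriv_zero (convex_Icc _ _) a2 ht z0
  simp only [h0] at b1 b2
  refine Prod.ext (by simp only; linarith) (Prod.ext b2 rfl)

theorem tr_path (he : ContDiff ℝ ∞ e) {γ : ℝ → ℝ × Q × (ℝ × Z)}
    (h : IsSol (trv αh sQ e) (trΩ αh O sQ e) γ) {t : ℝ} (ht : t ∈ Icc (0:ℝ) 1) :
    ∃ g', HasDerivWithinAt (fun t => e (γ t)) g' (Icc 0 1) t ∧ αh (sQ (γ t).2.1, e (γ t)) g' = 0 := by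
  refine ⟨_, ((he.differentiable (by simp) (γ t)).hasFDerivAt).comp_hasDerivWithinAt t (h t ht).2, ?_⟩
  exact trv_spec (h t ht).1

theorem Setup.tr_neg (S : Setup α αh O H) (he : ContDiff ℝ ∞ e) {γ : ℝ → ℝ × Q × (ℝ × Z)}
    (h : IsSol (trv αh sQ e) (trΩ αh O sQ e) γ) {q : Q} {f : ℝ × Z}
    (h0 : γ 0 = (0, q, f)) (hq : sQ q ≤ 0) {t : ℝ} (ht : t ∈ Icc (0:ℝ) 1) :
    F0 (e (γ t)) = F0 (e (0, q, f)) := by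
  rw [← h0]
  refine const_of_deriv_zero (f := fun t => F0 (e (γ t))) (convex_Icc 0 1) (fun t ht => ?_) ht
    (left_mem_Icc.2 zero_le_one)
  obtain ⟨g', h1, h2⟩ := tr_path he h ht
  have hq' : sQ (γ t).2.1 ≤ 0 := by rw [tr_form h h0 ht]; exact hq
  rw [S.neg _ _ hq'] at h2
  have := ((F0_contDiff (X := X) (Y := Y) (Z := Z)).differentiable (by simp) (e (γ t))).hasFDerivAt.comp_hasDerivWithinAt t h1
  rw [h2] at this
  exact this

theorem Setup.tr_exists (S : Setup α αh O H) (he : ContDiff ℝ ∞ e) {q : Q} (hq : sQ q ≤ 0) {f f' : ℝ → ℝ × Z}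
    (hf : ∀ t ∈ Icc (0:ℝ) 1, HasDerivWithinAt f (f' t) (Icc 0 1) t)
    (hΩ : ∀ t ∈ Icc (0:ℝ) 1, (t, q, f t) ∈ trΩ αh O sQ e)
    (hF : ∀ t ∈ Icc (0:ℝ) 1, F0 (e (t, q, f t)) = F0 (e (0, q, f 0))) :
    IsSol (trv αh sQ e) (trΩ αh O sQ e) (fun t => (t, q, f t)) := by
  intro t ht
  refine ⟨hΩ t ht, ?_⟩
  have hd : HasDerivWithinAt (fun t => (t, q, f t)) (1, 0, f' t) (Icc 0 1) t :=
    (hasDerivWithinAt_id t _).prodMk ((hasDerivWithinAt_const t _ q).prodMk (hf t ht))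
  have h1 := ((he.differentiable (by simp) (t, q, f t)).hasFDerivAt).comp_hasDerivWithinAt t hd
  have h2 := ((F0_contDiff (X := X) (Y := Y) (Z := Z)).differentiable (by simp) (e (t, q, f t))).hasFDerivAt.comp_hasDerivWithinAt t h1
  have h3 : HasDerivWithinAt (F0 ∘ e ∘ fun t => (t, q, f t)) 0 (Icc 0 1) t :=
    (hasDerivWithinAt_const t (Icc (0:ℝ) 1) (F0 (e (0, q, f 0)))).congr hF (hF t ht)
  have h4 := (uniqueDiffOn_Icc (zero_lt_one (α := ℝ)) t ht).eq_deriv _ h2 h3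
  have h5 := tr_unique (a := f' t) (hΩ t ht) (by
    simp only
    rw [S.neg _ _ hq]; exact h4)
  change HasDerivWithinAt _ (trv αh sQ e (t, q, f t)) _ _
  rw [← h5]; exact hd

/-- Derivatives in the kernel are transported into the kernel. -/
theorem Setup.tr_deriv (S : Setup α αh O H) (hs : ContDiff ℝ ∞ sQ) (he : ContDiff ℝ ∞ e)
    {κ : ℝ → Q × (ℝ × Z)} {u0 : ℝ} (hκ : DifferentiableAt ℝ κ u0)
    (hdom : (0, κ u0) ∈ odeDom (trv αh sQ e) (trΩ αh O sQ e)) (hpos : 0 < sQ (κ u0).1)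
    {w0 w1 : (X × Y) × Z}
    (hw0 : HasDerivAt (fun u => dil (sQ (κ u).1) (e (0, κ u))) w0 u0)
    (hk : α (dil (sQ (κ u0).1) (e (0, κ u0))) w0 = 0)
    (hw1 : HasDerivAt (fun u => dil (sQ (κ u).1) (e (odeFlow (trv αh sQ e) (trΩ αh O sQ e) (0, κ u) 1))) w1 u0) :
    α (dil (sQ (κ u0).1) (e (odeFlow (trv αh sQ e) (trΩ αh O sQ e) (0, κ u0) 1))) w1 = 0 := by
  set v := trv αh sQ e with hv
  set Ω := trΩ αh O sQ e with hΩ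
  have oΩ : IsOpen Ω := S.isOpen_trΩ hs he
  have cv : ContDiffOn ℝ ∞ v Ω := S.contDiffOn_trv hs he
  let G : ℝ → ℝ → (X × Y) × Z := fun t u => dil (sQ (κ u).1) (e (odeFlow v Ω (0, κ u) t))
  have cκ : ContinuousAt (fun u => ((0:ℝ), κ u)) u0 := continuousAt_const.prodMk hκ.continuousAt
  have cs : ContinuousAt (fun u => sQ (κ u).1) u0 := by
    have : ContinuousAt (fun u => (κ u).1) u0 := continuousAt_fst.comp hκ.continuousAt
    exact ContinuousAt.comp (f := fun u => (κ u).1) (g := sQ) hs.continuous.continuousAt this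
  have hev : ∀ᶠ u in 𝓝 u0, (0, κ u) ∈ odeDom v Ω ∧ 0 < sQ (κ u).1 :=
    (cκ.eventually ((isOpen_odeDom oΩ cv).mem_nhds hdom)).and (cs.eventually (lt_mem_nhds hpos))
  have hfl : ∀ u, (0, κ u) ∈ odeDom v Ω → ∀ t ∈ Icc (0:ℝ) 1,
      odeFlow v Ω (0, κ u) t ∈ Ω ∧ (odeFlow v Ω (0, κ u) t).2.1 = (κ u).1 := by
    intro u hu t ht
    obtain ⟨k0, k1⟩ := odeFlow_spec hu
    refine ⟨(k1 t ht).1, ?_⟩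
    have k0' : odeFlow v Ω (0, κ u) 0 = (0, (κ u).1, (κ u).2) := k0
    rw [tr_form k1 k0' ht]
  have hO' : ∀ u, (0, κ u) ∈ odeDom v Ω → ∀ t ∈ Icc (0:ℝ) 1,
      (sQ (κ u).1, e (odeFlow v Ω (0, κ u) t)) ∈ O := by
    intro u hu t ht
    have := (hfl u hu t ht)
    have h2 := this.1.1
    rw [this.2] at h2
    exact h2
  have hex : ∀ t ∈ Icc (0:ℝ) 1, DifferentiableAt ℝ (fun u => G t u) u0 := by
    intro t ht
    have d1 : DifferentiableAt ℝ (fun u => odeFlow v Ω (0, κ u) t) u0 := by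
      have := (odeFlow_contDiffAt oΩ cv hdom ht).differentiableAt (by simp)
      have d0 : DifferentiableAt ℝ (fun u => ((0:ℝ), κ u)) u0 := (differentiableAt_const _).prodMk hκ
      exact DifferentiableAt.comp (f := fun u => ((0:ℝ), κ u)) u0 this d0
    have d2 : DifferentiableAt ℝ (fun u => e (odeFlow v Ω (0, κ u) t)) u0 :=
      DifferentiableAt.comp (f := fun u => odeFlow v Ω (0, κ u) t) u0 (he.differentiable (by simp) _) d1
    have d3 : DifferentiableAt ℝ (fun u => sQ (κ u).1) u0 :=
      DifferentiableAt.comp (f := fun u => (κ u).1) u0 (hs.differentiable (by simp) _) hκ.fst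
    exact (d3.smul d2.fst).prodMk d2.snd
  have hG0 : ∀ᶠ u in 𝓝 u0, G 0 u = dil (sQ (κ u).1) (e (0, κ u)) := by
    filter_upwards [hev] with u hu
    simp only [G]
    rw [(odeFlow_spec hu.1).1]
  have hG0' : G 0 u0 = dil (sQ (κ u0).1) (e (0, κ u0)) := hG0.self_of_nhds
  have w0e : deriv (G 0) u0 = w0 := (hw0.congr_of_eventuallyEq hG0).deriv
  have w1e : deriv (G 1) u0 = w1 := hw1.deriv
  have := lemmaL (H := H) α G (fun t => deriv (fun u => G t u) u0) u0 ?_ ?_ ?_ ?_ ?_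
  · rw [← w1e]; exact this
  · intro t ht
    exact S.int _ _ (hO' u0 hdom t ht) hpos
  · intro t ht
    have c1 : ContinuousWithinAt (fun z : ℝ × ℝ => odeFlow v Ω (0, κ z.2) z.1) (Icc 0 1 ×ˢ univ) (t, u0) := by
      have c2 : ContinuousWithinAt (fun z : ℝ × ℝ => (((0:ℝ), κ z.2), z.1)) (Icc 0 1 ×ˢ univ) (t, u0) := by
        apply ContinuousAt.continuousWithinAt
        exact (ContinuousAt.comp (f := Prod.snd) (g := fun u => ((0:ℝ), κ u)) (x := (t, u0)) cκ continuousAt_snd).prodMk continuousAt_fst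
      have c3 := (odeFlow_continuousOn oΩ cv) ((0, κ u0), t) ⟨hdom, ht⟩
      have c4 : ContinuousWithinAt (fun z : (ℝ × Q × (ℝ × Z)) × ℝ => odeFlow v Ω z.1 z.2) (univ ×ˢ Icc 0 1) ((0, κ u0), t) := by
        refine c3.mono_of_mem_nhdsWithin ?_
        rw [nhdsWithin_prod_eq, nhdsWithin_univ]
        exact prod_mem_prod ((isOpen_odeDom oΩ cv).mem_nhds hdom) self_mem_nhdsWithin
      exact ContinuousWithinAt.comp (f := fun z : ℝ × ℝ => (((0:ℝ), κ z.2), z.1)) (x := (t, u0)) c4 c2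
        (fun z hz => ⟨mem_univ _, hz.1⟩)
    have c5 : ContinuousWithinAt (fun z : ℝ × ℝ => e (odeFlow v Ω (0, κ z.2) z.1)) (Icc 0 1 ×ˢ univ) (t, u0) :=
      he.continuous.continuousAt.comp_continuousWithinAt c1
    have c6 : ContinuousWithinAt (fun z : ℝ × ℝ => sQ (κ z.2).1) (Icc 0 1 ×ˢ univ) (t, u0) :=
      (ContinuousAt.comp (f := Prod.snd) (g := fun u => sQ (κ u).1) (x := (t, u0)) cs continuousAt_snd).continuousWithinAt
    exact (c6.smul c5.fst).prodMk c5.snd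
  · filter_upwards [hev] with u hu t ht
    obtain ⟨k0, k1⟩ := odeFlow_spec hu.1
    obtain ⟨g', g1, g2⟩ := tr_path he k1 ht
    refine ⟨dil (sQ (κ u).1) g', ?_, ?_⟩
    · let L : (X × Y) × Z →L[ℝ] (X × Y) × Z :=
        ((sQ (κ u).1) • ContinuousLinearMap.fst ℝ (X × Y) Z).prod (ContinuousLinearMap.snd ℝ (X × Y) Z)
      exact L.hasFDerivAt.comp_hasDerivWithinAt t g1
    · simp only [G]
      rw [S.pos _ _ _ (hO' u hu.1 t ht) hu.2]
      have := (hfl u hu.1 t ht).2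
      rw [this] at g2
      rw [g2]; simp [wt]
  · intro t ht
    exact (hex t ht).hasDerivAt
  · change α (G 0 u0) (deriv (G 0) u0) = 0
    rw [w0e, hG0']; exact hk

/-- injectivity at the end point -/
theorem Setup.tr_inj (S : Setup α αh O H) {σ : ℝ × Q × (ℝ × Z)} (h : σ ∈ trΩ αh O sQ e)
    (hpos : 0 < sQ σ.2.1) {a : ℝ × Z}
    (ha : α (dil (sQ σ.2.1) (e σ)) (dil (sQ σ.2.1) (fderiv ℝ e σ (inF a))) = 0) : a = 0 := by
  rw [S.pos _ _ _ h.1 hpos] at ha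
  have h1 : trM αh sQ e σ a = 0 := wt_inj hpos (by
    have hz : (0 : ℝ × Z) = wt (sQ σ.2.1) 0 := by simp [wt]; rfl
    rw [hz] at ha; exact ha)
  have := congrArg (fun T : (ℝ × Z) →L[ℝ] (ℝ × Z) => T a) (Ring.inverse_mul_cancel _ h.2)
  change Ring.inverse (trM αh sQ e σ) (trM αh sQ e σ a) = a at this
  rw [h1, map_zero] at this
  exact this.symm

end Transport
end NambuLin
end FileM4a

section FileM4b
open scoped ContDiff
open MeasureTheory Set Filter Topology

namespace NambuLin

section Families

set_option linter.unusedSectionVars false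

variable {X Y Z H Q : Type} [NormedAddCommGroup X] [InnerProductSpace ℝ X] [FiniteDimensional ℝ X]
  [NormedAddCommGroup Y] [InnerProductSpace ℝ Y] [FiniteDimensional ℝ Y]
  [NormedAddCommGroup Z] [NormedSpace ℝ Z] [FiniteDimensional ℝ Z]
  [NormedAddCommGroup H] [NormedSpace ℝ H]
  [NormedAddCommGroup Q] [NormedSpace ℝ Q] [FiniteDimensional ℝ Q]

/-- scaled families of functions -/
structure Hom (D : Set (ℝ × ((X × Y) × Z))) (Fh : ℝ × ((X × Y) × Z) → ℝ × Z) : Prop where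
  isOpen : IsOpen D
  smooth : ContDiffOn ℝ ∞ Fh D
  neg : ∀ s p, (s, p) ∈ D → s ≤ 0 → Fh (s, p) = F0 p
  homog : ∀ s r p, 0 < r → (s * r, p) ∈ D → (s, dil r p) ∈ D ∧ Fh (s, dil r p) = wt r (Fh (s * r, p))

/-- scaled families of partial first integrals -/
structure FI (α : (X × Y) × Z → ((X × Y) × Z →L[ℝ] ℝ × Z))
    (D : Set (ℝ × ((X × Y) × Z))) (Fh : ℝ × ((X × Y) × Z) → ℝ × Z) : Prop extends Hom D Fh where
  deriv : ∀ p v, (1, p) ∈ D → v.1.2 = 0 → α p v = 0 → fderiv ℝ (fun p => Fh (1, p)) p v = 0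

theorem dil_dil (s r : ℝ) (p : (X × Y) × Z) : dil s (dil r p) = dil (s * r) p := by
  simp [dil, smul_smul]

theorem dil_one (p : (X × Y) × Z) : dil 1 p = p := by simp [dil]

theorem wt_wt (s r : ℝ) (p : ℝ × Z) : wt s (wt r p) = wt (s * r) p := by
  simp [wt]; ring

theorem Hom.diff {D : Set (ℝ × ((X × Y) × Z))} {Fh : ℝ × ((X × Y) × Z) → ℝ × Z} (h : Hom D Fh)
    {p : (X × Y) × Z} (hp : (1, p) ∈ D) : DifferentiableAt ℝ (fun p => Fh (1, p)) p := by
  have h1 := (h.smooth.contDiffAt (h.isOpen.mem_nhds hp)).differentiableAt (by simp)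
  exact DifferentiableAt.comp (f := fun p => ((1:ℝ), p)) p h1 (by fun_prop)

theorem Hom_F0 : Hom (univ : Set (ℝ × ((X × Y) × Z))) (fun z => F0 z.2) where
  isOpen := isOpen_univ
  smooth := (F0_contDiff.comp contDiff_snd).contDiffOn
  neg _ _ _ _ := rfl
  homog s r p _ _ := ⟨mem_univ _, F0_dil r p⟩

variable {α : (X × Y) × Z → ((X × Y) × Z →L[ℝ] ℝ × Z)}
  {αh : ℝ × ((X × Y) × Z) → ((X × Y) × Z →L[ℝ] ℝ × Z)} {O : Set (ℝ × ((X × Y) × Z))}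
  {sQ : Q → ℝ} {e : ℝ × Q × (ℝ × Z) → (X × Y) × Z}

noncomputable def tEnd (αh : ℝ × ((X × Y) × Z) → ((X × Y) × Z →L[ℝ] ℝ × Z))
    (O : Set (ℝ × ((X × Y) × Z))) (sQ : Q → ℝ)
    (e : ℝ × Q × (ℝ × Z) → (X × Y) × Z) (σ : ℝ × Q × (ℝ × Z)) : (X × Y) × Z :=
  e (odeFlow (trv αh sQ e) (trΩ αh O sQ e) σ 1)

theorem Setup.tEnd_smooth (S : Setup α αh O H) (hs : ContDiff ℝ ∞ sQ) (he : ContDiff ℝ ∞ e) :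
    ContDiffOn ℝ ∞ (tEnd αh O sQ e) (odeDom (trv αh sQ e) (trΩ αh O sQ e)) := by
  intro σ hσ
  have := odeFlow_contDiffAt (S.isOpen_trΩ hs he) (S.contDiffOn_trv hs he) hσ (t := 1)
    (right_mem_Icc.2 zero_le_one)
  exact (he.contDiffAt.comp σ this).contDiffWithinAt

def famDom (αh : ℝ × ((X × Y) × Z) → ((X × Y) × Z →L[ℝ] ℝ × Z))
    (O : Set (ℝ × ((X × Y) × Z))) (sQ : Q → ℝ)
    (e : ℝ × Q × (ℝ × Z) → (X × Y) × Z) (ρ : (X × Y) × Z → ℝ) (U1 : Set ((X × Y) × Z))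
    (st : ℝ × ((X × Y) × Z) → ℝ × Q × (ℝ × Z)) (DT : Set (ℝ × ((X × Y) × Z))) :
    Set (ℝ × ((X × Y) × Z)) :=
  {z | z.2 ∈ U1 ∧ st z ∈ odeDom (trv αh sQ e) (trΩ αh O sQ e) ∧ (z.1 * ρ z.2, tEnd αh O sQ e (st z)) ∈ DT}

noncomputable def famF (αh : ℝ × ((X × Y) × Z) → ((X × Y) × Z →L[ℝ] ℝ × Z))
    (O : Set (ℝ × ((X × Y) × Z))) (sQ : Q → ℝ)
    (e : ℝ × Q × (ℝ × Z) → (X × Y) × Z) (ρ : (X × Y) × Z → ℝ)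
    (st : ℝ × ((X × Y) × Z) → ℝ × Q × (ℝ × Z)) (Th : ℝ × ((X × Y) × Z) → ℝ × Z)
    (z : ℝ × ((X × Y) × Z)) : ℝ × Z :=
  wt (ρ z.2) (Th (z.1 * ρ z.2, tEnd αh O sQ e (st z)))

theorem Setup.fam (S : Setup α αh O H) (hs : ContDiff ℝ ∞ sQ) (he : ContDiff ℝ ∞ e)
    {ρ : (X × Y) × Z → ℝ} {U1 : Set ((X × Y) × Z)} {st : ℝ × ((X × Y) × Z) → ℝ × Q × (ℝ × Z)}
    (hU1 : IsOpen U1) (hρ : ContDiffOn ℝ ∞ ρ U1) (hρ0 : ∀ p ∈ U1, 0 < ρ p)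
    (hst : ContDiffOn ℝ ∞ st (univ ×ˢ U1))
    (h1 : ∀ s, ∀ p ∈ U1, (st (s, p)).1 = 0 ∧ sQ (st (s, p)).2.1 = s * ρ p ∧ dil (ρ p) (e (st (s, p))) = p)
    (h2 : ∀ s r, ∀ p ∈ U1, 0 < r → dil r p ∈ U1 ∧ ρ (dil r p) = r * ρ p ∧ st (s, dil r p) = st (s * r, p))
    (hEnd : ∀ p ∈ U1, st (1, p) ∈ odeDom (trv αh sQ e) (trΩ αh O sQ e) → ∀ v : (X × Y) × Z, v.1.2 = 0 →
      ∃ a, HasDerivAt (fun u : ℝ => dil (ρ (p + u • v)) (tEnd αh O sQ e (st (1, p + u • v))))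
        (dil (ρ p) (fderiv ℝ e (odeFlow (trv αh sQ e) (trΩ αh O sQ e) (st (1, p)) 1) (inF a))) 0)
    {DT : Set (ℝ × ((X × Y) × Z))} {Th : ℝ × ((X × Y) × Z) → ℝ × Z} (hT : Hom DT Th) :
    FI α (famDom αh O sQ e ρ U1 st DT) (famF αh O sQ e ρ st Th) := by
  have oΩ := S.isOpen_trΩ (sQ := sQ) (e := e) hs he
  have cv := S.contDiffOn_trv (sQ := sQ) (e := e) hs he
  have oD := isOpen_odeDom oΩ cv
  have oU : IsOpen ((univ : Set ℝ) ×ˢ U1) := isOpen_univ.prod hU1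
  have oP : IsOpen ((univ ×ˢ U1) ∩ st ⁻¹' odeDom (trv αh sQ e) (trΩ αh O sQ e)) :=
    hst.continuousOn.isOpen_inter_preimage oU oD
  have cρ : ContDiffOn ℝ ∞ (fun z : ℝ × ((X × Y) × Z) => ρ z.2) (univ ×ˢ U1) :=
    hρ.comp contDiff_snd.contDiffOn (fun z hz => hz.2)
  have cP : ContDiffOn ℝ ∞ (fun z : ℝ × ((X × Y) × Z) => (z.1 * ρ z.2, tEnd αh O sQ e (st z)))
      ((univ ×ˢ U1) ∩ st ⁻¹' odeDom (trv αh sQ e) (trΩ αh O sQ e)) := by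
    refine ContDiffOn.prodMk (contDiff_fst.contDiffOn.mul (cρ.mono inter_subset_left)) ?_
    exact (S.tEnd_smooth hs he).comp (hst.mono inter_subset_left) (fun z hz => hz.2)
  have eD : famDom αh O sQ e ρ U1 st DT = ((univ ×ˢ U1) ∩ st ⁻¹' odeDom (trv αh sQ e) (trΩ αh O sQ e)) ∩
      (fun z : ℝ × ((X × Y) × Z) => (z.1 * ρ z.2, tEnd αh O sQ e (st z))) ⁻¹' DT := by
    ext z; simp [famDom, and_assoc]
  have hHom : Hom (famDom αh O sQ e ρ U1 st DT) (famF αh O sQ e ρ st Th) := by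
    refine ⟨?_, ?_, ?_, ?_⟩
    · rw [eD]
      exact cP.continuousOn.isOpen_inter_preimage oP hT.isOpen
    · rw [eD]
      have c1 : ContDiffOn ℝ ∞ (fun z : ℝ × ((X × Y) × Z) => Th (z.1 * ρ z.2, tEnd αh O sQ e (st z)))
        (((univ ×ˢ U1) ∩ st ⁻¹' odeDom (trv αh sQ e) (trΩ αh O sQ e)) ∩
      (fun z : ℝ × ((X × Y) × Z) => (z.1 * ρ z.2, tEnd αh O sQ e (st z))) ⁻¹' DT) :=
        hT.smooth.comp (cP.mono inter_subset_left) (fun z hz => hz.2)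
      exact (((cρ.mono (inter_subset_left.trans inter_subset_left)).pow 2).mul c1.fst).prodMk c1.snd
    · rintro s p ⟨k1, k2, k3⟩ hs0
      have hρp := hρ0 p k1
      obtain ⟨a1, a2, a3⟩ := h1 s p k1
      have hle : s * ρ p ≤ 0 := mul_nonpos_of_nonpos_of_nonneg hs0 hρp.le
      simp only [famF]
      rw [hT.neg _ _ k3 hle]
      obtain ⟨b0, b1⟩ := odeFlow_spec k2
      have b2 : odeFlow (trv αh sQ e) (trΩ αh O sQ e) (st (s, p)) 0 = (0, (st (s, p)).2.1, (st (s, p)).2.2) := by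
        rw [b0, ← a1]
      have := S.tr_neg he b1 b2 (by rw [a2]; exact hle) (right_mem_Icc.2 zero_le_one)
      rw [tEnd, this]
      rw [← F0_dil]
      congr 1
      have e1 : ((0:ℝ), (st (s, p)).2.1, (st (s, p)).2.2) = st (s, p) := by rw [← a1]
      rw [e1]; exact a3
    · rintro s r p hr ⟨k1, k2, k3⟩
      obtain ⟨a1, a2, a3⟩ := h2 s r p k1 hr
      have e1 : s * ρ (dil r p) = s * r * ρ p := by rw [a2]; ring
      refine ⟨⟨a1, ?_, ?_⟩, ?_⟩
      · rw [a3]; exact k2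
      · simp only [a3, e1]; exact k3
      · simp only [famF, a3, e1]
        rw [wt_wt, a2]
  refine ⟨hHom, ?_⟩
  intro p v hp hv hα
  obtain ⟨k1, k2, k3⟩ := hp
  obtain ⟨a, ha⟩ := hEnd p k1 k2 v hv
  obtain ⟨a1, a2, a3⟩ := h1 1 p k1
  simp only [one_mul] at a2 k3
  set κ : ℝ → Q × (ℝ × Z) := fun u => (st (1, p + u • v)).2 with hκ
  have d0 : HasDerivAt (fun u : ℝ => p + u • v) v 0 := by
    simpa using ((hasDerivAt_id (0:ℝ)).smul_const v).const_add p
  have evU : ∀ᶠ u : ℝ in 𝓝 0, p + u • v ∈ U1 := by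
    apply d0.continuousAt.eventually
    simpa using hU1.mem_nhds k1
  have ev1 : ∀ᶠ u : ℝ in 𝓝 0, ((0:ℝ), κ u) = st (1, p + u • v) := by
    filter_upwards [evU] with u hu
    rw [hκ, ← (h1 1 _ hu).1]
  have ev0 : ((0:ℝ), κ 0) = st (1, p) := by simpa using ev1.self_of_nhds
  have hκd : DifferentiableAt ℝ κ 0 := by
    have c1 := (hst.contDiffAt (oU.mem_nhds ⟨mem_univ (1:ℝ), k1⟩)).differentiableAt (by simp)
    have c2 : DifferentiableAt ℝ (fun u : ℝ => ((1:ℝ), p + u • v)) 0 :=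
      (differentiableAt_const _).prodMk d0.differentiableAt
    have c3 : DifferentiableAt ℝ (fun u : ℝ => st (1, p + u • v)) 0 :=
      DifferentiableAt.comp (f := fun u : ℝ => ((1:ℝ), p + u • v)) (g := st) 0 (by simpa using c1) c2
    exact c3.snd
  have es : ∀ᶠ u : ℝ in 𝓝 0, sQ (κ u).1 = ρ (p + u • v) := by
    filter_upwards [evU] with u hu
    simpa using (h1 1 _ hu).2.1
  have es0 : sQ (κ 0).1 = ρ p := by simpa using es.self_of_nhds
  have hρp := hρ0 p k1
  have key := S.tr_deriv (κ := κ) (u0 := 0) hs he hκd (by rw [ev0]; exact k2) (by rw [es0]; exact hρp)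
    (w0 := v) (w1 := dil (ρ p) (fderiv ℝ e (odeFlow (trv αh sQ e) (trΩ αh O sQ e) (st (1, p)) 1) (inF a)))
    (d0.congr_of_eventuallyEq (by
      filter_upwards [evU, es, ev1] with u u1 u2 u3
      rw [u2, u3]; exact (h1 1 _ u1).2.2))
    (by rw [es0, ev0, a3]; exact hα)
    (ha.congr_of_eventuallyEq (by
      filter_upwards [es, ev1] with u u2 u3
      rw [u2, u3]; rfl))
  rw [es0, ev0] at key
  obtain ⟨b0, b1⟩ := odeFlow_spec k2
  have b2 : odeFlow (trv αh sQ e) (trΩ αh O sQ e) (st (1, p)) 0 = (0, (st (1, p)).2.1, (st (1, p)).2.2) := by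
    rw [b0, ← a1]
  have one1 : (1:ℝ) ∈ Icc (0:ℝ) 1 := right_mem_Icc.2 zero_le_one
  have b3 := tr_form b1 b2 one1
  have b4 : (odeFlow (trv αh sQ e) (trΩ αh O sQ e) (st (1, p)) 1).2.1 = (st (1, p)).2.1 := by rw [b3]
  have a0 : a = 0 := by
    refine S.tr_inj (a := a) (b1 1 one1).1 ?_ ?_
    · rw [b4, a2]; exact hρp
    · rw [b4, a2]; exact key
  rw [a0, map_zero, map_zero] at ha
  have dz : dil (ρ p) (0 : (X × Y) × Z) = 0 := by simp [dil]
  rw [dz] at ha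
  have k4 := (hT.homog 1 (ρ p) (tEnd αh O sQ e (st (1, p))) hρp (by simpa using k3)).1
  have dT := (hT.diff k4).hasFDerivAt
  have d1 := HasFDerivAt.comp_hasDerivAt (0:ℝ)
    (f := fun u : ℝ => dil (ρ (p + u • v)) (tEnd αh O sQ e (st (1, p + u • v)))) (by simpa using dT) ha
  rw [map_zero] at d1
  have dF := (hHom.diff (p := p) ⟨k1, k2, by simpa using k3⟩).hasFDerivAt
  have d2 := HasFDerivAt.comp_hasDerivAt (0:ℝ) (f := fun u : ℝ => p + u • v) (by simpa using dF) d0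
  refine d2.unique (d1.congr_of_eventuallyEq ?_)
  have evD : ∀ᶠ u : ℝ in 𝓝 0, ((1:ℝ), p + u • v) ∈ famDom αh O sQ e ρ U1 st DT := by
    have : ContinuousAt (fun u : ℝ => ((1:ℝ), p + u • v)) 0 := continuousAt_const.prodMk d0.continuousAt
    apply this.eventually
    apply hHom.isOpen.mem_nhds
    have hmem : ((1:ℝ), p) ∈ famDom αh O sQ e ρ U1 st DT := ⟨k1, k2, by simpa using k3⟩
    have hpe : p + (0:ℝ) • v = p := by simp
    change ((1:ℝ), p + (0:ℝ) • v) ∈ _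
    rw [hpe]; exact hmem
  filter_upwards [evD] with u hu
  obtain ⟨m1, m2, m3⟩ := hu
  simp only [one_mul] at m3
  have := (hT.homog 1 (ρ (p + u • v)) (tEnd αh O sQ e (st (1, p + u • v))) (hρ0 _ m1) (by simpa using m3)).2
  simp only [Function.comp, this, famF]

end Families
end NambuLin
end FileM4b

section FileM4c
open scoped ContDiff
open MeasureTheory Set Filter Topology

namespace NambuLin

section FamAB

set_option linter.unusedSectionVars false

variable {X Y Z H : Type} [NormedAddCommGroup X] [InnerProductSpace ℝ X] [FiniteDimensional ℝ X]
  [NormedAddCommGroup Y] [InnerProductSpace ℝ Y] [FiniteDimensional ℝ Y]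
  [NormedAddCommGroup Z] [NormedSpace ℝ Z] [FiniteDimensional ℝ Z]
  [NormedAddCommGroup H] [NormedSpace ℝ H]

theorem fderiv_line {A B : Type} [NormedAddCommGroup A] [NormedSpace ℝ A] [NormedAddCommGroup B]
    [NormedSpace ℝ B] {f : A → B} {p v : A} {w : B} (hf : DifferentiableAt ℝ f p)
    (h : HasDerivAt (fun u : ℝ => f (p + u • v)) w 0) : fderiv ℝ f p v = w := by
  have d0 : HasDerivAt (fun u : ℝ => p + u • v) v 0 := by
    simpa using ((hasDerivAt_id (0:ℝ)).smul_const v).const_add p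
  have h1 := hf.hasFDerivAt
  have h2 := HasFDerivAt.comp_hasDerivAt (0:ℝ) (l := f) (f := fun u : ℝ => p + u • v) (by simpa using h1) d0
  exact h2.unique h

theorem isUnit_diag {T : (ℝ × Z) →L[ℝ] (ℝ × Z)} {c : ℝ} (hc : c ≠ 0) (h : ∀ a, T a = (c * a.1, a.2)) :
    IsUnit T := by
  let T' : (ℝ × Z) →L[ℝ] (ℝ × Z) := (c⁻¹ • ContinuousLinearMap.fst ℝ ℝ Z).prod (ContinuousLinearMap.snd ℝ ℝ Z)
  refine ⟨⟨T, T', ?_, ?_⟩, rfl⟩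
  · refine ContinuousLinearMap.ext fun a => ?_
    change T (T' a) = a
    rw [h]
    simp [T', hc]
  · refine ContinuousLinearMap.ext fun a => ?_
    change T' (T a) = a
    rw [h]
    simp [T', hc]

/-- family B -/
def eB (σ : ℝ × (ℝ × X × Y) × (ℝ × Z)) : (X × Y) × Z :=
  (((1 - σ.1) • σ.2.1.2.1, σ.2.2.1 • σ.2.1.2.2), σ.2.2.2)

theorem eB_contDiff : ContDiff ℝ ∞ (eB : ℝ × (ℝ × X × Y) × (ℝ × Z) → (X × Y) × Z) := by
  unfold eB; fun_prop

theorem eB_fderiv (σ : ℝ × (ℝ × X × Y) × (ℝ × Z)) (a : ℝ × Z) :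
    fderiv ℝ eB σ (inF a) = ((0, a.1 • σ.2.1.2.2), a.2) := by
  refine fderiv_line (eB_contDiff.differentiable (by simp) σ) ?_
  have h1 : (fun u : ℝ => eB (σ + u • inF a)) = fun u : ℝ => eB σ + u • ((0, a.1 • σ.2.1.2.2), a.2) := by
    funext u
    simp [eB, inF, add_smul, smul_smul]
  rw [h1]
  simpa using ((hasDerivAt_id (0:ℝ)).smul_const (((0, a.1 • σ.2.1.2.2), a.2) : (X × Y) × Z)).const_add (eB σ)

def sB : ℝ × X × Y → ℝ := fun q => q.1

noncomputable def stB (z : ℝ × ((X × Y) × Z)) : ℝ × (ℝ × X × Y) × (ℝ × Z) :=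
  (0, (z.1 * ‖z.2.1.2‖, ‖z.2.1.2‖⁻¹ • z.2.1.1, ‖z.2.1.2‖⁻¹ • z.2.1.2), (1, z.2.2))

def UB : Set ((X × Y) × Z) := {p | p.1.2 ≠ 0}

variable {α : (X × Y) × Z → ((X × Y) × Z →L[ℝ] ℝ × Z)}
  {αh : ℝ × ((X × Y) × Z) → ((X × Y) × Z →L[ℝ] ℝ × Z)} {O : Set (ℝ × ((X × Y) × Z))}

def DB (αh : ℝ × ((X × Y) × Z) → ((X × Y) × Z →L[ℝ] ℝ × Z)) (O : Set (ℝ × ((X × Y) × Z))) :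
    Set (ℝ × ((X × Y) × Z)) := famDom αh O sB eB (fun p => ‖p.1.2‖) UB stB univ

noncomputable def FB (αh : ℝ × ((X × Y) × Z) → ((X × Y) × Z →L[ℝ] ℝ × Z)) (O : Set (ℝ × ((X × Y) × Z))) :
    ℝ × ((X × Y) × Z) → ℝ × Z := famF αh O sB eB (fun p => ‖p.1.2‖) stB (fun z => F0 z.2)

theorem Setup.flow_diff {Q : Type} [NormedAddCommGroup Q] [NormedSpace ℝ Q] [FiniteDimensional ℝ Q]
    {sQ : Q → ℝ} {e : ℝ × Q × (ℝ × Z) → (X × Y) × Z}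
    (S : Setup α αh O H) (hs : ContDiff ℝ ∞ sQ) (he : ContDiff ℝ ∞ e)
    {κ : ℝ → ℝ × Q × (ℝ × Z)} {u0 : ℝ} (hκ : DifferentiableAt ℝ κ u0)
    (hd : κ u0 ∈ odeDom (trv αh sQ e) (trΩ αh O sQ e)) :
    DifferentiableAt ℝ (fun u => (odeFlow (trv αh sQ e) (trΩ αh O sQ e) (κ u) 1).2.2) u0 := by
  have := (odeFlow_contDiffAt (S.isOpen_trΩ hs he) (S.contDiffOn_trv hs he) hd (t := 1)
    (right_mem_Icc.2 zero_le_one)).differentiableAt (by simp)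
  exact (DifferentiableAt.comp (f := κ) u0 this hκ).snd.snd

theorem flow_one {Q : Type} [NormedAddCommGroup Q] [NormedSpace ℝ Q] [FiniteDimensional ℝ Q]
    {sQ : Q → ℝ} {e : ℝ × Q × (ℝ × Z) → (X × Y) × Z} {σ : ℝ × Q × (ℝ × Z)}
    (hd : σ ∈ odeDom (trv αh sQ e) (trΩ αh O sQ e)) (h0 : σ.1 = 0) :
    odeFlow (trv αh sQ e) (trΩ αh O sQ e) σ 1 =
      (1, σ.2.1, (odeFlow (trv αh sQ e) (trΩ αh O sQ e) σ 1).2.2) := by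
  obtain ⟨b0, b1⟩ := odeFlow_spec hd
  refine tr_form b1 (f := σ.2.2) ?_ (right_mem_Icc.2 zero_le_one)
  rw [b0, ← h0]

theorem dil_hasDerivAt {f : ℝ → (X × Y) × Z} {f' : (X × Y) × Z} {u : ℝ} (s : ℝ) (h : HasDerivAt f f' u) :
    HasDerivAt (fun u => dil s (f u)) (dil s f') u := by
  let L : (X × Y) × Z →L[ℝ] (X × Y) × Z :=
        (s • ContinuousLinearMap.fst ℝ (X × Y) Z).prod (ContinuousLinearMap.snd ℝ (X × Y) Z)
  exact L.hasFDerivAt.comp_hasDerivAt u h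

theorem Setup.famB (S : Setup α αh O H) : FI α (DB αh O) (FB αh O) := by
  have hU1 : IsOpen (UB : Set ((X × Y) × Z)) := by
    apply isOpen_ne_fun <;> fun_prop
  have hρ : ContDiffOn ℝ ∞ (fun p : (X × Y) × Z => ‖p.1.2‖) UB := by
    intro p hp
    refine ContDiffAt.contDiffWithinAt (ContDiffAt.norm ℝ (by fun_prop) hp)
  have hst : ContDiffOn ℝ ∞ (stB : ℝ × ((X × Y) × Z) → ℝ × (ℝ × X × Y) × (ℝ × Z)) (univ ×ˢ UB) := by
    have c : ContDiffOn ℝ ∞ (fun z : ℝ × ((X × Y) × Z) => ‖z.2.1.2‖) (univ ×ˢ UB) :=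
      hρ.comp contDiff_snd.contDiffOn (fun z hz => hz.2)
    have ci : ContDiffOn ℝ ∞ (fun z : ℝ × ((X × Y) × Z) => ‖z.2.1.2‖⁻¹) (univ ×ˢ UB) :=
      c.inv (fun z hz => norm_ne_zero_iff.2 hz.2)
    refine contDiffOn_const.prodMk (ContDiffOn.prodMk (ContDiffOn.prodMk (contDiff_fst.contDiffOn.mul c) (ContDiffOn.prodMk ?_ ?_)) ?_)
    · exact ci.smul (by fun_prop)
    · exact ci.smul (by fun_prop)
    · fun_prop
  refine S.fam (by unfold sB; fun_prop) eB_contDiff hU1 hρ (fun p hp => norm_pos_iff.2 hp) hst ?_ ?_ ?_ Hom_F0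
  · intro s p hp
    have : ‖p.1.2‖ ≠ 0 := norm_ne_zero_iff.2 hp
    refine ⟨rfl, rfl, ?_⟩
    simp [dil, eB, stB, smul_smul, this]
  · intro s r p hp hr
    have : ‖p.1.2‖ ≠ 0 := norm_ne_zero_iff.2 hp
    have hn : ‖r • p.1.2‖ = r * ‖p.1.2‖ := by rw [norm_smul, Real.norm_of_nonneg hr.le]
    refine ⟨?_, ?_, ?_⟩
    · change r • p.1.2 ≠ 0
      exact smul_ne_zero hr.ne' hp
    · exact hn
    · simp only [stB, dil, Prod.smul_snd, Prod.smul_fst, hn, smul_smul, Prod.mk.injEq]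
      have h1 : (r * ‖p.1.2‖)⁻¹ * r = ‖p.1.2‖⁻¹ := by field_simp
      rw [h1]
      refine ⟨trivial, ⟨by ring, rfl, rfl⟩, trivial⟩
  · intro p hp hd v hv
    have hs : ContDiff ℝ ∞ (sB : ℝ × X × Y → ℝ) := by unfold sB; fun_prop
    have d0 : HasDerivAt (fun u : ℝ => p + u • v) v 0 := by
      simpa using ((hasDerivAt_id (0:ℝ)).smul_const v).const_add p
    have oU : IsOpen ((univ : Set ℝ) ×ˢ (UB : Set ((X × Y) × Z))) := isOpen_univ.prod hU1
    have hκ : DifferentiableAt ℝ (fun u : ℝ => (stB (1, p + u • v) : ℝ × (ℝ × X × Y) × (ℝ × Z))) 0 := by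
      have c1 := (hst.contDiffAt (oU.mem_nhds (show ((1:ℝ), p) ∈ _ from ⟨mem_univ (1:ℝ), hp⟩))).differentiableAt (by simp)
      have c2 : DifferentiableAt ℝ (fun u : ℝ => ((1:ℝ), p + u • v)) 0 :=
        (differentiableAt_const _).prodMk d0.differentiableAt
      exact DifferentiableAt.comp (f := fun u : ℝ => ((1:ℝ), p + u • v)) (g := stB) 0 (by simpa using c1) c2
    have e0 : p + (0:ℝ) • v = p := by simp
    have hf := S.flow_diff hs eB_contDiff hκ (by simp only [e0]; exact hd)
    have hev : ∀ᶠ u : ℝ in 𝓝 0, stB (1, p + u • v) ∈ odeDom (trv αh sB eB) (trΩ αh O sB eB) := by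
      apply hκ.continuousAt.eventually
      apply (isOpen_odeDom (S.isOpen_trΩ hs eB_contDiff) (S.contDiffOn_trv hs eB_contDiff)).mem_nhds
      simp only [e0]; exact hd
    set f := fun u : ℝ => (odeFlow (trv αh sB eB) (trΩ αh O sB eB) (stB (1, p + u • v)) 1).2.2 with hfd
    obtain ⟨f', hf'⟩ : ∃ f', HasDerivAt f f' 0 := ⟨_, hf.hasDerivAt⟩
    have hy : ∀ u : ℝ, (p + u • v).1.2 = p.1.2 := by intro u; simp [hv]
    refine ⟨f', ?_⟩
    simp only [hy]
    apply dil_hasDerivAt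
    have k1 : HasDerivAt (fun u => (((0:X), (f u).1 • (‖p.1.2‖⁻¹ • p.1.2)), (f u).2)) ((0, f'.1 • (‖p.1.2‖⁻¹ • p.1.2)), f'.2) 0 := by
      have f1 : HasDerivAt (fun u => (f u).1) f'.1 0 := (ContinuousLinearMap.fst ℝ ℝ Z).hasFDerivAt.comp_hasDerivAt (0:ℝ) hf'
      have f2 : HasDerivAt (fun u => (f u).2) f'.2 0 := (ContinuousLinearMap.snd ℝ ℝ Z).hasFDerivAt.comp_hasDerivAt (0:ℝ) hf'
      exact ((hasDerivAt_const _ _).prodMk (f1.smul_const _)).prodMk f2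
    rw [eB_fderiv, flow_one hd rfl]
    refine k1.congr_of_eventuallyEq ?_
    filter_upwards [hev] with u hu
    rw [tEnd, flow_one hu rfl]
    change eB (1, (stB (1, p + u • v)).2.1, f u) = _
    simp only [eB, stB, hy, sub_self, zero_smul]

theorem Setup.memB (S : Setup α αh O H) {x : X} {y : Y} (h : ‖x‖ < ‖y‖) :
    ((0:ℝ), ((x, y), (0:Z))) ∈ DB αh O := by
  have hy : 0 < ‖y‖ := lt_of_le_of_lt (norm_nonneg _) h
  have hy0 : y ≠ 0 := norm_pos_iff.1 hy
  have hs : ContDiff ℝ ∞ (sB : ℝ × X × Y → ℝ) := by unfold sB; fun_prop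
  refine ⟨hy0, ?_, mem_univ _⟩
  set x' := ‖y‖⁻¹ • x with hx'
  set y' := ‖y‖⁻¹ • y with hy'
  have hx1 : ‖x'‖ ^ 2 < 1 := by
    have : ‖x'‖ < 1 := by
      rw [hx', norm_smul, norm_inv, norm_norm, inv_mul_lt_one₀ hy]; exact h
    nlinarith [norm_nonneg x']
  have hy1 : inner ℝ y' y' = (1:ℝ) := by
    rw [real_inner_self_eq_norm_sq, hy', norm_smul, norm_inv, norm_norm, inv_mul_cancel₀ hy.ne', one_pow]
  have hxx : inner ℝ x' x' = ‖x'‖ ^ 2 := real_inner_self_eq_norm_sq x'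
  set D : ℝ → ℝ := fun t => 1 - (1 - (1 - t) ^ 2) * ‖x'‖ ^ 2 with hD
  have hDpos : ∀ t ∈ Icc (0:ℝ) 1, 0 < D t := by
    intro t ht
    have h1 : (1 - (1 - t) ^ 2) ≤ 1 := by nlinarith [sq_nonneg (1 - t)]
    have : (1 - (1 - t) ^ 2) * ‖x'‖ ^ 2 ≤ 1 * ‖x'‖ ^ 2 := mul_le_mul_of_nonneg_right h1 (sq_nonneg _)
    simp only [hD]; linarith
  let f : ℝ → ℝ × Z := fun t => (Real.sqrt (D t), 0)
  let q : ℝ × X × Y := (0, x', y')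
  have hst : (stB ((0:ℝ), ((x, y), (0:Z))) : ℝ × (ℝ × X × Y) × (ℝ × Z)) = (0, q, f 0) := by
    simp [stB, q, f, hD, hx', hy']
  rw [hst]
  refine ⟨fun t => (t, q, f t), rfl, ?_⟩
  have hdd : ∀ t ∈ Icc (0:ℝ) 1, ∃ f', HasDerivWithinAt f f' (Icc 0 1) t := by
    intro t ht
    have : DifferentiableAt ℝ f t := by
      refine DifferentiableAt.prodMk (DifferentiableAt.sqrt (by simp only [hD]; fun_prop) (hDpos t ht).ne') (by fun_prop)
    exact ⟨_, this.hasDerivAt.hasDerivWithinAt⟩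
  choose! f' hf' using hdd
  refine S.tr_exists eB_contDiff (q := q) (f := f) (f' := f') le_rfl hf' ?_ ?_
  · intro t ht
    have hsq : 0 < Real.sqrt (D t) := Real.sqrt_pos.2 (hDpos t ht)
    have hy'0 : y' ≠ 0 := by
      intro hh; rw [hh] at hy1; simp at hy1
    refine ⟨?_, ?_⟩
    · refine S.mem _ _ ?_
      intro hh
      have := congrArg Prod.snd hh
      simp only [Prod.snd_zero] at this
      exact (smul_ne_zero hsq.ne' hy'0) this
    · refine isUnit_diag (c := - Real.sqrt (D t)) (neg_ne_zero.2 hsq.ne') ?_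
      intro a
      change αh ((0:ℝ), _) (fderiv ℝ eB _ (inF a)) = _
      rw [S.neg _ _ (le_refl (0:ℝ)), eB_fderiv, F0_fderiv]
      have hy2 : ‖y'‖ ^ 2 = 1 := by rw [← real_inner_self_eq_norm_sq]; exact hy1
      simp [eB, q, f, inner_smul_left, inner_smul_right, hy2]
      ring
  · intro t ht
    simp only [F0, eB, q, f, inner_smul_left, inner_smul_right, hy1, hxx]
    have h1 := Real.mul_self_sqrt (hDpos t ht).le
    have h0 := Real.mul_self_sqrt (hDpos 0 (by simp)).le
    simp only [conj_trivial, mul_one, h1, h0]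
    simp only [hD]
    congr 1
    ring

/-! terminal function -/

noncomputable def kap (p : (X × Y) × Z) : ℝ := Real.smoothTransition (‖p.1.2‖ ^ 2 / ‖p.1.1‖ ^ 2 - 5)

noncomputable def FK (αh : ℝ × ((X × Y) × Z) → ((X × Y) × Z →L[ℝ] ℝ × Z)) (O : Set (ℝ × ((X × Y) × Z)))
    (z : ℝ × ((X × Y) × Z)) : ℝ × Z := F0 z.2 + kap z.2 • (FB αh O z - F0 z.2)

def DK (αh : ℝ × ((X × Y) × Z) → ((X × Y) × Z →L[ℝ] ℝ × Z)) (O : Set (ℝ × ((X × Y) × Z))) :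
    Set (ℝ × ((X × Y) × Z)) := {z | z.2.1.1 ≠ 0 ∧ (‖z.2.1.2‖ ^ 2 < 5 * ‖z.2.1.1‖ ^ 2 ∨ z ∈ DB αh O)}

theorem kap_dil {r : ℝ} (hr : 0 < r) (p : (X × Y) × Z) : kap (dil r p) = kap p := by
  simp only [kap, dil, Prod.smul_fst, Prod.smul_snd, norm_smul, mul_pow]
  rw [mul_div_mul_left _ _ (by simp [hr.ne'])]

theorem kap_zero {p : (X × Y) × Z} (h0 : p.1.1 ≠ 0) (h : ‖p.1.2‖ ^ 2 < 5 * ‖p.1.1‖ ^ 2) : kap p = 0 := by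
  have : 0 < ‖p.1.1‖ := norm_pos_iff.2 h0
  apply Real.smoothTransition.zero_of_nonpos
  rw [sub_nonpos, div_le_iff₀ (by positivity)]
  exact h.le

theorem wt_add_smul (r c : ℝ) (a b : ℝ × Z) : wt r (a + c • (b - a)) = wt r a + c • (wt r b - wt r a) := by
  simp [wt]; ring

theorem Setup.homK (S : Setup α αh O H) : Hom (DK αh O) (FK αh O) := by
  have hB := S.famB
  have o1 : IsOpen {z : ℝ × ((X × Y) × Z) | z.2.1.1 ≠ 0} := by apply isOpen_ne_fun <;> fun_prop
  have o2 : IsOpen {z : ℝ × ((X × Y) × Z) | ‖z.2.1.2‖ ^ 2 < 5 * ‖z.2.1.1‖ ^ 2} := by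
    apply isOpen_lt <;> fun_prop
  have cF0 : ContDiff ℝ ∞ (fun z : ℝ × ((X × Y) × Z) => F0 z.2) := F0_contDiff.comp contDiff_snd
  refine ⟨o1.inter (o2.union hB.isOpen), ?_, ?_, ?_⟩
  · rintro z ⟨k1, k2 | k2⟩
    · apply ContDiffAt.contDiffWithinAt
      refine cF0.contDiffAt.congr_of_eventuallyEq ?_
      filter_upwards [o1.mem_nhds k1, o2.mem_nhds k2] with z' h1 h2
      simp [FK, kap_zero h1 h2]
    · apply ContDiffAt.contDiffWithinAt
      have c1 := hB.smooth.contDiffAt (hB.isOpen.mem_nhds k2)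
      have c2 : ContDiffAt ℝ ∞ (fun z : ℝ × ((X × Y) × Z) => kap z.2) z := by
        unfold kap
        refine Real.smoothTransition.contDiff.contDiffAt.comp z ?_
        refine ContDiffAt.sub (ContDiffAt.div ?_ ?_ ?_) contDiffAt_const
        · exact (ContDiff.norm_sq ℝ (by fun_prop)).contDiffAt
        · exact (ContDiff.norm_sq ℝ (by fun_prop)).contDiffAt
        · simpa using k1
      exact cF0.contDiffAt.add (c2.smul (c1.sub cF0.contDiffAt))
  · rintro s p ⟨k1, k2 | k2⟩ hs
    · simp [FK, kap_zero (p := p) k1 k2]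
    · simp [FK, hB.neg s p k2 hs]
  · rintro s r p hr ⟨k1, k2⟩
    have m1 : (dil r p).1.1 ≠ 0 := smul_ne_zero hr.ne' k1
    rcases k2 with k2 | k2
    · have k3 : ‖(dil r p).1.2‖ ^ 2 < 5 * ‖(dil r p).1.1‖ ^ 2 := by
        simp only [dil, Prod.smul_fst, Prod.smul_snd, norm_smul, mul_pow]
        have : 0 < ‖r‖ ^ 2 := by have := norm_pos_iff.2 hr.ne'; positivity
        simp only at k2
        nlinarith
      refine ⟨⟨m1, Or.inl k3⟩, ?_⟩
      simp [FK, kap_zero (p := p) k1 k2, kap_zero m1 k3, F0_dil]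
    · obtain ⟨a1, a2⟩ := hB.homog s r p hr k2
      refine ⟨⟨m1, Or.inr a1⟩, ?_⟩
      simp only [FK, a2, kap_dil hr, F0_dil]
      rw [wt_add_smul]

end FamAB
end NambuLin
end FileM4c

section FileM4d
open scoped ContDiff
open MeasureTheory Set Filter Topology

namespace NambuLin

section FamA

set_option linter.unusedSectionVars false

variable {X Y Z H : Type} [NormedAddCommGroup X] [InnerProductSpace ℝ X] [FiniteDimensional ℝ X]
  [NormedAddCommGroup Y] [InnerProductSpace ℝ Y] [FiniteDimensional ℝ Y]
  [NormedAddCommGroup Z] [NormedSpace ℝ Z] [FiniteDimensional ℝ Z]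
  [NormedAddCommGroup H] [NormedSpace ℝ H]

def cA (N x w : X) (t : ℝ) : X := (1 - t) ^ 2 • x + (t * (1 - t)) • w + t ^ 2 • N

/-- family A -/
def eA (N : X) (σ : ℝ × (ℝ × X × X × Y) × (ℝ × Z)) : (X × Y) × Z :=
  ((σ.2.2.1 • cA N σ.2.1.2.1 σ.2.1.2.2.1 σ.1, σ.2.1.2.2.2), σ.2.2.2)

theorem eA_contDiff (N : X) : ContDiff ℝ ∞ (eA N : ℝ × (ℝ × X × X × Y) × (ℝ × Z) → (X × Y) × Z) := by
  unfold eA cA; fun_prop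

theorem eA_fderiv (N : X) (σ : ℝ × (ℝ × X × X × Y) × (ℝ × Z)) (a : ℝ × Z) :
    fderiv ℝ (eA N) σ (inF a) = ((a.1 • cA N σ.2.1.2.1 σ.2.1.2.2.1 σ.1, 0), a.2) := by
  refine fderiv_line ((eA_contDiff N).differentiable (by simp) σ) ?_
  have h1 : (fun u : ℝ => eA N (σ + u • inF a)) = fun u : ℝ => eA N σ + u • ((a.1 • cA N σ.2.1.2.1 σ.2.1.2.2.1 σ.1, (0:Y)), a.2) := by
    funext u
    simp [eA, inF, add_smul, smul_smul]
  rw [h1]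
  simpa using ((hasDerivAt_id (0:ℝ)).smul_const (((a.1 • cA N σ.2.1.2.1 σ.2.1.2.2.1 σ.1, 0), a.2) : (X × Y) × Z)).const_add (eA N σ)

theorem cA_one (N x w : X) : cA N x w 1 = N := by simp [cA]

theorem cA_zero (N x w : X) : cA N x w 0 = x := by simp [cA]

def sA : ℝ × X × X × Y → ℝ := fun q => q.1

noncomputable def stA (w : X) (z : ℝ × ((X × Y) × Z)) : ℝ × (ℝ × X × X × Y) × (ℝ × Z) :=
  (0, (z.1 * ‖z.2.1.1‖, ‖z.2.1.1‖⁻¹ • z.2.1.1, w, ‖z.2.1.1‖⁻¹ • z.2.1.2), (1, z.2.2))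

def UA : Set ((X × Y) × Z) := {p | p.1.1 ≠ 0}

variable {α : (X × Y) × Z → ((X × Y) × Z →L[ℝ] ℝ × Z)}
  {αh : ℝ × ((X × Y) × Z) → ((X × Y) × Z →L[ℝ] ℝ × Z)} {O : Set (ℝ × ((X × Y) × Z))}

def DA (αh : ℝ × ((X × Y) × Z) → ((X × Y) × Z →L[ℝ] ℝ × Z)) (O : Set (ℝ × ((X × Y) × Z))) (N w : X) :
    Set (ℝ × ((X × Y) × Z)) := famDom αh O sA (eA N) (fun p => ‖p.1.1‖) UA (stA w) (DK αh O)

noncomputable def FA (αh : ℝ × ((X × Y) × Z) → ((X × Y) × Z →L[ℝ] ℝ × Z)) (O : Set (ℝ × ((X × Y) × Z)))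
    (N w : X) : ℝ × ((X × Y) × Z) → ℝ × Z :=
  famF αh O sA (eA N) (fun p => ‖p.1.1‖) (stA w) (FK αh O)

theorem isOpen_UA : IsOpen (UA : Set ((X × Y) × Z)) := by
  apply isOpen_ne_fun <;> fun_prop

theorem sA_contDiff : ContDiff ℝ ∞ (sA : ℝ × X × X × Y → ℝ) := by unfold sA; fun_prop

theorem UA_norm : ContDiffOn ℝ ∞ (fun p : (X × Y) × Z => ‖p.1.1‖) UA := by
  intro p hp
  refine ContDiffAt.contDiffWithinAt (ContDiffAt.norm ℝ (by fun_prop) hp)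

theorem stA_contDiffOn (w : X) :
    ContDiffOn ℝ ∞ (stA w : ℝ × ((X × Y) × Z) → ℝ × (ℝ × X × X × Y) × (ℝ × Z)) (univ ×ˢ UA) := by
  have c : ContDiffOn ℝ ∞ (fun z : ℝ × ((X × Y) × Z) => ‖z.2.1.1‖) (univ ×ˢ UA) :=
    UA_norm.comp contDiff_snd.contDiffOn (fun z hz => hz.2)
  have ci : ContDiffOn ℝ ∞ (fun z : ℝ × ((X × Y) × Z) => ‖z.2.1.1‖⁻¹) (univ ×ˢ UA) :=
    c.inv (fun z hz => norm_ne_zero_iff.2 hz.2)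
  refine contDiffOn_const.prodMk (ContDiffOn.prodMk (ContDiffOn.prodMk (contDiff_fst.contDiffOn.mul c)
    (ContDiffOn.prodMk ?_ (contDiffOn_const.prodMk ?_))) ?_)
  · exact ci.smul (by fun_prop)
  · exact ci.smul (by fun_prop)
  · fun_prop

theorem Setup.famA (S : Setup α αh O H) (N w : X) : FI α (DA αh O N w) (FA αh O N w) := by
  refine S.fam sA_contDiff (eA_contDiff N) isOpen_UA UA_norm (fun p hp => norm_pos_iff.2 hp) (stA_contDiffOn w) ?_ ?_ ?_ S.homK
  · intro s p hp
    have : ‖p.1.1‖ ≠ 0 := norm_ne_zero_iff.2 hp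
    refine ⟨rfl, rfl, ?_⟩
    simp [dil, eA, stA, cA, smul_smul, this]
  · intro s r p hp hr
    have : ‖p.1.1‖ ≠ 0 := norm_ne_zero_iff.2 hp
    have hn : ‖r • p.1.1‖ = r * ‖p.1.1‖ := by rw [norm_smul, Real.norm_of_nonneg hr.le]
    refine ⟨?_, ?_, ?_⟩
    · change r • p.1.1 ≠ 0
      exact smul_ne_zero hr.ne' hp
    · exact hn
    · simp only [stA, dil, Prod.smul_snd, Prod.smul_fst, hn, smul_smul, Prod.mk.injEq]
      have h1 : (r * ‖p.1.1‖)⁻¹ * r = ‖p.1.1‖⁻¹ := by field_simp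
      rw [h1]
      exact ⟨trivial, ⟨by ring, rfl, trivial, rfl⟩, trivial⟩
  · intro p hp hd v hv
    have hρ0 : ‖p.1.1‖ ≠ 0 := norm_ne_zero_iff.2 hp
    have d0 : HasDerivAt (fun u : ℝ => p + u • v) v 0 := by
      simpa using ((hasDerivAt_id (0:ℝ)).smul_const v).const_add p
    have e0 : p + (0:ℝ) • v = p := by simp
    have oU : IsOpen ((univ : Set ℝ) ×ˢ (UA : Set ((X × Y) × Z))) := isOpen_univ.prod isOpen_UA
    have hκ : DifferentiableAt ℝ (fun u : ℝ => (stA w (1, p + u • v) : ℝ × (ℝ × X × X × Y) × (ℝ × Z))) 0 := by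
      have c1 := ((stA_contDiffOn w).contDiffAt (oU.mem_nhds (show ((1:ℝ), p) ∈ _ from ⟨mem_univ (1:ℝ), hp⟩))).differentiableAt (by simp)
      have c2 : DifferentiableAt ℝ (fun u : ℝ => ((1:ℝ), p + u • v)) 0 :=
        (differentiableAt_const _).prodMk d0.differentiableAt
      exact DifferentiableAt.comp (f := fun u : ℝ => ((1:ℝ), p + u • v)) (g := stA w) 0 (by simpa using c1) c2
    have hρd : DifferentiableAt ℝ (fun u : ℝ => ‖(p + u • v).1.1‖) 0 := by
      have c1 := (UA_norm.contDiffAt (isOpen_UA.mem_nhds hp)).differentiableAt (by simp)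
      exact DifferentiableAt.comp (f := fun u : ℝ => p + u • v) (g := fun p : (X × Y) × Z => ‖p.1.1‖) 0 (by simpa using c1) d0.differentiableAt
    have hf := S.flow_diff sA_contDiff (eA_contDiff N) hκ (by simp only [e0]; exact hd)
    have hev : ∀ᶠ u : ℝ in 𝓝 0, stA w (1, p + u • v) ∈ odeDom (trv αh sA (eA N)) (trΩ αh O sA (eA N)) := by
      apply hκ.continuousAt.eventually
      apply (isOpen_odeDom (S.isOpen_trΩ sA_contDiff (eA_contDiff N)) (S.contDiffOn_trv sA_contDiff (eA_contDiff N))).mem_nhds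
      simp only [e0]; exact hd
    have hevU : ∀ᶠ u : ℝ in 𝓝 0, p + u • v ∈ UA := by
      apply d0.continuousAt.eventually
      apply isOpen_UA.mem_nhds
      simp only [e0]; exact hp
    set f := fun u : ℝ => (odeFlow (trv αh sA (eA N)) (trΩ αh O sA (eA N)) (stA w (1, p + u • v)) 1).2.2 with hfd
    obtain ⟨f', hf'⟩ : ∃ f', HasDerivAt f f' 0 := ⟨_, hf.hasDerivAt⟩
    obtain ⟨ρ', hρ'⟩ : ∃ f', HasDerivAt (fun u : ℝ => ‖(p + u • v).1.1‖) f' 0 := ⟨_, hρd.hasDerivAt⟩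
    have hy : ∀ u : ℝ, (p + u • v).1.2 = p.1.2 := by intro u; simp [hv]
    have f1 : HasDerivAt (fun u => (f u).1) f'.1 0 := (ContinuousLinearMap.fst ℝ ℝ Z).hasFDerivAt.comp_hasDerivAt (0:ℝ) hf'
    have f2 : HasDerivAt (fun u => (f u).2) f'.2 0 := (ContinuousLinearMap.snd ℝ ℝ Z).hasFDerivAt.comp_hasDerivAt (0:ℝ) hf'
    have f3 := hρ'.mul f1
    set r' := ρ' * (f 0).1 + ‖(p + (0:ℝ) • v).1.1‖ * f'.1 with hr'
    refine ⟨(‖p.1.1‖⁻¹ * r', f'.2), ?_⟩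
    have k1 : HasDerivAt (fun u : ℝ => (((‖(p + u • v).1.1‖ * (f u).1) • N, p.1.2), (f u).2)) ((r' • N, 0), f'.2) 0 :=
      ((f3.smul_const N).prodMk (hasDerivAt_const _ _)).prodMk f2
    have e1 : dil ‖p.1.1‖ (fderiv ℝ (eA N) (odeFlow (trv αh sA (eA N)) (trΩ αh O sA (eA N)) (stA w (1, p)) 1)
        (inF (‖p.1.1‖⁻¹ * r', f'.2))) = ((r' • N, 0), f'.2) := by
      rw [eA_fderiv, flow_one hd rfl]
      simp only [cA_one, dil, Prod.smul_mk, smul_zero, smul_smul]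
      rw [mul_inv_cancel_left₀ hρ0]
    rw [e1]
    refine k1.congr_of_eventuallyEq ?_
    filter_upwards [hev, hevU] with u hu hu2
    rw [tEnd, flow_one hu rfl]
    change dil _ (eA N (1, (stA w (1, p + u • v)).2.1, f u)) = _
    have hn : ‖(p + u • v).1.1‖ ≠ 0 := norm_ne_zero_iff.2 hu2
    simp only [eA, stA, hy, cA_one, dil, Prod.smul_mk, smul_smul]
    rw [mul_inv_cancel₀ hn, one_smul]

def Val (N x w : X) : Prop := ∀ t ∈ Icc (0:ℝ) 1, cA N x w t ≠ 0

theorem normc_smooth {N x w : X} (hv : Val N x w) {t : ℝ} (ht : t ∈ Icc (0:ℝ) 1) :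
    DifferentiableAt ℝ (fun t => ((‖cA N x w t‖⁻¹, (0:Z)) : ℝ × Z)) t := by
  have h1 : DifferentiableAt ℝ (fun t => ‖cA N x w t‖) t :=
    DifferentiableAt.norm ℝ (by unfold cA; fun_prop) (hv t ht)
  exact (h1.inv (norm_ne_zero_iff.2 (hv t ht))).prodMk (by fun_prop)

/-- the model solution -/
theorem Setup.solA (S : Setup α αh O H) {N x w : X} {y : Y} (hv : Val N x w) :
    IsSol (trv αh sA (eA N)) (trΩ αh O sA (eA N))
      (fun t => (t, ((0:ℝ), x, w, y), ((‖cA N x w t‖⁻¹, (0:Z)) : ℝ × Z))) := by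
  refine S.tr_exists (eA_contDiff N) (q := (0, x, w, y)) (f := fun t => (‖cA N x w t‖⁻¹, (0:Z)))
    (f' := fun t => deriv (fun t => ((‖cA N x w t‖⁻¹, (0:Z)) : ℝ × Z)) t) (le_refl (0:ℝ))
    (fun t ht => (normc_smooth hv ht).hasDerivAt.hasDerivWithinAt) ?_ ?_
  · intro t ht
    have hc := hv t ht
    have hn : ‖cA N x w t‖ ≠ 0 := norm_ne_zero_iff.2 hc
    refine ⟨?_, ?_⟩
    · refine S.mem _ _ ?_
      intro hh
      have := congrArg Prod.fst hh
      exact (smul_ne_zero (inv_ne_zero hn) hc) this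
    · refine isUnit_diag (c := ‖cA N x w t‖) hn ?_
      intro a
      change αh ((0:ℝ), _) (fderiv ℝ (eA N) _ (inF a)) = _
      rw [S.neg _ _ (le_refl (0:ℝ)), eA_fderiv, F0_fderiv]
      simp [eA, inner_smul_left, inner_smul_right]
      field_simp
  · have key : ∀ t ∈ Icc (0:ℝ) 1, F0 (eA N (t, ((0:ℝ), x, w, y), ((‖cA N x w t‖⁻¹, (0:Z)) : ℝ × Z))) =
        ((1/2:ℝ) * (1 - ‖y‖ ^ 2), 0) := by
      intro t ht
      have hn : ‖cA N x w t‖ ≠ 0 := norm_ne_zero_iff.2 (hv t ht)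
      have n1 : ‖(‖cA N x w t‖⁻¹ • cA N x w t)‖ = 1 := by
        rw [norm_smul, norm_inv, norm_norm, inv_mul_cancel₀ hn]
      simp only [F0, eA, real_inner_self_eq_norm_sq, n1, one_pow]
    intro t ht
    rw [key t ht, key 0 (by simp)]

theorem stA_zero {x : X} (hx : x ≠ 0) (N w : X) (y : Y) :
    stA w ((0:ℝ), ((x, y), (0:Z))) = (0, ((0:ℝ), ‖x‖⁻¹ • x, w, ‖x‖⁻¹ • y), ((‖cA N (‖x‖⁻¹ • x) w 0‖⁻¹, (0:Z)) : ℝ × Z)) := by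
  have hn : ‖x‖ ≠ 0 := norm_ne_zero_iff.2 hx
  simp [stA, cA_zero, norm_smul, hn]

theorem Setup.memA0 (S : Setup α αh O H) {N : X} {x w : X} {y : Y} (hx : x ≠ 0)
    (hv : Val N (‖x‖⁻¹ • x) w) : stA w ((0:ℝ), ((x, y), (0:Z))) ∈ odeDom (trv αh sA (eA N)) (trΩ αh O sA (eA N)) := by
  rw [stA_zero hx N w y]
  exact ⟨_, rfl, S.solA hv⟩

theorem Setup.memA (S : Setup α αh O H) {N : X} (hN : ‖N‖ = 1) {x w : X} {y : Y} (hx : x ≠ 0)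
    (hv : Val N (‖x‖⁻¹ • x) w) : ((0:ℝ), ((x, y), (0:Z))) ∈ DA αh O N w := by
  have hN0 : N ≠ 0 := by intro h; simp [h] at hN
  refine ⟨hx, S.memA0 hx hv, ?_⟩
  have h1 := odeFlow_eq (S.isOpen_trΩ sA_contDiff (eA_contDiff N)) (S.contDiffOn_trv sA_contDiff (eA_contDiff N))
    (S.solA (y := ‖x‖⁻¹ • y) hv) (stA_zero hx N w y).symm (right_mem_Icc.2 zero_le_one)
  rw [tEnd, h1]
  simp only [eA, cA_one, hN, inv_one, one_smul, zero_mul]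
  refine ⟨hN0, ?_⟩
  by_cases h : ‖(‖x‖⁻¹ • y)‖ ^ 2 < 5
  · left; simpa [hN] using h
  · right
    apply S.memB
    rw [hN]
    nlinarith [norm_nonneg (‖x‖⁻¹ • y)]

/-! agreement of A and B -/

theorem FI.const_path {D : Set (ℝ × ((X × Y) × Z))} {Fh : ℝ × ((X × Y) × Z) → ℝ × Z}
    (S : Setup α αh O H) (h : FI α D Fh) {s : ℝ} (hs : 0 < s) {γ g : ℝ → (X × Y) × Z}
    (hγ : ∀ t ∈ Icc (0:ℝ) 1, HasDerivWithinAt γ (g t) (Icc 0 1) t)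
    (hD : ∀ t ∈ Icc (0:ℝ) 1, (s, γ t) ∈ D ∧ (s, γ t) ∈ O) (hα : ∀ t ∈ Icc (0:ℝ) 1, αh (s, γ t) (g t) = 0)
    (hy : ∀ t ∈ Icc (0:ℝ) 1, (g t).1.2 = 0) : Fh (s, γ 0) = Fh (s, γ 1) := by
  have hh : ∀ t ∈ Icc (0:ℝ) 1, (1, dil s (γ t)) ∈ D ∧ Fh (1, dil s (γ t)) = wt s (Fh (s, γ t)) := by
    intro t ht
    have := h.homog 1 s (γ t) hs (by simpa using (hD t ht).1)
    simpa using this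
  have key : Fh (1, dil s (γ 0)) = Fh (1, dil s (γ 1)) := by
    refine const_of_deriv_zero (f := fun t => Fh (1, dil s (γ t))) (convex_Icc 0 1) (fun t ht => ?_)
      (left_mem_Icc.2 zero_le_one) (right_mem_Icc.2 zero_le_one)
    have d1 : HasDerivWithinAt (fun t => dil s (γ t)) (dil s (g t)) (Icc 0 1) t := by
      let L : (X × Y) × Z →L[ℝ] (X × Y) × Z :=
        (s • ContinuousLinearMap.fst ℝ (X × Y) Z).prod (ContinuousLinearMap.snd ℝ (X × Y) Z)
      exact L.hasFDerivAt.comp_hasDerivWithinAt t (hγ t ht)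
    have d2 := (h.toHom.diff (hh t ht).1).hasFDerivAt.comp_hasDerivWithinAt t d1
    have d3 := h.deriv (dil s (γ t)) (dil s (g t)) (hh t ht).1 (by simp [dil, hy t ht]) (by
      rw [S.pos _ _ _ (hD t ht).2 hs, hα t ht]; simp [wt])
    rw [d3] at d2
    exact d2
  rw [(hh 0 (by simp)).2, (hh 1 (by simp)).2] at key
  exact wt_inj hs key

theorem Setup.agreeAB (S : Setup α αh O H) {N : X} (hN : ‖N‖ = 1) {x w : X} {y : Y} (hx : x ≠ 0)
    (hv : Val N (‖x‖⁻¹ • x) w) (hxy : ‖y‖ = 3 * ‖x‖) :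
    ∀ᶠ z in 𝓝 ((0:ℝ), ((x, y), (0:Z))), FA αh O N w z = FB αh O z := by
  have hn : 0 < ‖x‖ := norm_pos_iff.2 hx
  have hA := S.famA N w
  have hB := S.famB
  have mA := S.memA (y := y) hN hx hv
  have mB : ((0:ℝ), ((x, y), (0:Z))) ∈ DB αh O := S.memB (by rw [hxy]; linarith)
  have oΩ := S.isOpen_trΩ (sQ := sA) (e := eA N) sA_contDiff (eA_contDiff N)
  have cv := S.contDiffOn_trv (sQ := sA) (e := eA N) sA_contDiff (eA_contDiff N)
  set v := trv αh sA (eA N) with hvd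
  set Ω := trΩ αh O sA (eA N) with hΩd
  set Ω' : Set (ℝ × (ℝ × X × X × Y) × (ℝ × Z)) := Ω ∩ {σ | (sA σ.2.1, eA N σ) ∈ DB αh O ∧
    6 * ‖(eA N σ).1.1‖ ^ 2 < ‖(eA N σ).1.2‖ ^ 2} with hΩ'
  have cE : Continuous (eA N : ℝ × (ℝ × X × X × Y) × (ℝ × Z) → (X × Y) × Z) := (eA_contDiff N).continuous
  have oΩ' : IsOpen Ω' := by
    refine oΩ.inter (IsOpen.inter (hB.isOpen.preimage (Continuous.prodMk (sA_contDiff.continuous.comp (by fun_prop)) cE)) ?_)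
    exact isOpen_lt (f := fun σ => 6 * ‖(eA N σ).1.1‖ ^ 2) (g := fun σ : ℝ × (ℝ × X × X × Y) × (ℝ × Z) => ‖(eA N σ).1.2‖ ^ 2) (continuous_const.mul ((cE.fst.fst.norm).pow 2)) ((cE.fst.snd.norm).pow 2)
  have cv' : ContDiffOn ℝ ∞ v Ω' := cv.mono inter_subset_left
  have hsol : IsSol v Ω' (fun t => (t, ((0:ℝ), ‖x‖⁻¹ • x, w, ‖x‖⁻¹ • y), ((‖cA N (‖x‖⁻¹ • x) w t‖⁻¹, (0:Z)) : ℝ × Z))) := by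
    intro t ht
    obtain ⟨k1, k2⟩ := S.solA (y := ‖x‖⁻¹ • y) hv t ht
    refine ⟨⟨k1, ?_⟩, k2⟩
    have hc : ‖cA N (‖x‖⁻¹ • x) w t‖ ≠ 0 := norm_ne_zero_iff.2 (hv t ht)
    have n1 : ‖(‖cA N (‖x‖⁻¹ • x) w t‖⁻¹ • cA N (‖x‖⁻¹ • x) w t)‖ = 1 := by
      rw [norm_smul, norm_inv, norm_norm, inv_mul_cancel₀ hc]
    have n2 : ‖(‖x‖⁻¹ • y)‖ = 3 := by
      rw [norm_smul, norm_inv, norm_norm, hxy]; field_simp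
    refine ⟨?_, ?_⟩
    · apply S.memB
      rw [n1]; simp only [n2]; norm_num
    · simp only [eA]; rw [n1, n2]; norm_num
  have hdom : stA w ((0:ℝ), ((x, y), (0:Z))) ∈ odeDom v Ω' := by
    rw [stA_zero hx N w y]
    exact ⟨_, rfl, hsol⟩
  have oU : IsOpen ((univ : Set ℝ) ×ˢ (UA : Set ((X × Y) × Z))) := isOpen_univ.prod isOpen_UA
  have cst : ContinuousAt (stA w : ℝ × ((X × Y) × Z) → ℝ × (ℝ × X × X × Y) × (ℝ × Z)) ((0:ℝ), ((x, y), (0:Z))) :=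
    (stA_contDiffOn w).continuousOn.continuousAt (oU.mem_nhds ⟨mem_univ _, hx⟩)
  filter_upwards [cst.eventually ((isOpen_odeDom oΩ' cv').mem_nhds hdom), hA.isOpen.mem_nhds mA, hB.isOpen.mem_nhds mB] with z h1 h2 h3
  obtain ⟨s, p⟩ := z
  rcases le_or_gt s 0 with hs | hs
  · rw [hA.neg s p h2 hs, hB.neg s p h3 hs]
  · obtain ⟨hp, hd, hT⟩ := h2
    have hρ : 0 < ‖p.1.1‖ := norm_pos_iff.2 hp
    obtain ⟨γ, g0, g1⟩ := h1
    have g1' : IsSol v Ω γ := fun t ht => ⟨(g1 t ht).1.1, (g1 t ht).2⟩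
    have hE : tEnd αh O sA (eA N) (stA w (s, p)) = eA N (γ 1) := by
      rw [tEnd, odeFlow_eq oΩ cv g1' g0 (right_mem_Icc.2 zero_le_one)]
    have hform : ∀ t ∈ Icc (0:ℝ) 1, γ t = (t, (stA w (s, p)).2.1, (γ t).2.2) := by
      intro t ht
      refine tr_form g1' (f := (stA w (s, p)).2.2) ?_ ht
      rw [g0]; rfl
    have hsQ : ∀ t ∈ Icc (0:ℝ) 1, sA (γ t).2.1 = s * ‖p.1.1‖ := by
      intro t ht; rw [hform t ht]; rfl
    have hpath : ∀ t ∈ Icc (0:ℝ) 1, ∃ g', HasDerivWithinAt (fun t => eA N (γ t)) g' (Icc 0 1) t ∧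
        αh (s * ‖p.1.1‖, eA N (γ t)) g' = 0 := by
      intro t ht
      obtain ⟨g', k1, k2⟩ := tr_path (eA_contDiff N) g1' ht
      rw [hsQ t ht] at k2
      exact ⟨g', k1, k2⟩
    choose! g hg1 hg2 using hpath
    have hpos : 0 < s * ‖p.1.1‖ := mul_pos hs hρ
    have hyc : ∀ t ∈ Icc (0:ℝ) 1, (eA N (γ t)).1.2 = (stA w (s, p)).2.1.2.2.2 := by
      intro t ht; rw [hform t ht]; rfl
    have key := FI.const_path S hB hpos (γ := fun t => eA N (γ t)) (g := g) hg1 (fun t ht => by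
        have k := (g1 t ht).1
        have k1 := k.2.1
        have k2 := k.1.1
        rw [hsQ t ht] at k1 k2
        exact ⟨k1, k2⟩) hg2 (fun t ht => by
        have d1 := ((ContinuousLinearMap.snd ℝ X Y).comp (ContinuousLinearMap.fst ℝ (X × Y) Z)).hasFDerivAt.comp_hasDerivWithinAt t (hg1 t ht)
        have d2 : HasDerivWithinAt (fun t => (eA N (γ t)).1.2) 0 (Icc 0 1) t :=
          (hasDerivWithinAt_const t (Icc (0:ℝ) 1) ((stA w (s, p)).2.1.2.2.2)).congr hyc (hyc t ht)
        exact (uniqueDiffOn_Icc (zero_lt_one (α := ℝ)) t ht).eq_deriv _ d1 d2)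
    have k1 : kap (eA N (γ 1)) = 1 := by
      have hk := (g1 1 (right_mem_Icc.2 zero_le_one)).1.2.2
      have hx1 : (eA N (γ 1)).1.1 ≠ 0 := by rw [← hE]; exact hT.1
      have hx2 : 0 < ‖(eA N (γ 1)).1.1‖ := norm_pos_iff.2 hx1
      apply Real.smoothTransition.one_of_one_le
      rw [le_sub_iff_add_le, le_div_iff₀ (by positivity)]
      linarith
    have e0 : dil ‖p.1.1‖ (eA N (stA w (s, p))) = p := by
      have : ‖p.1.1‖ ≠ 0 := hρ.ne'
      simp [dil, eA, stA, cA, smul_smul, this]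
    have hB0 : (s * ‖p.1.1‖, eA N (γ 0)) ∈ DB αh O := by
      have k := (g1 0 (left_mem_Icc.2 zero_le_one)).1.2.1
      rwa [hsQ 0 (left_mem_Icc.2 zero_le_one)] at k
    have hh := (hB.homog s ‖p.1.1‖ _ hρ hB0).2
    rw [g0, e0] at hh
    rw [hh, ← g0, key]
    simp only [FA, famF, hE, FK, k1, one_smul, add_sub_cancel]

/-! agreement of different paths -/

theorem Setup.agreeAA (S : Setup α αh O H) {N : X} (hN : ‖N‖ = 1) {x : X} {y : Y} (hx : x ≠ 0)
    {w : ℝ → X} (hw : Differentiable ℝ w)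
    (hv : ∀ u ∈ Icc (0:ℝ) 1, Val N (‖x‖⁻¹ • x) (w u)) :
    ∀ᶠ z in 𝓝 ((0:ℝ), ((x, y), (0:Z))), FA αh O N (w 0) z = FA αh O N (w 1) z := by
  have oΩ := S.isOpen_trΩ (sQ := sA) (e := eA N) sA_contDiff (eA_contDiff N)
  have cv := S.contDiffOn_trv (sQ := sA) (e := eA N) sA_contDiff (eA_contDiff N)
  have z01 := left_mem_Icc.2 (zero_le_one (α := ℝ))
  have o01 := right_mem_Icc.2 (zero_le_one (α := ℝ))
  have oU : IsOpen ((univ : Set ℝ) ×ˢ (UA : Set ((X × Y) × Z))) := isOpen_univ.prod isOpen_UA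
  have hev : ∀ᶠ z in 𝓝 ((0:ℝ), ((x, y), (0:Z))), ∀ u ∈ Icc (0:ℝ) 1,
      stA (w u) z ∈ odeDom (trv αh sA (eA N)) (trΩ αh O sA (eA N)) := by
    refine isCompact_Icc.eventually_forall_of_forall_eventually (fun u hu => ?_)
    have c1 : ContinuousAt (fun zu : (ℝ × ((X × Y) × Z)) × ℝ => (stA (w zu.2) zu.1 : ℝ × (ℝ × X × X × Y) × (ℝ × Z)))
        (((0:ℝ), ((x, y), (0:Z))), u) := by
      have cst : ContinuousAt (stA (0:X) : ℝ × ((X × Y) × Z) → ℝ × (ℝ × X × X × Y) × (ℝ × Z)) ((0:ℝ), ((x, y), (0:Z))) :=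
        (stA_contDiffOn 0).continuousOn.continuousAt (oU.mem_nhds ⟨mem_univ _, hx⟩)
      have c2 : ContinuousAt (fun zu : (ℝ × ((X × Y) × Z)) × ℝ => (stA (0:X) zu.1 : ℝ × (ℝ × X × X × Y) × (ℝ × Z)))
        (((0:ℝ), ((x, y), (0:Z))), u) :=
          ContinuousAt.comp (f := Prod.fst) (g := stA (0:X)) (x := (((0:ℝ), ((x, y), (0:Z))), u)) cst continuousAt_fst
      have c3 : ContinuousAt (fun zu : (ℝ × ((X × Y) × Z)) × ℝ => w zu.2) (((0:ℝ), ((x, y), (0:Z))), u) :=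
        (hw.continuous.comp continuous_snd).continuousAt
      exact continuousAt_const.prodMk ((c2.snd.fst.fst.prodMk (c2.snd.fst.snd.fst.prodMk (c3.prodMk c2.snd.fst.snd.snd.snd))).prodMk c2.snd.snd)
    exact c1.eventually ((isOpen_odeDom oΩ cv).mem_nhds (S.memA0 hx (hv u hu)))
  have hA0 := S.famA N (w 0)
  have hA1 := S.famA N (w 1)
  filter_upwards [hev, hA0.isOpen.mem_nhds (S.memA (y := y) hN hx (hv 0 z01)),
    hA1.isOpen.mem_nhds (S.memA (y := y) hN hx (hv 1 o01))] with z h1 h2 h3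
  obtain ⟨s, p⟩ := z
  rcases le_or_gt s 0 with hs | hs
  · rw [hA0.neg s p h2 hs, hA1.neg s p h3 hs]
  have hp : p.1.1 ≠ 0 := h2.1
  have hρ : 0 < ‖p.1.1‖ := norm_pos_iff.2 hp
  have hpos : 0 < s * ‖p.1.1‖ := mul_pos hs hρ
  have key : tEnd αh O sA (eA N) (stA (w 0) (s, p)) = tEnd αh O sA (eA N) (stA (w 1) (s, p)) := by
    refine const_of_deriv_zero (f := fun u => tEnd αh O sA (eA N) (stA (w u) (s, p))) (convex_Icc 0 1) (fun u0 hu0 => ?_) z01 o01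
    apply HasDerivAt.hasDerivWithinAt
    have hd := h1 u0 hu0
    have hκ2 : DifferentiableAt ℝ (fun u => (stA (w u) (s, p)).2) u0 := by
      have := hw u0
      simp only [stA]
      fun_prop
    have hκ : DifferentiableAt ℝ (fun u => stA (w u) (s, p)) u0 := (differentiableAt_const _).prodMk hκ2
    have hevu : ∀ᶠ u in 𝓝 u0, stA (w u) (s, p) ∈ odeDom (trv αh sA (eA N)) (trΩ αh O sA (eA N)) :=
      hκ.continuousAt.eventually ((isOpen_odeDom oΩ cv).mem_nhds hd)
    have hf := S.flow_diff sA_contDiff (eA_contDiff N) hκ hd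
    set f := fun u : ℝ => (odeFlow (trv αh sA (eA N)) (trΩ αh O sA (eA N)) (stA (w u) (s, p)) 1).2.2 with hfd
    obtain ⟨f', hf'⟩ : ∃ f', HasDerivAt f f' u0 := ⟨_, hf.hasDerivAt⟩
    have f1 : HasDerivAt (fun u => (f u).1) f'.1 u0 := (ContinuousLinearMap.fst ℝ ℝ Z).hasFDerivAt.comp_hasDerivAt u0 hf'
    have f2 : HasDerivAt (fun u => (f u).2) f'.2 u0 := (ContinuousLinearMap.snd ℝ ℝ Z).hasFDerivAt.comp_hasDerivAt u0 hf'
    have k1 : HasDerivAt (fun u : ℝ => (((f u).1 • N, ‖p.1.1‖⁻¹ • p.1.2), (f u).2)) ((f'.1 • N, 0), f'.2) u0 :=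
      ((f1.smul_const N).prodMk (hasDerivAt_const _ _)).prodMk f2
    have e1 : (fderiv ℝ (eA N) (odeFlow (trv αh sA (eA N)) (trΩ αh O sA (eA N)) (stA (w u0) (s, p)) 1)
        (inF f')) = (((f'.1 • N, 0), f'.2) : (X × Y) × Z) := by
      rw [eA_fderiv, flow_one hd rfl]
      simp only [cA_one]
    have k2 : HasDerivAt (fun u => tEnd αh O sA (eA N) (stA (w u) (s, p))) ((f'.1 • N, 0), f'.2) u0 := by
      refine k1.congr_of_eventuallyEq ?_
      filter_upwards [hevu] with u hu
      rw [tEnd, flow_one hu rfl]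
      change eA N (1, (stA (w u) (s, p)).2.1, f u) = _
      simp only [eA, stA, cA_one]
    have k3 := S.tr_deriv (κ := fun u => (stA (w u) (s, p)).2) (u0 := u0) sA_contDiff (eA_contDiff N) hκ2 hd hpos
      (w0 := 0) (w1 := dil (s * ‖p.1.1‖) ((f'.1 • N, 0), f'.2)) (by
        have : (fun u => dil (sA (stA (w u) (s, p)).2.1) (eA N (0, (stA (w u) (s, p)).2))) =
          fun u => dil (s * ‖p.1.1‖) (((1:ℝ) • (‖p.1.1‖⁻¹ • p.1.1), ‖p.1.1‖⁻¹ • p.1.2), p.2) := by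
          funext u
          simp only [eA, stA, cA_zero, sA]
        rw [this]
        exact hasDerivAt_const _ _) (map_zero _) (dil_hasDerivAt (s * ‖p.1.1‖) k2)
    have hflow := (odeFlow_spec hd).2 1 o01
    have b4 : (odeFlow (trv αh sA (eA N)) (trΩ αh O sA (eA N)) (stA (w u0) (s, p)) 1).2.1 = (stA (w u0) (s, p)).2.1 := by
      rw [flow_one hd rfl]
    have a0 : f' = 0 := by
      refine S.tr_inj (a := f') hflow.1 ?_ ?_
      · rw [b4]; exact hpos
      · rw [b4, e1]; exact k3
    refine k2.congr_deriv ?_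
    rw [a0]; simp
  simp only [FA, famF, key]

end FamA
end NambuLin
end FileM4d

section FileM4e
open scoped ContDiff
open MeasureTheory Set Filter Topology

namespace NambuLin

section Glue

set_option linter.unusedSectionVars false

variable {X Y Z H : Type} [NormedAddCommGroup X] [InnerProductSpace ℝ X] [FiniteDimensional ℝ X]
  [NormedAddCommGroup Y] [InnerProductSpace ℝ Y] [FiniteDimensional ℝ Y]
  [NormedAddCommGroup Z] [NormedSpace ℝ Z] [FiniteDimensional ℝ Z]
  [NormedAddCommGroup H] [NormedSpace ℝ H]

theorem cA_inner (N x w a : X) (t : ℝ) (h : cA N x w t = 0) :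
    (1 - t) ^ 2 * inner ℝ x a + (t * (1 - t)) * inner ℝ w a + t ^ 2 * inner ℝ N a = (0:ℝ) := by
  have := congrArg (fun c => inner ℝ c a) h
  simpa [cA, inner_add_left, inner_smul_left] using this

theorem val0 {N x : X} (hN : ‖N‖ = 1) (hx : ‖x‖ = 1) (h : -(1/2) ≤ (inner ℝ x N : ℝ)) : Val N x 0 := by
  intro t ht hc
  have h1 := cA_inner N x 0 N t hc
  have h2 := cA_inner N x 0 x t hc
  rw [real_inner_self_eq_norm_sq, hN] at h1
  rw [real_inner_self_eq_norm_sq, hx, real_inner_comm x N] at h2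
  simp only [inner_zero_left, mul_zero, add_zero, one_pow, mul_one] at h1 h2
  set ν : ℝ := inner ℝ x N
  nlinarith [sq_nonneg t, sq_nonneg (1 - t), mul_nonneg (sq_nonneg t) (by linarith : (0:ℝ) ≤ ν + 1/2),
    mul_nonneg (sq_nonneg (1 - t)) (by linarith : (0:ℝ) ≤ ν + 1/2)]

theorem bessel2 {N e x : X} (hN : ‖N‖ = 1) (he : ‖e‖ = 1) (hx : ‖x‖ = 1) (hNe : (inner ℝ N e : ℝ) = 0) :
    (inner ℝ x N : ℝ) ^ 2 + (inner ℝ x e : ℝ) ^ 2 ≤ 1 := by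
  have h0 := real_inner_self_nonneg (x := x - (inner ℝ x N : ℝ) • N - (inner ℝ x e : ℝ) • e)
  simp only [inner_sub_left, inner_sub_right, inner_smul_left, inner_smul_right, conj_trivial] at h0
  rw [real_inner_comm x N, real_inner_comm x e, real_inner_comm N e, hNe] at h0
  simp only [real_inner_self_eq_norm_sq, hN, he, hx] at h0
  nlinarith

theorem val1 {N e x : X} (hN : ‖N‖ = 1) (he : ‖e‖ = 1) (hx : ‖x‖ = 1) (hNe : (inner ℝ N e : ℝ) = 0)
    (h : (inner ℝ x N : ℝ) ≤ -(1/2)) : Val N x ((2:ℝ) • e) := by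
  intro t ht hc
  have h1 := cA_inner N x _ N t hc
  have h2 := cA_inner N x _ e t hc
  have hb := bessel2 hN he hx hNe
  rw [hNe] at h2
  rw [inner_smul_left, real_inner_comm N e, hNe] at h1
  rw [inner_smul_left] at h2
  simp only [real_inner_self_eq_norm_sq, hN, he, conj_trivial, one_pow, mul_one, mul_zero, add_zero] at h1 h2
  set ν : ℝ := inner ℝ x N
  set ξ : ℝ := inner ℝ x e
  have ht1 : 1 - t ≠ 0 := by
    intro h0
    rw [h0] at h1
    have : t = 1 := by linarith
    rw [this] at h1; norm_num at h1
  set r := t / (1 - t) with hr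
  have hν : ν = - r ^ 2 := by rw [hr]; field_simp; linarith
  have hξ : ξ = - 2 * r := by
    have : (1 - t) * ((1 - t) * ξ + 2 * t) = 0 := by linarith
    rcases mul_eq_zero.1 this with h | h
    · exact absurd h ht1
    · rw [hr]; field_simp; linarith
  rw [hν, hξ] at hb
  rw [hν] at h
  nlinarith [sq_nonneg r]

theorem valPath {N e e' x : X} (hN : ‖N‖ = 1) (he : ‖e‖ = 1) (he' : ‖e'‖ = 1) (hx : ‖x‖ = 1)
    (hNe : (inner ℝ N e : ℝ) = 0) (hNe' : (inner ℝ N e' : ℝ) = 0) (hee' : (inner ℝ e e' : ℝ) = 0)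
    (h : (inner ℝ x N : ℝ) = -(1/2)) : ∃ w : ℝ → X, Differentiable ℝ w ∧ w 0 = 0 ∧ w 1 = (2:ℝ) • e ∧
      ∀ u ∈ Icc (0:ℝ) 1, Val N x (w u) := by
  have hN0 : N ≠ 0 := by intro h; simp [h] at hN
  have hx0 : x ≠ 0 := by intro h; simp [h] at hx
  by_cases hxe : (inner ℝ x e' : ℝ) = 0
  · refine ⟨fun u => (2 * u) • e + (u * (1 - u)) • e', by fun_prop, by simp, by simp, ?_⟩
    intro u hu t ht hc
    have h1 := cA_inner N x _ e' t hc
    simp only [hxe, hNe', inner_add_left, inner_smul_left, hee', real_inner_self_eq_norm_sq, he'] at h1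
    simp only [conj_trivial, one_pow, mul_one, mul_zero, add_zero, zero_add, mul_eq_zero] at h1
    rcases h1 with (h1 | h1) | (h1 | h1)
    · rw [h1, cA_zero] at hc; exact hx0 hc
    · have : t = 1 := by linarith
      rw [this, cA_one] at hc; exact hN0 hc
    · rw [h1] at hc
      simp only [mul_zero, zero_mul, zero_smul, add_zero] at hc
      exact val0 hN hx h.ge t ht hc
    · have : u = 1 := by linarith
      rw [this] at hc
      simp only [mul_one, sub_self, mul_zero, zero_smul, add_zero] at hc
      exact val1 hN he hx hNe h.le t ht hc
  · refine ⟨fun u => (2 * u) • e, by fun_prop, by simp, by simp, ?_⟩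
    intro u hu t ht hc
    have h1 := cA_inner N x _ e' t hc
    simp only [hNe', inner_smul_left, hee', mul_zero, add_zero, mul_eq_zero, hxe, or_false] at h1
    have : t = 1 := by
      have := pow_eq_zero_iff (two_ne_zero) |>.1 h1
      linarith
    rw [this, cA_one] at hc; exact hN0 hc

variable {α : (X × Y) × Z → ((X × Y) × Z →L[ℝ] ℝ × Z)}
  {αh : ℝ × ((X × Y) × Z) → ((X × Y) × Z →L[ℝ] ℝ × Z)} {O : Set (ℝ × ((X × Y) × Z))}

open Classical in
/-- the glued family -/
noncomputable def FS (αh : ℝ × ((X × Y) × Z) → ((X × Y) × Z →L[ℝ] ℝ × Z)) (O : Set (ℝ × ((X × Y) × Z)))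
    (N e : X) (z : ℝ × ((X × Y) × Z)) : ℝ × Z :=
  if 3 * ‖z.2.1.1‖ ≤ ‖z.2.1.2‖ then FB αh O z else
  if - ‖z.2.1.1‖ < 2 * inner ℝ z.2.1.1 N then FA αh O N 0 z else FA αh O N ((2:ℝ) • e) z

theorem Setup.FS_homog (S : Setup α αh O H) (N e : X) {z : ℝ × ((X × Y) × Z)}
    (h1 : 3 * ‖z.2.1.1‖ ≤ ‖z.2.1.2‖ → z ∈ DB αh O)
    (h2 : ¬ 3 * ‖z.2.1.1‖ ≤ ‖z.2.1.2‖ → - ‖z.2.1.1‖ < 2 * inner ℝ z.2.1.1 N → z ∈ DA αh O N 0)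
    (h3 : ¬ 3 * ‖z.2.1.1‖ ≤ ‖z.2.1.2‖ → ¬ - ‖z.2.1.1‖ < 2 * inner ℝ z.2.1.1 N → z ∈ DA αh O N ((2:ℝ) • e))
    {s r : ℝ} (hr : 0 < r) (hz : s * r = z.1) : FS αh O N e (s, dil r z.2) = wt r (FS αh O N e z) := by
  obtain ⟨s', p⟩ := z
  simp only at hz
  subst hz
  have i1 : 3 * ‖(dil r p).1.1‖ ≤ ‖(dil r p).1.2‖ ↔ 3 * ‖p.1.1‖ ≤ ‖p.1.2‖ := by
    simp only [dil, Prod.smul_fst, Prod.smul_snd, norm_smul, Real.norm_of_nonneg hr.le]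
    rw [mul_left_comm, mul_le_mul_iff_right₀ hr]
  have i2 : - ‖(dil r p).1.1‖ < 2 * inner ℝ (dil r p).1.1 N ↔ - ‖p.1.1‖ < 2 * inner ℝ p.1.1 N := by
    simp only [dil, Prod.smul_fst, norm_smul, Real.norm_of_nonneg hr.le, inner_smul_left, conj_trivial]
    rw [mul_left_comm, ← mul_neg, mul_lt_mul_iff_right₀ hr]
  simp only [FS, i1, i2]
  split_ifs with k1 k2
  · exact (S.famB.homog s r p hr (h1 k1)).2
  · exact ((S.famA N 0).homog s r p hr (h2 k1 k2)).2
  · exact ((S.famA N _).homog s r p hr (h3 k1 k2)).2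

theorem Setup.loc (S : Setup α αh O H) {N e e' : X} (hN : ‖N‖ = 1) (he : ‖e‖ = 1) (he' : ‖e'‖ = 1)
    (hNe : (inner ℝ N e : ℝ) = 0) (hNe' : (inner ℝ N e' : ℝ) = 0) (hee' : (inner ℝ e e' : ℝ) = 0)
    {x : X} {y : Y} (hxy : (x, y) ≠ 0) :
    ∃ D' F', FI α D' F' ∧ ((0:ℝ), ((x, y), (0:Z))) ∈ D' ∧ ∀ᶠ z in 𝓝 ((0:ℝ), ((x, y), (0:Z))),
      FS αh O N e z = F' z ∧ ∀ s r, 0 < r → s * r = z.1 → FS αh O N e (s, dil r z.2) = wt r (FS αh O N e z) := by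
  have c1 : Continuous (fun z : ℝ × ((X × Y) × Z) => 3 * ‖z.2.1.1‖) := by fun_prop
  have c2 : Continuous (fun z : ℝ × ((X × Y) × Z) => ‖z.2.1.2‖) := by fun_prop
  have c3 : Continuous (fun z : ℝ × ((X × Y) × Z) => - ‖z.2.1.1‖) := by fun_prop
  have c4 : Continuous (fun z : ℝ × ((X × Y) × Z) => 2 * (inner ℝ z.2.1.1 N : ℝ)) := by fun_prop
  have v0 : x ≠ 0 → - ‖x‖ ≤ 2 * inner ℝ x N → Val N (‖x‖⁻¹ • x) 0 := by
    intro hx h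
    have hn : 0 < ‖x‖ := norm_pos_iff.2 hx
    apply val0 hN (by rw [norm_smul, norm_inv, norm_norm, inv_mul_cancel₀ hn.ne'])
    rw [inner_smul_left, conj_trivial, le_inv_mul_iff₀ hn]
    linarith
  have v1 : x ≠ 0 → 2 * inner ℝ x N ≤ - ‖x‖ → Val N (‖x‖⁻¹ • x) ((2:ℝ) • e) := by
    intro hx h
    have hn : 0 < ‖x‖ := norm_pos_iff.2 hx
    apply val1 hN he (by rw [norm_smul, norm_inv, norm_norm, inv_mul_cancel₀ hn.ne']) hNe
    rw [inner_smul_left, conj_trivial, inv_mul_le_iff₀ hn]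
    linarith
  have hAA : x ≠ 0 → 2 * inner ℝ x N = - ‖x‖ → ∀ᶠ z in 𝓝 ((0:ℝ), ((x, y), (0:Z))),
      FA αh O N 0 z = FA αh O N ((2:ℝ) • e) z := by
    intro hx h
    have hn : 0 < ‖x‖ := norm_pos_iff.2 hx
    obtain ⟨w, w1, w2, w3, w4⟩ := valPath (x := ‖x‖⁻¹ • x) hN he he'
      (by rw [norm_smul, norm_inv, norm_norm, inv_mul_cancel₀ hn.ne']) hNe hNe' hee' (by
        rw [inner_smul_left, conj_trivial, inv_mul_eq_iff_eq_mul₀ hn.ne']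
        linarith)
    have := S.agreeAA (y := y) hN hx w1 w4
    rwa [w2, w3] at this
  have hB := S.famB
  have hA0 := S.famA N 0
  have hA1 := S.famA N ((2:ℝ) • e)
  rcases lt_trichotomy (3 * ‖x‖) ‖y‖ with h | h | h
  · have m : ((0:ℝ), ((x, y), (0:Z))) ∈ DB αh O := S.memB (by linarith [norm_nonneg x])
    refine ⟨_, _, hB, m, ?_⟩
    filter_upwards [hB.isOpen.mem_nhds m, c1.continuousAt.eventually_lt c2.continuousAt h] with z k1 k2
    refine ⟨by simp only [FS, if_pos k2.le], fun s r hr hz => S.FS_homog N e (fun _ => k1)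
      (fun k => absurd k2.le k) (fun k => absurd k2.le k) hr hz⟩
  · have hx : x ≠ 0 := by
      intro hx
      rw [hx] at h
      simp at h
      apply hxy
      rw [hx, norm_eq_zero.1 h.symm]; rfl
    have hn : 0 < ‖x‖ := norm_pos_iff.2 hx
    have m : ((0:ℝ), ((x, y), (0:Z))) ∈ DB αh O := S.memB (by linarith)
    refine ⟨_, _, hB, m, ?_⟩
    have e0 : ∀ᶠ z in 𝓝 ((0:ℝ), ((x, y), (0:Z))), - ‖z.2.1.1‖ < 2 * inner ℝ z.2.1.1 N →
        z ∈ DA αh O N 0 ∧ FA αh O N 0 z = FB αh O z := by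
      by_cases hc : - ‖x‖ ≤ 2 * inner ℝ x N
      · filter_upwards [S.agreeAB hN hx (v0 hx hc) h.symm, hA0.isOpen.mem_nhds (S.memA hN hx (v0 hx hc))] with z h1 h2 _
        exact ⟨h2, h1⟩
      · filter_upwards [c4.continuousAt.eventually_lt c3.continuousAt (not_le.1 hc)] with z h1 h2
        exact absurd h2 h1.le.not_gt
    have e1 : ∀ᶠ z in 𝓝 ((0:ℝ), ((x, y), (0:Z))), ¬ - ‖z.2.1.1‖ < 2 * inner ℝ z.2.1.1 N →
        z ∈ DA αh O N ((2:ℝ) • e) ∧ FA αh O N ((2:ℝ) • e) z = FB αh O z := by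
      by_cases hc : 2 * inner ℝ x N ≤ - ‖x‖
      · filter_upwards [S.agreeAB hN hx (v1 hx hc) h.symm, hA1.isOpen.mem_nhds (S.memA hN hx (v1 hx hc))] with z h1 h2 _
        exact ⟨h2, h1⟩
      · filter_upwards [c3.continuousAt.eventually_lt c4.continuousAt (not_le.1 hc)] with z h1 h2
        exact absurd h1 h2
    filter_upwards [hB.isOpen.mem_nhds m, e0, e1] with z k1 k2 k3
    refine ⟨?_, fun s r hr hz => S.FS_homog N e (fun _ => k1) (fun _ k => (k2 k).1) (fun _ k => (k3 k).1) hr hz⟩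
    simp only [FS]
    split_ifs with a1 a2
    · rfl
    · exact (k2 a2).2
    · exact (k3 a2).2
  · have hx : x ≠ 0 := by
      intro hx
      rw [hx] at h
      simp at h
      exact absurd h (norm_nonneg y).not_gt
    have ev := (c2.continuousAt (x := ((0:ℝ), ((x, y), (0:Z))))).eventually_lt c1.continuousAt h
    rcases lt_trichotomy (- ‖x‖) (2 * inner ℝ x N) with hc | hc | hc
    · have m := S.memA (y := y) hN hx (v0 hx hc.le)
      refine ⟨_, _, hA0, m, ?_⟩
      filter_upwards [ev, hA0.isOpen.mem_nhds m, c3.continuousAt.eventually_lt c4.continuousAt hc] with z k1 k2 k3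
      refine ⟨?_, fun s r hr hz => S.FS_homog N e (fun k => absurd k k1.not_ge) (fun _ _ => k2)
        (fun _ k => absurd k3 k) hr hz⟩
      simp only [FS, if_neg k1.not_ge, if_pos k3]
    · have m0 := S.memA (y := y) hN hx (v0 hx hc.le)
      have m1 := S.memA (y := y) hN hx (v1 hx hc.ge)
      refine ⟨_, _, hA0, m0, ?_⟩
      filter_upwards [ev, hA0.isOpen.mem_nhds m0, hA1.isOpen.mem_nhds m1, hAA hx hc.symm] with z k1 k2 k3 k4
      refine ⟨?_, fun s r hr hz => S.FS_homog N e (fun k => absurd k k1.not_ge) (fun _ _ => k2) (fun _ _ => k3) hr hz⟩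
      simp only [FS, if_neg k1.not_ge, ← k4, ite_self]
    · have m := S.memA (y := y) hN hx (v1 hx hc.le)
      refine ⟨_, _, hA1, m, ?_⟩
      filter_upwards [ev, hA1.isOpen.mem_nhds m, c4.continuousAt.eventually_lt c3.continuousAt hc] with z k1 k2 k3
      refine ⟨?_, fun s r hr hz => S.FS_homog N e (fun k => absurd k k1.not_ge) (fun _ k => absurd k k3.not_gt)
        (fun _ _ => k2) hr hz⟩
      simp only [FS, if_neg k1.not_ge, if_neg k3.not_gt]

/-- Gluing: Theorem I. -/
theorem Setup.theoremI (S : Setup α αh O H) {N e e' : X} (hN : ‖N‖ = 1) (he : ‖e‖ = 1) (he' : ‖e'‖ = 1)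
    (hNe : (inner ℝ N e : ℝ) = 0) (hNe' : (inner ℝ N e' : ℝ) = 0) (hee' : (inner ℝ e e' : ℝ) = 0) :
    ∃ g : (X × Y) × Z → ℝ × Z, ∃ ε > 0, ContDiffOn ℝ ∞ g (Metric.ball 0 ε) ∧ g 0 = 0 ∧ fderiv ℝ g 0 = 0 ∧
      fderiv ℝ (fderiv ℝ g) 0 = 0 ∧
      ∀ p ∈ Metric.ball (0 : (X × Y) × Z) ε, p.1 ≠ 0 → ∀ v : (X × Y) × Z, v.1.2 = 0 → α p v = 0 →
        fderiv ℝ (fun p => F0 p + g p) p v = 0 := by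
  classical
  set F : (X × Y) × Z → ℝ × Z := fun p => FS αh O N e (1, p) with hF
  set g : (X × Y) × Z → ℝ × Z := fun p => if p.1 = 0 then 0 else F p - F0 p with hg
  -- the good set
  set G : Set (ℝ × (X × Y) × Z) := {z | ∃ D' F', FI α D' F' ∧ ∀ᶠ z' in 𝓝 z, z' ∈ D' ∧ z'.2.1 ≠ 0 ∧
      FS αh O N e z' = F' z' ∧ ∀ s r, 0 < r → s * r = z'.1 → FS αh O N e (s, dil r z'.2) = wt r (FS αh O N e z')} with hGd
  have oG : IsOpen G := by
    rw [isOpen_iff_eventually]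
    rintro z ⟨D', F', h1, h2⟩
    filter_upwards [eventually_eventually_nhds.2 h2] with z' hz'
    exact ⟨D', F', h1, hz'⟩
  have mG : ∀ σ : X × Y, σ ≠ 0 → ((0:ℝ), σ, (0:Z)) ∈ G := by
    rintro ⟨x, y⟩ hσ
    obtain ⟨D', F', h1, h2, h3⟩ := S.loc hN he he' hNe hNe' hee' hσ
    refine ⟨D', F', h1, ?_⟩
    have hne : IsOpen {z : ℝ × (X × Y) × Z | z.2.1 ≠ 0} := by apply isOpen_ne_fun <;> fun_prop
    filter_upwards [h1.isOpen.mem_nhds h2, hne.mem_nhds hσ, h3] with z k1 k2 k3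
    exact ⟨k1, k2, k3⟩
  have cG : ContDiffOn ℝ ∞ (bl g) G := by
    rintro z ⟨D', F', h1, h2⟩
    apply ContDiffAt.contDiffWithinAt
    have c1 : ContDiffAt ℝ ∞ (fun z : ℝ × (X × Y) × Z => wt z.1 (F' z - F0 z.2)) z := by
      have a1 := h1.smooth.contDiffAt (h1.isOpen.mem_nhds h2.self_of_nhds.1)
      have a2 : ContDiffAt ℝ ∞ (fun z : ℝ × (X × Y) × Z => F' z - F0 z.2) z :=
        a1.sub (F0_contDiff.comp contDiff_snd).contDiffAt
      exact ((contDiffAt_fst.pow 2).mul a2.fst).prodMk a2.snd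
    refine c1.congr_of_eventuallyEq ?_
    filter_upwards [h2] with z' hz'
    obtain ⟨k1, k2, k3, k4⟩ := hz'
    obtain ⟨s, p⟩ := z'
    rcases le_or_gt s 0 with hs | hs
    · rw [bl_zero _ _ hs, h1.neg s p k1 hs]
      simp [wt]
      rfl
    · have hne : s • p.1 ≠ 0 := smul_ne_zero hs.ne' k2
      have hh := k4 1 s hs (one_mul s)
      simp only [dil] at hh
      simp only [bl, if_pos hs, hg, hF, if_neg hne, hh, k3]
      have := F0_dil s p
      simp only [dil] at this
      rw [this]
      simp [wt]; ring
  obtain ⟨ε, hε, hOε⟩ : ∃ ε > 0, ∀ s (σ : X × Y) (z : Z), 0 ≤ s → s < ε → ‖σ‖ = 1 → ‖z‖ < ε → (s, σ, z) ∈ G := by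
    have hc : IsCompact (Metric.sphere (0 : X × Y) 1) := isCompact_sphere _ _
    have := hc.eventually_forall_of_forall_eventually (x₀ := ((0:ℝ), (0:Z)))
      (P := fun b σ => (b.1, σ, b.2) ∈ G) (fun σ hσ => by
        have hσ0 : σ ≠ 0 := by
          intro h; rw [h] at hσ; simp at hσ
        have cc : Continuous (fun q : (ℝ × Z) × (X × Y) => (q.1.1, q.2, q.1.2)) := by fun_prop
        exact (cc.continuousAt (x := (((0:ℝ), (0:Z)), σ))).eventually (oG.mem_nhds (mG σ hσ0)))
    obtain ⟨ε, hε, h⟩ := Metric.eventually_nhds_iff_ball.1 this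
    refine ⟨ε, hε, fun s σ z hs1 hs2 hσ hz => h (s, z) ?_ σ (by simp [hσ])⟩
    change (s, z) ∈ Metric.ball (0 : ℝ × Z) ε
    rw [mem_ball_zero_iff, Prod.norm_def]
    simp only [sup_lt_iff, Real.norm_of_nonneg hs1]
    exact ⟨hs2, hz⟩
  have h0 : ∀ z : Z, ‖z‖ < ε → g (0, z) = 0 := by intro z _; simp [hg]
  obtain ⟨B1, B2⟩ := blow_down oG cG hOε h0
  obtain ⟨D1, D2⟩ := bl_deriv oG cG
  obtain ⟨B3, B4⟩ := blow_down oG D2 hOε B2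
  refine ⟨g, ε, hε, B1, h0 0 (by simpa using hε), B2 0 (by simpa using hε), B4 0 (by simpa using hε), ?_⟩
  intro p hp hp0 v hv hα
  have hn : 0 < ‖p.1‖ := norm_pos_iff.2 hp0
  rw [mem_ball_zero_iff, Prod.norm_def, sup_lt_iff] at hp
  set s := ‖p.1‖ with hs
  set p1 : (X × Y) × Z := (s⁻¹ • p.1, p.2) with hp1
  have hd : dil s p1 = p := by simp [dil, hp1, smul_smul, hn.ne']
  have hG := hOε s (s⁻¹ • p.1) p.2 hn.le hp.1 (by rw [norm_smul, norm_inv, norm_norm, inv_mul_cancel₀ hn.ne']) hp.2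
  obtain ⟨D', F', k1, k2⟩ := hG
  have hm : (1, p) ∈ D' := by
    have := (k1.homog 1 s p1 hn (by rw [one_mul]; exact k2.self_of_nhds.1)).1
    rwa [hd] at this
  have hev : (fun p => F0 p + g p) =ᶠ[𝓝 p] fun p => F' (1, p) := by
    have cc : ContinuousAt (fun p' : (X × Y) × Z => (s, s⁻¹ • p'.1, p'.2)) p := by fun_prop
    have hne : IsOpen {p : (X × Y) × Z | p.1 ≠ 0} := by apply isOpen_ne_fun <;> fun_prop
    filter_upwards [cc.eventually k2, hne.mem_nhds hp0] with p' h1 h2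
    obtain ⟨a1, a2, a3, a4⟩ := h1
    have hd' : dil s ((s⁻¹ • p'.1, p'.2) : (X × Y) × Z) = p' := by simp [dil, smul_smul, hn.ne']
    have b1 := a4 1 s hn (one_mul s)
    have b2 := (k1.homog 1 s (s⁻¹ • p'.1, p'.2) hn (by rw [one_mul]; exact a1)).2
    simp only [hd', one_mul] at b1 b2
    simp only [hg, if_neg h2, hF, b1, b2, a3]
    abel
  rw [hev.fderiv_eq]
  exact k1.deriv p v hm hv hα

end Glue
end NambuLin
end FileM4e

section FileM6a
open scoped ContDiff
open MeasureTheory Set Filter Topology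

namespace NambuLin

section Averaging

set_option linter.unusedSectionVars false

variable {X W : Type} [NormedAddCommGroup X] [InnerProductSpace ℝ X] [FiniteDimensional ℝ X]
  [NormedAddCommGroup W] [NormedSpace ℝ W] [FiniteDimensional ℝ W]

/-- trace of the `X`-part of a linear map -/
noncomputable def TrX : (X × W →L[ℝ] X) →ₗ[ℝ] ℝ where
  toFun L := LinearMap.trace ℝ X ((L.comp (ContinuousLinearMap.inl ℝ X W)).toLinearMap)
  map_add' a b := by simp [ContinuousLinearMap.add_comp]
  map_smul' a b := by simp [ContinuousLinearMap.smul_comp]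

theorem TrX_apply (L : X × W →L[ℝ] X) :
    TrX L = LinearMap.trace ℝ X ((L.comp (ContinuousLinearMap.inl ℝ X W)).toLinearMap) := rfl

theorem TrX_rank (ℓ : X × W →L[ℝ] ℝ) (u : X) : TrX (ℓ.smulRight u) = ℓ (u, 0) := by
  have : ((ℓ.smulRight u).comp (ContinuousLinearMap.inl ℝ X W)).toLinearMap =
      (ℓ.comp (ContinuousLinearMap.inl ℝ X W)).toLinearMap.smulRight u := by
    ext y; simp
  rw [TrX_apply, this, LinearMap.trace_smulRight]
  rfl

theorem TrX_fst (A : X →L[ℝ] X) :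
    TrX (A.comp (ContinuousLinearMap.fst ℝ X W)) = LinearMap.trace ℝ X A.toLinearMap := by
  rw [TrX_apply]
  congr 1

theorem trace_skew {v : X →L[ℝ] X} (hv : star v = -v) : LinearMap.trace ℝ X v.toLinearMap = 0 := by
  have b := stdOrthonormalBasis ℝ X
  rw [LinearMap.trace_eq_sum_inner _ b]
  refine Finset.sum_eq_zero fun i _ => ?_
  have h1 : inner ℝ (b i) (v (b i)) = inner ℝ (star v (b i)) (b i) := by
    rw [ContinuousLinearMap.star_eq_adjoint, ContinuousLinearMap.adjoint_inner_left]
  rw [hv] at h1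
  simp only [neg_apply, inner_neg_left] at h1
  have h2 := real_inner_comm (b i) (v (b i))
  simp only [ContinuousLinearMap.coe_coe]
  linarith

theorem inner_skew {v : X →L[ℝ] X} (hv : star v = -v) (x : X) : inner ℝ (v x) x = 0 := by
  have h1 : inner ℝ x (v x) = inner ℝ (star v x) x := by
    rw [ContinuousLinearMap.star_eq_adjoint, ContinuousLinearMap.adjoint_inner_left]
  rw [hv] at h1
  simp only [neg_apply, inner_neg_left] at h1
  have h2 := real_inner_comm x (v x)
  linarith

/-- `f` is the divergence of a field tangent to spheres. -/
def Solv (f : X × W → ℝ) : Prop :=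
  ∃ V : X × W → X, ContDiff ℝ ∞ V ∧ (∀ p, inner ℝ (V p) p.1 = 0) ∧ ∀ p, TrX (fderiv ℝ V p) = f p

theorem Solv.add {f g : X × W → ℝ} (hf : Solv f) (hg : Solv g) : Solv (fun p => f p + g p) := by
  obtain ⟨V, h1, h2, h3⟩ := hf
  obtain ⟨V', h1', h2', h3'⟩ := hg
  refine ⟨fun p => V p + V' p, h1.add h1', fun p => by simp [inner_add_left, h2, h2'], fun p => ?_⟩
  rw [fderiv_fun_add (h1.differentiable (by simp) p) (h1'.differentiable (by simp) p), map_add, h3, h3']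

theorem Solv.smul {f : X × W → ℝ} (hf : Solv f) (c : ℝ) : Solv (fun p => c * f p) := by
  obtain ⟨V, h1, h2, h3⟩ := hf
  refine ⟨fun p => c • V p, contDiff_const.smul h1, fun p => by simp [inner_smul_left, h2], fun p => ?_⟩
  rw [fderiv_fun_const_smul (h1.differentiable (by simp) p), map_smul, h3, smul_eq_mul]

theorem Solv.comp {f : X × W → ℝ} (hf : Solv f) {c : X →L[ℝ] X} (hc : c ∈ unitary (X →L[ℝ] X)) :
    Solv (fun p : X × W => f (c p.1, p.2)) := by
  obtain ⟨V, h1, h2, h3⟩ := hf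
  have hm : ∀ p : X × W, HasFDerivAt (fun p : X × W => (c p.1, p.2))
      (c.prodMap (ContinuousLinearMap.id ℝ W)) p := fun p => (c.prodMap (ContinuousLinearMap.id ℝ W)).hasFDerivAt
  refine ⟨fun p => (star c) (V (c p.1, p.2)), ?_, fun p => ?_, fun p => ?_⟩
  · exact (star c).contDiff.comp (h1.comp (c.prodMap (ContinuousLinearMap.id ℝ W)).contDiff)
  · rw [ContinuousLinearMap.star_eq_adjoint, ContinuousLinearMap.adjoint_inner_left]
    exact h2 (c p.1, p.2)
  · have e1 : HasFDerivAt (fun p : X × W => (star c) (V (c p.1, p.2)))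
        ((star c).comp ((fderiv ℝ V (c p.1, p.2)).comp (c.prodMap (ContinuousLinearMap.id ℝ W)))) p :=
      (star c).hasFDerivAt.comp p (HasFDerivAt.comp p (g := V)
        (h1.differentiable (by simp) (c p.1, p.2)).hasFDerivAt (hm p))
    rw [e1.fderiv]
    change _ = f (c p.1, p.2)
    rw [← h3]
    set L := fderiv ℝ V (c p.1, p.2)
    rw [TrX_apply, TrX_apply]
    have e2 : (((star c).comp (L.comp (c.prodMap (ContinuousLinearMap.id ℝ W)))).comp
        (ContinuousLinearMap.inl ℝ X W)).toLinearMap =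
        (star c).toLinearMap ∘ₗ ((L.comp (ContinuousLinearMap.inl ℝ X W)).toLinearMap ∘ₗ c.toLinearMap) := by
      ext y; simp
    have e3 : c.toLinearMap ∘ₗ (star c).toLinearMap = LinearMap.id := by
      have := (Unitary.mem_iff.1 hc).2
      ext y
      exact congrArg (fun A : X →L[ℝ] X => A y) this
    rw [e2, LinearMap.trace_comp_comm', LinearMap.comp_assoc, e3, LinearMap.comp_id]

theorem exp_contDiff : ContDiff ℝ ∞ (NormedSpace.exp : (X →L[ℝ] X) → (X →L[ℝ] X)) := by
  have h : AnalyticOnNhd ℝ (NormedSpace.exp : (X →L[ℝ] X) → (X →L[ℝ] X)) univ :=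
    fun x _ => NormedSpace.exp_analytic (𝕂 := ℝ) x
  exact contDiffOn_univ.1 (h.contDiffOn uniqueDiffOn_univ)

/-- the potential -/
theorem pot (h : X × W → ℝ) (hh : ContDiff ℝ ∞ h) :
    ∃ H : (X →L[ℝ] X) × (X × W) → ℝ, ContDiff ℝ ∞ H ∧
      ∀ v p, fderiv ℝ H (v, p) (0, (v p.1, 0)) = h (NormedSpace.exp v p.1, p.2) - h p := by
  set Φ : ℝ × ((X →L[ℝ] X) × (X × W)) → ℝ := fun z => h (NormedSpace.exp (z.1 • z.2.1) z.2.2.1, z.2.2.2) with hΦ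
  have hΦc : ContDiff ℝ ∞ Φ := by
    refine hh.comp (ContDiff.prodMk (ContDiff.clm_apply (exp_contDiff.comp ?_) ?_) ?_) <;> fun_prop
  set H : (X →L[ℝ] X) × (X × W) → ℝ := fun u => ∫ t in (0:ℝ)..1, Φ (t, u) with hH
  have hHc : ContDiff ℝ ∞ H := by
    have := parInt_contDiff (T := ℝ) (volume.restrict (Ioc (0:ℝ) 1)) (fun t => max 0 (min t 1))
      (by fun_prop) 1 (fun t => by
        rw [Real.norm_of_nonneg (le_max_left _ _)]
        exact max_le zero_le_one (min_le_right _ _)) Φ hΦc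
    convert this using 1
    funext u
    simp only [hH]
    rw [intervalIntegral.integral_of_le zero_le_one]
    refine setIntegral_congr_fun measurableSet_Ioc fun t ht => ?_
    simp [min_eq_left ht.2, max_eq_right ht.1.le]
  refine ⟨H, hHc, fun v p => ?_⟩
  -- derivative along the orbit
  set φ : ℝ → ℝ := fun t => h (NormedSpace.exp (t • v) p.1, p.2) with hφ
  have hφc : Continuous φ := by
    have := hΦc.continuous.comp (by fun_prop : Continuous fun t : ℝ => (t, (v, p)))
    exact this
  set c : ℝ → (X →L[ℝ] X) × (X × W) := fun s => (v, (NormedSpace.exp (s • v) p.1, p.2)) with hc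
  have e1 : ∀ s, H (c s) = ∫ t in s..(1 + s), φ t := by
    intro s
    have := intervalIntegral.integral_comp_add_right φ s (a := 0) (b := 1)
    rw [zero_add] at this
    rw [← this]
    refine intervalIntegral.integral_congr fun t _ => ?_
    change h (NormedSpace.exp (t • v) (NormedSpace.exp (s • v) p.1), p.2) = h (NormedSpace.exp ((t + s) • v) p.1, p.2)
    have : NormedSpace.exp ((t + s) • v) = NormedSpace.exp (t • v) * NormedSpace.exp (s • v) := by
      letI : NormedAlgebra ℚ (X →L[ℝ] X) := NormedAlgebra.restrictScalars ℚ ℝ (X →L[ℝ] X)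
      rw [add_smul]
      exact NormedSpace.exp_add_of_commute ((Commute.refl v).smul_left t |>.smul_right s)
    rw [this]; rfl
  have hc0 : c 0 = (v, p) := by simp [hc]
  have e2 : HasDerivAt (fun s => H (c s)) (fderiv ℝ H (v, p) (0, (v p.1, 0))) 0 := by
    have d1 : HasDerivAt c (0, (v p.1, 0)) 0 := by
      have := hasDerivAt_exp_smul_const (𝕂 := ℝ) v (0:ℝ)
      simp only [zero_smul, NormedSpace.exp_zero, one_mul] at this
      have d2 : HasDerivAt (fun s : ℝ => NormedSpace.exp (s • v) p.1) (v p.1) 0 := by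
        have := this.clm_apply (hasDerivAt_const (0:ℝ) p.1)
        simpa using this
      exact (hasDerivAt_const _ _).prodMk (d2.prodMk (hasDerivAt_const _ _))
    have := (hHc.differentiable (by simp) (c 0)).hasFDerivAt.comp_hasDerivAt (0:ℝ) d1
    rwa [hc0] at this
  have e3 : HasDerivAt (fun s => H (c s)) (φ 1 - φ 0) 0 := by
    have i : ∀ a b, IntervalIntegrable φ volume a b := fun a b => hφc.intervalIntegrable a b
    have : (fun s => H (c s)) = fun s => (∫ t in (0:ℝ)..(1 + s), φ t) - ∫ t in (0:ℝ)..s, φ t := by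
      funext s
      rw [e1, intervalIntegral.integral_interval_sub_left (i _ _) (i _ _)]
    rw [this]
    have d1 : HasDerivAt (fun u => ∫ t in (0:ℝ)..u, φ t) (φ (1 + 0)) (1 + 0) :=
      intervalIntegral.integral_hasDerivAt_right (i _ _) (hφc.stronglyMeasurableAtFilter _ _) hφc.continuousAt
    have d2 : HasDerivAt (fun u => ∫ t in (0:ℝ)..u, φ t) (φ 0) 0 :=
      intervalIntegral.integral_hasDerivAt_right (i _ _) (hφc.stronglyMeasurableAtFilter _ _) hφc.continuousAt
    have d3 := (d1.comp_const_add 1 0).sub d2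
    rw [add_zero] at d3
    exact d3
  have := e2.unique e3
  rw [this]
  simp [hφ]

theorem solv_base {T : Type} [MeasurableSpace T] (μ : Measure T) [IsFiniteMeasure μ]
    (v : T → (X →L[ℝ] X)) (hv : Measurable v) (C : ℝ) (hC : ∀ t, ‖v t‖ ≤ C) (hsk : ∀ t, star (v t) = - v t)
    (h : X × W → ℝ) (hh : ContDiff ℝ ∞ h) :
    Solv (fun p : X × W => ∫ t, (h (NormedSpace.exp (v t) p.1, p.2) - h p) ∂μ) := by
  obtain ⟨H, hH, hHd⟩ := pot h hh
  set F : (X →L[ℝ] X) × (X × W) → X := fun z => H z • z.1 z.2.1 with hF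
  have hFc : ContDiff ℝ ∞ F := by
    refine hH.smul (ContDiff.clm_apply ?_ ?_) <;> fun_prop
  have bd : ∀ {G : Type} [NormedAddCommGroup G] [NormedSpace ℝ G] [FiniteDimensional ℝ G] (Ψ : (X →L[ℝ] X) → G),
      Continuous Ψ → Integrable (fun t => Ψ (v t)) μ := by
    intro G _ _ _ Ψ hΨ
    obtain ⟨B, hB⟩ := (isCompact_closedBall (0 : X →L[ℝ] X) C).exists_bound_of_continuousOn hΨ.continuousOn
    refine Integrable.of_bound (C := B) ?_ (ae_of_all _ fun t => hB _ (by simpa using hC t))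
    exact (hΨ.stronglyMeasurable.comp_measurable hv).aestronglyMeasurable
  refine ⟨fun p => ∫ t, F (v t, p) ∂μ, parInt_contDiff μ v hv C hC F hFc, fun p => ?_, fun p => ?_⟩
  · rw [real_inner_comm, ← integral_inner]
    · rw [← integral_zero T ℝ (μ := μ)]
      congr 1
      funext t
      simp only [hF, inner_smul_right]
      rw [real_inner_comm, inner_skew (hsk t), mul_zero]
    · exact bd (fun w => F (w, p)) (hFc.continuous.comp (by fun_prop))
  · rw [(parInt_hasFDerivAt μ v hv C hC F (hFc.of_le (by exact_mod_cast le_top)) p).fderiv]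
    have := ContinuousLinearMap.integral_comp_comm (𝕜 := ℝ) (μ := μ) (LinearMap.toContinuousLinearMap (TrX (X := X) (W := W)))
      (φ := fun t => (fderiv ℝ F (v t, p)).comp (ContinuousLinearMap.inr ℝ (X →L[ℝ] X) (X × W)))
      (bd (fun w => (fderiv ℝ F (w, p)).comp (ContinuousLinearMap.inr ℝ (X →L[ℝ] X) (X × W))) (by
        have h1 := hFc.continuous_fderiv (by simp)
        have h2 : Continuous fun w : X →L[ℝ] X => fderiv ℝ F (w, p) := h1.comp (by fun_prop)
        exact h2.clm_comp continuous_const))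
    simp only [LinearMap.coe_toContinuousLinearMap'] at this
    rw [← this]
    congr 1
    funext t
    have d1 : HasFDerivAt F (H (v t, p) • ((v t).comp ((ContinuousLinearMap.fst ℝ X W).comp
          (ContinuousLinearMap.snd ℝ (X →L[ℝ] X) (X × W))) +
          ((ContinuousLinearMap.apply ℝ X p.1).comp (ContinuousLinearMap.fst ℝ (X →L[ℝ] X) (X × W))))
        + (fderiv ℝ H (v t, p)).smulRight (v t p.1)) (v t, p) := by
      have a1 := (hH.differentiable (by simp) (v t, p)).hasFDerivAt
      have a2 : HasFDerivAt (fun z : (X →L[ℝ] X) × (X × W) => z.1 z.2.1) _ (v t, p) :=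
        (ContinuousLinearMap.fst ℝ (X →L[ℝ] X) (X × W)).hasFDerivAt.clm_apply
          ((ContinuousLinearMap.fst ℝ X W).comp
          (ContinuousLinearMap.snd ℝ (X →L[ℝ] X) (X × W))).hasFDerivAt
      refine (a1.smul a2).congr_fderiv ?_
      refine ContinuousLinearMap.ext fun z => ?_
      simp
    rw [d1.fderiv]
    have d2 : ((H (v t, p) • ((v t).comp ((ContinuousLinearMap.fst ℝ X W).comp
          (ContinuousLinearMap.snd ℝ (X →L[ℝ] X) (X × W))) +
          ((ContinuousLinearMap.apply ℝ X p.1).comp (ContinuousLinearMap.fst ℝ (X →L[ℝ] X) (X × W))))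
        + (fderiv ℝ H (v t, p)).smulRight (v t p.1))).comp (ContinuousLinearMap.inr ℝ (X →L[ℝ] X) (X × W)) =
        H (v t, p) • (v t).comp (ContinuousLinearMap.fst ℝ X W) +
          ((fderiv ℝ H (v t, p)).comp (ContinuousLinearMap.inr ℝ (X →L[ℝ] X) (X × W))).smulRight (v t p.1) := by
      refine ContinuousLinearMap.ext fun z => ?_
      simp
    rw [d2, map_add, map_smul, TrX_fst, trace_skew (hsk t), TrX_rank]
    simp [hHd]

end Averaging

end NambuLin
end FileM6a

section FileM6b
open scoped ContDiff
open MeasureTheory Set Filter Topology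

namespace NambuLin

section Averaging2

set_option linter.unusedSectionVars false

variable {X W : Type} [NormedAddCommGroup X] [InnerProductSpace ℝ X] [FiniteDimensional ℝ X]
  [NormedAddCommGroup W] [NormedSpace ℝ W] [FiniteDimensional ℝ W]

theorem exp_neg_mul (v : X →L[ℝ] X) : NormedSpace.exp (-v) * NormedSpace.exp v = 1 := by
  letI : NormedAlgebra ℚ (X →L[ℝ] X) := NormedAlgebra.restrictScalars ℚ ℝ (X →L[ℝ] X)
  rw [← NormedSpace.exp_add_of_commute (Commute.refl v).neg_left, neg_add_cancel, NormedSpace.exp_zero]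

theorem exp_unitary {v : X →L[ℝ] X} (hv : star v = -v) : NormedSpace.exp v ∈ unitary (X →L[ℝ] X) := by
  letI : NormedAlgebra ℚ (X →L[ℝ] X) := NormedAlgebra.restrictScalars ℚ ℝ (X →L[ℝ] X)
  exact NormedSpace.exp_mem_unitary_of_mem_skewAdjoint (skewAdjoint.mem_iff.2 hv)

theorem norm_unitary_le {c : X →L[ℝ] X} (hc : c ∈ unitary (X →L[ℝ] X)) : ‖c‖ ≤ 1 := by
  have h1 : ‖star c * c‖ = ‖c‖ * ‖c‖ := CStarRing.norm_star_mul_self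
  rw [(Unitary.mem_iff.1 hc).1] at h1
  have h2 : ‖(1 : X →L[ℝ] X)‖ ≤ 1 := ContinuousLinearMap.norm_id_le
  nlinarith [norm_nonneg c]

theorem exists_log : ∃ (N : Set (unitary (X →L[ℝ] X))) (L : unitary (X →L[ℝ] X) → (X →L[ℝ] X)) (C : ℝ),
    IsOpen N ∧ 1 ∈ N ∧ Measurable L ∧ (∀ c, ‖L c‖ ≤ C) ∧ (∀ c, star (L c) = - L c) ∧
    ∀ c ∈ N, NormedSpace.exp (L c) = c := by
  classical
  have hs : HasStrictFDerivAt (NormedSpace.exp : (X →L[ℝ] X) → (X →L[ℝ] X))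
      ((ContinuousLinearEquiv.refl ℝ (X →L[ℝ] X) : (X →L[ℝ] X) ≃L[ℝ] (X →L[ℝ] X)) : (X →L[ℝ] X) →L[ℝ] (X →L[ℝ] X)) 0 :=
    hasStrictFDerivAt_exp_zero
  obtain ⟨e, hes, hee⟩ : ∃ e : OpenPartialHomeomorph (X →L[ℝ] X) (X →L[ℝ] X), (0 : X →L[ℝ] X) ∈ e.source ∧
      ∀ v, e v = NormedSpace.exp v :=
    ⟨hs.toOpenPartialHomeomorph, hs.mem_toOpenPartialHomeomorph_source, fun v => rfl⟩
  obtain ⟨r, hr, hrs⟩ := Metric.mem_nhds_iff.1 (e.open_source.mem_nhds hes)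
  have hO : IsOpen (e.target ∩ e.symm ⁻¹' Metric.ball 0 r) := e.isOpen_inter_preimage_symm Metric.isOpen_ball
  set N : Set (unitary (X →L[ℝ] X)) := {c | (c : X →L[ℝ] X) ∈ e.target ∩ e.symm ⁻¹' Metric.ball 0 r} with hNd
  have hN : IsOpen N := hO.preimage continuous_subtype_val
  have hex : ∀ c ∈ N, NormedSpace.exp (e.symm (c : X →L[ℝ] X)) = c := fun c hc => by
    rw [← hee]; exact e.right_inv hc.1
  have hsk : ∀ c ∈ N, star (e.symm (c : X →L[ℝ] X)) = - e.symm (c : X →L[ℝ] X) := by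
    intro c hc
    set v := e.symm (c : X →L[ℝ] X) with hv
    have hvb : ‖v‖ < r := by simpa using hc.2
    have h1 : star v ∈ e.source := hrs (by rw [mem_ball_zero_iff, ContinuousLinearMap.star_eq_adjoint, LinearIsometryEquiv.norm_map]; exact hvb)
    have h2 : -v ∈ e.source := hrs (by rw [mem_ball_zero_iff, norm_neg]; exact hvb)
    apply e.injOn h1 h2
    rw [hee, hee, ← NormedSpace.star_exp, hex c hc]
    have h3 := exp_neg_mul v
    rw [hex c hc] at h3
    have h4 := (Unitary.mem_iff.1 c.2).2
    calc star (c : X →L[ℝ] X) = (NormedSpace.exp (-v) * c) * star (c : X →L[ℝ] X) := by rw [h3, one_mul]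
      _ = NormedSpace.exp (-v) := by rw [mul_assoc, h4, mul_one]
  refine ⟨N, N.indicator (fun c => e.symm (c : X →L[ℝ] X)), r, hN, ?_, ?_, ?_, ?_, ?_⟩
  · have h1 : e 0 = 1 := by rw [hee, NormedSpace.exp_zero]
    have h2 : e.symm 1 = 0 := by rw [← h1, e.left_inv hes]
    have h3 : (1 : X →L[ℝ] X) ∈ e.target := by
      rw [← h1]; exact e.map_source hes
    rw [hNd, mem_setOf_eq, OneMemClass.coe_one]
    refine ⟨h3, ?_⟩
    rw [mem_preimage, h2]
    exact Metric.mem_ball_self hr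
  · have hc : ContinuousOn (fun c : unitary (X →L[ℝ] X) => e.symm (c : X →L[ℝ] X)) N :=
      e.continuousOn_symm.comp continuous_subtype_val.continuousOn (fun c hc => hc.1)
    have := hc.measurable_piecewise (continuousOn_const (c := (0 : X →L[ℝ] X))) hN.measurableSet
    rw [← Set.piecewise_eq_indicator]
    exact this
  · intro c
    by_cases hc : c ∈ N
    · rw [indicator_of_mem hc]
      have : ‖e.symm (c : X →L[ℝ] X)‖ < r := by simpa using hc.2
      exact this.le
    · rw [indicator_of_notMem hc, norm_zero]; exact hr.le
  · intro c
    by_cases hc : c ∈ N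
    · rw [indicator_of_mem hc]; exact hsk c hc
    · rw [indicator_of_notMem hc]; simp
  · intro c hc
    rw [indicator_of_mem hc]; exact hex c hc

theorem solv_zero : Solv (fun _ : X × W => (0:ℝ)) :=
  ⟨fun _ => 0, contDiff_const, fun p => by simp, fun p => by simp⟩

theorem average (h : X × W → ℝ) (hh : ContDiff ℝ ∞ h) (hpos : ∀ p, 0 < h p) :
    ∃ hb : X × W → ℝ, ContDiff ℝ ∞ hb ∧ (∀ p, 0 < hb p) ∧ Solv (fun p => h p - hb p) ∧
      (∀ p, ∀ v : X →L[ℝ] X, star v = -v → fderiv ℝ hb p (v p.1, 0) = 0) ∧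
      ∀ w, hb (0, w) = h (0, w) := by
  classical
  obtain ⟨N, L, C, hN, h1N, hLm, hLC, hLsk, hLe⟩ := exists_log (X := X)
  set K : Subgroup (unitary (X →L[ℝ] X)) := Subgroup.closure N with hK
  have hNK : N ⊆ K := Subgroup.subset_closure
  have hKo : IsOpen (K : Set (unitary (X →L[ℝ] X))) :=
    Subgroup.isOpen_of_mem_nhds K (g := 1) (mem_of_superset (hN.mem_nhds h1N) hNK)
  have hKc : IsClosed (K : Set (unitary (X →L[ℝ] X))) := Subgroup.isClosed_of_isOpen K hKo
  have : CompactSpace (unitary (X →L[ℝ] X)) := by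
    refine (isCompact_iff_compactSpace (s := (unitary (X →L[ℝ] X) : Set (X →L[ℝ] X)))).1 ?_
    refine Metric.isCompact_of_isClosed_isBounded isClosed_unitary ?_
    refine (Metric.isBounded_closedBall (x := (0 : X →L[ℝ] X)) (r := 1)).subset fun c hc => ?_
    simpa using norm_unitary_le hc
  have : CompactSpace K := isCompact_iff_compactSpace.1 hKc.isCompact
  set μ : Measure K := Measure.haarMeasure ⊤ with hμ
  have : IsProbabilityMeasure μ := ⟨by
    have := Measure.haarMeasure_self (K₀ := (⊤ : TopologicalSpace.PositiveCompacts K))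
    simpa using this⟩
  -- the action
  set a : K → (X →L[ℝ] X) := fun k => ((k⁻¹ : K) : unitary (X →L[ℝ] X)) with ha
  have hac : Continuous a := by
    have : Continuous fun k : K => k⁻¹ := continuous_inv
    exact continuous_subtype_val.comp (continuous_subtype_val.comp this)
  have haC : ∀ k, ‖a k‖ ≤ 1 := fun k => norm_unitary_le ((k⁻¹ : K) : unitary (X →L[ℝ] X)).2
  set F : (X →L[ℝ] X) × (X × W) → ℝ := fun z => h (z.1 z.2.1, z.2.2) with hF
  have hFc : ContDiff ℝ ∞ F := by
    refine hh.comp (ContDiff.prodMk (ContDiff.clm_apply ?_ ?_) ?_) <;> fun_prop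
  have hitgr : ∀ p, Integrable (fun k => F (a k, p)) μ := by
    intro p
    have hc : Continuous fun k => F (a k, p) := hFc.continuous.comp (by fun_prop)
    have := hc.integrable_of_hasCompactSupport (μ := μ) (HasCompactSupport.of_compactSpace _)
    exact this
  -- one group element
  have hone : ∀ g ∈ K, ∀ h : X × W → ℝ, ContDiff ℝ ∞ h →
      Solv (fun p : X × W => h ((g : X →L[ℝ] X) p.1, p.2) - h p) := by
    intro g hg
    refine Subgroup.closure_induction (k := N) (p := fun (g : unitary (X →L[ℝ] X)) _ => ∀ h : X × W → ℝ, ContDiff ℝ ∞ h →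
      Solv (fun p : X × W => h ((g : X →L[ℝ] X) p.1, p.2) - h p)) ?_ ?_ ?_ ?_ hg
    · intro c hc h hh
      have := solv_base (T := Unit) (Measure.dirac ()) (fun _ => L c) measurable_const C (fun _ => hLC c)
        (fun _ => hLsk c) h hh
      simpa [hLe c hc] using this
    · intro h hh
      simpa using (solv_zero (X := X) (W := W))
    · intro x y _ _ hx hy h hh
      have s1 := (hx h hh).comp y.2
      have s2 := hy h hh
      convert s1.add s2 using 2 with p
      simp
    · intro x _ hx h hh
      have s1 := ((hx h hh).comp (x⁻¹).2).smul (-1)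
      convert s1 using 2 with p
      have : (x : X →L[ℝ] X) (((x⁻¹ : unitary (X →L[ℝ] X)) : X →L[ℝ] X) p.1) = p.1 := by
        have h1 : x * x⁻¹ = 1 := mul_inv_cancel x
        have h2 := congrArg (fun u : unitary (X →L[ℝ] X) => (u : X →L[ℝ] X) p.1) h1
        exact h2
      simp only [this]
      ring
  -- compactness
  have hall : ∃ s' : Set K, MeasurableSet s' ∧ univ ⊆ s' ∧ ∀ t ⊆ s', MeasurableSet t →
      Solv (fun p : X × W => ∫ k in t, (F (a k, p) - h p) ∂μ) := by
    refine isCompact_univ.induction_on (p := fun s => ∃ s' : Set K, MeasurableSet s' ∧ s ⊆ s' ∧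
      ∀ t ⊆ s', MeasurableSet t → Solv (fun p : X × W => ∫ k in t, (F (a k, p) - h p) ∂μ)) ?_ ?_ ?_ ?_
    · refine ⟨∅, MeasurableSet.empty, subset_rfl, fun t ht _ => ?_⟩
      rw [subset_empty_iff.1 ht]
      simpa using (solv_zero (X := X) (W := W))
    · rintro s t hst ⟨s', h1, h2, h3⟩
      exact ⟨s', h1, hst.trans h2, h3⟩
    · rintro s t ⟨s', h1, h2, h3⟩ ⟨t', k1, k2, k3⟩
      refine ⟨s' ∪ t', h1.union k1, union_subset_union h2 k2, fun u hu hum => ?_⟩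
      have e1 := h3 (u ∩ s') inter_subset_right (hum.inter h1)
      have e2 := k3 (u \ s') (fun x hx => (hu hx.1).resolve_left hx.2) (hum.diff h1)
      convert e1.add e2 using 2 with p
      exact (integral_inter_add_sdiff h1 ((hitgr p).sub (integrable_const _)).integrableOn).symm
    · intro k0 _
      set m : K → unitary (X →L[ℝ] X) := fun k => ((k⁻¹ * k0 : K) : unitary (X →L[ℝ] X)) with hm
      have hmc : Continuous m := by
        have : Continuous fun k : K => k⁻¹ * k0 := by fun_prop
        exact continuous_subtype_val.comp this
      have hso : IsOpen (m ⁻¹' N) := hN.preimage hmc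
      have hk0 : k0 ∈ m ⁻¹' N := by simp [hm, h1N]
      refine ⟨m ⁻¹' N, mem_nhdsWithin_of_mem_nhds (hso.mem_nhds hk0), m ⁻¹' N, hso.measurableSet, subset_rfl, ?_⟩
      intro t ht htm
      have s1 := solv_base (μ.restrict t) (fun k => L (m k)) (hLm.comp hmc.measurable) C (fun k => hLC _)
        (fun k => hLsk _) h hh
      have s2 := s1.comp ((k0⁻¹ : K) : unitary (X →L[ℝ] X)).2
      have s3 := (hone _ (k0⁻¹ : K).2 h hh).smul (μ.real t)
      convert s2.add s3 using 2 with p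
      have e1 : ∀ k ∈ t, F (a k, p) - h p = (h (NormedSpace.exp (L (m k)) (a k0 p.1), p.2) - h (a k0 p.1, p.2)) +
          (h (a k0 p.1, p.2) - h p) := by
        intro k hk
        rw [hLe _ (ht hk)]
        have : ((m k : unitary (X →L[ℝ] X)) : X →L[ℝ] X) (a k0 p.1) = a k p.1 := by
          have h1 : (k⁻¹ * k0) * k0⁻¹ = k⁻¹ := by group
          have h2 := congrArg (fun u : K => ((u : unitary (X →L[ℝ] X)) : X →L[ℝ] X) p.1) h1
          exact h2
        rw [this]
        simp [hF]
      rw [setIntegral_congr_fun htm e1, integral_add, setIntegral_const, smul_eq_mul]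
      · have e2 : IntegrableOn (fun k => F (a k, p) - h (a k0 p.1, p.2)) t μ :=
          ((hitgr p).sub (integrable_const _)).integrableOn
        refine e2.congr_fun (fun k hk => ?_) htm
        have := e1 k hk
        simp only
        linarith
      · exact (integrable_const _)
  obtain ⟨s', hs1, hs2, hs3⟩ := hall
  set hb : X × W → ℝ := fun p => ∫ k, F (a k, p) ∂μ with hhb
  have hbc : ContDiff ℝ ∞ hb := parInt_contDiff μ a hac.measurable 1 haC F hFc
  have hinv : ∀ c ∈ K, ∀ p : X × W, hb ((c : X →L[ℝ] X) p.1, p.2) = hb p := by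
    intro c hc p
    have := integral_mul_left_eq_self (μ := μ) (fun k => F (a k, p)) (⟨c, hc⟩⁻¹ : K)
    simp only [hhb]
    rw [← this]
    congr 1
    funext k
    have h1 : (((⟨c, hc⟩ : K)⁻¹ * k)⁻¹ : K) = k⁻¹ * ⟨c, hc⟩ := by group
    simp only [ha, h1, hF]
    rfl
  refine ⟨hb, hbc, fun p => ?_, ?_, ?_, ?_⟩
  · have : 0 < ∫ k, F (a k, p) ∂μ := by
      rw [integral_pos_iff_support_of_nonneg (fun k => (hpos _).le) (hitgr p)]
      have : Function.support (fun k => F (a k, p)) = univ := by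
        ext k; simp [hF, (hpos _).ne']
      rw [this]; simp
    exact this
  · have := (hs3 univ hs2 MeasurableSet.univ).smul (-1)
    convert this using 2 with p
    rw [setIntegral_univ, integral_sub (hitgr p) (integrable_const _)]
    simp [hhb]
  · intro p v hv
    have hsv : ∀ s : ℝ, star (s • v) = -(s • v) := fun s => by
      rw [star_smul, hv, smul_neg]; rfl
    set γ : ℝ → unitary (X →L[ℝ] X) := fun s => ⟨NormedSpace.exp (s • v), exp_unitary (hsv s)⟩ with hγ
    have hγc : Continuous γ := by
      refine Continuous.subtype_mk ?_ _
      exact exp_contDiff.continuous.comp (by fun_prop)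
    have hγ0 : γ 0 = 1 := by
      apply Subtype.ext
      simp [hγ]
    have hev : ∀ᶠ s in 𝓝 (0:ℝ), hb (NormedSpace.exp (s • v) p.1, p.2) = hb p := by
      have := hγc.continuousAt (x := (0:ℝ))
      have h2 := this.eventually (hN.mem_nhds (by rw [hγ0]; exact h1N))
      filter_upwards [h2] with s hs
      exact hinv (γ s) (hNK hs) p
    have d1 : HasDerivAt (fun s : ℝ => (NormedSpace.exp (s • v) p.1, p.2)) ((v p.1, 0) : X × W) 0 := by
      have := hasDerivAt_exp_smul_const (𝕂 := ℝ) v (0:ℝ)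
      simp only [zero_smul, NormedSpace.exp_zero, one_mul] at this
      have d2 : HasDerivAt (fun s : ℝ => NormedSpace.exp (s • v) p.1) (v p.1) 0 := by
        have := this.clm_apply (hasDerivAt_const (0:ℝ) p.1)
        simpa using this
      exact d2.prodMk (hasDerivAt_const _ _)
    have d2 := (hbc.differentiable (by simp) (NormedSpace.exp ((0:ℝ) • v) p.1, p.2)).hasFDerivAt.comp_hasDerivAt (0:ℝ) d1
    have d3 : HasDerivAt (fun s : ℝ => hb (NormedSpace.exp (s • v) p.1, p.2)) 0 0 :=
      (hasDerivAt_const (0:ℝ) (hb p)).congr_of_eventuallyEq hev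
    have := d2.unique d3
    simpa using this
  · intro w
    simp [hhb, hF]

end Averaging2

end NambuLin
end FileM6b

section FileM6c
open scoped ContDiff
open MeasureTheory Set Filter Topology

namespace NambuLin

section Moser

set_option linter.unusedSectionVars false

variable {X W : Type} [NormedAddCommGroup X] [InnerProductSpace ℝ X] [FiniteDimensional ℝ X]
  [NormedAddCommGroup W] [NormedSpace ℝ W] [FiniteDimensional ℝ W]

theorem matrix_det_deriv {ι : Type} [Fintype ι] [DecidableEq ι] {M : ℝ → Matrix ι ι ℝ} {A : Matrix ι ι ℝ}
    {s : Set ℝ} {t : ℝ} (h : ∀ i j, HasDerivWithinAt (fun t => M t i j) ((A * M t) i j) s t) :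
    HasDerivWithinAt (fun t => (M t).det) (A.trace * (M t).det) s t := by
  set D : ContinuousMultilinearMap ℝ (fun _ : ι => ι → ℝ) ℝ :=
    ⟨(Matrix.detRowAlternating (n := ι) (R := ℝ)).toMultilinearMap, by
      exact (Continuous.matrix_det continuous_id : Continuous fun M : Matrix ι ι ℝ => M.det)⟩ with hD
  have h1 : HasDerivWithinAt (fun t => (fun i j => M t i j : ι → ι → ℝ)) (fun i j => (A * M t) i j) s t :=
    hasDerivWithinAt_pi.2 fun i => hasDerivWithinAt_pi.2 fun j => h i j
  have h2 := (D.hasFDerivAt (fun i j => M t i j)).comp_hasDerivWithinAt t h1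
  refine HasDerivWithinAt.congr_deriv (f := fun t => (M t).det) h2 ?_
  rw [ContinuousMultilinearMap.linearDeriv_apply, Matrix.trace, Finset.sum_mul]
  refine Finset.sum_congr rfl fun i _ => ?_
  have h3 := Matrix.det_updateRow_sum (M t) i (A i)
  have h4 : (∑ k, A i k • M t k) = fun j => (A * M t) i j := by
    funext j
    simp [Matrix.mul_apply, Finset.sum_apply]
  rw [h4] at h3
  exact h3

theorem clm_det_deriv {B : ℝ → (X →L[ℝ] X)} {A : X →L[ℝ] X} {s : Set ℝ} {t : ℝ}
    (h : ∀ y, HasDerivWithinAt (fun t => B t y) (A (B t y)) s t) :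
    HasDerivWithinAt (fun t => LinearMap.det (B t).toLinearMap)
      (LinearMap.trace ℝ X A.toLinearMap * LinearMap.det (B t).toLinearMap) s t := by
  set b := (stdOrthonormalBasis ℝ X)
  have e1 : ∀ t, LinearMap.det (B t).toLinearMap = (LinearMap.toMatrix b.toBasis b.toBasis (B t).toLinearMap).det :=
    fun t => (LinearMap.det_toMatrix b.toBasis _).symm
  rw [LinearMap.trace_eq_matrix_trace ℝ b.toBasis]
  simp only [e1]
  refine matrix_det_deriv fun i j => ?_
  rw [← LinearMap.toMatrix_comp]
  simp only [LinearMap.toMatrix_apply]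
  have := (innerSL ℝ (b i)).hasFDerivAt.comp_hasDerivWithinAt t (h (b j))
  have e2 : ∀ x, b.toBasis.repr x i = inner ℝ (b i) x := fun x => by
    rw [OrthonormalBasis.coe_toBasis_repr_apply, OrthonormalBasis.repr_apply_apply]
  simp only [e2]
  exact this

theorem rank_one_det {κ : ℝ} (hκ : κ ≠ 0) (ℓ : X →ₗ[ℝ] ℝ) (u : X) (hd : 1 ≤ Module.finrank ℝ X) :
    LinearMap.det (κ • LinearMap.id + ℓ.smulRight u) = κ ^ (Module.finrank ℝ X - 1) * (κ + ℓ u) := by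
  have : κ • LinearMap.id + ℓ.smulRight u = κ • LinearMap.transvection (κ⁻¹ • ℓ) u := by
    ext y
    simp [LinearMap.transvection, smul_smul, hκ]
  rw [this, LinearMap.det_smul, LinearMap.transvection.det]
  obtain ⟨m, hm⟩ : ∃ m, Module.finrank ℝ X = m + 1 := ⟨_, (Nat.succ_pred_eq_of_pos hd).symm⟩
  rw [hm, Nat.add_sub_cancel, pow_succ]
  simp
  field_simp

/-- Flow part. -/
theorem moser_flow {g gb : X × W → ℝ} (hg : ContDiff ℝ ∞ g) (hgb : ContDiff ℝ ∞ gb)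
    (pg : ∀ p, 0 < g p) (pgb : ∀ p, 0 < gb p) (hS : Solv (fun p => g p - gb p)) :
    ∃ (Ψ : X × W → X) (N : Set (X × W)), IsOpen N ∧ (∀ w, (0, w) ∈ N) ∧ ContDiffOn ℝ ∞ Ψ N ∧
      (∀ w, Ψ (0, w) = 0) ∧ ∀ p ∈ N, (∀ y, inner ℝ (fderiv ℝ Ψ p (y, 0)) (Ψ p) = inner ℝ y p.1) ∧
      gb (Ψ p, p.2) * LinearMap.det ((fderiv ℝ Ψ p).comp (ContinuousLinearMap.inl ℝ X W)).toLinearMap = g p := by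
  obtain ⟨V, hV, hVx, hVt⟩ := hS
  have hV0 : ∀ w, V (0, w) = 0 := by
    intro w
    have h2 : ∀ t : ℝ, t * inner ℝ (V (t • V (0, w), w)) (V (0, w)) = 0 := by
      intro t
      have := hVx (t • V (0, w), w)
      simpa [inner_smul_right] using this
    have h3 : ∀ t ∈ ({0}ᶜ : Set ℝ), inner ℝ (V (t • V (0, w), w)) (V (0, w)) = 0 := fun t ht =>
      (mul_eq_zero.1 (h2 t)).resolve_left ht
    have h4 : Continuous fun t : ℝ => inner ℝ (V (t • V (0, w), w)) (V (0, w)) := by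
      have := hV.continuous
      fun_prop
    have h5 : (fun t : ℝ => inner ℝ (V (t • V (0, w), w)) (V (0, w))) = fun _ => (0:ℝ) :=
      Continuous.ext_on (dense_compl_singleton (0:ℝ)) h4 continuous_const h3
    have h6 := congrFun h5 0
    simpa using h6
  set G : ℝ × (X × W) → ℝ := fun z => g z.2 + z.1 * (gb z.2 - g z.2) with hG
  have hGc : ContDiff ℝ ∞ G := (hg.comp contDiff_snd).add (contDiff_fst.mul ((hgb.comp contDiff_snd).sub (hg.comp contDiff_snd)))
  set Ω : Set (ℝ × (X × W)) := {z | 0 < G z} with hΩd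
  have hΩ : IsOpen Ω := isOpen_lt continuous_const hGc.continuous
  have hmem : ∀ t ∈ Icc (0:ℝ) 1, ∀ p, (t, p) ∈ Ω := by
    intro t ht p
    have h1 := pg p
    have h2 := pgb p
    change 0 < g p + t * (gb p - g p)
    rcases eq_or_lt_of_le ht.1 with h | h
    · rw [← h]; simpa using h1
    · nlinarith [ht.2, mul_pos h h2, mul_nonneg (sub_nonneg.2 ht.2) h1.le]
  set vx : ℝ × (X × W) → X := fun z => (G z)⁻¹ • V z.2 with hvx
  have hvxc : ContDiffOn ℝ ∞ vx Ω := by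
    refine ContDiffOn.smul (hGc.contDiffOn.inv fun z hz => ?_) (hV.comp contDiff_snd).contDiffOn
    exact (show 0 < G z from hz).ne'
  set vf : ℝ × (X × W) → ℝ × (X × W) := fun z => (1, (vx z, 0)) with hvf
  have hvfc : ContDiffOn ℝ ∞ vf Ω := contDiffOn_const.prodMk (hvxc.prodMk contDiffOn_const)
  -- components of solutions
  have comp1 : ∀ γ, IsSol vf Ω γ → ∀ t ∈ Icc (0:ℝ) 1, (γ t).1 = (γ 0).1 + t ∧ (γ t).2.2 = (γ 0).2.2 ∧
      inner ℝ (γ t).2.1 (γ t).2.1 = inner ℝ (γ 0).2.1 (γ 0).2.1 := by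
    intro γ hγ t ht
    have d := fun t ht => (hγ t ht).2
    have d1 : ∀ t ∈ Icc (0:ℝ) 1, HasDerivWithinAt (fun t => (γ t).1 - t) 0 (Icc 0 1) t := fun t ht => by
      have := ((ContinuousLinearMap.fst ℝ ℝ (X × W)).hasFDerivAt.comp_hasDerivWithinAt t (d t ht)).sub (hasDerivWithinAt_id t _)
      refine this.congr_deriv ?_
      simp [hvf]
    have d2 : ∀ t ∈ Icc (0:ℝ) 1, HasDerivWithinAt (fun t => (γ t).2.2) 0 (Icc 0 1) t := fun t ht =>
      ((ContinuousLinearMap.snd ℝ X W).comp (ContinuousLinearMap.snd ℝ ℝ (X × W))).hasFDerivAt.comp_hasDerivWithinAt t (d t ht)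
    have d3 : ∀ t ∈ Icc (0:ℝ) 1, HasDerivWithinAt (fun t => (γ t).2.1) (vx (γ t)) (Icc 0 1) t := fun t ht =>
      ((ContinuousLinearMap.fst ℝ X W).comp (ContinuousLinearMap.snd ℝ ℝ (X × W))).hasFDerivAt.comp_hasDerivWithinAt t (d t ht)
    have d4 : ∀ t ∈ Icc (0:ℝ) 1, HasDerivWithinAt (fun t => (inner ℝ (γ t).2.1 (γ t).2.1 : ℝ)) 0 (Icc 0 1) t := fun t ht => by
      refine ((d3 t ht).inner ℝ (d3 t ht)).congr_deriv ?_
      have := hVx (γ t).2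
      rw [real_inner_comm (vx (γ t)) (γ t).2.1]
      simp only [hvx, inner_smul_left, this]
      simp
    have z0 : (0:ℝ) ∈ Icc (0:ℝ) 1 := ⟨le_rfl, zero_le_one⟩
    have c1 := const_of_deriv_zero (convex_Icc 0 1) d1 ht z0
    have c2 := const_of_deriv_zero (convex_Icc 0 1) d2 ht z0
    have c4 := const_of_deriv_zero (convex_Icc 0 1) d4 ht z0
    refine ⟨by linarith, c2, c4⟩
  set N : Set (X × W) := {p | ((0:ℝ), p) ∈ odeDom vf Ω} with hNd
  have hNo : IsOpen N := (isOpen_odeDom hΩ hvfc).preimage (by fun_prop)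
  have sol0 : ∀ w, IsSol vf Ω (fun t => (t, ((0:X), w))) := by
    intro w t ht
    refine ⟨hmem t ht _, ?_⟩
    have : vf (t, ((0:X), w)) = (1, (0, 0)) := by simp [hvf, hvx, hV0]
    rw [this]
    exact (hasDerivWithinAt_id t _).prodMk (hasDerivWithinAt_const t _ _)
  have i1 : (1:ℝ) ∈ Icc (0:ℝ) 1 := ⟨zero_le_one, le_rfl⟩
  have i0 : (0:ℝ) ∈ Icc (0:ℝ) 1 := ⟨le_rfl, zero_le_one⟩
  set Ψ : X × W → X := fun p => (odeFlow vf Ω (0, p) 1).2.1 with hΨ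
  have hsm : ∀ p ∈ N, ∀ t ∈ Icc (0:ℝ) 1, ContDiffAt ℝ ∞ (fun p => odeFlow vf Ω (0, p) t) p := by
    intro p hp t ht
    exact ContDiffAt.comp p (g := fun z => odeFlow vf Ω z t) (odeFlow_contDiffAt hΩ hvfc hp ht) (by fun_prop)
  have hΨc : ∀ p ∈ N, ContDiffAt ℝ ∞ Ψ p := fun p hp => (hsm p hp 1 i1).snd.fst
  refine ⟨Ψ, N, hNo, fun w => ⟨_, rfl, sol0 w⟩, fun p hp => (hΨc p hp).contDiffWithinAt, fun w => ?_, fun p hp => ⟨fun y => ?_, ?_⟩⟩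
  · simp only [hΨ]
    rw [odeFlow_eq hΩ hvfc (sol0 w) rfl i1]
  · -- norm preserved
    have ev : (fun p => (inner ℝ (Ψ p) (Ψ p) : ℝ)) =ᶠ[𝓝 p] fun p => inner ℝ p.1 p.1 := by
      filter_upwards [hNo.mem_nhds hp] with p' hp'
      obtain ⟨s1, s2⟩ := odeFlow_spec hp'
      have := (comp1 _ s2 1 i1).2.2
      rw [s1] at this
      exact this
    have dΨ := ((hΨc p hp).differentiableAt (by simp)).hasFDerivAt
    have d1 := dΨ.inner ℝ dΨ
    have d2 : HasFDerivAt (fun p : X × W => (inner ℝ p.1 p.1 : ℝ)) _ p :=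
      (ContinuousLinearMap.fst ℝ X W).hasFDerivAt.inner ℝ (ContinuousLinearMap.fst ℝ X W).hasFDerivAt
    have d3 := d1.unique (d2.congr_of_eventuallyEq ev)
    have d4 := congrArg (fun L : X × W →L[ℝ] ℝ => L (y, 0)) d3
    simp [fderivInnerCLM_apply] at d4
    rw [real_inner_comm _ (Ψ p), real_inner_comm y p.1] at d4
    linarith
  · -- volume
    obtain ⟨s1, s2⟩ := odeFlow_spec hp
    set Γ := odeFlow vf Ω (0, p) with hΓ
    set Bf : ℝ → (X → ℝ × (X × W)) := fun t y => fderiv ℝ (fun z => odeFlow vf Ω z t) (0, p) (0, (y, 0)) with hBf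
    set B : ℝ → (X →L[ℝ] X) := fun t => ((ContinuousLinearMap.fst ℝ X W).comp ((ContinuousLinearMap.snd ℝ ℝ (X × W)).comp
      (fderiv ℝ (fun z => odeFlow vf Ω z t) (0, p)))).comp
        ((ContinuousLinearMap.inr ℝ ℝ (X × W)).comp (ContinuousLinearMap.inl ℝ X W)) with hB
    have hBe : ∀ t y, B t y = (Bf t y).2.1 := fun t y => rfl
    have dflow : ∀ t ∈ Icc (0:ℝ) 1, HasFDerivAt (fun z => odeFlow vf Ω z t) (fderiv ℝ (fun z => odeFlow vf Ω z t) (0, p)) (0, p) :=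
      fun t ht => ((odeFlow_contDiffAt hΩ hvfc hp ht).differentiableAt (by simp)).hasFDerivAt
    have hBf1 : ∀ t ∈ Icc (0:ℝ) 1, ∀ y, Bf t y = (0, (B t y, 0)) := by
      intro t ht y
      have a1 : HasFDerivAt (fun z : ℝ × (X × W) => z.1 + t) (ContinuousLinearMap.fst ℝ ℝ (X × W)) (0, p) :=
        (ContinuousLinearMap.fst ℝ ℝ (X × W)).hasFDerivAt.add_const t
      have a2 := (ContinuousLinearMap.fst ℝ ℝ (X × W)).hasFDerivAt.comp (0, p) (dflow t ht)
      have b1 : HasFDerivAt (fun z : ℝ × (X × W) => z.2.2) ((ContinuousLinearMap.snd ℝ X W).comp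
        (ContinuousLinearMap.snd ℝ ℝ (X × W))) (0, p) :=
        ((ContinuousLinearMap.snd ℝ X W).comp (ContinuousLinearMap.snd ℝ ℝ (X × W))).hasFDerivAt
      have b2 := ((ContinuousLinearMap.snd ℝ X W).comp
        (ContinuousLinearMap.snd ℝ ℝ (X × W))).hasFDerivAt.comp (0, p) (dflow t ht)
      have ev := (isOpen_odeDom hΩ hvfc).mem_nhds hp
      have a3 := a2.unique (a1.congr_of_eventuallyEq (by
        filter_upwards [ev] with z hz
        obtain ⟨u1, u2⟩ := odeFlow_spec hz
        have := (comp1 _ u2 t ht).1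
        rw [u1] at this
        exact this))
      have b3 := b2.unique (b1.congr_of_eventuallyEq (by
        filter_upwards [ev] with z hz
        obtain ⟨u1, u2⟩ := odeFlow_spec hz
        have := (comp1 _ u2 t ht).2.1
        rw [u1] at this
        exact this))
      have a4 := congrArg (fun L : ℝ × (X × W) →L[ℝ] ℝ => L (0, (y, 0))) a3
      have b4 := congrArg (fun L : ℝ × (X × W) →L[ℝ] W => L (0, (y, 0))) b3
      exact Prod.ext a4 (Prod.ext rfl b4)
    have hvd : ∀ t ∈ Icc (0:ℝ) 1, HasFDerivAt vx (fderiv ℝ vx (Γ t)) (Γ t) := fun t ht =>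
      ((hvxc.contDiffAt (hΩ.mem_nhds (s2 t ht).1)).differentiableAt (by simp)).hasFDerivAt
    have hvfd : ∀ t ∈ Icc (0:ℝ) 1, ∀ u, fderiv ℝ vf (Γ t) u = (0, (fderiv ℝ vx (Γ t) u, 0)) := by
      intro t ht u
      have : HasFDerivAt vf _ (Γ t) := (hasFDerivAt_const (1:ℝ) (Γ t)).prodMk ((hvd t ht).prodMk (hasFDerivAt_const (0:W) (Γ t)))
      rw [this.fderiv]
      rfl
    set A : ℝ → (X →L[ℝ] X) := fun t => ((fderiv ℝ vx (Γ t)).comp (ContinuousLinearMap.inr ℝ ℝ (X × W))).comp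
      (ContinuousLinearMap.inl ℝ X W) with hA
    have hBd : ∀ t ∈ Icc (0:ℝ) 1, ∀ y, HasDerivWithinAt (fun t => B t y) (A t (B t y)) (Icc 0 1) t := by
      intro t ht y
      have h1 := odeFlow_fderiv hΩ hvfc hp (0, (y, 0)) ht
      have h2 := ((ContinuousLinearMap.fst ℝ X W).comp (ContinuousLinearMap.snd ℝ ℝ (X × W))).hasFDerivAt.comp_hasDerivWithinAt t h1
      refine HasDerivWithinAt.congr_deriv (f := fun t => B t y) h2 ?_
      have h3 := hBf1 t ht y
      simp only [hBf] at h3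
      rw [← hΓ, h3, hvfd t ht]
      rfl
    have hdet : ∀ t ∈ Icc (0:ℝ) 1, HasDerivWithinAt (fun t => G (Γ t) * LinearMap.det (B t).toLinearMap) 0 (Icc 0 1) t := by
      intro t ht
      have dG := (hGc.differentiable (by simp) (Γ t)).hasFDerivAt
      have h1 := dG.comp_hasDerivWithinAt t (s2 t ht).2
      have h2 := clm_det_deriv (hBd t ht)
      refine (h1.mul h2).congr_deriv ?_
      have hGp : 0 < G (Γ t) := (s2 t ht).1
      -- trace identity
      have t1 : HasFDerivAt (fun z : ℝ × (X × W) => V z.2) (G (Γ t) • fderiv ℝ vx (Γ t) + (fderiv ℝ G (Γ t)).smulRight (vx (Γ t))) (Γ t) := by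
        refine (dG.smul (hvd t ht)).congr_of_eventuallyEq ?_
        filter_upwards [hΩ.mem_nhds (s2 t ht).1] with z hz
        have : G z ≠ 0 := (show 0 < G z from hz).ne'
        simp only [hvx, Pi.smul_apply', smul_smul, mul_inv_cancel₀ this, one_smul]
      have t2 : HasFDerivAt (fun z : ℝ × (X × W) => V z.2) ((fderiv ℝ V (Γ t).2).comp (ContinuousLinearMap.snd ℝ ℝ (X × W))) (Γ t) :=
        (hV.differentiable (by simp) (Γ t).2).hasFDerivAt.comp (Γ t) (ContinuousLinearMap.snd ℝ ℝ (X × W)).hasFDerivAt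
      have t3 := t1.unique t2
      have t4 : fderiv ℝ V (Γ t).2 = G (Γ t) • (fderiv ℝ vx (Γ t)).comp (ContinuousLinearMap.inr ℝ ℝ (X × W)) +
          ((fderiv ℝ G (Γ t)).comp (ContinuousLinearMap.inr ℝ ℝ (X × W))).smulRight (vx (Γ t)) := by
        refine ContinuousLinearMap.ext fun u => ?_
        have := congrArg (fun L : ℝ × (X × W) →L[ℝ] X => L (0, u)) t3
        simpa using this.symm
      have t5 := hVt (Γ t).2
      rw [t4, map_add, map_smul, TrX_rank] at t5
      have t6 : TrX ((fderiv ℝ vx (Γ t)).comp (ContinuousLinearMap.inr ℝ ℝ (X × W))) = LinearMap.trace ℝ X (A t).toLinearMap := rfl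
      rw [t6] at t5
      -- time derivative of G
      have g1 : fderiv ℝ G (Γ t) (1, 0) = gb (Γ t).2 - g (Γ t).2 := by
        have a1 : HasDerivAt (fun s : ℝ => G (s, (Γ t).2)) (gb (Γ t).2 - g (Γ t).2) (Γ t).1 := by
          have := ((hasDerivAt_id (Γ t).1).mul_const (gb (Γ t).2 - g (Γ t).2)).const_add (g (Γ t).2)
          refine HasDerivAt.congr_deriv (f := fun s : ℝ => G (s, (Γ t).2)) this ?_
          simp
        have a2 : HasDerivAt (fun s : ℝ => G (s, (Γ t).2)) (fderiv ℝ G (Γ t) (1, 0)) (Γ t).1 :=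
          HasFDerivAt.comp_hasDerivAt (Γ t).1 (l := G) (f := fun s => (s, (Γ t).2)) dG ((hasDerivAt_id _).prodMk (hasDerivAt_const _ _))
        exact a2.unique a1
      have g2 : fderiv ℝ G (Γ t) (vf (Γ t)) = (gb (Γ t).2 - g (Γ t).2) + fderiv ℝ G (Γ t) (0, (vx (Γ t), 0)) := by
        rw [← g1, ← map_add]
        simp [hvf]
      rw [g2]
      simp only [ContinuousLinearMap.comp_apply, ContinuousLinearMap.inr_apply, smul_eq_mul] at t5
      have : fderiv ℝ G (Γ t) (0, (vx (Γ t), 0)) = g (Γ t).2 - gb (Γ t).2 - G (Γ t) * LinearMap.trace ℝ X (A t).toLinearMap := by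
        linarith
      rw [this]
      simp only [Function.comp_apply]
      ring
    have hcst := const_of_deriv_zero (convex_Icc 0 1) hdet i1 i0
    have hc0 := comp1 _ s2 1 i1
    rw [s1] at hc0
    have hΓ1 : Γ 1 = (1, (Ψ p, p.2)) := by
      refine Prod.ext ?_ (Prod.ext rfl hc0.2.1)
      simpa using hc0.1
    have hB0 : (B 0) = ContinuousLinearMap.id ℝ X := by
      have : fderiv ℝ (fun z => odeFlow vf Ω z 0) (0, p) = ContinuousLinearMap.id ℝ _ := by
        have ev : (fun z => odeFlow vf Ω z 0) =ᶠ[𝓝 (0, p)] fun z => z := by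
          filter_upwards [(isOpen_odeDom hΩ hvfc).mem_nhds hp] with z hz
          exact (odeFlow_spec hz).1
        rw [ev.fderiv_eq, fderiv_fun_id]
      ext y
      simp [hB, this]
    have hB1 : (B 1) = (fderiv ℝ Ψ p).comp (ContinuousLinearMap.inl ℝ X W) := by
      have : HasFDerivAt Ψ (((ContinuousLinearMap.fst ℝ X W).comp ((ContinuousLinearMap.snd ℝ ℝ (X × W)).comp
          (fderiv ℝ (fun z => odeFlow vf Ω z 1) (0, p)))).comp (ContinuousLinearMap.inr ℝ ℝ (X × W))) p := by
        have h1 := ((ContinuousLinearMap.fst ℝ X W).comp (ContinuousLinearMap.snd ℝ ℝ (X × W))).hasFDerivAt.comp (0, p) (dflow 1 i1)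
        have h2 : HasFDerivAt (fun p : X × W => ((0:ℝ), p)) (ContinuousLinearMap.inr ℝ ℝ (X × W)) p :=
          (ContinuousLinearMap.inr ℝ ℝ (X × W)).hasFDerivAt
        exact HasFDerivAt.comp p (f := fun p : X × W => ((0:ℝ), p)) h1 h2
      rw [this.fderiv]
      rfl
    rw [hΓ1, s1, hB0, hB1] at hcst
    simp only [hG] at hcst
    simp at hcst
    simpa using hcst

end Moser

end NambuLin
end FileM6c

section FileM6d
open scoped ContDiff
open MeasureTheory Set Filter Topology

namespace NambuLin

section Moser2

set_option linter.unusedSectionVars false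

variable {X W : Type} [NormedAddCommGroup X] [InnerProductSpace ℝ X] [FiniteDimensional ℝ X]
  [NormedAddCommGroup W] [NormedSpace ℝ W] [FiniteDimensional ℝ W]

theorem skew_pair (x y : X) : star ((innerSL ℝ x).smulRight y - (innerSL ℝ y).smulRight x : X →L[ℝ] X)
    = -((innerSL ℝ x).smulRight y - (innerSL ℝ y).smulRight x : X →L[ℝ] X) := by
  rw [ContinuousLinearMap.star_eq_adjoint]
  symm
  rw [ContinuousLinearMap.eq_adjoint_iff]
  intro a b
  simp [inner_sub_left, inner_sub_right, inner_smul_left, inner_smul_right]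
  rw [real_inner_comm x a, real_inner_comm y a]
  ring

theorem moser (hd : 3 ≤ Module.finrank ℝ X) {f : X × W → ℝ} {N0 : Set (X × W)} (hN0 : IsOpen N0)
    (h0 : (0 : X × W) ∈ N0) (hf : ContDiffOn ℝ ∞ f N0) (hf0 : f 0 = 1) :
    ∃ (Xt : X × W → X) (N : Set (X × W)), IsOpen N ∧ (0 : X × W) ∈ N ∧ N ⊆ N0 ∧ ContDiffOn ℝ ∞ Xt N ∧
      Xt 0 = 0 ∧ ∀ p ∈ N,
        LinearMap.det ((fderiv ℝ Xt p).comp (ContinuousLinearMap.inl ℝ X W)).toLinearMap ≠ 0 ∧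
        ∀ y, inner ℝ (fderiv ℝ Xt p (y, 0)) (Xt p) =
          f p * LinearMap.det ((fderiv ℝ Xt p).comp (ContinuousLinearMap.inl ℝ X W)).toLinearMap * inner ℝ y p.1 := by
  -- global log
  set N1 : Set (X × W) := N0 ∩ f ⁻¹' (Ioi 0) with hN1
  have oN1 : IsOpen N1 := hf.continuousOn.isOpen_inter_preimage hN0 isOpen_Ioi
  have h1 : (0 : X × W) ∈ N1 := ⟨h0, by simp [hf0]⟩
  have hl : ContDiffOn ℝ ∞ (fun p => Real.log (f p)) N1 :=
    (hf.mono inter_subset_left).log fun p hp => ne_of_gt hp.2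
  obtain ⟨c, hc1, hc2⟩ := globalize oN1 hl h1
  set g : X × W → ℝ := fun p => Real.exp (-(c p • Real.log (f p))) with hg
  have hgC : ContDiff ℝ ∞ g := Real.contDiff_exp.comp hc1.neg
  have hgp : ∀ p, 0 < g p := fun p => Real.exp_pos _
  have hgf : ∀ᶠ p in 𝓝 (0 : X × W), f p * g p = 1 := by
    filter_upwards [hc2, oN1.mem_nhds h1] with p a b
    have : (0:ℝ) < f p := b.2
    simp only [hg, a, one_smul, Real.exp_neg, Real.exp_log this]
    exact mul_inv_cancel₀ this.ne'
  obtain ⟨gb, hbC, hbp, hbS, hbsk, hb0⟩ := average g hgC hgp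
  obtain ⟨Ψ, N, oN, hN0w, hΨC, hΨ0, hΨ⟩ := moser_flow hgC hbC hgp hbp hbS
  obtain ⟨m, hm⟩ : ∃ m : ℕ, Module.finrank ℝ X = m + 3 := ⟨_, (Nat.sub_add_cancel hd).symm⟩
  set ρ : ℝ → ℝ := fun t => Real.exp (Real.log t / ((m:ℝ) + 1)) with hρ
  have hρd : ∀ t, 0 < t → HasDerivAt ρ (deriv ρ t) t := fun t ht => by
    refine DifferentiableAt.hasDerivAt ?_
    exact ((Real.differentiableAt_log ht.ne').div_const _).exp
  set κ : X × W → ℝ := fun p => ρ (gb p) with hκ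
  have hκp : ∀ p, 0 < κ p := fun p => Real.exp_pos _
  have hκm : ∀ p, κ p ^ (m+1) = gb p := fun p => by
    simp only [hκ, hρ]
    rw [← Real.exp_nat_mul]
    push_cast
    rw [mul_div_cancel₀ _ (by positivity : (m:ℝ)+1 ≠ 0), Real.exp_log (hbp p)]
  have hκC : ContDiff ℝ ∞ κ := by
    refine Real.contDiff_exp.comp (ContDiff.div_const ?_ _)
    exact hbC.log fun p => (hbp p).ne'
  have hκd : ∀ p, fderiv ℝ κ p = deriv ρ (gb p) • fderiv ℝ gb p := fun p =>
    ((hρd _ (hbp p)).comp_hasFDerivAt p (hbC.differentiable (by simp) p).hasFDerivAt).fderiv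
  have hκr : ∀ p : X × W, ∀ y : X, inner ℝ p.1 p.1 * fderiv ℝ κ p (y, 0) = inner ℝ y p.1 * fderiv ℝ κ p (p.1, 0) := by
    intro p y
    have := hbsk p _ (skew_pair p.1 y)
    have e : (((innerSL ℝ p.1).smulRight y - (innerSL ℝ y).smulRight p.1 : X →L[ℝ] X) p.1, (0:W))
      = (inner ℝ p.1 p.1 : ℝ) • (y, (0:W)) - (inner ℝ y p.1 : ℝ) • (p.1, (0:W)) := by simp
    rw [e, map_sub, map_smul, map_smul, sub_eq_zero] at this
    rw [hκd]
    simp only [ContinuousLinearMap.smul_apply, smul_eq_mul] at this ⊢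
    linear_combination (deriv ρ (gb p)) * this
  set τ : X × W → X × W := fun p => (Ψ p, p.2) with hτ
  have hτC : ContDiffOn ℝ ∞ τ N := hΨC.prodMk contDiffOn_snd
  set Xt : X × W → X := fun p => κ (τ p) • Ψ p with hXt
  set r : X × W → ℝ := fun p => κ (τ p) + fderiv ℝ κ (τ p) (Ψ p, 0) with hr
  have hrC : ContinuousOn r N := by
    refine ContinuousOn.add (hκC.continuous.comp_continuousOn hτC.continuousOn) ?_
    refine ContinuousOn.clm_apply (((hκC.continuous_fderiv (by simp))).comp_continuousOn hτC.continuousOn) ?_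
    exact hΨC.continuousOn.prodMk continuousOn_const
  have r0 : r 0 ≠ 0 := by
    have : Ψ (0 : X × W) = 0 := hΨ0 0
    simp only [hr, this]
    have e : ((0:X), (0:W)) = 0 := rfl
    rw [e, map_zero, add_zero]
    exact (hκp _).ne'
  obtain ⟨M, hM, oM, zM⟩ := eventually_nhds_iff.1 hgf
  set N' : Set (X × W) := (N ∩ r ⁻¹' {0}ᶜ) ∩ (M ∩ N0) with hN'
  have oN' : IsOpen N' := (hrC.isOpen_inter_preimage oN isOpen_compl_singleton).inter (oM.inter hN0)
  refine ⟨Xt, N', oN', ⟨⟨hN0w 0, r0⟩, zM, h0⟩, fun p hp => hp.2.2, ?_, ?_, ?_⟩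
  · exact ContDiffOn.mono ((hκC.comp_contDiffOn hτC).smul hΨC) fun p hp => hp.1.1
  · have : Ψ (0 : X × W) = 0 := hΨ0 0
    simp [hXt, this]
  · intro p hp
    have pN := hp.1.1
    obtain ⟨i1, i2⟩ := hΨ p pN
    set B := (fderiv ℝ Ψ p).comp (ContinuousLinearMap.inl ℝ X W) with hB
    set u := Ψ p with hu
    set k0 := κ (τ p) with hk0
    set ℓ : X →ₗ[ℝ] ℝ := ((fderiv ℝ κ (τ p)).comp (ContinuousLinearMap.inl ℝ X W)).toLinearMap with hℓ
    have dΨ : HasFDerivAt Ψ (fderiv ℝ Ψ p) p := ((hΨC.contDiffAt (oN.mem_nhds pN)).differentiableAt (by simp)).hasFDerivAt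
    have dτ : HasFDerivAt τ ((fderiv ℝ Ψ p).prod (ContinuousLinearMap.snd ℝ X W)) p := dΨ.prodMk hasFDerivAt_snd
    have dκ : HasFDerivAt κ (fderiv ℝ κ (τ p)) (τ p) := (hκC.differentiable (by simp) _).hasFDerivAt
    have dX := ((dκ.comp p dτ).smul dΨ).fderiv
    have dX2 : ∀ y, fderiv ℝ Xt p (y, 0) = k0 • B y + ℓ (B y) • u := by
      intro y
      have := congrArg (fun L : X × W →L[ℝ] X => L (y, 0)) dX
      refine Eq.trans this ?_
      simp [hB, hℓ, hk0, hu]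
    have dX3 : ((fderiv ℝ Xt p).comp (ContinuousLinearMap.inl ℝ X W)).toLinearMap =
        (k0 • LinearMap.id + ℓ.smulRight u) ∘ₗ B.toLinearMap := by
      refine LinearMap.ext fun y => ?_
      refine Eq.trans (dX2 y) ?_
      simp
    have detE : LinearMap.det ((fderiv ℝ Xt p).comp (ContinuousLinearMap.inl ℝ X W)).toLinearMap =
        k0 ^ (m + 2) * (k0 + ℓ u) * LinearMap.det B.toLinearMap := by
      rw [dX3, LinearMap.det_comp, rank_one_det (hκp _).ne' _ _ (by omega), hm]
      simp
      exact Or.inl rfl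
    have hru : k0 + ℓ u ≠ 0 := hp.1.2
    have hfg : f p * g p = 1 := hM p hp.2.1
    have hk0p : 0 < k0 := hκp _
    have hdB : gb (τ p) * LinearMap.det B.toLinearMap = g p := i2
    have hkm : k0 ^ (m+1) = gb (τ p) := hκm _
    rw [detE]
    constructor
    · refine mul_ne_zero (mul_ne_zero (pow_ne_zero _ hk0p.ne') hru) ?_
      intro h
      rw [h, mul_zero] at hdB
      exact (hgp p).ne hdB
    · intro y
      rw [dX2]
      have i3 := i1 y
      have i4 : (inner ℝ u u : ℝ) * ℓ (B y) = inner ℝ (B y) u * ℓ u := hκr (τ p) (B y)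
      have i5 : (inner ℝ (B y) u : ℝ) = inner ℝ y p.1 := i3
      simp only [hXt]
      change inner ℝ (k0 • B y + ℓ (B y) • u) (k0 • u) = _
      rw [inner_smul_right, inner_add_left, inner_smul_left, inner_smul_left]
      simp only [conj_trivial]
      have i6 : f p * (k0 ^ (m+1) * LinearMap.det B.toLinearMap) = 1 := by rw [hkm, hdB, hfg]
      rw [i5] at i4 ⊢
      have : k0 ^ (m+2) = k0 ^ (m+1) * k0 := pow_succ _ _
      rw [this]
      linear_combination k0 * i4 - (k0 * (k0 + ℓ u) * inner ℝ y p.1) * i6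

end Moser2

end NambuLin
end FileM6d

section FileM5a
open scoped ContDiff
open MeasureTheory Set Filter Topology

namespace NambuLin

section Ift

set_option linter.unusedSectionVars false

/-- Smooth inverse function theorem with a uniform neighbourhood. -/
theorem ift {E F : Type} [NormedAddCommGroup E] [NormedSpace ℝ E] [CompleteSpace E]
    [NormedAddCommGroup F] [NormedSpace ℝ F] [CompleteSpace F] {f : E → F} {O : Set E}
    (hO : IsOpen O) (hf : ContDiffOn ℝ ∞ f O) {x : E} (hx : x ∈ O) {f' : E ≃L[ℝ] F}
    (hf' : HasFDerivAt f (f' : E →L[ℝ] F) x) :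
    ∃ e : OpenPartialHomeomorph E F, x ∈ e.source ∧ e.source ⊆ O ∧ (e : E → F) = f ∧
      ContDiffOn ℝ ∞ e.symm e.target := by
  have hc : ContDiffAt ℝ ∞ f x := hf.contDiffAt (hO.mem_nhds hx)
  set e0 := hc.toOpenPartialHomeomorph f hf' (by simp) with he0
  have hd : ContinuousOn (fderiv ℝ f) O := (hf.fderiv_of_isOpen hO (m := ∞) (by simp)).continuousOn
  set O' : Set E := O ∩ (fderiv ℝ f) ⁻¹' (range ((↑) : (E ≃L[ℝ] F) → E →L[ℝ] F)) with hO'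
  have oO' : IsOpen O' := hd.isOpen_inter_preimage hO ContinuousLinearEquiv.isOpen
  have hxO' : x ∈ O' := ⟨hx, f', hf'.fderiv.symm⟩
  refine ⟨e0.restrOpen O' oO', ⟨hc.mem_toOpenPartialHomeomorph_source hf' _, hxO'⟩, fun y hy => hy.2.1, rfl, ?_⟩
  intro y hy
  set e1 := e0.restrOpen O' oO' with he1
  have hs : e1.symm y ∈ e1.source := e1.map_target hy
  obtain ⟨g', hg'⟩ := hs.2.2
  have hat : ContDiffAt ℝ ∞ f (e1.symm y) := hf.contDiffAt (hO.mem_nhds hs.2.1)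
  refine (e1.contDiffAt_symm hy (f₀' := g') ?_ hat).contDiffWithinAt
  rw [hg']
  exact (hat.differentiableAt (by simp)).hasFDerivAt

theorem taylor2 {φ φ1 φ2 : ℝ → ℝ} (h1 : ∀ t, HasDerivAt φ (φ1 t) t) (h2 : ∀ t, HasDerivAt φ1 (φ2 t) t)
    (hc : Continuous φ2) : φ 1 = φ 0 + φ1 0 + ∫ t in (0:ℝ)..1, (1 - t) * φ2 t := by
  have h3 : ∀ t, HasDerivAt (fun t => φ t + (1 - t) * φ1 t) ((1 - t) * φ2 t) t := by
    intro t
    refine ((h1 t).add (((hasDerivAt_id t).const_sub 1).mul (h2 t))).congr_deriv ?_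
    simp
  rw [intervalIntegral.integral_eq_sub_of_hasDerivAt (fun t _ => h3 t)
    (by apply Continuous.intervalIntegrable; fun_prop)]
  ring

theorem op_sqrt {A : Type} [NormedRing A] [NormedAlgebra ℝ A] [CompleteSpace A] [StarRing A] [ContinuousStar A] :
    ∃ (R : A → A) (N : Set A), IsOpen N ∧ 1 ∈ N ∧
    ContDiffOn ℝ ∞ R N ∧ R 1 = 1 ∧ (∀ H ∈ N, R H * R H = H) ∧
    ∀ H ∈ N, star H = H → star (R H) = R H := by
  have hsq : ContDiff ℝ ∞ (fun S : A => S * S) := contDiff_id.mul contDiff_id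
  have hd : HasFDerivAt (fun S : A => S * S)
      ((ContinuousLinearEquiv.smulLeft (Units.mk0 (2:ℝ) two_ne_zero) : A ≃L[ℝ] A) : A →L[ℝ] A) 1 := by
    refine HasFDerivAt.congr_fderiv ((hasFDerivAt_id (1 : A)).mul' (hasFDerivAt_id _)) ?_
    refine ContinuousLinearMap.ext fun S => ?_
    simp [two_smul, Units.smul_def]
  obtain ⟨e, h1, h2, h3, h4⟩ := ift isOpen_univ hsq.contDiffOn (mem_univ 1) hd
  have e1 : e 1 = 1 := by rw [h3]; simp
  have s1 : e.symm 1 = 1 := by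
    conv_lhs => rw [← e1]
    exact e.left_inv h1
  have sqe : ∀ H ∈ e.target, e.symm H * e.symm H = H := fun H hH => by
    have := e.right_inv hH
    rw [h3] at this
    exact this
  refine ⟨e.symm, e.target ∩ (fun H => star (e.symm H)) ⁻¹' e.source, ?_, ⟨?_, ?_⟩, h4.mono inter_subset_left,
    s1, fun H hH => sqe H hH.1, ?_⟩
  · refine ContinuousOn.isOpen_inter_preimage ?_ e.open_target e.open_source
    exact continuous_star.comp_continuousOn h4.continuousOn
  · rw [← e1]; exact e.map_source h1
  · simp only [mem_preimage, s1, star_one]; exact h1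
  · rintro H ⟨hH, hH'⟩ hs
    refine e.injOn hH' (e.map_target hH) ?_
    rw [e.right_inv hH, h3]
    simp only
    rw [← star_mul, sqe H hH, hs]

end Ift

end NambuLin
end FileM5a

section FileM5b
open scoped ContDiff
open MeasureTheory Set Filter Topology

namespace NambuLin

section Morse

set_option linter.unusedSectionVars false
set_option maxSynthPendingDepth 3

variable {X W : Type} [NormedAddCommGroup X] [InnerProductSpace ℝ X] [FiniteDimensional ℝ X]
  [NormedAddCommGroup W] [NormedSpace ℝ W] [FiniteDimensional ℝ W]

theorem exists_sharp : ∃ sh : (X →L[ℝ] ℝ) →L[ℝ] X, ∀ ℓ x, inner ℝ (sh ℓ) x = ℓ x := by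
  set b := stdOrthonormalBasis ℝ X
  refine ⟨∑ i, (ContinuousLinearMap.apply ℝ ℝ (b i)).smulRight (b i), fun ℓ x => ?_⟩
  conv_rhs => rw [← b.sum_repr' x, map_sum]
  simp [ContinuousLinearMap.sum_apply, sum_inner, inner_smul_left, mul_comm]

theorem exists_sharp2 : ∃ M : (X × W →L[ℝ] ℝ) →L[ℝ] X, ∀ ℓ x, inner ℝ (M ℓ) x = ℓ (x, 0) := by
  obtain ⟨sh, h⟩ := exists_sharp (X := X)
  refine ⟨sh.comp ((ContinuousLinearMap.compL ℝ X (X × W) ℝ).flip (ContinuousLinearMap.inl ℝ X W)), fun ℓ x => ?_⟩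
  simp [h]

theorem morse_crit {q : X × W → ℝ} (hq : ContDiff ℝ ∞ q) (h1 : ∀ x, fderiv ℝ q 0 (x, 0) = 0)
    (h2 : ∀ u x, fderiv ℝ (fderiv ℝ q) 0 u (x, 0) = inner ℝ u.1 x) :
    ∃ σ : W → X, ContDiff ℝ ∞ σ ∧ σ 0 = 0 ∧ fderiv ℝ σ 0 = 0 ∧
      ∀ᶠ w in 𝓝 (0:W), ∀ x, fderiv ℝ q (σ w, w) (x, 0) = 0 := by
  obtain ⟨M, hM⟩ := exists_sharp2 (X := X) (W := W)
  have hq' : ContDiff ℝ ∞ (fderiv ℝ q) := hq.fderiv_right (m := ∞) (by simp)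
  set T : X × W → X × W := fun p => (M (fderiv ℝ q p), p.2) with hT
  have hTC : ContDiff ℝ ∞ T := ((ContinuousLinearMap.contDiff M).comp hq').prodMk contDiff_snd
  have hTd : HasFDerivAt T ((ContinuousLinearEquiv.refl ℝ (X × W) : (X × W) ≃L[ℝ] (X × W)) : X × W →L[ℝ] X × W) 0 := by
    have a := (M.hasFDerivAt.comp (0 : X × W) (hq'.differentiable (by simp) 0).hasFDerivAt).prodMk
      (hasFDerivAt_snd (𝕜 := ℝ) (p := (0 : X × W)))
    refine a.congr_fderiv ?_
    refine ContinuousLinearMap.ext fun u => Prod.ext ?_ rfl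
    refine ext_inner_right ℝ fun x => ?_
    refine (hM _ _).trans ?_
    exact h2 u x
  obtain ⟨e, m1, m2, m3, m4⟩ := ift isOpen_univ hTC.contDiffOn (mem_univ 0) hTd
  have T0 : T 0 = 0 := by
    refine Prod.ext ?_ rfl
    refine ext_inner_right ℝ fun x => ?_
    refine (hM _ _).trans ?_
    rw [h1]; simp
  have e0 : e 0 = 0 := by rw [m3, T0]
  have t0 : (0 : X × W) ∈ e.target := by
    have := e.map_source m1
    rwa [e0] at this
  have s0 : e.symm 0 = 0 := by
    have := e.left_inv m1
    rwa [e0] at this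
  set D : Set W := {w | ((0:X), w) ∈ e.target} with hD
  have oD : IsOpen D := e.open_target.preimage (by fun_prop)
  set σ0 : W → X := fun w => (e.symm ((0:X), w)).1 with hσ0
  have hσ0C : ContDiffOn ℝ ∞ σ0 D := by
    refine contDiff_fst.comp_contDiffOn ?_
    refine m4.comp (f := fun w : W => ((0:X), w)) (by fun_prop) fun w hw => hw
  obtain ⟨c, hc1, hc2⟩ := globalize oD hσ0C (x := 0) t0
  have heq : (fun w => c w • σ0 w) =ᶠ[𝓝 0] σ0 := by
    filter_upwards [hc2] with w hw
    rw [hw, one_smul]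
  have z00 : σ0 0 = 0 := by
    have : e.symm ((0:X), (0:W)) = 0 := s0
    simp only [hσ0, this]
    rfl
  refine ⟨_, hc1, ?_, ?_, ?_⟩
  · simp only [z00, smul_zero]
  · rw [heq.fderiv_eq]
    have a : HasFDerivAt e.symm ((ContinuousLinearEquiv.refl ℝ (X × W)).symm : X × W →L[ℝ] X × W) ((0:X), (0:W)) := by
      refine e.hasFDerivAt_symm t0 ?_
      have : e.symm ((0:X), (0:W)) = 0 := s0
      rw [this, m3]
      exact hTd
    have b := (hasFDerivAt_fst.comp _ a).comp (0:W) (hasFDerivAt_prodMk_right (𝕜 := ℝ) (0:X) (0:W))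
    refine Eq.trans b.fderiv ?_
    refine ContinuousLinearMap.ext fun w => ?_
    simp
  · filter_upwards [heq, oD.mem_nhds t0] with w hw hwD x
    rw [hw]
    have r := e.right_inv hwD
    rw [m3] at r
    have r2 : (e.symm ((0:X), w)).2 = w := congrArg Prod.snd r
    have r1 : M (fderiv ℝ q (e.symm ((0:X), w))) = 0 := congrArg Prod.fst r
    have r3 : e.symm ((0:X), w) = (σ0 w, w) := Prod.ext rfl r2
    rw [← r3, ← hM, r1, inner_zero_left]

theorem morse_global {q : X × W → ℝ} (hq : ContDiff ℝ ∞ q) (h1 : ∀ x, fderiv ℝ q 0 (x, 0) = 0)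
    (h2 : ∀ u x, fderiv ℝ (fderiv ℝ q) 0 u (x, 0) = inner ℝ u.1 x) :
    ∃ (ξ : X × W → X) (c : W → ℝ) (N : Set (X × W)), IsOpen N ∧ (0 : X × W) ∈ N ∧ ContDiffOn ℝ ∞ ξ N ∧
      ξ 0 = 0 ∧ HasFDerivAt ξ (ContinuousLinearMap.fst ℝ X W) 0 ∧
      ∀ p ∈ N, q p = (1/2 : ℝ) * inner ℝ (ξ p) (ξ p) + c p.2 := by
  obtain ⟨σ, hσ, σ0, dσ, hcrit⟩ := morse_crit hq h1 h2
  obtain ⟨M, hM⟩ := exists_sharp2 (X := X) (W := W)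
  have hq' : ContDiff ℝ ∞ (fderiv ℝ q) := hq.fderiv_right (m := ∞) (by simp)
  have hq'' : ContDiff ℝ ∞ (fderiv ℝ (fderiv ℝ q)) := hq'.fderiv_right (m := ∞) (by simp)
  set K : X × W → (X →L[ℝ] X) := fun p => M.comp ((fderiv ℝ (fderiv ℝ q) p).comp (ContinuousLinearMap.inl ℝ X W)) with hK
  have hKC : ContDiff ℝ ∞ K := contDiff_const.clm_comp (hq''.clm_comp contDiff_const)
  have hKi : ∀ p y x, inner ℝ (K p y) x = fderiv ℝ (fderiv ℝ q) p (y, 0) (x, 0) := fun p y x => hM _ _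
  have hKs : ∀ p y x, (inner ℝ (K p y) x : ℝ) = inner ℝ (K p x) y := by
    intro p y x
    rw [hKi, hKi]
    exact (hq.contDiffAt (x := p)).isSymmSndFDerivAt (by simp only [minSmoothness_of_isRCLikeNormedField]; exact WithTop.coe_le_coe.2 le_top) _ _
  set cv : ℝ × (X × W) → X × W := fun z => (σ z.2.2 + z.1 • (z.2.1 - σ z.2.2), z.2.2) with hcv
  have hcvC : ContDiff ℝ ∞ cv := by
    have a : ContDiff ℝ ∞ (fun z : ℝ × (X × W) => σ z.2.2) := hσ.comp (contDiff_snd.comp contDiff_snd)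
    refine (a.add (contDiff_fst.smul ((contDiff_fst.comp contDiff_snd).sub a))).prodMk (contDiff_snd.comp contDiff_snd)
  set F : ℝ × (X × W) → (X →L[ℝ] X) := fun z => (2 * (1 - z.1)) • K (cv z) with hF
  have hFC : ContDiff ℝ ∞ F := (contDiff_const.mul (contDiff_const.sub contDiff_fst)).smul (hKC.comp hcvC)
  set H : X × W → (X →L[ℝ] X) := fun p => ∫ t in (0:ℝ)..1, F (t, p) with hH
  have hHC : ContDiff ℝ ∞ H := by
    borelize ℝ
    have := parInt_contDiff (T := ℝ) (volume.restrict (Ioc (0:ℝ) 1))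
      (fun t => max 0 (min t 1)) (by fun_prop) 1 (by
      intro t; rw [Real.norm_eq_abs, abs_le]; constructor
      · linarith [le_max_left 0 (min t 1)]
      · exact max_le zero_le_one (min_le_right _ _)) F hFC
    convert this using 1
    funext p
    simp only [hH]
    rw [intervalIntegral.integral_of_le zero_le_one]
    refine setIntegral_congr_fun measurableSet_Ioc fun t ht => ?_
    rw [min_eq_left ht.2, max_eq_right ht.1.le]
  have hFi : ∀ p, Continuous fun t : ℝ => F (t, p) := fun p => hFC.continuous.comp (by fun_prop)
  have hHi : ∀ p y x, (inner ℝ (H p y) x : ℝ) = ∫ t in (0:ℝ)..1, 2 * (1 - t) * inner ℝ (K (cv (t, p)) y) x := by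
    intro p y x
    have := ContinuousLinearMap.intervalIntegral_comp_comm (μ := volume) (a := 0) (b := 1)
      ((innerSL ℝ x).comp (ContinuousLinearMap.apply ℝ X y)) ((hFi p).intervalIntegrable 0 1)
    simp only [ContinuousLinearMap.comp_apply, ContinuousLinearMap.apply_apply, innerSL_apply_apply] at this
    rw [real_inner_comm]
    refine this.symm.trans ?_
    refine intervalIntegral.integral_congr fun t _ => ?_
    simp [hF, inner_smul_right, real_inner_comm]
  have hHs : ∀ p, star (H p) = H p := by
    intro p
    rw [ContinuousLinearMap.star_eq_adjoint]
    symm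
    rw [ContinuousLinearMap.eq_adjoint_iff]
    intro y x
    rw [hHi, ← real_inner_comm y, hHi]
    simp only [hKs _ y x]
  have cv0 : ∀ t, cv (t, 0) = 0 := fun t => by simp [hcv, σ0]
  have hH0 : H 0 = 1 := by
    refine ContinuousLinearMap.ext fun y => ext_inner_right ℝ fun x => ?_
    rw [hHi]
    simp only [cv0, hKi, h2]
    rw [intervalIntegral.integral_mul_const, intervalIntegral.integral_const_mul, intervalIntegral.integral_sub (by simp) (by simp)]
    simp
    norm_num
  obtain ⟨R, NR, oNR, m1, hR, R1, Rsq, Rst⟩ := op_sqrt (A := X →L[ℝ] X)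
  obtain ⟨D, hD, oD, zD⟩ := eventually_nhds_iff.1 hcrit
  set ξ : X × W → X := fun p => R (H p) (p.1 - σ p.2) with hξ
  have hRH : ContDiffOn ℝ ∞ (fun p => R (H p)) (H ⁻¹' NR) := hR.comp hHC.contDiffOn fun p hp => hp
  have oNH : IsOpen (H ⁻¹' NR) := oNR.preimage hHC.continuous
  have z0 : (0 : X × W) ∈ H ⁻¹' NR := by simpa only [mem_preimage, hH0] using m1
  refine ⟨ξ, fun w => q (σ w, w), H ⁻¹' NR ∩ Prod.snd ⁻¹' D, oNH.inter (oD.preimage continuous_snd), ⟨z0, zD⟩, ?_, ?_, ?_, ?_⟩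
  · refine ContDiffOn.mono (hRH.clm_apply ?_) inter_subset_left
    exact (contDiff_fst.sub (hσ.comp contDiff_snd)).contDiffOn
  · simp [hξ, σ0]
  · have a : HasFDerivAt (fun p : X × W => p.1 - σ p.2) (ContinuousLinearMap.fst ℝ X W) 0 := by
      have := (hasFDerivAt_fst (𝕜 := ℝ) (p := (0 : X × W))).sub
        (((hσ.differentiable (by simp) (0 : X × W).2).hasFDerivAt).comp (0 : X × W) hasFDerivAt_snd)
      refine HasFDerivAt.congr_fderiv (f := fun p : X × W => p.1 - σ p.2) this ?_
      rw [Prod.snd_zero, dσ]; simp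
    have b := ((hRH.contDiffAt (oNH.mem_nhds z0)).differentiableAt (by simp)).hasFDerivAt
    refine (b.clm_apply a).congr_fderiv ?_
    refine ContinuousLinearMap.ext fun u => ?_
    simp [hH0, R1, σ0]
  · rintro p ⟨hp, hpD⟩
    set d := p.1 - σ p.2 with hd
    have n1 : (inner ℝ (ξ p) (ξ p) : ℝ) = inner ℝ (H p d) d := by
      have s := Rst _ hp (hHs p)
      have r := Rsq _ hp
      conv_rhs => rw [← r]
      simp only [hξ, mul_apply_eq_comp]
      nth_rewrite 3 [← s]
      rw [ContinuousLinearMap.star_eq_adjoint, ContinuousLinearMap.adjoint_inner_left]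
    have dcv : ∀ t : ℝ, HasDerivAt (fun t : ℝ => cv (t, p)) ((d, 0) : X × W) t := by
      intro t
      have := (((hasDerivAt_id t).smul_const d).const_add (σ p.2)).prodMk (hasDerivAt_const t p.2)
      refine HasDerivAt.congr_deriv (f := fun t : ℝ => cv (t, p)) this (by simp)
    have k1 : ∀ t : ℝ, HasDerivAt (fun t : ℝ => q (cv (t, p))) (fderiv ℝ q (cv (t, p)) (d, 0)) t := fun t =>
      HasFDerivAt.comp_hasDerivAt t (l := q) (f := fun t => cv (t, p)) (hq.differentiable (by simp) _).hasFDerivAt (dcv t)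
    have k2 : ∀ t : ℝ, HasDerivAt (fun t : ℝ => fderiv ℝ q (cv (t, p)) (d, 0)) (inner ℝ (K (cv (t, p)) d) d) t := fun t => by
      have := HasFDerivAt.comp_hasDerivAt t (l := fderiv ℝ q) (f := fun t => cv (t, p)) (hq'.differentiable (by simp) _).hasFDerivAt (dcv t)
      rw [hKi]
      exact ((ContinuousLinearMap.apply ℝ ℝ ((d, 0) : X × W)).hasFDerivAt).comp_hasDerivAt t this
    have tay := taylor2 k1 k2 (by
      have := hKC.continuous.comp (hcvC.continuous.comp (Continuous.prodMk_left p))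
      exact Continuous.inner (Continuous.clm_apply this continuous_const) continuous_const)
    have c1 : cv (1, p) = p := by simp [hcv]
    have c0 : cv (0, p) = (σ p.2, p.2) := by simp [hcv]
    rw [c1, c0, hD p.2 hpD d] at tay
    rw [tay, n1, hHi]
    simp only [mul_assoc]
    rw [intervalIntegral.integral_const_mul]
    ring

/-- Parametrised Morse lemma. -/
theorem morse {q : X × W → ℝ} {N0 : Set (X × W)} (hN0 : IsOpen N0) (h0 : (0 : X × W) ∈ N0)
    (hq : ContDiffOn ℝ ∞ q N0) (h1 : ∀ x, fderiv ℝ q 0 (x, 0) = 0)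
    (h2 : ∀ u x, fderiv ℝ (fderiv ℝ q) 0 u (x, 0) = inner ℝ u.1 x) :
    ∃ (ξ : X × W → X) (c : W → ℝ) (N : Set (X × W)), IsOpen N ∧ (0 : X × W) ∈ N ∧ N ⊆ N0 ∧ ContDiffOn ℝ ∞ ξ N ∧
      ξ 0 = 0 ∧ HasFDerivAt ξ (ContinuousLinearMap.fst ℝ X W) 0 ∧
      ∀ p ∈ N, q p = (1/2 : ℝ) * inner ℝ (ξ p) (ξ p) + c p.2 := by
  obtain ⟨b, hb1, hb2⟩ := globalize hN0 hq h0
  have heq : (fun p => b p • q p) =ᶠ[𝓝 0] q := by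
    filter_upwards [hb2] with w hw
    rw [hw, one_smul]
  obtain ⟨ξ, c, N, k1, k2, k3, k4, k5, k6⟩ := morse_global hb1 (by rw [heq.fderiv_eq]; exact h1)
    (by rw [heq.fderiv.fderiv_eq]; exact h2)
  obtain ⟨D, hD, oD, zD⟩ := eventually_nhds_iff.1 heq
  refine ⟨ξ, c, N ∩ (D ∩ N0), k1.inter (oD.inter hN0), ⟨k2, zD, h0⟩, fun p hp => hp.2.2, k3.mono inter_subset_left, k4, k5, fun p hp => ?_⟩
  rw [← hD p hp.2.1]
  exact k6 p hp.1

end Morse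

end NambuLin
end FileM5b

section FileM5c
open scoped ContDiff
open MeasureTheory Set Filter Topology

namespace NambuLin

section Hadamard

set_option linter.unusedSectionVars false
set_option maxSynthPendingDepth 3

variable {W : Type} [NormedAddCommGroup W] [NormedSpace ℝ W] [FiniteDimensional ℝ W]

theorem zero_of_punctured {g : ℝ → ℝ} (hg : ContinuousAt g 0) (h : ∀ᶠ t in 𝓝[≠] (0:ℝ), g t = 0) : g 0 = 0 := by
  have a : Tendsto g (𝓝[≠] 0) (𝓝 (g 0)) := hg.tendsto.mono_left nhdsWithin_le_nhds
  refine tendsto_nhds_unique a (tendsto_const_nhds.congr' ?_)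
  filter_upwards [h] with t ht
  exact ht.symm

theorem hadamard {ι : Type} [Fintype ι] [DecidableEq ι] {a b : ι} (hab : a ≠ b)
    {G : EuclideanSpace ℝ ι × W → ι → ℝ} {N0 : Set (EuclideanSpace ℝ ι × W)} (hN0 : IsOpen N0)
    (h0 : (0 : EuclideanSpace ℝ ι × W) ∈ N0) (hG : ContDiffOn ℝ ∞ G N0)
    (rel : ∀ p ∈ N0, ∀ i j, G p i * p.1 j = G p j * p.1 i)
    (hd : fderiv ℝ (fun p => G p a) 0 (EuclideanSpace.single a (1:ℝ), 0) = 1) :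
    ∃ (f : EuclideanSpace ℝ ι × W → ℝ) (N : Set (EuclideanSpace ℝ ι × W)), IsOpen N ∧
      (0 : EuclideanSpace ℝ ι × W) ∈ N ∧ N ⊆ N0 ∧ ContDiffOn ℝ ∞ f N ∧ f 0 = 1 ∧
      ∀ p ∈ N, ∀ i, G p i = f p * p.1 i := by
  set u : ι → (EuclideanSpace ℝ ι × W) := fun i => (EuclideanSpace.single i (1:ℝ), 0) with hu
  have hui : ∀ i, (u i).1 i = 1 := fun i => by simp [hu]
  have huij : ∀ i j, j ≠ i → (u i).1 j = 0 := fun i j h => by simp [hu, h]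
  have hcont : ∀ (p : (EuclideanSpace ℝ ι × W)) (v : (EuclideanSpace ℝ ι × W)), Continuous fun t : ℝ => p + t • v := fun p v => by fun_prop
  -- vanishing
  have hGc : ∀ i, ∀ p ∈ N0, ContinuousAt (fun p => G p i) p := fun i p hp =>
    (continuous_apply i).continuousAt.comp ((hG.continuousOn).continuousAt (hN0.mem_nhds hp))
  have van : ∀ p ∈ N0, p.1 a = 0 → G p a = 0 := by
    intro p hp hpa
    by_cases hpb : p.1 b = 0
    · have c : ContinuousAt (fun t : ℝ => G (p + t • u b) a) 0 := by
        refine ContinuousAt.comp (g := fun p => G p a) (f := fun t : ℝ => p + t • u b) ?_ (hcont _ _).continuousAt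
        simpa using hGc a p hp
      have ev : ∀ᶠ t in 𝓝 (0:ℝ), p + t • u b ∈ N0 := by
        have := (hcont p (u b)).continuousAt (x := 0)
        exact this.eventually (by simpa using hN0.mem_nhds hp)
      have := zero_of_punctured c (by
        filter_upwards [nhdsWithin_le_nhds ev, self_mem_nhdsWithin] with t ht ht0
        have r := rel _ ht a b
        simp only [Prod.fst_add, Prod.smul_fst, PiLp.add_apply, PiLp.smul_apply, hui, hpa, hpb, huij b a hab,
          smul_eq_mul, mul_one, mul_zero, zero_add] at r
        exact (mul_eq_zero.1 r).resolve_right ht0)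
      simpa using this
    · have r := rel p hp a b
      rw [hpa, mul_zero] at r
      exact (mul_eq_zero.1 r).resolve_right hpb
  have hGa : ContDiffOn ℝ ∞ (fun p => G p a) N0 := contDiffOn_pi.1 hG a
  obtain ⟨c, hc1, hc2⟩ := globalize hN0 hGa h0
  set g : (EuclideanSpace ℝ ι × W) → ℝ := fun p => c p • G p a with hg
  obtain ⟨F1, hF1, hF⟩ := division_global (F := fun z : ℝ × (EuclideanSpace ℝ ι × W) => g (z.2 + z.1 • u a) - g z.2)
    (by
      refine ContDiff.sub (hc1.comp ?_) (hc1.comp contDiff_snd)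
      exact contDiff_snd.add (contDiff_fst.smul contDiff_const)) (by intro w; simp)
  have hpr : ContDiff ℝ ∞ (fun p : (EuclideanSpace ℝ ι × W) => p.1 a) := by fun_prop
  have hpa : ContDiff ℝ ∞ (fun p : (EuclideanSpace ℝ ι × W) => p - p.1 a • u a) := contDiff_id.sub (hpr.smul contDiff_const)
  set f : (EuclideanSpace ℝ ι × W) → ℝ := fun p => F1 (p.1 a, p - p.1 a • u a) with hf
  have hfC : ContDiff ℝ ∞ f := hF1.comp (hpr.prodMk hpa)
  have ha : ∀ᶠ p in 𝓝 (0:(EuclideanSpace ℝ ι × W)), G p a = p.1 a * f p := by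
    have z : Tendsto (fun p : (EuclideanSpace ℝ ι × W) => p - p.1 a • u a) (𝓝 0) (𝓝 0) := by
      have := hpa.continuous.tendsto 0
      simpa using this
    filter_upwards [hc2, z.eventually hc2, z.eventually (hN0.mem_nhds h0)] with p k1 k2 k3
    have := hF (p.1 a, p - p.1 a • u a)
    simp only [sub_add_cancel, hg, k1, k2, smul_eq_mul, one_mul] at this
    rw [van _ k3 (by simp [hui]), sub_zero] at this
    exact this
  obtain ⟨N, hN, oN, zN⟩ := eventually_nhds_iff.1 (ha.and (hN0.mem_nhds h0))
  have f0 : f 0 = 1 := by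
    have e : (fun p => G p a) =ᶠ[𝓝 0] fun p : (EuclideanSpace ℝ ι × W) => p.1 a * f p := ha
    rw [e.fderiv_eq] at hd
    have := ((hpr.differentiable (by simp) 0).hasFDerivAt.mul (hfC.differentiable (by simp) 0).hasFDerivAt).fderiv
    have h3 : HasFDerivAt (fun p : (EuclideanSpace ℝ ι × W) => p.1 a) ((EuclideanSpace.proj (𝕜 := ℝ) a).comp (ContinuousLinearMap.fst ℝ (EuclideanSpace ℝ ι) W)) 0 :=
      ContinuousLinearMap.hasFDerivAt ((EuclideanSpace.proj (𝕜 := ℝ) a).comp (ContinuousLinearMap.fst ℝ (EuclideanSpace ℝ ι) W))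
    rw [h3.fderiv] at this
    have t := congrArg (fun L : (EuclideanSpace ℝ ι × W) →L[ℝ] ℝ => L (u a)) this
    simp only [] at t
    have t2 := t.symm.trans hd
    simp at t2
    rw [hui, mul_one] at t2
    exact t2
  refine ⟨f, N, oN, zN, fun p hp => (hN p hp).2, hfC.contDiffOn, f0, ?_⟩
  intro p hp i
  have gen : ∀ p ∈ N, p.1 a ≠ 0 → G p i - f p * p.1 i = 0 := by
    intro p hp hpa
    have r := rel p (hN p hp).2 a i
    rw [(hN p hp).1] at r
    have : p.1 a * (G p i - f p * p.1 i) = 0 := by linear_combination -r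
    exact (mul_eq_zero.1 this).resolve_left hpa
  by_cases hpa0 : p.1 a = 0
  · have c : ContinuousAt (fun p : (EuclideanSpace ℝ ι × W) => G p i - f p * p.1 i) p := by
      refine (hGc i p (hN p hp).2).sub ?_
      have : Continuous (fun p : (EuclideanSpace ℝ ι × W) => f p * p.1 i) := hfC.continuous.mul (by fun_prop)
      exact this.continuousAt
    have c2 : ContinuousAt (fun t : ℝ => G (p + t • u a) i - f (p + t • u a) * (p + t • u a).1 i) 0 := by
      refine ContinuousAt.comp (g := fun p : (EuclideanSpace ℝ ι × W) => G p i - f p * p.1 i) (f := fun t : ℝ => p + t • u a) ?_ (hcont _ _).continuousAt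
      simpa using c
    have ev : ∀ᶠ t in 𝓝 (0:ℝ), p + t • u a ∈ N := by
      have := (hcont p (u a)).continuousAt (x := 0)
      exact this.eventually (by simpa using oN.mem_nhds hp)
    have := zero_of_punctured c2 (by
      filter_upwards [nhdsWithin_le_nhds ev, self_mem_nhdsWithin] with t ht ht0
      refine gen _ ht ?_
      simp only [Prod.fst_add, Prod.smul_fst, PiLp.add_apply, PiLp.smul_apply, hui, hpa0]
      simpa using ht0)
    simp only [zero_smul, add_zero] at this
    exact sub_eq_zero.1 this
  · exact sub_eq_zero.1 (gen p hp hpa0)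

end Hadamard

end NambuLin
end FileM5c

section FileM7a
open scoped ContDiff
open MeasureTheory Set Filter Topology
namespace NambuLin
section M7a
set_option linter.unusedSectionVars false

/-- the alternating form on covectors attached to a multivector. -/
noncomputable def altW {n q : ℕ} (w : MultiVec n q) : (Fin n → ℝ) [⋀^Fin q]→ₗ[ℝ] ℝ :=
  ∑ I : Idx n q, w I • (Matrix.detRowAlternating (n := Fin q) (R := ℝ)).compLinearMap
    (LinearMap.funLeft ℝ ℝ (I.1.orderEmbOfFin I.2))

theorem altW_apply {n q : ℕ} (w : MultiVec n q) (γ : Fin q → Fin n → ℝ) :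
    altW w γ = ∑ I : Idx n q, w I *
      (Matrix.of fun a b => γ a (I.1.orderEmbOfFin I.2 b)).det := by
  unfold altW
  have h : ∀ (s : Finset (Idx n q)) (f : Idx n q → (Fin n → ℝ) [⋀^Fin q]→ₗ[ℝ] ℝ),
      (∑ I ∈ s, f I) γ = ∑ I ∈ s, f I γ := by
    intro s f
    induction s using Finset.cons_induction with
    | empty => simp
    | cons a s ha ih => rw [Finset.sum_cons, Finset.sum_cons, AlternatingMap.add_apply, ih]
  rw [h]
  rfl

theorem altW_rows {n q : ℕ} (A : Matrix (Fin n) (Fin n) ℝ) (w : MultiVec n q) (J : Idx n q) :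
    altW w (fun a => A (J.1.orderEmbOfFin J.2 a)) = extPow n q A w J := by
  rw [altW_apply]
  unfold extPow
  refine Finset.sum_congr rfl fun I _ => ?_
  rw [mul_comm]
  rfl

theorem altW_basis {n q : ℕ} (w : MultiVec n q) (J : Idx n q) :
    altW w (fun a => Pi.single (J.1.orderEmbOfFin J.2 a) 1) = w J := by
  rw [altW_apply, Finset.sum_eq_single J]
  · have : (Matrix.of fun a b => (Pi.single (J.1.orderEmbOfFin J.2 a) 1 : Fin n → ℝ)
        (J.1.orderEmbOfFin J.2 b)) = (1 : Matrix (Fin q) (Fin q) ℝ) := by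
      ext a b
      rw [Matrix.of_apply, Pi.single_apply, Matrix.one_apply]
      simp only [(J.1.orderEmbOfFin J.2).injective.eq_iff]
      simp only [eq_comm]
    rw [this, Matrix.det_one, mul_one]
  · intro I _ hIJ
    have : ∃ x ∈ J.1, x ∉ I.1 := by
      by_contra hh
      push Not at hh
      exact hIJ (Subtype.ext (Finset.eq_of_subset_of_card_le hh (by rw [I.2, J.2])).symm)
    obtain ⟨x, hxJ, hxI⟩ := this
    have : x ∈ Set.range (J.1.orderEmbOfFin J.2) := by
      rw [Finset.range_orderEmbOfFin]; exact hxJ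
    obtain ⟨a, rfl⟩ := this
    rw [Matrix.det_eq_zero_of_row_eq_zero a, mul_zero]
    intro b
    rw [Matrix.of_apply, Pi.single_apply, if_neg]
    intro h
    exact hxI (h ▸ Finset.orderEmbOfFin_mem _ _ b)
  · intro h; exact absurd (Finset.mem_univ _) h

theorem alt_ext {n q : ℕ} (f g : (Fin n → ℝ) [⋀^Fin q]→ₗ[ℝ] ℝ)
    (h : ∀ J : Idx n q, f (fun a => Pi.single (J.1.orderEmbOfFin J.2 a) 1) =
      g (fun a => Pi.single (J.1.orderEmbOfFin J.2 a) 1)) : f = g := by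
  refine Module.Basis.ext_alternating (Pi.basisFun ℝ (Fin n)) fun v hv => ?_
  have hc : (Finset.univ.image v).card = q := by
    rw [Finset.card_image_of_injective _ hv, Finset.card_univ, Fintype.card_fin]
  set J : Idx n q := ⟨Finset.univ.image v, hc⟩ with hJ
  have hr : ∀ a, ∃ b, J.1.orderEmbOfFin J.2 b = v a := by
    intro a
    have : v a ∈ Set.range (J.1.orderEmbOfFin J.2) := by
      rw [Finset.range_orderEmbOfFin]
      simp [hJ]
    exact this
  choose σ hσ using hr
  have hinj : Function.Injective σ := fun a b hab => hv (by rw [← hσ, ← hσ, hab])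
  set τ : Equiv.Perm (Fin q) := Equiv.ofBijective σ (Finite.injective_iff_bijective.1 hinj)
  have hvv : (fun i => (Pi.basisFun ℝ (Fin n)) (v i)) =
      (fun a => (Pi.single (J.1.orderEmbOfFin J.2 a) 1 : Fin n → ℝ)) ∘ τ := by
    funext i
    rw [Pi.basisFun_apply, Function.comp]
    change _ = Pi.single (J.1.orderEmbOfFin J.2 (σ i)) 1
    rw [hσ]
  rw [hvv, AlternatingMap.map_perm, AlternatingMap.map_perm, h]

theorem altW_extPow {n q : ℕ} (A : Matrix (Fin n) (Fin n) ℝ) (w : MultiVec n q)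
    (γ : Fin q → Fin n → ℝ) :
    altW (extPow n q A w) γ = altW w (fun a => Matrix.vecMul (γ a) A) := by
  have : altW (extPow n q A w) = (altW w).compLinearMap (Matrix.vecMulLinear A) := by
    apply alt_ext
    intro J
    rw [altW_basis, ← altW_rows]
    change _ = altW w (fun a => Matrix.vecMul (Pi.single (J.1.orderEmbOfFin J.2 a) 1) A)
    congr 1
    funext a
    rw [Matrix.single_one_vecMul]
    rfl
  rw [this]
  rfl

theorem extPow_mul {n q : ℕ} (A B : Matrix (Fin n) (Fin n) ℝ) (w : MultiVec n q) :
    extPow n q (A * B) w = extPow n q A (extPow n q B w) := by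
  funext J
  rw [← altW_rows, ← altW_rows, altW_extPow]
  congr 1

theorem extPow_one {n q : ℕ} (w : MultiVec n q) : extPow n q 1 w = w := by
  funext J
  rw [← altW_rows, ← altW_basis w J]
  congr 1
  funext a b
  rw [Matrix.one_apply, Pi.single_apply]
  simp only [eq_comm]

/-- decomposable multivector with span `L`. -/
def Decomp {n q : ℕ} (w : MultiVec n q) (L : Submodule ℝ (Fin n → ℝ)) : Prop :=
  ∃ v : Fin q → Fin n → ℝ, (∀ γ : Fin q → Fin n → ℝ,
    altW w γ = (Matrix.of fun a b => γ a ⬝ᵥ v b).det) ∧ LinearIndependent ℝ v ∧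
    Submodule.span ℝ (Set.range v) = L

theorem Decomp.finrank {n q : ℕ} {w : MultiVec n q} {L : Submodule ℝ (Fin n → ℝ)}
    (h : Decomp w L) : Module.finrank ℝ L = q := by
  obtain ⟨v, -, hi, rfl⟩ := h
  rw [finrank_span_eq_card hi, Fintype.card_fin]

theorem Decomp.exists_coef {n q : ℕ} {v : Fin q → Fin n → ℝ} {u : Fin n → ℝ}
    (hu : u ∈ Submodule.span ℝ (Set.range v)) : ∃ c : Fin q → ℝ, ∀ γ : Fin n → ℝ,
      γ ⬝ᵥ u = ∑ b, (γ ⬝ᵥ v b) * c b := by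
  obtain ⟨c, rfl⟩ := (Submodule.mem_span_range_iff_exists_fun ℝ).1 hu
  refine ⟨c, fun γ => ?_⟩
  rw [dotProduct_sum]
  refine Finset.sum_congr rfl fun b _ => ?_
  rw [dotProduct_smul, smul_eq_mul, mul_comm]

theorem Decomp.dep {n q : ℕ} {w : MultiVec n q} {L : Submodule ℝ (Fin n → ℝ)}
    (h : Decomp w L) (γ : Fin q → Fin n → ℝ) (a0 : Fin q)
    (hγ : ∀ u ∈ L, (∀ a, a ≠ a0 → γ a ⬝ᵥ u = 0) → γ a0 ⬝ᵥ u = 0) : altW w γ = 0 := by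
  obtain ⟨v, hv, hi, rfl⟩ := h
  rw [hv]
  by_contra hd
  set M : Matrix (Fin q) (Fin q) ℝ := Matrix.of fun a b => γ a ⬝ᵥ v b with hM
  set c := Matrix.mulVec M⁻¹ (Pi.single a0 1) with hc
  have hMc : Matrix.mulVec M c = Pi.single a0 1 := by
    rw [hc, Matrix.mulVec_mulVec, Matrix.mul_nonsing_inv _ (isUnit_iff_ne_zero.2 hd),
      Matrix.one_mulVec]
  have hk : ∀ a, γ a ⬝ᵥ (∑ b, c b • v b) = (Pi.single a0 1 : Fin q → ℝ) a := by
    intro a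
    rw [← hMc, dotProduct_sum]
    refine Finset.sum_congr rfl fun b _ => ?_
    rw [dotProduct_smul, smul_eq_mul, mul_comm]
    rfl
  have := hγ (∑ b, c b • v b) (Submodule.sum_mem _ fun b _ => Submodule.smul_mem _ _
    (Submodule.subset_span ⟨b, rfl⟩)) (fun a ha => by rw [hk, Pi.single_eq_of_ne ha])
  rw [hk, Pi.single_eq_same] at this
  exact one_ne_zero this

theorem Decomp.plucker {n q : ℕ} {w : MultiVec n q} {L : Submodule ℝ (Fin n → ℝ)}
    (h : Decomp w L) {u : Fin n → ℝ} (hu : u ∈ L) (γ : Fin (q + 1) → Fin n → ℝ) :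
    ∑ i : Fin (q + 1), (-1 : ℝ) ^ (i : ℕ) * (γ i ⬝ᵥ u) * altW w (γ ∘ i.succAbove) = 0 := by
  obtain ⟨v, hv, hi, rfl⟩ := h
  obtain ⟨c, hc⟩ := Decomp.exists_coef hu
  set M : Matrix (Fin (q + 1)) (Fin (q + 1)) ℝ :=
    Matrix.of fun i => Fin.cons (γ i ⬝ᵥ u) (fun b => γ i ⬝ᵥ v b) with hM
  have h0 : M.det = 0 := by
    rw [← Matrix.exists_mulVec_eq_zero_iff]
    refine ⟨Fin.cons (-1) c, fun hh => ?_, ?_⟩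
    · have := congrFun hh 0
      simp at this
    · funext i
      rw [Matrix.mulVec, dotProduct, Fin.sum_univ_succ]
      simp only [hM, Matrix.of_apply, Fin.cons_zero, Fin.cons_succ, Pi.zero_apply]
      rw [hc (γ i)]
      ring
  rw [Matrix.det_succ_column_zero] at h0
  rw [← h0]
  refine Finset.sum_congr rfl fun i _ => ?_
  rw [hv]
  rfl

theorem Decomp.ne_zero {n q : ℕ} {w : MultiVec n q} {L : Submodule ℝ (Fin n → ℝ)}
    (h : Decomp w L) : w ≠ 0 := by
  rintro rfl
  obtain ⟨v, hv, hi, rfl⟩ := h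
  set A : Matrix (Fin q) (Fin n) ℝ := Matrix.of v
  obtain ⟨g, hg⟩ : ∃ g : (Fin n → ℝ) →ₗ[ℝ] (Fin q → ℝ), ∀ b, g (v b) = Pi.single b 1 := by
    have hinj : LinearMap.ker (Fintype.linearCombination ℝ v) = ⊥ :=
      LinearMap.ker_eq_bot.2 hi.fintypeLinearCombination_injective
    obtain ⟨g, hg⟩ := LinearMap.exists_leftInverse_of_injective _ hinj
    refine ⟨g, fun b => ?_⟩
    have := LinearMap.congr_fun hg (Pi.single b 1)
    simpa [Fintype.linearCombination_apply_single] using this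
  have := hv (fun a => fun j => g (Pi.single j 1) a)
  have h1 : (Matrix.of fun a b => (fun j => g (Pi.single j 1) a) ⬝ᵥ v b) =
      (1 : Matrix (Fin q) (Fin q) ℝ) := by
    ext a b
    rw [Matrix.of_apply, Matrix.one_apply]
    have h2 : v b = ∑ j, v b j • (Pi.single j 1 : Fin n → ℝ) := pi_eq_sum_univ' (v b)
    have h3 := congrFun (hg b) a
    rw [h2, map_sum, Finset.sum_apply] at h3
    rw [dotProduct]
    rw [Pi.single_apply] at h3
    rw [← h3]
    refine Finset.sum_congr rfl fun j _ => ?_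
    rw [map_smul, Pi.smul_apply, smul_eq_mul, mul_comm]
  rw [h1, Matrix.det_one, altW_apply] at this
  simp at this

end M7a
end NambuLin
end FileM7a

section FileM7b
open scoped ContDiff
open MeasureTheory Set Filter Topology
namespace NambuLin
section M7b
set_option linter.unusedSectionVars false

/-- inclusion of the first `q+1` indices. -/
def io {n q : ℕ} (hn : q < n) (j : Fin (q + 1)) : Fin n := Fin.castLE hn j

@[simp] theorem io_val {n q : ℕ} (hn : q < n) (j : Fin (q + 1)) : (io hn j : ℕ) = j := rfl

theorem io_inj {n q : ℕ} (hn : q < n) : Function.Injective (io hn) := fun a b h => by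
  have := congrArg Fin.val h
  exact Fin.ext this

theorem io_surj {n q : ℕ} (hn : q < n) {j : Fin n} (hj : (j : ℕ) < q + 1) :
    ∃ i, io hn i = j := ⟨⟨j, hj⟩, rfl⟩

theorem mem_topIdx {n q : ℕ} {j : Fin n} : j ∈ topIdx n q ↔ (j : ℕ) < q + 1 := by
  simp [topIdx]

theorem card_topIdx {n q : ℕ} (hn : q < n) : (topIdx n q).card = q + 1 := by
  have : topIdx n q = Finset.univ.image (io hn) := by
    ext j
    rw [mem_topIdx, Finset.mem_image]
    constructor
    · intro h
      obtain ⟨i, hi⟩ := io_surj hn h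
      exact ⟨i, Finset.mem_univ _, hi⟩
    · rintro ⟨i, -, rfl⟩
      exact i.2
  rw [this, Finset.card_image_of_injective _ (io_inj hn), Finset.card_univ, Fintype.card_fin]

/-- the index `top \ j`. -/
def tI {n q : ℕ} (hn : q < n) (j : Fin (q + 1)) : Idx n q :=
  ⟨(topIdx n q).erase (io hn j), by
    rw [Finset.card_erase_of_mem ((mem_topIdx (j := io hn j)).2 j.2), card_topIdx hn]; rfl⟩

theorem tI_inj {n q : ℕ} (hn : q < n) : Function.Injective (tI (q := q) hn) := by
  intro a b h
  have h1 : (topIdx n q).erase (io hn a) = (topIdx n q).erase (io hn b) := congrArg Subtype.val h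
  by_contra hab
  have : io hn a ∈ (topIdx n q).erase (io hn b) :=
    Finset.mem_erase.2 ⟨fun h => hab (io_inj hn h), mem_topIdx.2 a.2⟩
  rw [← h1] at this
  exact Finset.notMem_erase _ _ this

theorem orderEmb_tI {n q : ℕ} (hn : q < n) (j : Fin (q + 1)) (a : Fin q) :
    (tI hn j).1.orderEmbOfFin (tI hn j).2 a = io hn (j.succAbove a) := by
  have := Finset.orderEmbOfFin_unique (tI hn j).2 (f := fun a => io hn (j.succAbove a))
    (fun a => Finset.mem_erase.2 ⟨fun h => Fin.succAbove_ne j a (io_inj hn h),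
      mem_topIdx.2 (j.succAbove a).2⟩)
    (fun a b hab => (Fin.strictMono_succAbove j hab))
  exact (congrFun this a).symm

theorem eq_tI_of_subset {n q : ℕ} (hn : q < n) (I : Idx n q) (hI : I.1 ⊆ topIdx n q) :
    ∃ j, I = tI hn j := by
  have : ∃ x ∈ topIdx n q, x ∉ I.1 := by
    by_contra hh
    push Not at hh
    have := Finset.card_le_card (show topIdx n q ⊆ I.1 from hh)
    rw [card_topIdx hn, I.2] at this
    omega
  obtain ⟨x, hx, hxI⟩ := this
  obtain ⟨j, rfl⟩ := io_surj hn (mem_topIdx.1 hx)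
  refine ⟨j, Subtype.ext (Finset.eq_of_subset_of_card_le ?_ ?_)⟩
  · intro y hy
    exact Finset.mem_erase.2 ⟨fun h => hxI (h ▸ hy), hI hy⟩
  · rw [I.2, (tI hn j).2]

theorem mem_sliceIdx {n q k : ℕ} {j : Fin n} :
    j ∈ sliceIdx n q k ↔ k ≤ (j : ℕ) ∧ (j : ℕ) < q + 1 := by
  simp [sliceIdx]

theorem slice_sub_tI {n q k : ℕ} (hn : q < n) (j : Fin (q + 1)) :
    sliceIdx n q k ⊆ (tI hn j).1 ↔ (j : ℕ) < k := by
  constructor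
  · intro h
    by_contra hj
    have : io hn j ∈ sliceIdx n q k := mem_sliceIdx.2 ⟨not_lt.1 hj, j.2⟩
    exact Finset.notMem_erase _ _ (h this)
  · intro h x hx
    rw [mem_sliceIdx] at hx
    refine Finset.mem_erase.2 ⟨fun hh => ?_, mem_topIdx.2 hx.2⟩
    have := congrArg Fin.val hh
    rw [io_val] at this
    omega

theorem modelPi_tI {n q k : ℕ} (hn : q < n) (j : Fin (q + 1)) (x : Fin n → ℝ) :
    modelPi n q k x (tI hn j) = (-1 : ℝ) ^ (j : ℕ) * eps k (io hn j) * x (io hn j) := by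
  unfold modelPi
  rw [Finset.sum_eq_single (io hn j)]
  · rw [if_pos ⟨j.2, rfl⟩, io_val]
  · intro b _ hb
    rw [if_neg]
    rintro ⟨h1, h2⟩
    obtain ⟨i, rfl⟩ := io_surj hn h1
    exact hb (congrArg _ (tI_inj hn (Subtype.ext h2 : tI hn j = tI hn i)).symm)
  · intro h; exact absurd (Finset.mem_univ _) h

theorem modelPi_not {n q k : ℕ} (J : Idx n q) (hJ : ¬ J.1 ⊆ topIdx n q) (x : Fin n → ℝ) :
    modelPi n q k x J = 0 := by
  unfold modelPi
  refine Finset.sum_eq_zero fun j _ => ?_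
  rw [if_neg]
  rintro ⟨-, h⟩
  exact hJ (h ▸ Finset.erase_subset _ _)

theorem sum_tI {n q : ℕ} (hn : q < n) (F : Idx n q → ℝ) (hF : ∀ I, ¬ I.1 ⊆ topIdx n q → F I = 0) :
    ∑ I, F I = ∑ j, F (tI hn j) := by
  rw [← Finset.sum_image (s := Finset.univ) (g := tI hn) (f := F) (fun a _ b _ h => tI_inj hn h)]
  symm
  refine Finset.sum_subset (Finset.subset_univ _) fun I _ hI => hF I fun hh => hI ?_
  obtain ⟨j, rfl⟩ := eq_tI_of_subset hn I hh
  exact Finset.mem_image_of_mem _ (Finset.mem_univ _)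

theorem slice_algebra {n q k : ℕ} (hn : q < n) (w : MultiVec n q) (r : Fin (q + 1) → ℝ)
    (hw1 : ∀ b : Fin (q + 1), (b : ℕ) < k → w (tI hn b) = (-1) ^ (b : ℕ) * r b)
    (hw2 : ∀ J : Idx n q, sliceIdx n q k ⊆ J.1 → ¬ J.1 ⊆ topIdx n q → w J = 0)
    (hr : ∀ b : Fin (q + 1), k ≤ (b : ℕ) → r b = 0)
    (A : Matrix (Fin n) (Fin n) ℝ) (hA : ∀ j : Fin n, k ≤ (j : ℕ) → A j = Pi.single j 1)
    (lam : Fin (q + 1) → ℝ)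
    (hl : ∀ b, ∑ i, lam i * A (io hn i) (io hn b) = r b) (hkq : k ≤ q + 1) :
    (∀ j : Fin (q + 1), (j : ℕ) < k → extPow n q A w (tI hn j) =
      (-1) ^ (j : ℕ) * (lam j * (A.submatrix (io hn) (io hn)).det)) ∧
    ∀ J : Idx n q, sliceIdx n q k ⊆ J.1 → ¬ J.1 ⊆ topIdx n q → extPow n q A w J = 0 := by
  have key : ∀ J : Idx n q, sliceIdx n q k ⊆ J.1 → extPow n q A w J =
      ∑ b : Fin (q + 1), (-1) ^ (b : ℕ) * r b *
        (A.submatrix (J.1.orderEmbOfFin J.2) (fun a => io hn (b.succAbove a))).det := by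
    intro J hJ
    have hz : ∀ I : Idx n q, ¬ sliceIdx n q k ⊆ I.1 →
        (A.submatrix (J.1.orderEmbOfFin J.2) (I.1.orderEmbOfFin I.2)).det = 0 := by
      intro I hI
      obtain ⟨x, hx, hxI⟩ := Finset.not_subset.1 hI
      have : x ∈ Set.range (J.1.orderEmbOfFin J.2) := by
        rw [Finset.range_orderEmbOfFin]; exact hJ hx
      obtain ⟨a, ha⟩ := this
      refine Matrix.det_eq_zero_of_row_eq_zero a fun b => ?_
      rw [Matrix.submatrix_apply, ha, hA x (mem_sliceIdx.1 hx).1, Pi.single_apply, if_neg]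
      intro h
      exact hxI (h ▸ Finset.orderEmbOfFin_mem _ _ b)
    unfold extPow
    rw [sum_tI hn]
    · refine Finset.sum_congr rfl fun b _ => ?_
      by_cases hb : (b : ℕ) < k
      · rw [hw1 b hb, mul_comm]
        congr 2
        ext a c
        rw [Matrix.submatrix_apply, Matrix.submatrix_apply, orderEmb_tI]
      · rw [hz (tI hn b) (fun h => hb ((slice_sub_tI hn b).1 h)), hr b (not_lt.1 hb)]
        ring
    · intro I hI
      by_cases hS : sliceIdx n q k ⊆ I.1
      · rw [hw2 I hS hI, mul_zero]
      · rw [hz I hS, zero_mul]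
  constructor
  · intro j hj
    rw [key _ ((slice_sub_tI hn j).2 hj)]
    set C := A.submatrix (io hn) (io hn) with hC
    have h1 := Matrix.det_updateRow_sum C j lam
    have h2 : (∑ i, lam i • C i) = r := by
      funext b
      rw [Finset.sum_apply, ← hl b]
      rfl
    rw [h2, Matrix.det_succ_row _ j] at h1
    rw [smul_eq_mul] at h1
    rw [← h1, Finset.mul_sum]
    refine Finset.sum_congr rfl fun b _ => ?_
    rw [Matrix.updateRow_self]
    have h3 : (C.updateRow j r).submatrix j.succAbove b.succAbove =
        A.submatrix ((tI hn j).1.orderEmbOfFin (tI hn j).2) (fun a => io hn (b.succAbove a)) := by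
      ext a c
      rw [Matrix.submatrix_apply, Matrix.updateRow_ne (Fin.succAbove_ne j a),
        Matrix.submatrix_apply, orderEmb_tI]
      rfl
    rw [h3, pow_add]
    have h4 : (-1 : ℝ) ^ (j : ℕ) * (-1) ^ (j : ℕ) = 1 := by
      rw [← pow_add, ← two_mul, pow_mul]; simp
    linear_combination (-(-1 : ℝ) ^ (b : ℕ) * r b * (A.submatrix
      ((tI hn j).1.orderEmbOfFin (tI hn j).2) (fun a => io hn (b.succAbove a))).det) * h4
  · intro J hJ hJt
    rw [key J hJ]
    refine Finset.sum_eq_zero fun b _ => ?_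
    obtain ⟨x, hx, hxt⟩ := Finset.not_subset.1 hJt
    have : x ∈ Set.range (J.1.orderEmbOfFin J.2) := by
      rw [Finset.range_orderEmbOfFin]; exact hx
    obtain ⟨a, ha⟩ := this
    rw [mem_topIdx] at hxt
    rw [Matrix.det_eq_zero_of_row_eq_zero a, mul_zero]
    intro c
    rw [Matrix.submatrix_apply, ha, hA x (by omega), Pi.single_apply, if_neg]
    intro h
    have := congrArg Fin.val h
    rw [io_val] at this
    omega

end M7b
end NambuLin
end FileM7b

section FileM7c
open scoped ContDiff
open MeasureTheory Set Filter Topology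
namespace NambuLin
section M7c
set_option linter.unusedSectionVars false

theorem jac_mulVec {n : ℕ} (φ : (Fin n → ℝ) → (Fin n → ℝ)) (x u : Fin n → ℝ) :
    Matrix.mulVec (jac φ x) u = fderiv ℝ φ x u := by
  conv_rhs => rw [pi_eq_sum_univ' u, map_sum]
  funext i
  rw [Finset.sum_apply, Matrix.mulVec, dotProduct]
  refine Finset.sum_congr rfl fun j _ => ?_
  rw [map_smul, Pi.smul_apply, smul_eq_mul, mul_comm]
  rfl

theorem jac_row {n : ℕ} (φ : (Fin n → ℝ) → (Fin n → ℝ)) (x u : Fin n → ℝ) (i : Fin n) :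
    jac φ x i ⬝ᵥ u = fderiv ℝ φ x u i := congrFun (jac_mulVec φ x u) i

theorem jac_comp {n : ℕ} {φ ψ : (Fin n → ℝ) → (Fin n → ℝ)} {x : Fin n → ℝ}
    (hψ : DifferentiableAt ℝ ψ (φ x)) (hφ : DifferentiableAt ℝ φ x) :
    jac (fun y => ψ (φ y)) x = jac ψ (φ x) * jac φ x := by
  apply Matrix.mulVec_injective
  funext u
  rw [← Matrix.mulVec_mulVec, jac_mulVec, jac_mulVec, jac_mulVec,
    show (fun y => ψ (φ y)) = ψ ∘ φ from rfl, fderiv_comp x hψ hφ]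
  rfl

theorem jac_inv {n : ℕ} {φ ψ : (Fin n → ℝ) → (Fin n → ℝ)} {x : Fin n → ℝ}
    (hψ : DifferentiableAt ℝ ψ (φ x)) (hφ : DifferentiableAt ℝ φ x)
    (h : ∀ᶠ y in 𝓝 x, ψ (φ y) = y) : jac ψ (φ x) * jac φ x = 1 := by
  rw [← jac_comp hψ hφ]
  apply Matrix.mulVec_injective
  funext u
  have : (fun y => ψ (φ y)) =ᶠ[𝓝 x] id := h
  rw [jac_mulVec, this.fderiv_eq, fderiv_id, Matrix.one_mulVec]
  rfl

theorem altW_std {n q : ℕ} (hn : q ≤ n) (γ : Fin q → Fin n → ℝ) :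
    altW (stdVec n q) γ = (Matrix.of fun a b => γ a (Fin.castLE hn b)).det := by
  have hc : (Finset.univ.filter (fun i : Fin n => (i : ℕ) < q)).card = q := by
    have : Finset.univ.filter (fun i : Fin n => (i : ℕ) < q) =
        Finset.univ.image (Fin.castLE hn) := by
      ext j
      simp only [Finset.mem_filter, Finset.mem_univ, true_and, Finset.mem_image]
      constructor
      · intro h
        exact ⟨⟨j, h⟩, rfl⟩
      · rintro ⟨i, rfl⟩
        exact i.2
    rw [this, Finset.card_image_of_injective _ (Fin.castLE_injective hn), Finset.card_univ,
      Fintype.card_fin]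
  set J : Idx n q := ⟨_, hc⟩ with hJ
  rw [altW_apply, Finset.sum_eq_single J]
  · have h1 : stdVec n q J = 1 := if_pos rfl
    rw [h1, one_mul]
    congr 1
    ext a b
    rw [Matrix.of_apply, Matrix.of_apply]
    congr 1
    have := Finset.orderEmbOfFin_unique J.2 (f := fun a => Fin.castLE hn a)
      (fun a => by simp [hJ]) (fun a b hab => hab)
    exact (congrFun this b).symm
  · intro I _ hI
    have h1 : stdVec n q I = 0 := if_neg fun h => hI (Subtype.ext h)
    rw [h1, zero_mul]
  · intro h; exact absurd (Finset.mem_univ _) h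

theorem nambu_local {n q : ℕ} (hn : q ≤ n) {P : (Fin n → ℝ) → MultiVec n q}
    {U : Set (Fin n → ℝ)} (hN : IsNambu n q P U) {p : Fin n → ℝ} (hp : p ∈ U) (h0 : P p ≠ 0) :
    ∃ h : (Fin n → ℝ) → (Fin n → ℝ), ∀ᶠ x in 𝓝 p, DifferentiableAt ℝ h x ∧
      Decomp (P x) (LinearMap.ker (fderiv ℝ h x).toLinearMap) := by
  obtain ⟨W, hpW, hWU, φ, ⟨hWo, hφo, hφ, ψ, hψ, h1, h2⟩, hstd⟩ := hN.2 p hp h0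
  set π : (Fin n → ℝ) →L[ℝ] (Fin n → ℝ) := ContinuousLinearMap.pi fun j =>
    if (j : ℕ) < q then 0 else ContinuousLinearMap.proj j with hπ
  have hπa : ∀ u j, π u j = if (j : ℕ) < q then 0 else u j := by
    intro u j
    rw [hπ, ContinuousLinearMap.pi_apply]
    split_ifs <;> rfl
  refine ⟨fun x => π (φ x), ?_⟩
  filter_upwards [hWo.mem_nhds hpW] with x hx
  have hφd : DifferentiableAt ℝ φ x :=
    (hφ.contDiffAt (hWo.mem_nhds hx)).differentiableAt (by simp)
  have hψd : DifferentiableAt ℝ ψ (φ x) :=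
    (hψ.contDiffAt (hφo.mem_nhds ⟨x, hx, rfl⟩)).differentiableAt (by simp)
  refine ⟨π.differentiableAt.comp x hφd, ?_⟩
  have hBA := jac_inv hψd hφd (by filter_upwards [hWo.mem_nhds hx] with y hy using h1 y hy)
  set A := jac φ x with hA
  set B := jac ψ (φ x) with hB
  have hAB : A * B = 1 := mul_eq_one_comm.1 hBA
  have hfd : ∀ u, fderiv ℝ (fun x => π (φ x)) x u = π (Matrix.mulVec A u) := by
    intro u
    rw [show (fun x => π (φ x)) = π ∘ φ from rfl, fderiv_comp x π.differentiableAt hφd,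
      ContinuousLinearMap.fderiv, hA, jac_mulVec]
    rfl
  set v : Fin q → Fin n → ℝ := fun b => Matrix.mulVec B (Pi.single (Fin.castLE hn b) 1) with hv
  have hAv : ∀ b, Matrix.mulVec A (v b) = Pi.single (Fin.castLE hn b) 1 := by
    intro b
    rw [hv, Matrix.mulVec_mulVec, hAB, Matrix.one_mulVec]
  refine ⟨v, ?_, ?_, ?_⟩
  · intro γ
    have : P x = extPow n q B (stdVec n q) := by
      rw [← hstd x hx, ← extPow_mul, hBA, extPow_one]
    rw [this, altW_extPow, altW_std hn]
    congr 1
    ext a b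
    rw [Matrix.of_apply, Matrix.of_apply, hv, Matrix.dotProduct_mulVec, dotProduct_single, mul_one]
  · rw [Fintype.linearIndependent_iff]
    intro c hc b
    have := congrArg (Matrix.mulVec A) hc
    rw [Matrix.mulVec_sum, Matrix.mulVec_zero] at this
    have := congrFun this (Fin.castLE hn b)
    rw [Finset.sum_apply, Finset.sum_eq_single b] at this
    · rw [Matrix.mulVec_smul, hAv] at this
      simpa using this
    · intro b' _ hb'
      rw [Matrix.mulVec_smul, hAv, Pi.smul_apply, Pi.single_eq_of_ne, smul_zero]
      intro h
      exact hb' (Fin.castLE_injective hn h).symm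
    · intro h; exact absurd (Finset.mem_univ _) h
  · apply le_antisymm
    · rw [Submodule.span_le]
      rintro _ ⟨b, rfl⟩
      rw [SetLike.mem_coe, LinearMap.mem_ker]
      change fderiv ℝ (fun x => π (φ x)) x (v b) = 0
      rw [hfd, hAv]
      funext j
      rw [hπa]
      split_ifs with hj
      · rfl
      · rw [Pi.single_eq_of_ne, Pi.zero_apply]
        rintro rfl
        exact hj b.2
    · intro u hu
      rw [LinearMap.mem_ker] at hu
      have hu1 : π (Matrix.mulVec A u) = 0 := by rw [← hfd]; exact hu
      have hu2 : u = ∑ b, (Matrix.mulVec A u) (Fin.castLE hn b) • v b := by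
        have h3 : Matrix.mulVec A u = ∑ b, (Matrix.mulVec A u) (Fin.castLE hn b) •
            (Pi.single (Fin.castLE hn b) 1 : Fin n → ℝ) := by
          funext j
          rw [Finset.sum_apply]
          by_cases hj : (j : ℕ) < q
          · rw [Finset.sum_eq_single (⟨j, hj⟩ : Fin q)]
            · have : Fin.castLE hn ⟨j, hj⟩ = j := rfl
              rw [this, Pi.smul_apply, Pi.single_eq_same, smul_eq_mul, mul_one]
            · intro b _ hb
              rw [Pi.smul_apply, Pi.single_eq_of_ne, smul_zero]
              rintro rfl
              exact hb rfl
            · intro h; exact absurd (Finset.mem_univ _) h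
          · have := congrFun hu1 j
            rw [hπa, if_neg hj] at this
            rw [this, Pi.zero_apply]
            symm
            refine Finset.sum_eq_zero fun b _ => ?_
            rw [Pi.smul_apply, Pi.single_eq_of_ne, smul_zero]
            rintro rfl
            exact hj b.2
        have h4 := congrArg (Matrix.mulVec B) h3
        rw [Matrix.mulVec_mulVec, hBA, Matrix.one_mulVec, Matrix.mulVec_sum] at h4
        refine h4.trans (Finset.sum_congr rfl fun b _ => ?_)
        rw [Matrix.mulVec_smul]
      rw [hu2]
      exact Submodule.sum_mem _ fun b _ => Submodule.smul_mem _ _ (Submodule.subset_span ⟨b, rfl⟩)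

end M7c
end NambuLin
end FileM7c

section FileM7d
open scoped ContDiff
open MeasureTheory Set Filter Topology
namespace NambuLin
section M7d
set_option linter.unusedSectionVars false

theorem altW_add {n q : ℕ} (w w' : MultiVec n q) (γ : Fin q → Fin n → ℝ) :
    altW (w + w') γ = altW w γ + altW w' γ := by
  simp only [altW_apply, Pi.add_apply, add_mul, Finset.sum_add_distrib]

theorem altW_smul {n q : ℕ} (c : ℝ) (w : MultiVec n q) (γ : Fin q → Fin n → ℝ) :
    altW (c • w) γ = c * altW w γ := by
  simp only [altW_apply, Pi.smul_apply, smul_eq_mul, Finset.mul_sum, mul_assoc]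

/-- the one-form `i_Π Ω` on the top coordinates. -/
noncomputable def B0 {n q : ℕ} (hn : q < n) : MultiVec n q →ₗ[ℝ] (Fin n → ℝ) →ₗ[ℝ] ℝ :=
  LinearMap.mk₂ ℝ (fun w v => ∑ i : Fin (q + 1), (-1 : ℝ) ^ (i : ℕ) * v (io hn i) * w (tI hn i))
    (fun a b v => by
      rw [← Finset.sum_add_distrib]
      exact Finset.sum_congr rfl fun i _ => by rw [Pi.add_apply]; ring)
    (fun c a v => by
      rw [smul_eq_mul, Finset.mul_sum]
      exact Finset.sum_congr rfl fun i _ => by rw [Pi.smul_apply, smul_eq_mul]; ring)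
    (fun a b v => by
      rw [← Finset.sum_add_distrib]
      exact Finset.sum_congr rfl fun i _ => by rw [Pi.add_apply]; ring)
    (fun c a v => by
      rw [smul_eq_mul, Finset.mul_sum]
      exact Finset.sum_congr rfl fun i _ => by rw [Pi.smul_apply, smul_eq_mul]; ring)

theorem B0_apply {n q : ℕ} (hn : q < n) (w : MultiVec n q) (v : Fin n → ℝ) :
    B0 hn w v = ∑ i : Fin (q + 1), (-1 : ℝ) ^ (i : ℕ) * v (io hn i) * w (tI hn i) := rfl

/-- covectors `e_l, e_{top \ j}`. -/
def gl {n q : ℕ} (hn : q < n) (l : Fin n) (j : Fin (q + 1)) : Fin (q + 1) → Fin n → ℝ :=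
  Fin.cons (Pi.single l 1) (fun a => Pi.single (io hn (j.succAbove a)) 1)

/-- the one-form obtained by contracting with `e_l ∧ e_{top \ j}`. -/
noncomputable def B1 {n q : ℕ} (hn : q < n) (l : Fin n) (j : Fin (q + 1)) :
    MultiVec n q →ₗ[ℝ] (Fin n → ℝ) →ₗ[ℝ] ℝ :=
  LinearMap.mk₂ ℝ (fun w v => ∑ i : Fin (q + 1), (-1 : ℝ) ^ (i : ℕ) * (gl hn l j i ⬝ᵥ v) *
      altW w (gl hn l j ∘ i.succAbove))
    (fun a b v => by
      rw [← Finset.sum_add_distrib]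
      exact Finset.sum_congr rfl fun i _ => by rw [altW_add]; ring)
    (fun c a v => by
      rw [smul_eq_mul, Finset.mul_sum]
      exact Finset.sum_congr rfl fun i _ => by rw [altW_smul]; ring)
    (fun a b v => by
      rw [← Finset.sum_add_distrib]
      exact Finset.sum_congr rfl fun i _ => by rw [dotProduct_add]; ring)
    (fun c a v => by
      rw [smul_eq_mul, Finset.mul_sum]
      exact Finset.sum_congr rfl fun i _ => by rw [dotProduct_smul, smul_eq_mul]; ring)

theorem B1_apply {n q : ℕ} (hn : q < n) (l : Fin n) (j : Fin (q + 1)) (w : MultiVec n q)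
    (v : Fin n → ℝ) : B1 hn l j w v = ∑ i : Fin (q + 1), (-1 : ℝ) ^ (i : ℕ) *
      (gl hn l j i ⬝ᵥ v) * altW w (gl hn l j ∘ i.succAbove) := rfl

theorem altW_tI {n q : ℕ} (hn : q < n) (w : MultiVec n q) (i : Fin (q + 1)) :
    altW w (fun a => Pi.single (io hn (i.succAbove a)) 1) = w (tI hn i) := by
  rw [← altW_basis w (tI hn i)]
  congr 1
  funext a
  rw [orderEmb_tI]

theorem B0_mem {n q : ℕ} (hn : q < n) {w : MultiVec n q} {L : Submodule ℝ (Fin n → ℝ)}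
    (h : Decomp w L) {u : Fin n → ℝ} (hu : u ∈ L) : B0 hn w u = 0 := by
  rw [B0_apply, ← h.plucker hu (fun i => Pi.single (io hn i) 1)]
  refine Finset.sum_congr rfl fun i _ => ?_
  rw [single_dotProduct, one_mul]
  congr 1
  exact (altW_tI hn w i).symm

theorem B1_mem {n q : ℕ} (hn : q < n) (l : Fin n) (j : Fin (q + 1)) {w : MultiVec n q}
    {L : Submodule ℝ (Fin n → ℝ)}
    (h : Decomp w L) {u : Fin n → ℝ} (hu : u ∈ L) : B1 hn l j w u = 0 :=
  h.plucker hu _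

theorem B0_model {n q k : ℕ} (hn : q < n) (x v : Fin n → ℝ) :
    B0 hn (modelPi n q k x) v = ∑ i : Fin (q + 1), eps k (io hn i) * x (io hn i) * v (io hn i) := by
  rw [B0_apply]
  refine Finset.sum_congr rfl fun i _ => ?_
  rw [modelPi_tI]
  have h4 : (-1 : ℝ) ^ (i : ℕ) * (-1) ^ (i : ℕ) = 1 := by
    rw [← pow_add, ← two_mul, pow_mul]; simp
  linear_combination (eps k (io hn i) * x (io hn i) * v (io hn i)) * h4

/-- coefficients of the model. -/
def cof {n q : ℕ} (k : ℕ) (hn : q < n) (x : Fin n → ℝ) (j : Fin (q + 1)) : ℝ :=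
  (-1 : ℝ) ^ (j : ℕ) * eps k (io hn j) * x (io hn j)

theorem altW_model_zero {n q k : ℕ} (x : Fin n → ℝ) (γ : Fin q → Fin n → ℝ)
    (a : Fin q) (l : Fin n) (hl : q < l) (ha : γ a = Pi.single l 1) :
    altW (modelPi n q k x) γ = 0 := by
  rw [altW_apply]
  refine Finset.sum_eq_zero fun I _ => ?_
  by_cases hI : I.1 ⊆ topIdx n q
  · rw [Matrix.det_eq_zero_of_row_eq_zero a, mul_zero]
    intro b
    rw [Matrix.of_apply, ha, Pi.single_apply, if_neg]
    intro h
    have := mem_topIdx.1 (hI (Finset.orderEmbOfFin_mem I.1 I.2 b))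
    rw [h] at this
    omega
  · rw [modelPi_not I hI, zero_mul]

theorem B1_model {n q k : ℕ} (hn : q < n) (hq : 0 < q) (l : Fin n) (hl : q < l) (j : Fin (q + 1))
    (x v : Fin n → ℝ) :
    B1 hn l j (modelPi n q k x) v = cof k hn x j * v l := by
  rw [B1_apply, Fin.sum_univ_succ]
  have h0 : gl hn l j ∘ (0 : Fin (q + 1)).succAbove =
      fun a => Pi.single (io hn (j.succAbove a)) 1 := by
    funext a
    simp [gl]
  rw [h0, altW_tI, modelPi_tI]
  have h1 : gl hn l j 0 = Pi.single l 1 := rfl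
  rw [h1, single_dotProduct, one_mul, Finset.sum_eq_zero]
  · unfold cof
    simp
    ring
  · intro i _
    have : NeZero q := ⟨hq.ne'⟩
    rw [altW_model_zero x _ (⟨0, hq⟩ : Fin q) l hl, mul_zero]
    have : i.succ.succAbove (⟨0, hq⟩ : Fin q) = 0 := by
      apply Fin.ext
      rw [Fin.succAbove_of_castSucc_lt]
      · rfl
      · rw [Fin.lt_def]; simp
    rw [Function.comp, this, h1]

end M7d
end NambuLin
end FileM7d

section FileM7e
open scoped ContDiff
open MeasureTheory Set Filter Topology
namespace NambuLin
section M7e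
set_option linter.unusedSectionVars false
set_option maxSynthPendingDepth 3

/-- coordinates `x`. -/
abbrev XX (n k : ℕ) := EuclideanSpace ℝ {j : Fin n // (j : ℕ) < k}
/-- coordinates `y`. -/
abbrev YY (n q k : ℕ) := EuclideanSpace ℝ {j : Fin n // k ≤ (j : ℕ) ∧ (j : ℕ) < q + 1}
/-- coordinates `z`. -/
abbrev ZZ (n q : ℕ) := {j : Fin n // q < (j : ℕ)} → ℝ

/-- the splitting of coordinates. -/
noncomputable def PhiL (n q k : ℕ) (hk : k ≤ q + 1) :
    ((XX n k × YY n q k) × ZZ n q) ≃ₗ[ℝ] (Fin n → ℝ) where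
  toFun p := fun j => if h : (j : ℕ) < k then p.1.1 ⟨j, h⟩ else
    if h2 : (j : ℕ) < q + 1 then p.1.2 ⟨j, not_lt.1 h, h2⟩ else p.2 ⟨j, by omega⟩
  map_add' a b := by
    funext j
    simp only [Pi.add_apply]
    split_ifs <;> rfl
  map_smul' c a := by
    funext j
    simp only [Pi.smul_apply]
    split_ifs <;> rfl
  invFun v := ((WithLp.toLp 2 fun j => v j.1, WithLp.toLp 2 fun j => v j.1), fun j => v j.1)
  left_inv p := by
    refine Prod.ext (Prod.ext ?_ ?_) ?_
    · ext j
      simp only [dif_pos j.2]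
    · ext j
      simp only [dif_neg (not_lt.2 j.2.1), dif_pos j.2.2]
    · funext j
      have h1 : ¬ (j.1 : ℕ) < q + 1 := by have := j.2; omega
      have h2 : ¬ (j.1 : ℕ) < k := by omega
      simp only [dif_neg h1, dif_neg h2]
  right_inv v := by
    funext j
    simp only
    split_ifs <;> rfl

/-- the splitting of coordinates, continuous version. -/
noncomputable def Phi (n q k : ℕ) (hk : k ≤ q + 1) :
    (((XX n k × YY n q k) × ZZ n q) ≃L[ℝ] (Fin n → ℝ)) := (PhiL n q k hk).toContinuousLinearEquiv

theorem Phi_x {n q k : ℕ} (hk : k ≤ q + 1) (p : (XX n k × YY n q k) × ZZ n q)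
    (j : {j : Fin n // (j : ℕ) < k}) : Phi n q k hk p j.1 = p.1.1 j := dif_pos j.2

theorem Phi_y {n q k : ℕ} (hk : k ≤ q + 1) (p : (XX n k × YY n q k) × ZZ n q)
    (j : {j : Fin n // k ≤ (j : ℕ) ∧ (j : ℕ) < q + 1}) : Phi n q k hk p j.1 = p.1.2 j :=
  (dif_neg (not_lt.2 j.2.1)).trans (dif_pos j.2.2)

theorem Phi_z {n q k : ℕ} (hk : k ≤ q + 1) (p : (XX n k × YY n q k) × ZZ n q)
    (j : {j : Fin n // q < (j : ℕ)}) : Phi n q k hk p j.1 = p.2 j := by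
  have h1 : ¬ (j.1 : ℕ) < q + 1 := by have := j.2; omega
  have h2 : ¬ (j.1 : ℕ) < k := by omega
  exact (dif_neg h2).trans (dif_neg h1)

theorem Phi_dil {n q k : ℕ} (hk : k ≤ q + 1) (s : ℝ) (p : (XX n k × YY n q k) × ZZ n q)
    (j : Fin n) (hj : (j : ℕ) < q + 1) : Phi n q k hk (dil s p) j = s * Phi n q k hk p j := by
  by_cases h : (j : ℕ) < k
  · rw [Phi_x hk _ ⟨j, h⟩, Phi_x hk _ ⟨j, h⟩]; rfl
  · rw [Phi_y hk _ ⟨j, not_lt.1 h, hj⟩, Phi_y hk _ ⟨j, not_lt.1 h, hj⟩]; rfl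

theorem Phi_dil_z {n q k : ℕ} (hk : k ≤ q + 1) (s : ℝ) (p : (XX n k × YY n q k) × ZZ n q)
    (j : Fin n) (hj : q < (j : ℕ)) : Phi n q k hk (dil s p) j = Phi n q k hk p j := by
  rw [Phi_z hk _ ⟨j, hj⟩, Phi_z hk _ ⟨j, hj⟩]; rfl

theorem Phi_top {n q k : ℕ} (hk : k ≤ q + 1) (p : (XX n k × YY n q k) × ZZ n q) :
    p.1 = 0 ↔ ∀ j : Fin n, (j : ℕ) < q + 1 → Phi n q k hk p j = 0 := by
  constructor
  · intro h j hj
    by_cases h2 : (j : ℕ) < k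
    · rw [Phi_x hk _ ⟨j, h2⟩, h]; rfl
    · rw [Phi_y hk _ ⟨j, not_lt.1 h2, hj⟩, h]; rfl
  · intro h
    refine Prod.ext ?_ ?_
    · ext j
      rw [← Phi_x hk p j, h j.1 (by have := j.2; omega)]; rfl
    · ext j
      rw [← Phi_y hk p j, h j.1 j.2.2]; rfl

theorem sum_io {n q : ℕ} (hn : q < n) (f : Fin n → ℝ) :
    ∑ i : Fin (q + 1), f (io hn i) = ∑ j : Fin n, if (j : ℕ) < q + 1 then f j else 0 := by
  rw [← Finset.sum_filter, ← Finset.sum_image (s := Finset.univ) (g := io hn) (f := f)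
    (fun a _ b _ h => io_inj hn h)]
  congr 1
  ext j
  simp only [Finset.mem_image, Finset.mem_univ, true_and, Finset.mem_filter]
  constructor
  · rintro ⟨i, rfl⟩
    exact i.2
  · intro h
    exact io_surj hn h

theorem sum_sub {n : ℕ} (p : Fin n → Prop) [DecidablePred p] (f : Fin n → ℝ) :
    ∑ j : {j // p j}, f j.1 = ∑ j : Fin n, if p j then f j else 0 := by
  rw [← Finset.sum_filter, Finset.sum_subtype (p := p) _ (fun x => by simp) f]

theorem F0_eq {n q k : ℕ} (hn : q < n) (hk : k ≤ q + 1) (p v : (XX n k × YY n q k) × ZZ n q) :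
    inner ℝ p.1.1 v.1.1 - inner ℝ p.1.2 v.1.2 =
      ∑ i : Fin (q + 1), eps k (io hn i) * Phi n q k hk p (io hn i) * Phi n q k hk v (io hn i) := by
  rw [sum_io hn (fun j => eps k j * Phi n q k hk p j * Phi n q k hk v j),
    PiLp.inner_apply, PiLp.inner_apply]
  have h1 : ∑ j, inner ℝ (p.1.1 j) (v.1.1 j) = ∑ j : {j : Fin n // (j : ℕ) < k},
      Phi n q k hk p j.1 * Phi n q k hk v j.1 := by
    refine Finset.sum_congr rfl fun j _ => ?_
    rw [Phi_x, Phi_x]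
    simp [mul_comm]
  have h2 : ∑ j, inner ℝ (p.1.2 j) (v.1.2 j) =
      ∑ j : {j : Fin n // k ≤ (j : ℕ) ∧ (j : ℕ) < q + 1},
      Phi n q k hk p j.1 * Phi n q k hk v j.1 := by
    refine Finset.sum_congr rfl fun j _ => ?_
    rw [Phi_y, Phi_y]
    simp [mul_comm]
  rw [h1, h2, sum_sub (fun j : Fin n => (j : ℕ) < k) (fun j => Phi n q k hk p j * Phi n q k hk v j),
    sum_sub (fun j : Fin n => k ≤ (j : ℕ) ∧ (j : ℕ) < q + 1)
      (fun j => Phi n q k hk p j * Phi n q k hk v j), ← Finset.sum_sub_distrib]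
  refine Finset.sum_congr rfl fun j _ => ?_
  unfold eps
  by_cases hj1 : (j : ℕ) < k
  · rw [if_pos hj1, if_neg (by omega), if_pos (by omega), if_pos hj1]; ring
  · by_cases hj2 : (j : ℕ) < q + 1
    · rw [if_neg hj1, if_pos (by omega), if_pos hj2, if_neg hj1]; ring
    · rw [if_neg hj1, if_neg (by omega), if_neg hj2]; ring

theorem isOpen_surj {E F : Type} [NormedAddCommGroup E] [NormedSpace ℝ E] [NormedAddCommGroup F]
    [NormedSpace ℝ F] [FiniteDimensional ℝ F] [CompleteSpace F] :
    IsOpen {f : E →L[ℝ] F | Function.Surjective f} := by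
  rw [isOpen_iff_mem_nhds]
  intro f hf
  obtain ⟨r, hr⟩ := LinearMap.exists_rightInverse_of_surjective f.toLinearMap
    (LinearMap.range_eq_top.2 hf)
  have hc : Continuous (fun g : E →L[ℝ] F => g.comp (LinearMap.toContinuousLinearMap r)) := by
    fun_prop
  have h1 : f.comp (LinearMap.toContinuousLinearMap r) = 1 :=
    ContinuousLinearMap.ext fun a => LinearMap.congr_fun hr a
  have ho : IsOpen {g : E →L[ℝ] F | IsUnit (g.comp (LinearMap.toContinuousLinearMap r))} :=
    Units.isOpen.preimage hc
  have hm : f ∈ {g : E →L[ℝ] F | IsUnit (g.comp (LinearMap.toContinuousLinearMap r))} := by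
    change IsUnit _
    rw [h1]; exact isUnit_one
  filter_upwards [ho.mem_nhds hm] with g hg
  obtain ⟨u, hu⟩ := hg
  intro y
  refine ⟨r ((u⁻¹ : (F →L[ℝ] F)ˣ).1 y), ?_⟩
  have h2 : (u.1 * (u⁻¹ : (F →L[ℝ] F)ˣ).1) y = y := by rw [Units.mul_inv]; rfl
  rw [hu] at h2
  exact h2

theorem card_z {n q : ℕ} (hn : q < n) : Fintype.card {j : Fin n // q < (j : ℕ)} = n - (q + 1) := by
  rw [Fintype.card_subtype]
  have : Finset.univ.filter (fun j : Fin n => q < (j : ℕ)) = (topIdx n q)ᶜ := by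
    ext j
    simp only [Finset.mem_filter, Finset.mem_univ, true_and, Finset.mem_compl, mem_topIdx]
    omega
  rw [this, Finset.card_compl, card_topIdx hn, Fintype.card_fin]

end M7e
end NambuLin
end FileM7e

section FileM7f
open scoped ContDiff
open MeasureTheory Set Filter Topology
namespace NambuLin
section M7f
set_option linter.unusedSectionVars false
set_option maxSynthPendingDepth 3

/-- dilation as a linear map. -/
def dilL {X Y Z : Type} [NormedAddCommGroup X] [InnerProductSpace ℝ X] [NormedAddCommGroup Y]
    [InnerProductSpace ℝ Y] [NormedAddCommGroup Z] [NormedSpace ℝ Z] (s : ℝ) :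
    ((X × Y) × Z) →ₗ[ℝ] ((X × Y) × Z) where
  toFun := dil s
  map_add' a b := by simp [dil]
  map_smul' c a := by simp [dil, smul_comm s c]

/-- the form `α` in coordinates, second component -/
noncomputable def aL2 {n q : ℕ} (hn : q < n) (w : MultiVec n q) (c : Fin (q + 1) → ℝ) :
    (Fin n → ℝ) →ₗ[ℝ] ZZ n q :=
  LinearMap.pi fun l => (∑ j, c j ^ 2)⁻¹ • ∑ j, c j • B1 hn l.1 j w

theorem aL2_apply {n q : ℕ} (hn : q < n) (w : MultiVec n q) (c : Fin (q + 1) → ℝ)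
    (v : Fin n → ℝ) (l : {j : Fin n // q < (j : ℕ)}) :
    aL2 hn w c v l = (∑ j, c j ^ 2)⁻¹ * ∑ j, c j * B1 hn l.1 j w v := by
  unfold aL2
  rw [LinearMap.pi_apply, LinearMap.smul_apply, LinearMap.sum_apply]
  rfl

theorem aL2_smul {n q : ℕ} (hn : q < n) (w : MultiVec n q) (c : Fin (q + 1) → ℝ) (s : ℝ)
    (hs : s ≠ 0) : aL2 hn (s • w) (s • c) = aL2 hn w c := by
  refine LinearMap.ext fun v => ?_
  funext l
  rw [aL2_apply, aL2_apply]
  have h1 : ∑ j, (s • c) j ^ 2 = s ^ 2 * ∑ j, c j ^ 2 := by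
    rw [Finset.mul_sum]
    exact Finset.sum_congr rfl fun j _ => by rw [Pi.smul_apply, smul_eq_mul]; ring
  have h2 : ∑ j, (s • c) j * B1 hn l.1 j (s • w) v = s ^ 2 * ∑ j, c j * B1 hn l.1 j w v := by
    rw [Finset.mul_sum]
    exact Finset.sum_congr rfl fun j _ => by
      rw [Pi.smul_apply, smul_eq_mul, map_smul, LinearMap.smul_apply, smul_eq_mul]; ring
  rw [h1, h2, mul_inv]
  field_simp

/-- `α` -/
noncomputable def alp {n q k : ℕ} (hn : q < n) (hk : k ≤ q + 1) (P : (Fin n → ℝ) → MultiVec n q)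
    (p : (XX n k × YY n q k) × ZZ n q) : ((XX n k × YY n q k) × ZZ n q) →L[ℝ] ℝ × ZZ n q :=
  LinearMap.toContinuousLinearMap
    (((B0 hn (P (Phi n q k hk p))).prod (aL2 hn (P (Phi n q k hk p)) (cof k hn (Phi n q k hk p)))).comp
      (Phi n q k hk).toLinearEquiv.toLinearMap)

theorem alp_apply {n q k : ℕ} (hn : q < n) (hk : k ≤ q + 1) (P : (Fin n → ℝ) → MultiVec n q)
    (p v : (XX n k × YY n q k) × ZZ n q) : alp hn hk P p v =
      (B0 hn (P (Phi n q k hk p)) (Phi n q k hk v),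
        aL2 hn (P (Phi n q k hk p)) (cof k hn (Phi n q k hk p)) (Phi n q k hk v)) := rfl

/-- rescaled structure -/
noncomputable def Ph {n q k : ℕ} (hk : k ≤ q + 1) (P : (Fin n → ℝ) → MultiVec n q)
    (z : ℝ × ((XX n k × YY n q k) × ZZ n q)) : MultiVec n q :=
  modelPi n q k (Phi n q k hk z.2) + z.1⁻¹ •
    bl (fun p => P (Phi n q k hk p) - modelPi n q k (Phi n q k hk p)) z

open Classical in
/-- rescaled `α` -/
noncomputable def alph {n q k : ℕ} (hn : q < n) (hk : k ≤ q + 1) (P : (Fin n → ℝ) → MultiVec n q)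
    (z : ℝ × ((XX n k × YY n q k) × ZZ n q)) :
    ((XX n k × YY n q k) × ZZ n q) →L[ℝ] ℝ × ZZ n q :=
  if z.2.1 = 0 then fderiv ℝ F0 z.2 else
  LinearMap.toContinuousLinearMap
    (((B0 hn (Ph hk P z)).comp (Phi n q k hk).toLinearEquiv.toLinearMap).prod
      ((aL2 hn (Ph hk P z) (cof k hn (Phi n q k hk z.2))).comp
      ((Phi n q k hk).toLinearEquiv.toLinearMap.comp (dilL z.1))))

theorem alph_apply {n q k : ℕ} (hn : q < n) (hk : k ≤ q + 1) (P : (Fin n → ℝ) → MultiVec n q)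
    (z : ℝ × ((XX n k × YY n q k) × ZZ n q)) (hz : z.2.1 ≠ 0) (v : (XX n k × YY n q k) × ZZ n q) :
    alph hn hk P z v = (B0 hn (Ph hk P z) (Phi n q k hk v),
      aL2 hn (Ph hk P z) (cof k hn (Phi n q k hk z.2)) (Phi n q k hk (dil z.1 v))) := by
  unfold alph
  rw [if_neg hz]
  rfl

theorem modelPi_top {n q k : ℕ} (hn : q < n) (s : ℝ) (x y : Fin n → ℝ)
    (h : ∀ j : Fin n, (j : ℕ) < q + 1 → y j = s * x j) :
    modelPi n q k y = s • modelPi n q k x := by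
  funext J
  rw [Pi.smul_apply, smul_eq_mul]
  by_cases hJ : J.1 ⊆ topIdx n q
  · obtain ⟨j, rfl⟩ := eq_tI_of_subset hn J hJ
    rw [modelPi_tI, modelPi_tI, h _ j.2]
    ring
  · rw [modelPi_not J hJ, modelPi_not J hJ, mul_zero]

theorem cof_dil {n q k : ℕ} (hn : q < n) (hk : k ≤ q + 1) (s : ℝ)
    (p : (XX n k × YY n q k) × ZZ n q) :
    cof k hn (Phi n q k hk (dil s p)) = s • cof k hn (Phi n q k hk p) := by
  funext j
  rw [Pi.smul_apply, smul_eq_mul]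
  unfold cof
  rw [Phi_dil hk s p _ j.2]
  ring

theorem eps_sq {n : ℕ} (k : ℕ) (j : Fin n) : eps k j * eps k j = 1 := by
  unfold eps
  split_ifs <;> norm_num

theorem cof_ne {n q k : ℕ} (hn : q < n) (hk : k ≤ q + 1)
    (p : (XX n k × YY n q k) × ZZ n q) (hp : p.1 ≠ 0) :
    ∑ j, cof k hn (Phi n q k hk p) j ^ 2 ≠ 0 := by
  intro h
  apply hp
  rw [Phi_top hk]
  intro j hj
  obtain ⟨i, rfl⟩ := io_surj hn hj
  have := (Finset.sum_eq_zero_iff_of_nonneg (fun i _ => sq_nonneg _)).1 h i (Finset.mem_univ _)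
  have h2 : cof k hn (Phi n q k hk p) i = 0 := by
    rw [sq_eq_zero_iff] at this; exact this
  unfold cof at h2
  have h3 : eps k (io hn i) ≠ 0 := by
    intro h
    have := eps_sq k (io hn i)
    rw [h] at this
    norm_num at this
  have h4 : ((-1 : ℝ) ^ (i : ℕ)) ≠ 0 := pow_ne_zero _ (by norm_num)
  simpa [h3, h4] using h2

theorem B0_dil {n q k : ℕ} (hn : q < n) (hk : k ≤ q + 1) (s : ℝ) (w : MultiVec n q)
    (v : (XX n k × YY n q k) × ZZ n q) :
    B0 hn w (Phi n q k hk (dil s v)) = s * B0 hn w (Phi n q k hk v) := by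
  rw [B0_apply, B0_apply, Finset.mul_sum]
  refine Finset.sum_congr rfl fun i _ => ?_
  rw [Phi_dil hk s v _ i.2]
  ring

theorem Ph_pos {n q k : ℕ} (hn : q < n) (hk : k ≤ q + 1) (P : (Fin n → ℝ) → MultiVec n q)
    (s : ℝ) (hs : 0 < s) (p : (XX n k × YY n q k) × ZZ n q) :
    P (Phi n q k hk (dil s p)) = s • Ph hk P (s, p) := by
  unfold Ph bl
  simp only [if_pos hs]
  rw [smul_add, smul_smul, mul_inv_cancel₀ hs.ne', one_smul,
    ← modelPi_top hn s (Phi n q k hk p) (Phi n q k hk (dil s p)) (Phi_dil hk s p)]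
  change _ = _ + (P (Phi n q k hk (dil s p)) - modelPi n q k (Phi n q k hk (dil s p)))
  abel

theorem Ph_neg {n q k : ℕ} (hk : k ≤ q + 1) (P : (Fin n → ℝ) → MultiVec n q)
    (s : ℝ) (hs : s ≤ 0) (p : (XX n k × YY n q k) × ZZ n q) :
    Ph hk P (s, p) = modelPi n q k (Phi n q k hk p) := by
  unfold Ph
  rw [bl_zero _ _ hs, smul_zero, add_zero]

theorem alph_neg {n q k : ℕ} (hn : q < n) (hq : 0 < q) (hk : k ≤ q + 1)
    (P : (Fin n → ℝ) → MultiVec n q)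
    (s : ℝ) (hs : s ≤ 0) (p : (XX n k × YY n q k) × ZZ n q) :
    alph hn hk P (s, p) = fderiv ℝ F0 p := by
  by_cases hp : p.1 = 0
  · unfold alph
    rw [if_pos hp]
  · refine ContinuousLinearMap.ext fun v => ?_
    rw [alph_apply hn hk P (s, p) hp, F0_fderiv, Ph_neg hk P s hs, B0_model, F0_eq hn hk]
    refine Prod.ext rfl ?_
    funext l
    change aL2 hn (modelPi n q k (Phi n q k hk p)) (cof k hn (Phi n q k hk p))
      (Phi n q k hk (dil s v)) l = v.2 l
    rw [aL2_apply, inv_mul_eq_iff_eq_mul₀ (cof_ne hn hk p hp), Finset.sum_mul]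
    refine Finset.sum_congr rfl fun j _ => ?_
    rw [B1_model hn hq l.1 l.2, Phi_dil_z hk s v l.1 l.2, Phi_z]
    ring

theorem alph_pos {n q k : ℕ} (hn : q < n) (hk : k ≤ q + 1)
    (P : (Fin n → ℝ) → MultiVec n q)
    (s : ℝ) (hs : 0 < s) (p v : (XX n k × YY n q k) × ZZ n q) (hp : p.1 ≠ 0) :
    alp hn hk P (dil s p) (dil s v) = wt s (alph hn hk P (s, p) v) := by
  rw [alph_apply hn hk P (s, p) hp, alp_apply, Ph_pos hn hk P s hs, cof_dil, aL2_smul _ _ _ _ hs.ne',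
    B0_dil, map_smul, LinearMap.smul_apply, smul_eq_mul]
  unfold wt
  refine Prod.ext ?_ rfl
  simp only
  ring

theorem Ph_smooth {n q k : ℕ} (hn : q < n) (hk : k ≤ q + 1) {P : (Fin n → ℝ) → MultiVec n q}
    {U : Set (Fin n → ℝ)} (hU : IsOpen U) (hP : ContDiffOn ℝ ∞ P U)
    (hflat : ∀ x ∈ U, (∀ j : Fin n, (j : ℕ) < q + 1 → x j = 0) →
      ∀ l : ℕ, iteratedFDerivWithin ℝ l (fun z => P z - modelPi n q k z) U x = 0) :
    ContDiffOn ℝ ∞ (Ph hk P) {z | Phi n q k hk (dil z.1 z.2) ∈ U} := by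
  have hm : ContDiff ℝ ∞ (modelPi n q k) := by
    rw [contDiff_pi]
    intro J
    unfold modelPi
    refine ContDiff.sum fun j _ => ?_
    split_ifs
    · exact contDiff_const.mul (contDiff_apply ℝ ℝ j)
    · exact contDiff_const
  set R : (Fin n → ℝ) → MultiVec n q := fun z => P z - modelPi n q k z with hR
  have hRs : ContDiffOn ℝ ∞ R U := hP.sub hm.contDiffOn
  set Φ := Phi n q k hk with hΦ
  have hU' : IsOpen (Φ ⁻¹' U) := hU.preimage Φ.continuous
  have hb := bl_forward (g := R ∘ Φ) hU' (hRs.comp Φ.contDiff.contDiffOn fun x hx => hx) (by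
    intro l x hx hx1
    rw [← iteratedFDerivWithin_of_isOpen l hU' hx,
      Φ.iteratedFDerivWithin_comp_right R hU.uniqueDiffOn hx,
      hflat _ hx ((Phi_top hk x).1 hx1)]
    ext m
    rfl)
  have hO : IsOpen {z : ℝ × ((XX n k × YY n q k) × ZZ n q) | Φ (dil z.1 z.2) ∈ U} := by
    have hc : Continuous fun z : ℝ × ((XX n k × YY n q k) × ZZ n q) => Φ (dil z.1 z.2) := by
      unfold dil
      fun_prop
    exact hU.preimage hc
  have hd := division hO hb (fun p hp => bl_zero _ p hp)
  exact ((hm.comp Φ.contDiff).comp contDiff_snd).contDiffOn.add hd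

theorem alph_smooth {n q k : ℕ} (hn : q < n) (hk : k ≤ q + 1) {P : (Fin n → ℝ) → MultiVec n q}
    {U : Set (Fin n → ℝ)} (hU : IsOpen U) (hP : ContDiffOn ℝ ∞ P U)
    (hflat : ∀ x ∈ U, (∀ j : Fin n, (j : ℕ) < q + 1 → x j = 0) →
      ∀ l : ℕ, iteratedFDerivWithin ℝ l (fun z => P z - modelPi n q k z) U x = 0) :
    ContDiffOn ℝ ∞ (alph hn hk P) ({z | Phi n q k hk (dil z.1 z.2) ∈ U} ∩ {z | z.2.1 ≠ 0}) := by
  rw [contDiffOn_clm_apply]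
  intro v
  have hPh := (Ph_smooth hn hk hU hP hflat).mono
    (inter_subset_left (t := {z | z.2.1 ≠ 0}))
  have hcof : ∀ j, ContDiff ℝ ∞ (fun z : ℝ × ((XX n k × YY n q k) × ZZ n q) =>
      cof k hn (Phi n q k hk z.2) j) := by
    intro j
    unfold cof
    exact contDiff_const.mul ((contDiff_apply ℝ ℝ (io hn j)).comp
      ((Phi n q k hk).contDiff.comp contDiff_snd))
  have hw : ContDiff ℝ ∞ (fun z : ℝ × ((XX n k × YY n q k) × ZZ n q) =>
      Phi n q k hk (dil z.1 v)) := by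
    refine (Phi n q k hk).contDiff.comp ?_
    unfold dil
    fun_prop
  refine ContDiffOn.congr (f := fun z => (B0 hn (Ph hk P z) (Phi n q k hk v),
      aL2 hn (Ph hk P z) (cof k hn (Phi n q k hk z.2)) (Phi n q k hk (dil z.1 v)))) ?_
    (fun z hz => alph_apply hn hk P z hz.2 v)
  refine ContDiffOn.prodMk ?_ ?_
  · exact ((B0 hn).toContinuousBilinearMap.contDiff.comp_contDiffOn hPh).clm_apply contDiffOn_const
  · rw [contDiffOn_pi]
    intro l
    simp only [aL2_apply]
    refine ContDiffOn.mul (ContDiffOn.inv ?_ ?_) ?_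
    · exact ContDiffOn.sum fun j _ => ((hcof j).pow 2).contDiffOn
    · intro z hz
      exact cof_ne hn hk z.2 hz.2
    · refine ContDiffOn.sum fun j _ => ((hcof j).contDiffOn).mul ?_
      exact ((B1 hn l.1 j).toContinuousBilinearMap.contDiff.comp_contDiffOn hPh).clm_apply
        hw.contDiffOn

end M7f
end NambuLin
end FileM7f

section FileM7g
open scoped ContDiff
open MeasureTheory Set Filter Topology
namespace NambuLin
section M7g
set_option linter.unusedSectionVars false
set_option maxSynthPendingDepth 3

/-- the domain -/
def OO {n q k : ℕ} (hn : q < n) (hk : k ≤ q + 1) (P : (Fin n → ℝ) → MultiVec n q)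
    (U : Set (Fin n → ℝ)) : Set (ℝ × ((XX n k × YY n q k) × ZZ n q)) :=
  ({z | Phi n q k hk (dil z.1 z.2) ∈ U} ∩ {z | z.2.1 ≠ 0}) ∩
    alph hn hk P ⁻¹' {f | Function.Surjective f}

theorem alp_surj {n q k : ℕ} (hn : q < n) (hk : k ≤ q + 1) (P : (Fin n → ℝ) → MultiVec n q)
    (U : Set (Fin n → ℝ)) (s : ℝ) (hs : 0 < s) (p : (XX n k × YY n q k) × ZZ n q)
    (h : (s, p) ∈ OO hn hk P U) : Function.Surjective (alp hn hk P (dil s p)) := by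
  intro a
  obtain ⟨v, hv⟩ := h.2 (wt s⁻¹ a)
  refine ⟨dil s v, ?_⟩
  rw [alph_pos hn hk P s hs p v h.1.2, hv]
  unfold wt
  refine Prod.ext ?_ rfl
  simp only
  field_simp

theorem ker_alp {n q k : ℕ} (hn : q < n) (hk : k ≤ q + 1) (P : (Fin n → ℝ) → MultiVec n q)
    (p : (XX n k × YY n q k) × ZZ n q) (hs : Function.Surjective (alp hn hk P p))
    {L : Submodule ℝ (Fin n → ℝ)} (hL : Decomp (P (Phi n q k hk p)) L)
    (v : (XX n k × YY n q k) × ZZ n q) : Phi n q k hk v ∈ L ↔ alp hn hk P p v = 0 := by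
  set A : (Fin n → ℝ) →ₗ[ℝ] ℝ × ZZ n q := (B0 hn (P (Phi n q k hk p))).prod
    (aL2 hn (P (Phi n q k hk p)) (cof k hn (Phi n q k hk p))) with hA
  have hAs : Function.Surjective A := by
    intro a
    obtain ⟨v, hv⟩ := hs a
    exact ⟨Phi n q k hk v, hv⟩
  have hle : L ≤ LinearMap.ker A := by
    intro u hu
    rw [LinearMap.mem_ker]
    refine Prod.ext (B0_mem hn hL hu) ?_
    funext l
    change aL2 hn (P (Phi n q k hk p)) (cof k hn (Phi n q k hk p)) u l = 0
    rw [aL2_apply]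
    refine mul_eq_zero_of_right _ (Finset.sum_eq_zero fun j _ => ?_)
    rw [B1_mem hn l.1 j hL hu, mul_zero]
  have hf : Module.finrank ℝ (LinearMap.ker A) = q := by
    have := LinearMap.finrank_range_add_finrank_ker A
    rw [LinearMap.range_eq_top.2 hAs, finrank_top, Module.finrank_prod, Module.finrank_self,
      Module.finrank_fintype_fun_eq_card, card_z hn, Module.finrank_fin_fun] at this
    omega
  have heq : L = LinearMap.ker A :=
    Submodule.eq_of_le_of_finrank_eq hle (by rw [hf, hL.finrank])
  rw [heq, LinearMap.mem_ker]
  rfl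

theorem F0_surj {X Y Z : Type} [NormedAddCommGroup X] [InnerProductSpace ℝ X]
    [FiniteDimensional ℝ X] [NormedAddCommGroup Y]
    [InnerProductSpace ℝ Y] [FiniteDimensional ℝ Y] [NormedAddCommGroup Z] [NormedSpace ℝ Z]
    [FiniteDimensional ℝ Z] (x : X) (y : Y) (z : Z)
    (hxy : (x, y) ≠ 0) :
    Function.Surjective (fderiv ℝ (F0 : (X × Y) × Z → ℝ × Z) ((x, y), z)) := by
  intro a
  have : x ≠ 0 ∨ y ≠ 0 := by
    by_contra hh
    push Not at hh
    exact hxy (Prod.ext hh.1 hh.2)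
  rcases this with hx | hy
  · have hx' : (inner ℝ x x : ℝ) ≠ 0 := inner_self_ne_zero.2 hx
    refine ⟨(((a.1 / inner ℝ x x) • x, 0), a.2), ?_⟩
    rw [F0_fderiv]
    refine Prod.ext ?_ rfl
    simp only [inner_smul_right, inner_zero_right, sub_zero]
    field_simp
  · have hy' : (inner ℝ y y : ℝ) ≠ 0 := inner_self_ne_zero.2 hy
    refine ⟨((0, (-a.1 / inner ℝ y y) • y), a.2), ?_⟩
    rw [F0_fderiv]
    refine Prod.ext ?_ rfl
    simp only [inner_smul_right, inner_zero_right, zero_sub]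
    field_simp
    try ring

set_option maxHeartbeats 1600000 in
theorem setup {n q k : ℕ} (hn : q < n) (hq : 0 < q) (hk : k ≤ q + 1)
    {P : (Fin n → ℝ) → MultiVec n q}
    {U : Set (Fin n → ℝ)} (hU : IsOpen U) (h0 : (0 : Fin n → ℝ) ∈ U) (hN : IsNambu n q P U)
    (hflat : ∀ x ∈ U, (∀ j : Fin n, (j : ℕ) < q + 1 → x j = 0) →
      ∀ l : ℕ, iteratedFDerivWithin ℝ l (fun z => P z - modelPi n q k z) U x = 0) :
    Setup (alp (k := k) hn hk P) (alph hn hk P) (OO hn hk P U) (Fin n → ℝ) := by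
  have hsm := alph_smooth hn hk hU hN.1 hflat
  have hO1 : IsOpen ({z : ℝ × ((XX n k × YY n q k) × ZZ n q) | Phi n q k hk (dil z.1 z.2) ∈ U} ∩
      {z | z.2.1 ≠ 0}) := by
    have hc : Continuous fun z : ℝ × ((XX n k × YY n q k) × ZZ n q) =>
        Phi n q k hk (dil z.1 z.2) := by
      unfold dil
      fun_prop
    refine (hU.preimage hc).inter (isOpen_ne_fun ?_ continuous_const)
    fun_prop
  have hO : IsOpen (OO hn hk P U) := hsm.continuousOn.isOpen_inter_preimage hO1 isOpen_surj
  refine ⟨hO, hsm.mono inter_subset_left, fun s p hs => alph_neg hn hq hk P s hs p,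
    fun s p v h hs => alph_pos hn hk P s hs p v h.1.2, ?_, ?_⟩
  · intro x y hxy
    refine ⟨⟨?_, hxy⟩, ?_⟩
    · change Phi n q k hk (dil 0 ((x, y), 0)) ∈ U
      have : dil 0 ((x, y), (0 : ZZ n q)) = 0 := by
        unfold dil
        rw [zero_smul]
        rfl
      rw [this, ContinuousLinearEquiv.map_zero]
      exact h0
    · change Function.Surjective (alph hn hk P (0, ((x, y), 0)))
      rw [alph_neg hn hq hk P 0 le_rfl]
      exact F0_surj x y 0 hxy
  · intro s p hsp hs
    have hP0 : P (Phi n q k hk (dil s p)) ≠ 0 := by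
      intro h
      obtain ⟨v, hv⟩ := alp_surj hn hk P U s hs p hsp ((1 : ℝ), (0 : ZZ n q))
      rw [alp_apply, h, map_zero, LinearMap.zero_apply] at hv
      exact zero_ne_one (congrArg Prod.fst hv)
    obtain ⟨h, hh⟩ := nambu_local hn.le hN hsp.1.1 hP0
    refine ⟨fun p' => h (Phi n q k hk p'), ?_⟩
    have h1 : ∀ᶠ p' in 𝓝 (dil s p), (s, dil s⁻¹ p') ∈ OO hn hk P U := by
      have hc : Continuous fun p' : (XX n k × YY n q k) × ZZ n q => (s, dil s⁻¹ p') := by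
        unfold dil
        fun_prop
      refine hc.continuousAt.eventually (hO.mem_nhds ?_)
      change (s, dil s⁻¹ (dil s p)) ∈ OO hn hk P U
      rw [dil_dil, inv_mul_cancel₀ hs.ne', dil_one]
      exact hsp
    have h2 := (Phi n q k hk).continuous.continuousAt.eventually hh
    filter_upwards [h1, h2] with p' hp1 hp2
    refine ⟨hp2.1.comp p' (Phi n q k hk).differentiableAt, fun v => ?_⟩
    have hsurj := alp_surj hn hk P U s hs _ hp1
    rw [dil_dil, mul_inv_cancel₀ hs.ne', dil_one] at hsurj
    rw [← ker_alp hn hk P p' hsurj hp2.2 v, LinearMap.mem_ker]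
    have : fderiv ℝ (fun p' => h (Phi n q k hk p')) p' v =
        fderiv ℝ h (Phi n q k hk p') (Phi n q k hk v) := by
      rw [show (fun p' => h (Phi n q k hk p')) = h ∘ (Phi n q k hk) from rfl,
        fderiv_comp p' hp2.1 (Phi n q k hk).differentiableAt, (Phi n q k hk).fderiv]
      rfl
    rw [this]
    rfl

end M7g
end NambuLin
end FileM7g

section FileM7h
open scoped ContDiff
open MeasureTheory Set Filter Topology
namespace NambuLin
section M7h
set_option linter.unusedSectionVars false
set_option maxSynthPendingDepth 3

theorem P_zero {n q k : ℕ} (hn : q < n)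
    {P : (Fin n → ℝ) → MultiVec n q} {U : Set (Fin n → ℝ)}
    (hflat : ∀ x ∈ U, (∀ j : Fin n, (j : ℕ) < q + 1 → x j = 0) →
      ∀ l : ℕ, iteratedFDerivWithin ℝ l (fun z => P z - modelPi n q k z) U x = 0)
    {x : Fin n → ℝ} (hx : x ∈ U) (hxt : ∀ j : Fin n, (j : ℕ) < q + 1 → x j = 0) : P x = 0 := by
  have h1 := hflat x hx hxt 0
  have h2 : P x - modelPi n q k x = 0 := by
    have := congrArg (fun m => m 0) h1
    simpa using this
  have h3 : modelPi n q k x = (0 : ℝ) • modelPi n q k 0 :=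
    modelPi_top hn 0 0 x (fun j hj => by rw [hxt j hj, zero_mul])
  rw [h3, zero_smul, sub_zero] at h2
  exact h2

theorem orthon {n k : ℕ} (hk3 : 3 ≤ k) (hkn : k ≤ n) : ∃ N e e' : XX n k, ‖N‖ = 1 ∧ ‖e‖ = 1 ∧
    ‖e'‖ = 1 ∧ (inner ℝ N e : ℝ) = 0 ∧ (inner ℝ N e' : ℝ) = 0 ∧ (inner ℝ e e' : ℝ) = 0 := by
  set i0 : {j : Fin n // (j : ℕ) < k} := ⟨⟨0, by omega⟩, by simp; omega⟩
  set i1 : {j : Fin n // (j : ℕ) < k} := ⟨⟨1, by omega⟩, by simp; omega⟩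
  set i2 : {j : Fin n // (j : ℕ) < k} := ⟨⟨2, by omega⟩, by simp; omega⟩
  have h01 : i0 ≠ i1 := fun h => by
    have := congrArg (fun j : {j : Fin n // (j : ℕ) < k} => (j.1 : ℕ)) h
    simp [i0, i1] at this
  have h02 : i0 ≠ i2 := fun h => by
    have := congrArg (fun j : {j : Fin n // (j : ℕ) < k} => (j.1 : ℕ)) h
    simp [i0, i2] at this
  have h12 : i1 ≠ i2 := fun h => by
    have := congrArg (fun j : {j : Fin n // (j : ℕ) < k} => (j.1 : ℕ)) h
    simp [i1, i2] at this
  refine ⟨EuclideanSpace.single i0 1, EuclideanSpace.single i1 1, EuclideanSpace.single i2 1,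
    by simp, by simp, by simp, ?_, ?_, ?_⟩ <;>
    rw [EuclideanSpace.inner_single_left] <;>
    simp only [EuclideanSpace.single, PiLp.toLp_apply, map_one, one_mul]
  · exact Pi.single_eq_of_ne h01 (1 : ℝ)
  · exact Pi.single_eq_of_ne h02 (1 : ℝ)
  · exact Pi.single_eq_of_ne h12 (1 : ℝ)

theorem step0 {n q k : ℕ} (hn : q < n) (hk3 : 3 ≤ k) (hkq : k ≤ q)
    {P : (Fin n → ℝ) → MultiVec n q}
    {U : Set (Fin n → ℝ)} (hU : IsOpen U) (h0 : (0 : Fin n → ℝ) ∈ U) (hN : IsNambu n q P U)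
    (hflat : ∀ x ∈ U, (∀ j : Fin n, (j : ℕ) < q + 1 → x j = 0) →
      ∀ l : ℕ, iteratedFDerivWithin ℝ l (fun z => P z - modelPi n q k z) U x = 0) :
    ∃ (Q : (Fin n → ℝ) → ℝ) (ζ : (Fin n → ℝ) → (Fin n → ℝ)) (N : Set (Fin n → ℝ)),
      IsOpen N ∧ 0 ∈ N ∧ N ⊆ U ∧ ContDiffOn ℝ ∞ Q N ∧ ContDiffOn ℝ ∞ ζ N ∧
      fderiv ℝ Q 0 = 0 ∧ (∀ u v, fderiv ℝ (fderiv ℝ Q) 0 u v =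
        ∑ i : Fin (q + 1), eps k (io hn i) * u (io hn i) * v (io hn i)) ∧
      ζ 0 = 0 ∧ HasFDerivAt ζ (ContinuousLinearMap.id ℝ (Fin n → ℝ)) 0 ∧
      (∀ x, ∀ j : Fin n, (j : ℕ) < q + 1 → ζ x j = x j) ∧
      ∀ x ∈ N, P x ≠ 0 → ∃ L, Decomp (P x) L ∧ ∀ u ∈ L,
        (∀ j : Fin n, k ≤ (j : ℕ) → (j : ℕ) < q + 1 → u j = 0) →
        fderiv ℝ Q x u = 0 ∧ ∀ l : Fin n, q < (l : ℕ) → fderiv ℝ ζ x u l = 0 := by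
  have hk : k ≤ q + 1 := by omega
  obtain ⟨o1, o2, o3, ho1, ho2, ho3, ho4, ho5, ho6⟩ := orthon hk3 (show k ≤ n by omega)
  obtain ⟨g, ε, hε, hg, hg0, hg1, hg2, hgk⟩ :=
    (setup hn (by omega) hk hU h0 hN hflat).theoremI ho1 ho2 ho3 ho4 ho5 ho6
  set Φ := Phi n q k hk with hΦ
  set Ψ := Φ.symm with hΨ
  set N : Set (Fin n → ℝ) := U ∩ Ψ ⁻¹' Metric.ball 0 ε with hNd
  have hNo : IsOpen N := hU.inter (Metric.isOpen_ball.preimage Ψ.continuous)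
  have hΨ0 : Ψ 0 = 0 := Ψ.map_zero
  have h0N : 0 ∈ N := ⟨h0, by
    change Ψ 0 ∈ Metric.ball 0 ε
    rw [hΨ0]; exact Metric.mem_ball_self hε⟩
  set Fv : (Fin n → ℝ) → ℝ × ZZ n q := fun x => F0 (Ψ x) + g (Ψ x) with hFv
  have hgd : ∀ x ∈ N, DifferentiableAt ℝ g (Ψ x) := fun x hx =>
    (hg.contDiffAt (Metric.isOpen_ball.mem_nhds hx.2)).differentiableAt (by simp)
  have hFd : ∀ x ∈ N, HasFDerivAt Fv ((fderiv ℝ F0 (Ψ x) + fderiv ℝ g (Ψ x)).comp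
      (Ψ : (Fin n → ℝ) →L[ℝ] (XX n k × YY n q k) × ZZ n q)) x := by
    intro x hx
    exact HasFDerivAt.comp (g := fun p => F0 p + g p) (f := fun x => Ψ x) x
      (((F0_contDiff.differentiable (by simp) _).hasFDerivAt).add (hgd x hx).hasFDerivAt)
      Ψ.hasFDerivAt
  have hFs : ContDiffOn ℝ ∞ Fv N :=
    ((F0_contDiff.comp Ψ.contDiff).contDiffOn).add
      (hg.comp Ψ.contDiff.contDiffOn fun x hx => hx.2)
  set T : ((Fin n → ℝ) × (ℝ × ZZ n q)) →L[ℝ] (Fin n → ℝ) :=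
    (Φ : ((XX n k × YY n q k) × ZZ n q) →L[ℝ] (Fin n → ℝ)).comp
      (((ContinuousLinearMap.fst ℝ _ _).comp ((Ψ : (Fin n → ℝ) →L[ℝ] (XX n k × YY n q k) × ZZ n q).comp
        (ContinuousLinearMap.fst ℝ _ _))).prod
      ((ContinuousLinearMap.snd ℝ _ _).comp (ContinuousLinearMap.snd ℝ _ _))) with hT
  have hTa : ∀ a b, T (a, b) = Φ ((Ψ a).1, b.2) := fun a b => rfl
  have hTz : ∀ a b (l : {l : Fin n // q < (l : ℕ)}), T (a, b) l.1 = b.2 l := by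
    intro a b l
    rw [hTa, hΦ, Phi_z]
  have hTt : ∀ a b (j : Fin n), (j : ℕ) < q + 1 → T (a, b) j = a j := by
    intro a b j hj
    have h1 : T (a, b) - a = Φ ((0, b.2 - (Ψ a).2)) := by
      have : a = Φ (Ψ a) := (Φ.apply_symm_apply a).symm
      conv_lhs => rw [this, hTa, ← map_sub]
      congr 1
      rw [hΨ, ContinuousLinearEquiv.symm_apply_apply]
      refine Prod.ext ?_ rfl
      simp
    have h2 := (Phi_top hk ((0, b.2 - (Ψ a).2) : (XX n k × YY n q k) × ZZ n q)).1 rfl j hj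
    have h3 := congrFun h1 j
    rw [Pi.sub_apply, h2] at h3
    linarith
  have hζd : ∀ x ∈ N, HasFDerivAt (fun x => T (x, Fv x))
      (T.comp ((ContinuousLinearMap.id ℝ _).prod ((fderiv ℝ F0 (Ψ x) + fderiv ℝ g (Ψ x)).comp
      (Ψ : (Fin n → ℝ) →L[ℝ] (XX n k × YY n q k) × ZZ n q)))) x := by
    intro x hx
    exact T.hasFDerivAt.comp x ((hasFDerivAt_id x).prodMk (hFd x hx))
  have hQd : ∀ x ∈ N, HasFDerivAt (fun x => (Fv x).1) ((ContinuousLinearMap.fst ℝ _ _).comp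
      ((fderiv ℝ F0 (Ψ x) + fderiv ℝ g (Ψ x)).comp (Ψ : (Fin n → ℝ) →L[ℝ] (XX n k × YY n q k) × ZZ n q))) x := by
    intro x hx
    exact (ContinuousLinearMap.fst ℝ ℝ (ZZ n q)).hasFDerivAt.comp x (hFd x hx)
  have hD1 : ∀ x u, ((fderiv ℝ F0 (Ψ x) + fderiv ℝ g (Ψ x)) (Ψ u)).1 =
      ∑ i : Fin (q + 1), eps k (io hn i) * x (io hn i) * u (io hn i) +
        (fderiv ℝ g (Ψ x) (Ψ u)).1 := by
    intro x u
    rw [ContinuousLinearMap.add_apply, Prod.fst_add, F0_fderiv, F0_eq hn hk,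
      ← hΦ, Φ.apply_symm_apply, Φ.apply_symm_apply]
  have hQs : ContDiffOn ℝ ∞ (fun x => (Fv x).1) N := hFs.fst
  refine ⟨fun x => (Fv x).1, fun x => T (x, Fv x), N, hNo, h0N, inter_subset_left,
    hQs, T.contDiff.comp_contDiffOn (contDiffOn_id.prodMk hFs), ?_, ?_, ?_, ?_, ?_, ?_⟩
  · rw [(hQd 0 h0N).fderiv]
    refine ContinuousLinearMap.ext fun u => ?_
    change ((fderiv ℝ F0 (Ψ 0) + fderiv ℝ g (Ψ 0)) (Ψ u)).1 = 0
    rw [hD1, hΨ0, hg1]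
    simp
  · intro u v
    have hd2 : DifferentiableAt ℝ (fderiv ℝ (fun x => (Fv x).1)) 0 := by
      have := (hQs.contDiffAt (hNo.mem_nhds h0N)).fderiv_right (m := 1) (by
        exact WithTop.coe_le_coe.2 le_top)
      exact this.differentiableAt (by simp)
    have hgd2 : DifferentiableAt ℝ (fderiv ℝ g) 0 := by
      have := (hg.contDiffAt (Metric.isOpen_ball.mem_nhds (Metric.mem_ball_self hε))).fderiv_right
        (m := 1) (by exact WithTop.coe_le_coe.2 le_top)
      exact this.differentiableAt (by simp)
    have h1 : HasFDerivAt (fun x => fderiv ℝ (fun x => (Fv x).1) x v)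
        ((ContinuousLinearMap.apply ℝ ℝ v).comp (fderiv ℝ (fderiv ℝ (fun x => (Fv x).1)) 0)) 0 :=
      (ContinuousLinearMap.apply ℝ ℝ v).hasFDerivAt.comp (0 : Fin n → ℝ) hd2.hasFDerivAt
    have h2 : (fun x => fderiv ℝ (fun x => (Fv x).1) x v) =ᶠ[𝓝 0]
        fun x => (∑ i : Fin (q + 1), (eps k (io hn i) * v (io hn i)) •
          (ContinuousLinearMap.proj (R := ℝ) (φ := fun _ : Fin n => ℝ) (io hn i))) x +
            (fderiv ℝ g (Ψ x) (Ψ v)).1 := by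
      filter_upwards [hNo.mem_nhds h0N] with x hx
      rw [(hQd x hx).fderiv]
      change ((fderiv ℝ F0 (Ψ x) + fderiv ℝ g (Ψ x)) (Ψ v)).1 = _
      rw [hD1, ContinuousLinearMap.sum_apply]
      congr 1
      refine Finset.sum_congr rfl fun i _ => ?_
      rw [ContinuousLinearMap.smul_apply, ContinuousLinearMap.proj_apply, smul_eq_mul]
      ring
    have h3 : HasFDerivAt (fun x => (fderiv ℝ g (Ψ x) (Ψ v)).1) (0 : (Fin n → ℝ) →L[ℝ] ℝ) 0 := by
      have ha : HasFDerivAt (fderiv ℝ g) (0 : _ →L[ℝ] _) (Ψ 0) := by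
        rw [hΨ0, ← hg2]; exact hgd2.hasFDerivAt
      have hb := HasFDerivAt.comp (g := fderiv ℝ g) (f := fun x => Ψ x) (0 : Fin n → ℝ) ha Ψ.hasFDerivAt
      have hc := ((ContinuousLinearMap.fst ℝ ℝ (ZZ n q)).comp
        (ContinuousLinearMap.apply ℝ (ℝ × ZZ n q) (Ψ v))).hasFDerivAt.comp (0 : Fin n → ℝ) hb
      refine hc.congr_fderiv ?_
      refine ContinuousLinearMap.ext fun a => ?_
      simp
    have h4 := ((ContinuousLinearMap.hasFDerivAt (∑ i : Fin (q + 1), (eps k (io hn i) * v (io hn i)) •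
          (ContinuousLinearMap.proj (R := ℝ) (φ := fun _ : Fin n => ℝ) (io hn i)))
          (x := (0 : Fin n → ℝ))).add h3).congr_of_eventuallyEq h2
    have h5 := congrArg (fun M => M u) (h1.unique h4)
    change fderiv ℝ (fderiv ℝ (fun x => (Fv x).1)) 0 u v = _ at h5
    rw [h5]
    simp only [add_zero, ContinuousLinearMap.sum_apply]
    refine Finset.sum_congr rfl fun i _ => ?_
    rw [ContinuousLinearMap.smul_apply, ContinuousLinearMap.proj_apply, smul_eq_mul]
    ring
  · have : Fv 0 = 0 := by
      rw [hFv]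
      simp only
      rw [hΨ0, hg0, add_zero]
      unfold F0
      simp
    change T (0, Fv 0) = 0
    rw [this]
    exact T.map_zero
  · refine (hζd 0 h0N).congr_fderiv ?_
    refine ContinuousLinearMap.ext fun u => ?_
    change T (u, (fderiv ℝ F0 (Ψ 0) + fderiv ℝ g (Ψ 0)) (Ψ u)) = u
    rw [hΨ0, hg1, add_zero, hTa, F0_fderiv]
    exact Φ.apply_symm_apply u
  · intro x j hj
    exact hTt _ _ j hj
  · intro x hx hPx
    obtain ⟨h, hh⟩ := nambu_local hn.le hN hx.1 hPx
    obtain ⟨-, hL⟩ := hh.self_of_nhds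
    refine ⟨_, hL, fun u hu hus => ?_⟩
    have hne : (Ψ x).1 ≠ 0 := by
      intro hc
      apply hPx
      refine P_zero hn hflat hx.1 ?_
      have := (Phi_top hk (Ψ x)).1 hc
      rwa [← hΦ, Φ.apply_symm_apply] at this
    have hy : (Ψ u).1.2 = 0 := by
      ext j
      have := Phi_y hk (Ψ u) j
      rw [← hΦ, Φ.apply_symm_apply] at this
      rw [← this, hus j.1 j.2.1 j.2.2]
      rfl
    have hal : alp hn hk P (Ψ x) (Ψ u) = 0 := by
      rw [alp_apply, ← hΦ, Φ.apply_symm_apply, Φ.apply_symm_apply]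
      refine Prod.ext (B0_mem hn hL hu) ?_
      funext l
      change aL2 hn (P x) (cof k hn x) u l = 0
      rw [aL2_apply]
      refine mul_eq_zero_of_right _ (Finset.sum_eq_zero fun j _ => ?_)
      rw [B1_mem hn l.1 j hL hu, mul_zero]
    have hz := hgk (Ψ x) hx.2 hne (Ψ u) hy hal
    have hz' : (fderiv ℝ F0 (Ψ x) + fderiv ℝ g (Ψ x)) (Ψ u) = 0 := by
      rw [← hz]
      have := (((F0_contDiff.differentiable (by simp) (Ψ x)).hasFDerivAt).add
        (hgd x hx).hasFDerivAt).fderiv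
      exact (congrArg (fun M => M (Ψ u)) this).symm
    constructor
    · rw [(hQd x hx).fderiv]
      change ((fderiv ℝ F0 (Ψ x) + fderiv ℝ g (Ψ x)) (Ψ u)).1 = 0
      rw [hz']
      rfl
    · intro l hl
      rw [(hζd x hx).fderiv]
      change T (u, (fderiv ℝ F0 (Ψ x) + fderiv ℝ g (Ψ x)) (Ψ u)) l = 0
      rw [hz', hTz _ _ ⟨l, hl⟩]
      rfl

end M7h
end NambuLin
end FileM7h

section FileM7i
open scoped ContDiff
open MeasureTheory Set Filter Topology
namespace NambuLin
section M7i
set_option linter.unusedSectionVars false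
set_option maxSynthPendingDepth 3

/-- the coordinates other than `x`. -/
abbrev WW (n k : ℕ) := {j : Fin n // ¬ (j : ℕ) < k} → ℝ

/-- splitting of coordinates into two blocks. -/
noncomputable def ThetaL (n k : ℕ) : (XX n k × WW n k) ≃ₗ[ℝ] (Fin n → ℝ) where
  toFun p := fun j => if h : (j : ℕ) < k then p.1 ⟨j, h⟩ else p.2 ⟨j, h⟩
  map_add' a b := by
    funext j
    simp only [Pi.add_apply]
    split_ifs <;> rfl
  map_smul' c a := by
    funext j
    simp only [Pi.smul_apply]
    split_ifs <;> rfl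
  invFun v := (WithLp.toLp 2 fun j => v j.1, fun j => v j.1)
  left_inv p := by
    refine Prod.ext ?_ ?_
    · ext j
      simp only [dif_pos j.2]
    · funext j
      simp only [dif_neg j.2]
  right_inv v := by
    funext j
    simp only
    split_ifs <;> rfl

/-- splitting of coordinates into two blocks, continuous version. -/
noncomputable def Theta (n k : ℕ) : (XX n k × WW n k) ≃L[ℝ] (Fin n → ℝ) :=
  (ThetaL n k).toContinuousLinearEquiv

theorem Theta_x {n k : ℕ} (p : XX n k × WW n k) (j : {j : Fin n // (j : ℕ) < k}) :
    Theta n k p j.1 = p.1 j := dif_pos j.2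

theorem Theta_w {n k : ℕ} (p : XX n k × WW n k) (j : {j : Fin n // ¬ (j : ℕ) < k}) :
    Theta n k p j.1 = p.2 j := dif_neg j.2

theorem Theta_symm_x {n k : ℕ} (v : Fin n → ℝ) (j : {j : Fin n // (j : ℕ) < k}) :
    ((Theta n k).symm v).1 j = v j.1 := rfl

theorem Theta_symm_w {n k : ℕ} (v : Fin n → ℝ) (j : {j : Fin n // ¬ (j : ℕ) < k}) :
    ((Theta n k).symm v).2 j = v j.1 := rfl

theorem hess_comp {E F : Type} [NormedAddCommGroup E] [NormedSpace ℝ E]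
    [NormedAddCommGroup F] [NormedSpace ℝ F] {Q : F → ℝ} {m : E → F} {p : E}
    (hQ : ContDiffAt ℝ 2 Q (m p)) (hm : ContDiffAt ℝ 2 m p) (h0 : fderiv ℝ Q (m p) = 0) (u v : E) :
    fderiv ℝ (fderiv ℝ (fun x => Q (m x))) p u v =
      fderiv ℝ (fderiv ℝ Q) (m p) (fderiv ℝ m p u) (fderiv ℝ m p v) := by
  have e1 : (fderiv ℝ (fun x => Q (m x))) =ᶠ[𝓝 p]
      fun x => (fderiv ℝ Q (m x)).comp (fderiv ℝ m x) := by
    have a1 : ∀ᶠ x in 𝓝 p, ContDiffAt ℝ 2 Q (m x) :=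
      hm.continuousAt.eventually (hQ.eventually (by simp))
    filter_upwards [a1, hm.eventually (by simp)] with x h1 h2
    exact ((h1.differentiableAt (by simp)).hasFDerivAt.comp x
      (h2.differentiableAt (by simp)).hasFDerivAt).fderiv
  rw [e1.fderiv_eq]
  have d1 : DifferentiableAt ℝ (fderiv ℝ Q) (m p) :=
    (hQ.fderiv_right (m := 1) (by norm_num)).differentiableAt (by simp)
  have d2 : DifferentiableAt ℝ (fderiv ℝ m) p :=
    (hm.fderiv_right (m := 1) (by norm_num)).differentiableAt (by simp)
  have d3 : HasFDerivAt (fun x => fderiv ℝ Q (m x)) ((fderiv ℝ (fderiv ℝ Q) (m p)).comp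
      (fderiv ℝ m p)) p := d1.hasFDerivAt.comp p (hm.differentiableAt (by simp)).hasFDerivAt
  rw [(d3.clm_comp d2.hasFDerivAt).fderiv]
  rw [h0]
  simp

theorem fderiv_snd_zero {X W : Type} [NormedAddCommGroup X] [NormedSpace ℝ X]
    [NormedAddCommGroup W] [NormedSpace ℝ W] {h : X × W → ℝ} {c : W → ℝ} {p : X × W}
    {h' : X × W →L[ℝ] ℝ} (hh : HasFDerivAt h h' p) (he : h =ᶠ[𝓝 p] fun p => c p.2) (a : X) :
    h' (a, 0) = 0 := by
  have l1 : HasDerivAt (fun t : ℝ => p + t • ((a, 0) : X × W)) (a, 0) 0 := by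
    have := ((hasDerivAt_id (0:ℝ)).smul_const ((a, 0) : X × W)).const_add p
    simpa using this
  have l0 : p + (0 : ℝ) • ((a, 0) : X × W) = p := by simp
  have l2 : HasDerivAt (fun t : ℝ => h (p + t • ((a, 0) : X × W))) (h' (a, 0)) 0 := by
    have hh2 : HasFDerivAt h h' (p + (0 : ℝ) • ((a, 0) : X × W)) := by rw [l0]; exact hh
    exact hh2.comp_hasDerivAt (0 : ℝ) l1
  have l3 : (fun t : ℝ => h (p + t • ((a, 0) : X × W))) =ᶠ[𝓝 0] fun _ => c p.2 := by
    have : Tendsto (fun t : ℝ => p + t • ((a, 0) : X × W)) (𝓝 0) (𝓝 p) := by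
      have := l1.continuousAt.tendsto
      rwa [l0] at this
    filter_upwards [this.eventually he] with t ht
    rw [ht]
    simp
  exact (l2.congr_of_eventuallyEq l3.symm).unique (hasDerivAt_const _ _)

theorem step1 {n q k : ℕ} (hn : q < n) (hk3 : 3 ≤ k) (hkq : k ≤ q)
    {P : (Fin n → ℝ) → MultiVec n q}
    {U : Set (Fin n → ℝ)} (hU : IsOpen U) (h0 : (0 : Fin n → ℝ) ∈ U) (hN : IsNambu n q P U)
    (hflat : ∀ x ∈ U, (∀ j : Fin n, (j : ℕ) < q + 1 → x j = 0) →
      ∀ l : ℕ, iteratedFDerivWithin ℝ l (fun z => P z - modelPi n q k z) U x = 0) :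
    ∃ e : OpenPartialHomeomorph (Fin n → ℝ) (Fin n → ℝ), 0 ∈ e.source ∧ e.source ⊆ U ∧
      ContDiffOn ℝ ∞ e e.source ∧ ContDiffOn ℝ ∞ e.symm e.target ∧ e 0 = 0 ∧
      HasFDerivAt e (ContinuousLinearMap.id ℝ (Fin n → ℝ)) 0 ∧
      (∀ x, ∀ j : Fin n, k ≤ (j : ℕ) → (j : ℕ) < q + 1 → e x j = x j) ∧
      ∀ x ∈ e.source, P x ≠ 0 → ∃ L, Decomp (P x) L ∧ ∀ u ∈ L,
        (∀ j : Fin n, k ≤ (j : ℕ) → (j : ℕ) < q + 1 → u j = 0) →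
        (∑ j : {j : Fin n // (j : ℕ) < k}, e x j.1 * fderiv ℝ e x u j.1 = 0) ∧
        ∀ l : Fin n, q < (l : ℕ) → fderiv ℝ e x u l = 0 := by
  obtain ⟨Q, ζ, N, hNo, h0N, hNU, hQs, hζs, hQ1, hQ2, hζ0, hζ1, hζt, hker⟩ :=
    step0 hn hk3 hkq hU h0 hN hflat
  obtain ⟨e1, s0, sN, ce, ssm⟩ := ift hNo hζs h0N
    (f' := ContinuousLinearEquiv.refl ℝ (Fin n → ℝ)) hζ1
  set Θ := Theta n k with hΘ
  set m : XX n k × WW n k → (Fin n → ℝ) := fun p => e1.symm (Θ p) with hm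
  set N0 : Set (XX n k × WW n k) := Θ ⁻¹' e1.target with hN0
  have hN0o : IsOpen N0 := e1.open_target.preimage Θ.continuous
  have hΘ0 : Θ 0 = 0 := Θ.map_zero
  have e10 : e1 0 = 0 := by rw [ce]; exact hζ0
  have t0 : (0 : Fin n → ℝ) ∈ e1.target := by
    have := e1.map_source s0
    rwa [e10] at this
  have h0N0 : (0 : XX n k × WW n k) ∈ N0 := by
    change Θ 0 ∈ e1.target
    rw [hΘ0]; exact t0
  have hm0 : m 0 = 0 := by
    change e1.symm (Θ 0) = 0
    rw [hΘ0]
    conv_lhs => rw [← e10]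
    exact e1.left_inv s0
  have hms : ContDiffOn ℝ ∞ m N0 := ssm.comp Θ.contDiff.contDiffOn fun p hp => hp
  have hmN : ∀ p ∈ N0, m p ∈ e1.source := fun p hp => e1.map_target hp
  have hm1 : HasFDerivAt m (Θ : (XX n k × WW n k) →L[ℝ] (Fin n → ℝ)) 0 := by
    have a1 : HasFDerivAt e1.symm (ContinuousLinearEquiv.refl ℝ (Fin n → ℝ) :
        (Fin n → ℝ) →L[ℝ] (Fin n → ℝ)) 0 := by
      have := OpenPartialHomeomorph.hasFDerivAt_symm e1 (a := 0)
        (f' := ContinuousLinearEquiv.refl ℝ (Fin n → ℝ)) t0 (by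
          have hs : e1.symm 0 = 0 := by
            conv_lhs => rw [← e10]
            exact e1.left_inv s0
          rw [hs, ce]
          exact hζ1)
      exact this
    have a2 : HasFDerivAt e1.symm (ContinuousLinearEquiv.refl ℝ (Fin n → ℝ) :
        (Fin n → ℝ) →L[ℝ] (Fin n → ℝ)) (Θ 0) := by rw [hΘ0]; exact a1
    exact HasFDerivAt.comp (g := e1.symm) (f := fun p => Θ p) (0 : XX n k × WW n k) a2
      Θ.hasFDerivAt
  have hqs : ContDiffOn ℝ ∞ (fun p => Q (m p)) N0 :=
    hQs.comp hms fun p hp => sN (hmN p hp)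
  have hQat : ContDiffAt ℝ ∞ Q (m 0) := by rw [hm0]; exact hQs.contDiffAt (hNo.mem_nhds h0N)
  have hmat : ContDiffAt ℝ ∞ m 0 := hms.contDiffAt (hN0o.mem_nhds h0N0)
  have h2inf : (2 : WithTop ℕ∞) ≤ ∞ := WithTop.coe_le_coe.2 le_top
  obtain ⟨ξ, c, Nm, hNmo, h0Nm, hNm0, hξs, hξ0, hξ1, hξq⟩ := morse (X := XX n k) (W := WW n k)
    (q := fun p => Q (m p)) hN0o h0N0 hqs
    (by
      intro x
      have a := HasFDerivAt.comp (g := Q) (f := m) (0 : XX n k × WW n k)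
        (hQat.differentiableAt (by simp)).hasFDerivAt hm1
      have b : fderiv ℝ (fun p => Q (m p)) 0 = _ := a.fderiv
      rw [b, hm0, hQ1]
      rfl)
    (by
      intro u x
      rw [hess_comp (hQat.of_le h2inf) (hmat.of_le h2inf) (by rw [hm0]; exact hQ1), hm0, hQ2,
        hm1.fderiv]
      change ∑ i : Fin (q + 1), eps k (io hn i) * Θ u (io hn i) * Θ (x, 0) (io hn i) = _
      rw [sum_io hn (fun j => eps k j * Θ u j * Θ (x, 0) j), PiLp.inner_apply]
      have a1 : ∑ j, inner ℝ (u.1 j) (x j) = ∑ j : {j : Fin n // (j : ℕ) < k},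
          (fun j => eps k j * Θ u j * Θ (x, 0) j) j.1 := by
        refine Finset.sum_congr rfl fun j _ => ?_
        simp only
        rw [hΘ, Theta_x, Theta_x, eps, if_pos j.2]
        simp [mul_comm]
      rw [a1, sum_sub (fun j : Fin n => (j : ℕ) < k) (fun j => eps k j * Θ u j * Θ (x, 0) j)]
      refine Finset.sum_congr rfl fun j _ => ?_
      by_cases hj : (j : ℕ) < k
      · rw [if_pos hj, if_pos (by omega)]
      · have : Θ (x, 0) j = 0 := by rw [hΘ, Theta_w _ ⟨j, hj⟩]; rfl
        rw [this, mul_zero, if_neg hj]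
        split_ifs <;> rfl)
  set O : Set (Fin n → ℝ) := e1.source ∩ ζ ⁻¹' (Θ.symm ⁻¹' Nm) with hO
  have hOo : IsOpen O := (hζs.mono sN).continuousOn.isOpen_inter_preimage e1.open_source
    (hNmo.preimage Θ.symm.continuous)
  have hΘs0 : Θ.symm 0 = 0 := Θ.symm.map_zero
  have h0O : (0 : Fin n → ℝ) ∈ O := by
    refine ⟨s0, ?_⟩
    change Θ.symm (ζ 0) ∈ Nm
    rw [hζ0, hΘs0]
    exact h0Nm
  set E : (Fin n → ℝ) → (Fin n → ℝ) := fun x => Θ (ξ (Θ.symm (ζ x)), (Θ.symm (ζ x)).2) with hE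
  have hζO : ∀ x ∈ O, HasFDerivAt ζ (fderiv ℝ ζ x) x := fun x hx =>
    ((hζs.contDiffAt (hNo.mem_nhds (sN hx.1))).differentiableAt (by simp)).hasFDerivAt
  have hξN : ∀ p ∈ Nm, HasFDerivAt ξ (fderiv ℝ ξ p) p := fun p hp =>
    ((hξs.contDiffAt (hNmo.mem_nhds hp)).differentiableAt (by simp)).hasFDerivAt
  have hEs : ContDiffOn ℝ ∞ E O := by
    have a : ContDiffOn ℝ ∞ (fun x => Θ.symm (ζ x)) O :=
      Θ.symm.contDiff.comp_contDiffOn (hζs.mono fun x hx => sN hx.1)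
    exact Θ.contDiff.comp_contDiffOn ((hξs.comp a fun x hx => hx.2).prodMk a.snd)
  have hgen : ∀ x (ζ' : (Fin n → ℝ) →L[ℝ] (Fin n → ℝ)) (ξ' : XX n k × WW n k →L[ℝ] XX n k),
      HasFDerivAt ζ ζ' x → HasFDerivAt ξ ξ' (Θ.symm (ζ x)) → HasFDerivAt E
      ((Θ : (XX n k × WW n k) →L[ℝ] (Fin n → ℝ)).comp
        ((ξ'.prod (ContinuousLinearMap.snd ℝ _ _)).comp
          ((Θ.symm : (Fin n → ℝ) →L[ℝ] XX n k × WW n k).comp ζ'))) x := by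
    intro x ζ' ξ' a1 a2
    have b1 : HasFDerivAt (fun x => Θ.symm (ζ x))
      ((Θ.symm : (Fin n → ℝ) →L[ℝ] XX n k × WW n k).comp ζ') x :=
      Θ.symm.hasFDerivAt.comp x a1
    have b2 : HasFDerivAt (fun p : XX n k × WW n k => (ξ p, p.2))
        (ξ'.prod (ContinuousLinearMap.snd ℝ _ _)) (Θ.symm (ζ x)) :=
      a2.prodMk hasFDerivAt_snd
    exact Θ.hasFDerivAt.comp x (b2.comp x b1)
  have hE1 : HasFDerivAt E (ContinuousLinearMap.id ℝ (Fin n → ℝ)) 0 := by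
    refine (hgen 0 _ _ hζ1 (by rw [hζ0, hΘs0]; exact hξ1)).congr_fderiv ?_
    refine ContinuousLinearMap.ext fun u => ?_
    exact Θ.apply_symm_apply u
  obtain ⟨e, es0, esO, eE, esm⟩ := ift hOo hEs h0O
    (f' := ContinuousLinearEquiv.refl ℝ (Fin n → ℝ)) hE1
  refine ⟨e, es0, fun x hx => hNU (sN (esO hx).1), ?_, esm, ?_, ?_, ?_, ?_⟩
  · rw [eE]; exact hEs.mono esO
  · rw [eE]
    change Θ (ξ (Θ.symm (ζ 0)), (Θ.symm (ζ 0)).2) = 0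
    rw [hζ0, hΘs0, hξ0]
    exact hΘ0
  · rw [eE]; exact hE1
  · intro x j hj1 hj2
    rw [eE]
    change Θ (ξ (Θ.symm (ζ x)), (Θ.symm (ζ x)).2) j = x j
    rw [hΘ, Theta_w _ ⟨j, not_lt.2 hj1⟩, Theta_symm_w]
    exact hζt x j hj2
  · intro x hx hPx
    have hxO := esO hx
    obtain ⟨L, hL, hLu⟩ := hker x (sN hxO.1) hPx
    refine ⟨L, hL, fun u hu hus => ?_⟩
    obtain ⟨hu1, hu2⟩ := hLu u hu hus
    set p := Θ.symm (ζ x) with hp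
    have hpN : p ∈ Nm := hxO.2
    have hmp : m p = x := by
      change e1.symm (Θ (Θ.symm (ζ x))) = x
      rw [Θ.apply_symm_apply, ← ce]
      exact e1.left_inv hxO.1
    have hder := hgen x _ _ (hζO x hxO) (hξN p hpN)
    set a := Θ.symm (fderiv ℝ ζ x u) with ha
    have ha2 : a.2 = 0 := by
      funext j
      rw [ha, hΘ, Theta_symm_w]
      by_cases hj : (j.1 : ℕ) < q + 1
      · have h1 := hζO x hxO
        have h2 : HasFDerivAt (fun x => ζ x j.1)
            ((ContinuousLinearMap.proj (R := ℝ) (φ := fun _ : Fin n => ℝ) j.1).comp (fderiv ℝ ζ x)) x :=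
          (ContinuousLinearMap.proj (R := ℝ) (φ := fun _ : Fin n => ℝ) j.1).hasFDerivAt.comp x h1
        have h3 : (fun x => ζ x j.1) =
            fun x => (ContinuousLinearMap.proj (R := ℝ) (φ := fun _ : Fin n => ℝ) j.1) x := by
          funext y
          exact hζt y j.1 hj
        rw [h3] at h2
        have h4 := h2.unique (ContinuousLinearMap.hasFDerivAt _)
        have h5 := congrArg (fun M => M u) h4
        change fderiv ℝ ζ x u j.1 = u j.1 at h5
        rw [h5]
        exact hus j.1 (not_lt.1 j.2) hj
      · exact hu2 j.1 (by omega)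
    have hae : a = (a.1, 0) := Prod.ext rfl ha2
    have hEu : fderiv ℝ e x u = Θ (fderiv ℝ ξ p a, 0) := by
      rw [eE, hder.fderiv]
      change Θ (fderiv ℝ ξ p a, a.2) = _
      rw [ha2]
    have hex : e x = Θ (ξ p, p.2) := by rw [eE]
    constructor
    · have q1 : HasFDerivAt (fun p => Q (m p)) (fderiv ℝ (fun p => Q (m p)) p) p :=
        ((hqs.contDiffAt (hN0o.mem_nhds (hNm0 hpN))).differentiableAt (by simp)).hasFDerivAt
      have q2 : fderiv ℝ (fun p => Q (m p)) p a = 0 := by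
        rw [← hu1]
        have b1 : HasFDerivAt (fun x => Θ.symm (ζ x))
          ((Θ.symm : (Fin n → ℝ) →L[ℝ] XX n k × WW n k).comp (fderiv ℝ ζ x)) x :=
          Θ.symm.hasFDerivAt.comp x (hζO x hxO)
        have b2 := HasFDerivAt.comp (g := fun p => Q (m p)) (f := fun x => Θ.symm (ζ x)) x q1 b1
        have b3 : (fun x => Q (m (Θ.symm (ζ x)))) =ᶠ[𝓝 x] Q := by
          filter_upwards [e1.open_source.mem_nhds hxO.1] with y hy
          change Q (e1.symm (Θ (Θ.symm (ζ y)))) = Q y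
          rw [Θ.apply_symm_apply, ← ce, e1.left_inv hy]
        have b4 := (b2.congr_of_eventuallyEq b3.symm).fderiv
        rw [b4]
        rfl
      have q3 := q1.sub (((hξN p hpN).inner ℝ (hξN p hpN)).const_mul (1/2 : ℝ))
      have q4 := fderiv_snd_zero (c := c) q3 (by
        filter_upwards [hNmo.mem_nhds hpN] with y hy
        have := hξq y hy
        change Q (m y) - (1/2 : ℝ) * inner ℝ (ξ y) (ξ y) = c y.2
        rw [this]; ring) a.1
      rw [← hae] at q4
      have q5 : (inner ℝ (ξ p) (fderiv ℝ ξ p a) : ℝ) = 0 := by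
        have : fderiv ℝ (fun p => Q (m p)) p a - (1/2 : ℝ) *
          (inner ℝ (ξ p) (fderiv ℝ ξ p a) + inner ℝ (fderiv ℝ ξ p a) (ξ p)) = 0 := by
          rw [← q4]
          simp
        have hcm := real_inner_comm (ξ p) (fderiv ℝ ξ p a)
        rw [q2] at this
        linarith
      rw [hEu, hex, ← q5, PiLp.inner_apply]
      refine Finset.sum_congr rfl fun j _ => ?_
      rw [hΘ, Theta_x, Theta_x]
      simp [mul_comm]
    · intro l hl
      rw [hEu, hΘ, Theta_w _ ⟨l, by omega⟩]
      rfl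

end M7i
end NambuLin
end FileM7i

section FileM7j
open scoped ContDiff
open MeasureTheory Set Filter Topology
namespace NambuLin
section M7j
set_option linter.unusedSectionVars false
set_option maxSynthPendingDepth 3

theorem two_perp {ι : Type} [Fintype ι] (R : Submodule ℝ (EuclideanSpace ℝ ι))
    (hR : Fintype.card ι ≤ Module.finrank ℝ R + 1) (g h : EuclideanSpace ℝ ι)
    (hg : g ∈ Rᗮ) (hh : h ∈ Rᗮ) (i j : ι) : g i * h j = g j * h i := by
  have h1 := R.finrank_add_finrank_orthogonal
  rw [finrank_euclideanSpace] at h1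
  have h2 : Module.finrank ℝ Rᗮ ≤ 1 := by omega
  obtain ⟨v, hv⟩ := finrank_le_one_iff.1 h2
  obtain ⟨c, hc⟩ := hv ⟨g, hg⟩
  obtain ⟨d, hd⟩ := hv ⟨h, hh⟩
  have hc' : g = c • (v : EuclideanSpace ℝ ι) := (congrArg Subtype.val hc).symm
  have hd' : h = d • (v : EuclideanSpace ℝ ι) := (congrArg Subtype.val hd).symm
  rw [hc', hd']
  simp only [PiLp.smul_apply, smul_eq_mul]
  ring

theorem card_x {n k : ℕ} (hk : k ≤ n) : Fintype.card {j : Fin n // (j : ℕ) < k} = k := by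
  rw [Fintype.card_subtype]
  have : (Finset.univ.filter fun j : Fin n => (j : ℕ) < k) =
      (Finset.univ : Finset (Fin k)).map (Fin.castLEEmb hk) := by
    ext j
    simp only [Finset.mem_filter, Finset.mem_univ, true_and, Finset.mem_map]
    constructor
    · intro h
      exact ⟨⟨j, h⟩, Fin.ext rfl⟩
    · rintro ⟨i, rfl⟩
      exact i.2
  rw [this, Finset.card_map, Finset.card_univ, Fintype.card_fin]

theorem card_y {n q k : ℕ} (hn : q < n) (hk : k ≤ q + 1) :
    Fintype.card {j : Fin n // k ≤ (j : ℕ) ∧ (j : ℕ) < q + 1} + k = q + 1 := by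
  have h1 := card_x (n := n) (k := q + 1) hn
  have h2 := card_x (n := n) (k := k) (by omega)
  rw [Fintype.card_subtype] at h1 h2 ⊢
  rw [← h1]
  conv_lhs => rw [← h2]
  rw [← Finset.card_union_of_disjoint]
  · congr 1
    ext j
    simp only [Finset.mem_union, Finset.mem_filter, Finset.mem_univ, true_and]
    omega
  · rw [Finset.disjoint_filter]
    intro j _ h
    omega

theorem point_van {n q k : ℕ} {w : MultiVec n q} {L : Submodule ℝ (Fin n → ℝ)} (hL : Decomp w L)
    {A : Matrix (Fin n) (Fin n) ℝ}
    (hA : ∀ j : Fin n, k ≤ (j : ℕ) → (j : ℕ) < q + 1 → ∀ u, A j ⬝ᵥ u = u j)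
    (hz : ∀ u ∈ L, (∀ j : Fin n, k ≤ (j : ℕ) → (j : ℕ) < q + 1 → u j = 0) →
      ∀ l : Fin n, q < (l : ℕ) → A l ⬝ᵥ u = 0)
    (J : Idx n q) (hJ : sliceIdx n q k ⊆ J.1) (hJt : ¬ J.1 ⊆ topIdx n q) :
    extPow n q A w J = 0 := by
  rw [← altW_rows]
  obtain ⟨l, hl, hlt⟩ := Finset.not_subset.1 hJt
  have hl' : q < (l : ℕ) := by
    rw [mem_topIdx] at hlt; omega
  have hsur : ∀ j ∈ J.1, ∃ a, J.1.orderEmbOfFin J.2 a = j := by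
    intro j hj
    have := Finset.range_orderEmbOfFin J.1 J.2
    have h2 : j ∈ Set.range (J.1.orderEmbOfFin J.2) := by rw [this]; exact hj
    exact h2
  obtain ⟨a0, ha0⟩ := hsur l hl
  refine hL.dep _ a0 fun u hu ha => ?_
  rw [ha0]
  refine hz u hu (fun j hj1 hj2 => ?_) l hl'
  obtain ⟨a, haj⟩ := hsur j (hJ (mem_sliceIdx.2 ⟨hj1, hj2⟩))
  have := ha a (by
    rintro rfl
    rw [ha0] at haj
    rw [haj] at hl'
    omega)
  rw [haj, hA j hj1 hj2] at this
  exact this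

theorem point_rel {n q k : ℕ} (hn : q < n) (hk : k ≤ q + 1) {w : MultiVec n q}
    {L : Submodule ℝ (Fin n → ℝ)} (hL : Decomp w L)
    {A B : Matrix (Fin n) (Fin n) ℝ} (hBA : B * A = 1)
    (hA : ∀ j : Fin n, k ≤ (j : ℕ) → (j : ℕ) < q + 1 → ∀ u, A j ⬝ᵥ u = u j)
    (hz : ∀ u ∈ L, (∀ j : Fin n, k ≤ (j : ℕ) → (j : ℕ) < q + 1 → u j = 0) →
      ∀ l : Fin n, q < (l : ℕ) → A l ⬝ᵥ u = 0) (x : Fin n → ℝ)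
    (hx : ∀ u ∈ L, (∀ j : Fin n, k ≤ (j : ℕ) → (j : ℕ) < q + 1 → u j = 0) →
      ∑ j : {j : Fin n // (j : ℕ) < k}, x j.1 * (A j.1 ⬝ᵥ u) = 0)
    (i j : {j : Fin n // (j : ℕ) < k}) (g : Fin n → ℝ)
    (hg : ∀ i : Fin (q + 1), g (io hn i) = (-1) ^ (i : ℕ) * extPow n q A w (tI hn i)) :
    g i.1 * x j.1 = g j.1 * x i.1 := by
  -- restriction to the slice coordinates
  let ρ : (Fin n → ℝ) →ₗ[ℝ] ({j : Fin n // k ≤ (j : ℕ) ∧ (j : ℕ) < q + 1} → ℝ) :=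
    LinearMap.pi fun j => LinearMap.proj j.1
  let r := ρ.comp L.subtype
  let K := LinearMap.ker r
  have hKdim : k ≤ Module.finrank ℝ K + 1 := by
    have h1 := r.finrank_range_add_finrank_ker
    rw [hL.finrank] at h1
    have h2 : Module.finrank ℝ (LinearMap.range r) ≤ _ := Submodule.finrank_le _
    rw [Module.finrank_fintype_fun_eq_card] at h2
    have h3 := card_y hn hk
    change k ≤ Module.finrank ℝ (LinearMap.ker r) + 1
    omega
  let τ : (Fin n → ℝ) →ₗ[ℝ] XX n k :=
    (WithLp.linearEquiv 2 ℝ ({j : Fin n // (j : ℕ) < k} → ℝ)).symm.toLinearMap.comp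
      (LinearMap.pi fun j => (LinearMap.proj j.1).comp A.mulVecLin)
  have hτ : ∀ u j, τ u j = A j.1 ⬝ᵥ u := fun u j => rfl
  let T : K →ₗ[ℝ] XX n k := τ.comp (L.subtype.comp K.subtype)
  have hKu : ∀ u : K, ∀ j : Fin n, k ≤ (j : ℕ) → (j : ℕ) < q + 1 → (u.1.1 : Fin n → ℝ) j = 0 := by
    intro u j h1 h2
    have := congrFun (LinearMap.mem_ker.1 u.2) ⟨j, h1, h2⟩
    exact this
  have hTi : Function.Injective T := by
    rw [← LinearMap.ker_eq_bot, LinearMap.ker_eq_bot']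
    intro u hu
    have h1 : A.mulVec u.1.1 = 0 := by
      funext l
      change A l ⬝ᵥ u.1.1 = 0
      by_cases hl : (l : ℕ) < k
      · rw [← hτ u.1.1 ⟨l, hl⟩]
        change T u ⟨l, hl⟩ = 0
        rw [hu]
        rfl
      · by_cases hl2 : (l : ℕ) < q + 1
        · rw [hA l (not_lt.1 hl) hl2, hKu u l (not_lt.1 hl) hl2]
        · exact hz _ u.1.2 (hKu u) l (by omega)
    have h2 : B.mulVec (A.mulVec u.1.1) = u.1.1 := by
      rw [Matrix.mulVec_mulVec, hBA, Matrix.one_mulVec]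
    rw [h1, Matrix.mulVec_zero] at h2
    exact Subtype.ext (Subtype.ext h2.symm)
  have hRdim : Fintype.card {j : Fin n // (j : ℕ) < k} ≤
      Module.finrank ℝ (LinearMap.range T) + 1 := by
    rw [card_x (by omega), LinearMap.finrank_range_of_inj hTi]
    exact hKdim
  have perp : ∀ y : Fin n → ℝ, (∀ u ∈ L,
      (∀ j : Fin n, k ≤ (j : ℕ) → (j : ℕ) < q + 1 → u j = 0) →
      ∑ j : {j : Fin n // (j : ℕ) < k}, y j.1 * (A j.1 ⬝ᵥ u) = 0) →
      (WithLp.toLp 2 (fun j : {j : Fin n // (j : ℕ) < k} => y j.1) : XX n k)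
        ∈ (LinearMap.range T)ᗮ := by
    intro y hy
    rw [Submodule.mem_orthogonal']
    rintro _ ⟨u, rfl⟩
    rw [PiLp.inner_apply, ← hy u.1.1 u.1.2 (hKu u)]
    refine Finset.sum_congr rfl fun j _ => ?_
    rw [← hτ u.1.1 j]
    change (τ u.1.1 j) * (y j.1) = y j.1 * τ u.1.1 j
    ring
  refine two_perp (LinearMap.range T) hRdim (WithLp.toLp 2 (fun j => g j.1))
    (WithLp.toLp 2 (fun j => x j.1)) (perp g ?_) (perp x hx) i j
  intro u hu hus
  have h1 := hL.plucker hu (fun i => A (io hn i))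
  rw [sum_sub (fun j : Fin n => (j : ℕ) < k) (fun j => g j * (A j ⬝ᵥ u))]
  have h2 : ∀ i : Fin (q + 1), altW w ((fun i => A (io hn i)) ∘ i.succAbove) =
      extPow n q A w (tI hn i) := by
    intro i
    rw [← altW_rows]
    congr 1
    funext a
    rw [orderEmb_tI]
    rfl
  have h3 : ∑ i : Fin (q + 1), g (io hn i) * (A (io hn i) ⬝ᵥ u) = 0 := by
    rw [← h1]
    refine Finset.sum_congr rfl fun i _ => ?_
    rw [h2, hg]
    ring
  rw [sum_io hn (fun j => g j * (A j ⬝ᵥ u))] at h3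
  refine Eq.trans (Finset.sum_congr rfl fun j _ => ?_) h3
  by_cases hj : (j : ℕ) < k
  · rw [if_pos hj, if_pos (by omega)]
  · rw [if_neg hj]
    split_ifs with h
    · rw [hA j (not_lt.1 hj) h, hus j (not_lt.1 hj) h, mul_zero]
    · rfl

theorem contDiffOn_det {E : Type} [NormedAddCommGroup E] [NormedSpace ℝ E] {ι : Type} [Fintype ι]
    [DecidableEq ι] {M : E → Matrix ι ι ℝ} {s : Set E}
    (hM : ∀ i j, ContDiffOn ℝ ∞ (fun p => M p i j) s) : ContDiffOn ℝ ∞ (fun p => (M p).det) s := by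
  simp only [Matrix.det_apply]
  refine ContDiffOn.sum fun σ _ => ?_
  have h1 : ContDiffOn ℝ ∞ (fun p => ∏ i, M p (σ i) i) s := contDiffOn_prod fun i _ => hM _ _
  have h2 := (contDiffOn_const (c := ((Equiv.Perm.sign σ : ℤ) : ℝ))).mul h1
  refine h2.congr fun p _ => ?_
  rw [Units.smul_def, zsmul_eq_mul]

theorem contDiffOn_extPow {E : Type} [NormedAddCommGroup E] [NormedSpace ℝ E] {n q : ℕ}
    {A : E → Matrix (Fin n) (Fin n) ℝ} {w : E → MultiVec n q} {s : Set E}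
    (hA : ∀ i j, ContDiffOn ℝ ∞ (fun p => A p i j) s) (hw : ContDiffOn ℝ ∞ w s) (J : Idx n q) :
    ContDiffOn ℝ ∞ (fun p => extPow n q (A p) (w p) J) s := by
  unfold extPow
  refine ContDiffOn.sum fun I _ => ?_
  exact (contDiffOn_det fun i j => hA _ _).mul (contDiffOn_pi.1 hw I)

theorem extPow_deriv {E : Type} [NormedAddCommGroup E] [NormedSpace ℝ E] {n q : ℕ}
    {A : E → Matrix (Fin n) (Fin n) ℝ} {w : E → MultiVec n q} {s : Set E} (hs : IsOpen s) {p : E}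
    (hp : p ∈ s)
    (hA : ∀ i j, ContDiffOn ℝ ∞ (fun p => A p i j) s) (hw : ContDiffOn ℝ ∞ w s) (hA1 : A p = 1)
    (hw0 : w p = 0) (J : Idx n q) (u : E) :
    fderiv ℝ (fun p => extPow n q (A p) (w p) J) p u = fderiv ℝ (fun p => w p J) p u := by
  have h1 : ∀ I : Idx n q, HasFDerivAt (fun p => ((A p).submatrix (J.1.orderEmbOfFin J.2)
      (I.1.orderEmbOfFin I.2)).det) (fderiv ℝ (fun p => ((A p).submatrix (J.1.orderEmbOfFin J.2)
      (I.1.orderEmbOfFin I.2)).det) p) p := fun I =>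
    (((contDiffOn_det fun i j => hA _ _).contDiffAt (hs.mem_nhds hp)).differentiableAt
      (by simp)).hasFDerivAt
  have h2 : ∀ I : Idx n q, HasFDerivAt (fun p => w p I) (fderiv ℝ (fun p => w p I) p) p := fun I =>
    (((contDiffOn_pi.1 hw I).contDiffAt (hs.mem_nhds hp)).differentiableAt (by simp)).hasFDerivAt
  have h3 := HasFDerivAt.fun_sum (u := Finset.univ) fun I _ => (h1 I).mul (h2 I)
  have h4 : HasFDerivAt (fun p => extPow n q (A p) (w p) J) _ p := h3
  rw [h4.fderiv]
  have h5 := congrFun (extPow_one (n := n) (q := q) (fun I => fderiv ℝ (fun p => w p I) p u)) J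
  rw [← h5, ← hA1]
  unfold extPow
  rw [ContinuousLinearMap.sum_apply]
  refine Finset.sum_congr rfl fun I _ => ?_
  have h6 : w p I = 0 := by rw [hw0]; rfl
  rw [h6, zero_smul, add_zero]
  rfl

end M7j
end NambuLin
end FileM7j

section FileM7k
open scoped ContDiff
open MeasureTheory Set Filter Topology
namespace NambuLin
section M7k
set_option linter.unusedSectionVars false
set_option maxSynthPendingDepth 3

theorem fderiv_coord {n : ℕ} {φ : (Fin n → ℝ) → (Fin n → ℝ)} {x : Fin n → ℝ}
    (hφ : DifferentiableAt ℝ φ x) (j : Fin n) (h : ∀ y, φ y j = y j) (u : Fin n → ℝ) :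
    fderiv ℝ φ x u j = u j := by
  have h2 : HasFDerivAt (fun x => φ x j)
      ((ContinuousLinearMap.proj (R := ℝ) (φ := fun _ : Fin n => ℝ) j).comp (fderiv ℝ φ x)) x :=
    (ContinuousLinearMap.proj (R := ℝ) (φ := fun _ : Fin n => ℝ) j).hasFDerivAt.comp x
      hφ.hasFDerivAt
  have h3 : (fun x => φ x j) =
      fun x => (ContinuousLinearMap.proj (R := ℝ) (φ := fun _ : Fin n => ℝ) j) x := by
    funext y
    exact h y
  rw [h3] at h2
  have h4 := h2.unique (ContinuousLinearMap.hasFDerivAt _)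
  exact congrArg (fun M => M u) h4

theorem jac_smooth {E : Type} [NormedAddCommGroup E] [NormedSpace ℝ E] {n : ℕ}
    {φ : (Fin n → ℝ) → (Fin n → ℝ)} {s : Set (Fin n → ℝ)} (hs : IsOpen s)
    (hφ : ContDiffOn ℝ ∞ φ s) {m : E → (Fin n → ℝ)} {t : Set E} (hm : ContDiffOn ℝ ∞ m t)
    (hmt : ∀ p ∈ t, m p ∈ s) (i j : Fin n) : ContDiffOn ℝ ∞ (fun p => jac φ (m p) i j) t := by
  have h1 : ContDiffOn ℝ ∞ (fderiv ℝ φ) s := hφ.fderiv_of_isOpen hs (m := ∞) (by simp)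
  have h2 : ContDiffOn ℝ ∞ (fun p => fderiv ℝ φ (m p)) t := h1.comp hm hmt
  have h3 : ContDiffOn ℝ ∞ (fun p => fderiv ℝ φ (m p) (Pi.single j 1)) t :=
    h2.clm_apply contDiffOn_const
  exact contDiffOn_pi.1 h3 i

theorem jac_one {n : ℕ} {φ : (Fin n → ℝ) → (Fin n → ℝ)} {x : Fin n → ℝ}
    (h : HasFDerivAt φ (ContinuousLinearMap.id ℝ (Fin n → ℝ)) x) : jac φ x = 1 := by
  apply Matrix.mulVec_injective
  funext u
  rw [jac_mulVec, h.fderiv, Matrix.one_mulVec]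
  rfl

theorem P_deriv {n q k : ℕ} (hn : q < n) {P : (Fin n → ℝ) → MultiVec n q}
    {U : Set (Fin n → ℝ)} (hU : IsOpen U) (h0 : (0 : Fin n → ℝ) ∈ U) (hP : ContDiffOn ℝ ∞ P U)
    (hflat : ∀ x ∈ U, (∀ j : Fin n, (j : ℕ) < q + 1 → x j = 0) →
      ∀ l : ℕ, iteratedFDerivWithin ℝ l (fun z => P z - modelPi n q k z) U x = 0)
    (b : Fin (q + 1)) : HasFDerivAt (fun x => P x (tI hn b)) (((-1 : ℝ) ^ (b : ℕ) *
      eps k (io hn b)) • (ContinuousLinearMap.proj (R := ℝ) (φ := fun _ : Fin n => ℝ) (io hn b))) 0 := by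
  have hf := hflat 0 h0 (fun _ _ => rfl) 1
  have hPd : DifferentiableAt ℝ P 0 :=
    (hP.contDiffAt (hU.mem_nhds h0)).differentiableAt (by simp)
  have hMd : DifferentiableAt ℝ (modelPi n q k) 0 := by
    rw [differentiableAt_pi]
    intro J
    unfold modelPi
    refine DifferentiableAt.fun_sum fun j _ => ?_
    split_ifs
    · fun_prop
    · fun_prop
  have hd : fderiv ℝ (fun z => P z - modelPi n q k z) 0 = 0 := by
    refine ContinuousLinearMap.ext fun u => ?_
    have h1 := congrArg (fun m => m (fun _ => u)) hf
    simp only [iteratedFDerivWithin_one_apply (hU.uniqueDiffOn 0 h0)] at h1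
    rw [fderivWithin_of_isOpen hU h0] at h1
    exact h1
  have h2 : HasFDerivAt (fun z => P z - modelPi n q k z) (0 : (Fin n → ℝ) →L[ℝ] MultiVec n q) 0 := by
    rw [← hd]
    exact (hPd.sub hMd).hasFDerivAt
  have h3 : HasFDerivAt (fun z => P z (tI hn b) - modelPi n q k z (tI hn b))
      (0 : (Fin n → ℝ) →L[ℝ] ℝ) 0 := by
    have := (hasFDerivAt_pi'.1 h2) (tI hn b)
    refine this.congr_fderiv ?_
    exact ContinuousLinearMap.ext fun u => rfl
  set ℓ : (Fin n → ℝ) →L[ℝ] ℝ := (((-1 : ℝ) ^ (b : ℕ) *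
      eps k (io hn b)) • (ContinuousLinearMap.proj (R := ℝ) (φ := fun _ : Fin n => ℝ) (io hn b)))
  have h4 := h3.add (ℓ.hasFDerivAt (x := 0))
  rw [zero_add] at h4
  refine h4.congr_of_eventuallyEq (Eventually.of_forall fun z => ?_)
  change P z (tI hn b) = P z (tI hn b) - modelPi n q k z (tI hn b) +
    ((-1 : ℝ) ^ (b : ℕ) * eps k (io hn b)) * z (io hn b)
  rw [modelPi_tI]
  ring

theorem step2 {n q k : ℕ} (hn : q < n) (hk3 : 3 ≤ k) (hkq : k ≤ q)
    {P : (Fin n → ℝ) → MultiVec n q}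
    {U : Set (Fin n → ℝ)} (hU : IsOpen U) (h0 : (0 : Fin n → ℝ) ∈ U) (hN : IsNambu n q P U)
    (hflat : ∀ x ∈ U, (∀ j : Fin n, (j : ℕ) < q + 1 → x j = 0) →
      ∀ l : ℕ, iteratedFDerivWithin ℝ l (fun z => P z - modelPi n q k z) U x = 0) :
    ∃ (e : OpenPartialHomeomorph (Fin n → ℝ) (Fin n → ℝ)) (f : XX n k × WW n k → ℝ)
      (N : Set (XX n k × WW n k)), 0 ∈ e.source ∧ e.source ⊆ U ∧
      ContDiffOn ℝ ∞ e e.source ∧ e 0 = 0 ∧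
      HasFDerivAt e (ContinuousLinearMap.id ℝ (Fin n → ℝ)) 0 ∧
      (∀ x, ∀ j : Fin n, k ≤ (j : ℕ) → (j : ℕ) < q + 1 → e x j = x j) ∧
      IsOpen N ∧ 0 ∈ N ∧ ContDiffOn ℝ ∞ f N ∧ f 0 = 1 ∧
      ∀ x ∈ e.source, (Theta n k).symm (e x) ∈ N →
        (∀ b : Fin (q + 1), (b : ℕ) < k → extPow n q (jac e x) (P x) (tI hn b) =
          (-1) ^ (b : ℕ) * (f ((Theta n k).symm (e x)) * e x (io hn b))) ∧
        ∀ J : Idx n q, sliceIdx n q k ⊆ J.1 → ¬ J.1 ⊆ topIdx n q →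
          extPow n q (jac e x) (P x) J = 0 := by
  obtain ⟨e, s0, sU, es, ess, e0, e1, ey, eL⟩ := step1 hn hk3 hkq hU h0 hN hflat
  have hk : k ≤ q + 1 := by omega
  set Θ := Theta n k with hΘ
  set m : XX n k × WW n k → (Fin n → ℝ) := fun p => e.symm (Θ p) with hm
  set N0 : Set (XX n k × WW n k) := Θ ⁻¹' e.target with hN0
  have hN0o : IsOpen N0 := e.open_target.preimage Θ.continuous
  have hΘ0 : Θ 0 = 0 := Θ.map_zero
  have t0 : (0 : Fin n → ℝ) ∈ e.target := by
    have := e.map_source s0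
    rwa [e0] at this
  have h0N0 : (0 : XX n k × WW n k) ∈ N0 := by
    change Θ 0 ∈ e.target
    rw [hΘ0]; exact t0
  have hes0 : e.symm 0 = 0 := by
    conv_lhs => rw [← e0]
    exact e.left_inv s0
  have hm0 : m 0 = 0 := by
    change e.symm (Θ 0) = 0
    rw [hΘ0, hes0]
  have hms : ContDiffOn ℝ ∞ m N0 := ess.comp Θ.contDiff.contDiffOn fun p hp => hp
  have hmN : ∀ p ∈ N0, m p ∈ e.source := fun p hp => e.map_target hp
  have hm1 : HasFDerivAt m (Θ : (XX n k × WW n k) →L[ℝ] (Fin n → ℝ)) 0 := by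
    have a1 : HasFDerivAt e.symm (ContinuousLinearEquiv.refl ℝ (Fin n → ℝ) :
        (Fin n → ℝ) →L[ℝ] (Fin n → ℝ)) 0 :=
      OpenPartialHomeomorph.hasFDerivAt_symm e (a := 0)
        (f' := ContinuousLinearEquiv.refl ℝ (Fin n → ℝ)) t0 (by
          rw [hes0]
          exact e1)
    have a2 : HasFDerivAt e.symm (ContinuousLinearEquiv.refl ℝ (Fin n → ℝ) :
        (Fin n → ℝ) →L[ℝ] (Fin n → ℝ)) (Θ 0) := by rw [hΘ0]; exact a1
    exact HasFDerivAt.comp (g := e.symm) (f := fun p => Θ p) (0 : XX n k × WW n k) a2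
      Θ.hasFDerivAt
  have ed : ∀ x ∈ e.source, DifferentiableAt ℝ e x := fun x hx =>
    (es.contDiffAt (e.open_source.mem_nhds hx)).differentiableAt (by simp)
  have esd : ∀ x ∈ e.target, DifferentiableAt ℝ e.symm x := fun x hx =>
    (ess.contDiffAt (e.open_target.mem_nhds hx)).differentiableAt (by simp)
  have hAy : ∀ x ∈ e.source, ∀ j : Fin n, k ≤ (j : ℕ) → (j : ℕ) < q + 1 → ∀ u,
      jac e x j ⬝ᵥ u = u j := by
    intro x hx j h1 h2 u
    rw [jac_row]
    exact fderiv_coord (ed x hx) j (fun y => ey y j h1 h2) u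
  have hzero : ∀ (A : Matrix (Fin n) (Fin n) ℝ) J, extPow n q A 0 J = 0 := by
    intro A J
    unfold extPow
    simp
  have hP1 := hN.1
  have hwS : ContDiffOn ℝ ∞ (fun p => P (m p)) N0 := hP1.comp hms fun p hp => sU (hmN p hp)
  have hAS := jac_smooth e.open_source es hms hmN
  have ib : ∀ i : {j : Fin n // (j : ℕ) < k}, (i.1 : ℕ) < q + 1 := fun i => by
    have := i.2; omega
  set G : XX n k × WW n k → {j : Fin n // (j : ℕ) < k} → ℝ := fun p i =>
    (-1) ^ (i.1 : ℕ) * extPow n q (jac e (m p)) (P (m p)) (tI hn ⟨i.1, ib i⟩) with hG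
  have hGs : ContDiffOn ℝ ∞ G N0 := contDiffOn_pi.2 fun i =>
    contDiffOn_const.mul (contDiffOn_extPow hAS hwS _)
  have rel : ∀ p ∈ N0, ∀ i j, G p i * p.1 j = G p j * p.1 i := by
    intro p hp i j
    have hx := hmN p hp
    have hex : e (m p) = Θ p := e.right_inv hp
    by_cases hP0 : P (m p) = 0
    · simp only [hG, hP0, hzero]
      ring
    obtain ⟨L, hL, hLu⟩ := eL (m p) hx hP0
    have hinv : jac e.symm (e (m p)) * jac e (m p) = 1 :=
      jac_inv (esd _ (e.map_source hx)) (ed _ hx) (by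
        filter_upwards [e.open_source.mem_nhds hx] with y hy
        exact e.left_inv hy)
    set g : Fin n → ℝ := fun j => if h : (j : ℕ) < q + 1 then
      (-1) ^ (j : ℕ) * extPow n q (jac e (m p)) (P (m p)) (tI hn ⟨j, h⟩) else 0 with hg
    have key := point_rel hn hk hL hinv (hAy _ hx)
      (fun u hu hus l hl => by
        rw [jac_row]; exact (hLu u hu hus).2 l hl) (e (m p))
      (fun u hu hus => by
        rw [← (hLu u hu hus).1]
        refine Finset.sum_congr rfl fun j _ => ?_
        rw [jac_row]) i j g
      (fun i => dif_pos i.2)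
    have gi : ∀ i : {j : Fin n // (j : ℕ) < k}, g i.1 = G p i := fun i => dif_pos (ib i)
    rw [gi, gi, hex, hΘ, Theta_x, Theta_x] at key
    exact key
  set ia : {j : Fin n // (j : ℕ) < k} := ⟨⟨0, by omega⟩, by simp; omega⟩ with hia
  set ic : {j : Fin n // (j : ℕ) < k} := ⟨⟨1, by omega⟩, by simp; omega⟩ with hic
  have hac : ia ≠ ic := fun h => by
    have := congrArg (fun j : {j : Fin n // (j : ℕ) < k} => (j.1 : ℕ)) h
    simp [ia, ic] at this
  have hd : fderiv ℝ (fun p => G p ia) 0 (EuclideanSpace.single ia (1:ℝ), 0) = 1 := by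
    have c1 : (fun p => G p ia) = fun p => extPow n q (jac e (m p)) (P (m p))
        (tI hn ⟨ia.1, ib ia⟩) := by
      funext p
      simp [hG, hia]
    rw [c1, extPow_deriv (w := fun p => P (m p)) hN0o h0N0 hAS hwS
      (by rw [hm0]; exact jac_one e1)
      (by
        change P (m 0) = 0
        rw [hm0]
        exact P_zero hn hflat h0 fun _ _ => rfl)]
    have c2 := P_deriv hn hU h0 hP1 hflat ⟨ia.1, ib ia⟩
    rw [← hm0] at c2
    have c3 := HasFDerivAt.comp (g := fun x => P x (tI hn ⟨ia.1, ib ia⟩)) (f := m)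
      (0 : XX n k × WW n k) c2 hm1
    have c4 := c3.fderiv
    have c5 : fderiv ℝ (fun p => P (m p) (tI hn ⟨ia.1, ib ia⟩)) 0 = _ := c4
    rw [c5]
    change ((-1 : ℝ) ^ (ia.1 : ℕ) * eps k (io hn ⟨ia.1, ib ia⟩)) *
      Θ (EuclideanSpace.single ia (1:ℝ), 0) ia.1 = 1
    have hep : eps k (io hn ⟨ia.1, ib ia⟩) = 1 := if_pos ia.2
    rw [hΘ, Theta_x, hep]
    have : (EuclideanSpace.single ia (1:ℝ) : XX n k) ia = 1 := by
      unfold EuclideanSpace.single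
      exact Pi.single_eq_same (M := fun _ => ℝ) ia (1:ℝ)
    rw [this]
    simp [hia]
  obtain ⟨f, N, hNo, h0N', hNN0, hfs, hf0, hfG⟩ := hadamard (W := WW n k) hac hN0o h0N0 hGs rel hd
  refine ⟨e, f, N, s0, sU, es, e0, e1, ey, hNo, h0N', hfs, hf0, ?_⟩
  intro x hx hxN
  have hmx : m (Θ.symm (e x)) = x := by
    change e.symm (Θ (Θ.symm (e x))) = x
    rw [Θ.apply_symm_apply, e.left_inv hx]
  constructor
  · intro b hb
    have c1 := hfG _ hxN ⟨io hn b, (io_val hn b).symm ▸ hb⟩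
    change (-1) ^ (b : ℕ) * extPow n q (jac e (m (Θ.symm (e x)))) (P (m (Θ.symm (e x)))) (tI hn b)
      = _ at c1
    rw [hmx, hΘ, Theta_symm_x, ← hΘ] at c1
    rw [← c1, ← mul_assoc, ← pow_add, Even.neg_one_pow ⟨(b : ℕ), rfl⟩, one_mul]
  · intro J hJ hJt
    by_cases hP0 : P x = 0
    · rw [hP0, hzero]
    obtain ⟨L, hL, hLu⟩ := eL x hx hP0
    exact point_van hL (hAy x hx) (fun u hu hus l hl => by
        rw [jac_row]; exact (hLu u hu hus).2 l hl) J hJ hJt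

end M7k
end NambuLin
end FileM7k

section FileM8a
open scoped ContDiff
open MeasureTheory Set Filter Topology
namespace NambuLin
section M8a
set_option linter.unusedSectionVars false
set_option maxSynthPendingDepth 3

theorem Theta_symm_single {n k : ℕ} (j : {j : Fin n // (j : ℕ) < k}) :
    (Theta n k).symm (Pi.single j.1 1) = (EuclideanSpace.single j (1:ℝ), 0) := by
  refine Prod.ext ?_ ?_
  · ext i
    rw [Theta_symm_x, EuclideanSpace.single_apply, Pi.single_apply]
    simp only [Subtype.ext_iff]
  · funext i
    rw [Theta_symm_w]
    exact Pi.single_eq_of_ne (fun h => i.2 (by rw [h]; exact j.2)) _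

/-- the Jacobian matrix of a map changing only the `x` coordinates -/
noncomputable def CM {n k : ℕ} (T : XX n k × WW n k →L[ℝ] XX n k) : Matrix (Fin n) (Fin n) ℝ :=
  Matrix.of fun i j => Theta n k (T ((Theta n k).symm (Pi.single j 1)),
    ((Theta n k).symm (Pi.single j 1)).2) i

theorem CM_row {n k : ℕ} (T : XX n k × WW n k →L[ℝ] XX n k) (i : Fin n) (hi : k ≤ (i : ℕ)) :
    CM T i = Pi.single i 1 := by
  funext j
  change Theta n k (T ((Theta n k).symm (Pi.single j 1)),
    ((Theta n k).symm (Pi.single j 1)).2) i = _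
  rw [Theta_w _ ⟨i, not_lt.2 hi⟩]
  change (Pi.single j (1:ℝ) : Fin n → ℝ) i = _
  rw [Pi.single_apply, Pi.single_apply]
  simp only [eq_comm]

theorem CM_x {n k : ℕ} (T : XX n k × WW n k →L[ℝ] XX n k) (i j : {j : Fin n // (j : ℕ) < k}) :
    CM T i.1 j.1 = T (EuclideanSpace.single j (1:ℝ), 0) i := by
  change Theta n k (T ((Theta n k).symm (Pi.single j.1 1)),
    ((Theta n k).symm (Pi.single j.1 1)).2) i.1 = _
  rw [Theta_x, Theta_symm_single]

/-- equivalence of index sets -/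
def exE {n q k : ℕ} (hn : q < n) (hk : k ≤ q + 1) :
    {i : Fin (q + 1) // (i : ℕ) < k} ≃ {j : Fin n // (j : ℕ) < k} where
  toFun i := ⟨io hn i.1, i.2⟩
  invFun j := ⟨⟨j.1, lt_of_lt_of_le j.2 hk⟩, j.2⟩
  left_inv _ := rfl
  right_inv _ := rfl

theorem CM_det {n q k : ℕ} (hn : q < n) (hk : k ≤ q + 1) (T : XX n k × WW n k →L[ℝ] XX n k) :
    ((CM T).submatrix (io hn) (io hn)).det =
      LinearMap.det (T.comp (ContinuousLinearMap.inl ℝ (XX n k) (WW n k))).toLinearMap := by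
  rw [Matrix.twoBlockTriangular_det _ (fun i : Fin (q + 1) => (i : ℕ) < k)]
  · have h1 : (Matrix.toSquareBlockProp ((CM T).submatrix (io hn) (io hn))
        fun i : Fin (q + 1) => ¬ (i : ℕ) < k) = 1 := by
      ext i j
      change CM T (io hn i.1) (io hn j.1) = _
      rw [CM_row T _ (not_lt.1 i.2), Pi.single_apply, Matrix.one_apply]
      by_cases h : i = j
      · rw [h, if_pos rfl, if_pos rfl]
      · rw [if_neg h, if_neg]
        intro h'
        exact h (Subtype.ext (io_inj hn h'.symm))
    rw [h1, Matrix.det_one, mul_one]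
    rw [← LinearMap.det_toMatrix (EuclideanSpace.basisFun {j : Fin n // (j : ℕ) < k} ℝ).toBasis]
    rw [← Matrix.det_submatrix_equiv_self (exE hn hk)]
    congr 1
    ext i j
    rw [Matrix.submatrix_apply, LinearMap.toMatrix_apply]
    change CM T (exE hn hk i).1 (exE hn hk j).1 = _
    rw [CM_x]
    simp
  · intro i hi j hj
    change CM T (io hn i) (io hn j) = 0
    rw [CM_row T _ (not_lt.1 hi), Pi.single_apply, if_neg]
    intro h
    apply hi
    rw [← io_inj hn h]
    exact hj

theorem moser_alg {n q k : ℕ} (hn : q < n) (hk : k ≤ q + 1) (T : XX n k × WW n k →L[ℝ] XX n k)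
    (X : XX n k) (f : ℝ) (v : Fin n → ℝ)
    (hd : LinearMap.det (T.comp (ContinuousLinearMap.inl ℝ (XX n k) (WW n k))).toLinearMap ≠ 0)
    (hT : ∀ y, inner ℝ (T (y, 0)) X = f *
      LinearMap.det (T.comp (ContinuousLinearMap.inl ℝ (XX n k) (WW n k))).toLinearMap *
        inner ℝ y ((Theta n k).symm v).1)
    (w : MultiVec n q)
    (hw1 : ∀ b : Fin (q + 1), (b : ℕ) < k → w (tI hn b) = (-1) ^ (b : ℕ) * (f * v (io hn b)))
    (hw2 : ∀ J : Idx n q, sliceIdx n q k ⊆ J.1 → ¬ J.1 ⊆ topIdx n q → w J = 0) :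
    (∀ j : Fin (q + 1), ∀ hj : (j : ℕ) < k, extPow n q (CM T) w (tI hn j) =
      (-1) ^ (j : ℕ) * X ⟨io hn j, hj⟩) ∧
    ∀ J : Idx n q, sliceIdx n q k ⊆ J.1 → ¬ J.1 ⊆ topIdx n q → extPow n q (CM T) w J = 0 := by
  set d := LinearMap.det (T.comp (ContinuousLinearMap.inl ℝ (XX n k) (WW n k))).toLinearMap with hdd
  set S : Fin n → ℝ := fun c => ∑ i : {j : Fin n // (j : ℕ) < k}, X i / d * CM T i.1 c with hS
  set Lam : Fin n → ℝ := fun j => if h : (j : ℕ) < k then X ⟨j, h⟩ / d else - S j with hLam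
  have hSx : ∀ c : {j : Fin n // (j : ℕ) < k}, S c.1 = f * v c.1 := by
    intro c
    have h1 := hT (EuclideanSpace.single c 1)
    rw [EuclideanSpace.inner_single_left, Theta_symm_x, PiLp.inner_apply] at h1
    have h2 : S c.1 = d⁻¹ * ∑ i, inner ℝ (T (EuclideanSpace.single c (1:ℝ), 0) i) (X i) := by
      rw [hS, Finset.mul_sum]
      refine Finset.sum_congr rfl fun i _ => ?_
      rw [CM_x]
      change _ = d⁻¹ * (X i * T (EuclideanSpace.single c (1:ℝ), 0) i)
      rw [div_eq_mul_inv]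
      ring
    rw [h2, h1]
    simp only [map_one, one_mul]
    field_simp
  have main := slice_algebra hn w (fun b => if (b : ℕ) < k then f * v (io hn b) else 0)
    (fun b hb => by rw [hw1 b hb, if_pos hb]) hw2
    (fun b hb => if_neg (not_lt.2 hb)) (CM T) (CM_row T) (fun i => Lam (io hn i)) (fun b => by
      rw [sum_io hn (fun j => Lam j * CM T j (io hn b))]
      set c := io hn b with hc
      have hcq : (c : ℕ) < q + 1 := b.2
      have e1 : ∀ j : Fin n, (if (j : ℕ) < q + 1 then Lam j * CM T j c else 0) =
          (if (j : ℕ) < k then Lam j * CM T j c else 0) +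
            (if j = c then (if (c : ℕ) < k then 0 else Lam c) else 0) := by
        intro j
        by_cases h1 : (j : ℕ) < k
        · rw [if_pos h1, if_pos (by omega)]
          by_cases h2 : j = c
          · rw [if_pos h2, if_pos (by rw [← h2]; exact h1), add_zero]
          · rw [if_neg h2, add_zero]
        · rw [if_neg h1, zero_add, CM_row T j (not_lt.1 h1), Pi.single_apply]
          by_cases h2 : j = c
          · rw [if_pos h2, if_pos (by rw [h2]; exact hcq), if_pos h2.symm,
              if_neg (by rw [← h2]; exact h1), h2, mul_one]
          · have h3 : ¬ c = j := fun h => h2 h.symm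
            rw [if_neg h2, if_neg h3, mul_zero]
            split_ifs <;> rfl
      rw [Finset.sum_congr rfl fun j _ => e1 j, Finset.sum_add_distrib,
        Finset.sum_ite_eq' Finset.univ c, if_pos (Finset.mem_univ _)]
      have e2 : ∑ j : Fin n, (if (j : ℕ) < k then Lam j * CM T j c else 0) = S c := by
        rw [← sum_sub (fun j : Fin n => (j : ℕ) < k) (fun j => Lam j * CM T j c)]
        refine Finset.sum_congr rfl fun j _ => ?_
        have : Lam j.1 = X j / d := dif_pos j.2
        rw [this]
      rw [e2]
      by_cases hck : (c : ℕ) < k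
      · rw [if_pos hck, if_pos (show (b : ℕ) < k from hck), hSx ⟨c, hck⟩, add_zero]
      · have : Lam c = - S c := dif_neg hck
        rw [if_neg hck, if_neg (show ¬ (b : ℕ) < k from hck), this]
        ring) hk
  refine ⟨fun j hj => ?_, main.2⟩
  rw [main.1 j hj, CM_det hn hk]
  have : Lam (io hn j) = X ⟨io hn j, hj⟩ / d := dif_pos hj
  rw [this, div_mul_cancel₀ _ hd]

end M8a
end NambuLin
end FileM8a

section FileM8b
open scoped ContDiff
open MeasureTheory Set Filter Topology
namespace NambuLin
section M8b
set_option linter.unusedSectionVars false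
set_option maxSynthPendingDepth 3

theorem slice_final {n q k : ℕ} (hn : q < n) (hk3 : 3 ≤ k) (hkq : k ≤ q)
    {P : (Fin n → ℝ) → MultiVec n q}
    {U : Set (Fin n → ℝ)} (hU : IsOpen U) (h0 : (0 : Fin n → ℝ) ∈ U) (hN : IsNambu n q P U)
    (hflat : ∀ x ∈ U, (∀ j : Fin n, (j : ℕ) < q + 1 → x j = 0) →
      ∀ l : ℕ, iteratedFDerivWithin ℝ l (fun z => P z - modelPi n q k z) U x = 0) :
    ∃ φ : OpenPartialHomeomorph (Fin n → ℝ) (Fin n → ℝ), 0 ∈ φ.source ∧ φ.source ⊆ U ∧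
      ContDiffOn ℝ ∞ φ φ.source ∧ ContDiffOn ℝ ∞ φ.symm φ.target ∧ φ 0 = 0 ∧
      (∀ x, ∀ j : Fin n, k ≤ (j : ℕ) → (j : ℕ) < q + 1 → φ x j = x j) ∧
      ∀ x ∈ φ.source, (∀ j : Fin (q + 1), (j : ℕ) < k →
        extPow n q (jac φ x) (P x) (tI hn j) = (-1) ^ (j : ℕ) * φ x (io hn j)) ∧
        ∀ J : Idx n q, sliceIdx n q k ⊆ J.1 → ¬ J.1 ⊆ topIdx n q →
          extPow n q (jac φ x) (P x) J = 0 := by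
  obtain ⟨e, f, N1, s0, sU, es, e0, e1, ey, N1o, h0N1, fs, f0, hef⟩ :=
    step2 hn hk3 hkq hU h0 hN hflat
  have hk : k ≤ q + 1 := by omega
  obtain ⟨Xt, N2, N2o, h0N2, N21, Xs, X0, hX⟩ := moser (X := XX n k) (W := WW n k)
    (by rw [finrank_euclideanSpace, card_x (by omega)]; exact hk3) N1o h0N1 fs f0
  set Θ := Theta n k with hΘ
  have hΘ0 : Θ 0 = 0 := Θ.map_zero
  have hΘs0 : Θ.symm 0 = 0 := Θ.symm.map_zero
  set V2 : Set (Fin n → ℝ) := Θ.symm ⁻¹' N2 with hV2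
  have hV2o : IsOpen V2 := N2o.preimage Θ.symm.continuous
  have h0V2 : (0 : Fin n → ℝ) ∈ V2 := by
    change Θ.symm 0 ∈ N2
    rw [hΘs0]; exact h0N2
  set φ2 : (Fin n → ℝ) → (Fin n → ℝ) := fun v => Θ (Xt (Θ.symm v), (Θ.symm v).2) with hφ2
  have hφ2s : ContDiffOn ℝ ∞ φ2 V2 := by
    have a : ContDiffOn ℝ ∞ (fun x => Θ.symm x) V2 := Θ.symm.contDiff.contDiffOn
    exact Θ.contDiff.comp_contDiffOn ((Xs.comp a fun x hx => hx).prodMk a.snd)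
  have hφ2d : ∀ v ∈ V2, HasFDerivAt φ2 ((Θ : (XX n k × WW n k) →L[ℝ] (Fin n → ℝ)).comp
        (((fderiv ℝ Xt (Θ.symm v)).prod (ContinuousLinearMap.snd ℝ _ _)).comp
          (Θ.symm : (Fin n → ℝ) →L[ℝ] XX n k × WW n k))) v := by
    intro v hv
    have a2 : HasFDerivAt Xt (fderiv ℝ Xt (Θ.symm v)) (Θ.symm v) :=
      ((Xs.contDiffAt (N2o.mem_nhds hv)).differentiableAt (by simp)).hasFDerivAt
    have b2 : HasFDerivAt (fun p : XX n k × WW n k => (Xt p, p.2))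
        ((fderiv ℝ Xt (Θ.symm v)).prod (ContinuousLinearMap.snd ℝ _ _)) (Θ.symm v) :=
      a2.prodMk hasFDerivAt_snd
    exact Θ.hasFDerivAt.comp v (b2.comp v Θ.symm.hasFDerivAt)
  have hjac : ∀ v ∈ V2, jac φ2 v = CM (fderiv ℝ Xt (Θ.symm v)) := by
    intro v hv
    ext i j
    change fderiv ℝ φ2 v (Pi.single j 1) i = _
    rw [(hφ2d v hv).fderiv]
    rfl
  set O : Set (Fin n → ℝ) := e.source ∩ e ⁻¹' V2 with hO
  have hOo : IsOpen O := es.continuousOn.isOpen_inter_preimage e.open_source hV2o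
  have h0O : (0 : Fin n → ℝ) ∈ O := ⟨s0, by
    change e 0 ∈ V2
    rw [e0]; exact h0V2⟩
  have hs : ContDiffOn ℝ ∞ (fun x => φ2 (e x)) O :=
    hφ2s.comp (es.mono inter_subset_left) fun x hx => hx.2
  -- the derivative at the origin is invertible
  set D := ((Θ : (XX n k × WW n k) →L[ℝ] (Fin n → ℝ)).comp
        (((fderiv ℝ Xt (Θ.symm 0)).prod (ContinuousLinearMap.snd ℝ _ _)).comp
          (Θ.symm : (Fin n → ℝ) →L[ℝ] XX n k × WW n k))) with hD
  have hDi : Function.Injective D.toLinearMap := by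
    rw [← LinearMap.ker_eq_bot, LinearMap.ker_eq_bot']
    intro u hu
    have h1 : Θ (fderiv ℝ Xt (Θ.symm 0) (Θ.symm u), (Θ.symm u).2) = 0 := hu
    have h2 : ((fderiv ℝ Xt (Θ.symm 0) (Θ.symm u), (Θ.symm u).2) : XX n k × WW n k) = 0 := by
      apply Θ.injective
      rw [h1, hΘ0]
    have h3 : (Θ.symm u).2 = 0 := congrArg Prod.snd h2
    have h4 : fderiv ℝ Xt (Θ.symm 0) (Θ.symm u) = 0 := congrArg Prod.fst h2
    have h5 : Θ.symm u = ((Θ.symm u).1, 0) := Prod.ext rfl h3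
    rw [h5] at h4
    have hdet := (hX _ h0V2).1
    have h6 := LinearMap.bot_lt_ker_of_det_eq_zero (f :=
      ((fderiv ℝ Xt (Θ.symm 0)).comp (ContinuousLinearMap.inl ℝ (XX n k) (WW n k))).toLinearMap)
    have h7 : LinearMap.ker ((fderiv ℝ Xt (Θ.symm 0)).comp
        (ContinuousLinearMap.inl ℝ (XX n k) (WW n k))).toLinearMap = ⊥ :=
      (LinearMap.equivOfDetNeZero _ hdet).ker
    have h8 : (Θ.symm u).1 ∈ LinearMap.ker ((fderiv ℝ Xt (Θ.symm 0)).comp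
        (ContinuousLinearMap.inl ℝ (XX n k) (WW n k))).toLinearMap := h4
    rw [h7, Submodule.mem_bot] at h8
    rw [h8] at h5
    apply Θ.symm.injective
    rw [h5, hΘs0]
    rfl
  set De : (Fin n → ℝ) ≃L[ℝ] (Fin n → ℝ) :=
    (LinearEquiv.ofInjectiveEndo D.toLinearMap hDi).toContinuousLinearEquiv with hDe
  have hder : HasFDerivAt (fun x => φ2 (e x)) (De : (Fin n → ℝ) →L[ℝ] (Fin n → ℝ)) 0 := by
    have a1 : HasFDerivAt φ2 D (e 0) := by rw [e0]; exact hφ2d 0 h0V2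
    have a2 := HasFDerivAt.comp (g := φ2) (f := e) (0 : Fin n → ℝ) a1 e1
    refine a2.congr_fderiv ?_
    exact ContinuousLinearMap.ext fun u => rfl
  obtain ⟨φ, hφ0, hφO, hφe, hφs⟩ := ift hOo hs h0O hder
  refine ⟨φ, hφ0, fun x hx => sU (hφO hx).1, ?_, hφs, ?_, ?_, ?_⟩
  · rw [hφe]; exact hs.mono hφO
  · rw [hφe]
    change Θ (Xt (Θ.symm (e 0)), (Θ.symm (e 0)).2) = 0
    rw [e0, hΘs0, X0]
    exact hΘ0
  · intro x j h1 h2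
    rw [hφe]
    change Θ (Xt (Θ.symm (e x)), (Θ.symm (e x)).2) j = x j
    rw [hΘ, Theta_w _ ⟨j, not_lt.2 h1⟩, Theta_symm_w]
    exact ey x j h1 h2
  · intro x hx
    obtain ⟨hx1, hx2⟩ := hφO hx
    have hed : DifferentiableAt ℝ e x :=
      (es.contDiffAt (e.open_source.mem_nhds hx1)).differentiableAt (by simp)
    obtain ⟨g1, g2⟩ := hef x hx1 (N21 hx2)
    obtain ⟨x1, x2⟩ := hX _ hx2
    have main := moser_alg hn hk (fderiv ℝ Xt (Θ.symm (e x))) (Xt (Θ.symm (e x)))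
      (f (Θ.symm (e x))) (e x) x1 x2 _ g1 g2
    rw [hφe, jac_comp (hφ2d _ hx2).differentiableAt hed, extPow_mul, hjac _ hx2]
    refine ⟨fun j hj => ?_, main.2⟩
    rw [main.1 j hj]
    change _ = _ * Θ (Xt (Θ.symm (e x)), (Θ.symm (e x)).2) (io hn j)
    rw [hΘ, Theta_x _ ⟨io hn j, hj⟩]

/-- Step 1 of the proof of Theorem 1.2 in the paper: linearization
of the sliced structure. Let `Π` be a smooth Nambu structure of order `q` (with
`3 ≤ k ≤ q`) such that `Π − Π_{k,q}` is flat along `Σ = {x₁ = ⋯ = x_{q+1} = 0}`.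
Then, after a local diffeomorphism `φ` fixing the coordinates `x_{k+1},…,x_{q+1}`,
the sliced structure `Λ = (e*_{k+1} ∧ ⋯ ∧ e*_{q+1}) ⌟ Π` becomes linear:
`(e*_{k+1} ∧ ⋯ ∧ e*_{q+1}) ⌟ (φ_*Π) = (e*_{k+1} ∧ ⋯ ∧ e*_{q+1}) ⌟ Π_{k,q}`. -/
theorem slicing_linearization (n q k : ℕ) (hq : 3 ≤ q) (hn : q < n) (hk3 : 3 ≤ k)
    (hkq : k ≤ q)
    (U : Set (Fin n → ℝ)) (hU : IsOpen U) (h0U : (0 : Fin n → ℝ) ∈ U)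
    (P : (Fin n → ℝ) → MultiVec n q) (hN : IsNambu n q P U)
    (hflat : ∀ x ∈ U, (∀ j : Fin n, (j : ℕ) < q + 1 → x j = 0) →
      ∀ l : ℕ, iteratedFDerivWithin ℝ l (fun z => P z - modelPi n q k z) U x = 0) :
    ∃ W : Set (Fin n → ℝ), W ⊆ U ∧ (0 : Fin n → ℝ) ∈ W ∧
      ∃ φ : (Fin n → ℝ) → (Fin n → ℝ), IsSmoothDiffeoOn φ W ∧ φ 0 = 0 ∧
        (∀ x ∈ W, ∀ j : Fin n, k ≤ (j : ℕ) → (j : ℕ) < q + 1 → φ x j = x j) ∧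
        ∀ x ∈ W, contr n q (k - 1) (sliceIdx n q k) (extPow n q (jac φ x) (P x)) =
          contr n q (k - 1) (sliceIdx n q k) (modelPi n q k (φ x)) := by
  obtain ⟨φ, s0, sU, hs, hss, hφ0, hy, hx⟩ := slice_final hn hk3 hkq hU h0U hN hflat
  have him : φ '' φ.source = φ.target := φ.image_source_eq_target
  refine ⟨φ.source, sU, s0, φ, ⟨φ.open_source, ?_, hs, φ.symm, ?_, fun x hx => φ.left_inv hx, ?_⟩,
    hφ0, fun x _ => hy x, fun x hxs => ?_⟩
  · rw [him]; exact φ.open_target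
  · rw [him]; exact hss
  · rw [him]; exact fun y hy => φ.right_inv hy
  obtain ⟨h1, h2⟩ := hx x hxs
  funext K
  unfold contr
  split_ifs with h
  · congr 1
    by_cases ht : sliceIdx n q k ∪ K.1 ⊆ topIdx n q
    · obtain ⟨j, hj⟩ := eq_tI_of_subset hn ⟨sliceIdx n q k ∪ K.1, h.2⟩ ht
      have hjk : (j : ℕ) < k := by
        rw [← slice_sub_tI hn, ← hj]
        exact Finset.subset_union_left
      have hep : eps k (io hn j) = 1 := if_pos hjk
      rw [hj, h1 j hjk, modelPi_tI, hep, mul_one]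
    · rw [h2 _ Finset.subset_union_left ht, modelPi_not _ ht]
  · rfl

end M8b
end NambuLin
end FileM8b
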